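/- Elliptic regularity for the Weyl tensor in conformal harmonic coordinates (Theorem 3.9(a), coordinate version): Let n ≥ 4, k ∈ ℕ with k ≥ 2, and α ∈ (0,1). Let g be a metric of class C^{k+α} on an open set U ⊆ ℝⁿ satisfying the conformal harmonic gauge on U, and let ĝ := (det g)^{−1/n} g be its determinant-normalized metric. If the components W_{abc}{}^{d} of the Weyl tensor of g, computed in these coordinates, are of class C^{m+β} on U for some m ∈ ℕ and β ∈ (0,1) with m + β > k + α − 2, then every entry of ĝ is of class C^{m+2+β} on U; if the components W_{abc}{}^{d} are C^∞ on U then ĝ is C^∞ on U; and if the Weyl tensor of g vanishes identically on U, then every entry of ĝ is real-analytic on U. -/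

import Mathlib

noncomputable section

open Set Matrix Matrix

/-- Points of `ℝⁿ`. -/
abbrev Pt (n : ℕ) := Fin n → ℝ

/-- A metric in coordinates: a matrix-valued map. -/
abbrev Met (n : ℕ) := Pt n → Matrix (Fin n) (Fin n) ℝ

/-- Partial derivative of `f` in the `a`-th coordinate direction. -/
def pd {n : ℕ} (a : Fin n) (f : Pt n → ℝ) (x : Pt n) : ℝ :=
  fderiv ℝ f x (Pi.single a 1)

/-- `g` is a metric (pointwise symmetric positive definite) on `U`. -/
def IsMetricOn {n : ℕ} (g : Met n) (U : Set (Pt n)) : Prop :=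
  ∀ x ∈ U, (g x).IsSymm ∧ (g x).PosDef

/-- Christoffel symbols `Γ^c_{ab}` of `g`. -/
def christoffel {n : ℕ} (g : Met n) (c a b : Fin n) (x : Pt n) : ℝ :=
  (1 / 2) * ∑ d, (g x)⁻¹ c d *
    (pd a (fun y => g y b d) x + pd b (fun y => g y a d) x - pd d (fun y => g y a b) x)

/-- Ricci tensor `R_{ab}` of `g`. -/
def ricci {n : ℕ} (g : Met n) (a b : Fin n) (x : Pt n) : ℝ :=
  (∑ c, pd c (christoffel g c a b) x) - (∑ c, pd a (christoffel g c c b) x)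
    + (∑ c, ∑ d, christoffel g c a b x * christoffel g d d c x)
    - (∑ c, ∑ d, christoffel g d c b x * christoffel g c a d x)

/-- Scalar curvature `R(g)`. -/
def scalarCurv {n : ℕ} (g : Met n) (x : Pt n) : ℝ :=
  ∑ a, ∑ b, (g x)⁻¹ a b * ricci g a b x

/-- Laplace–Beltrami operator `Δ_g`. -/
def laplaceBeltrami {n : ℕ} (g : Met n) (u : Pt n → ℝ) (x : Pt n) : ℝ :=
  -(Real.sqrt (g x).det)⁻¹ *
    ∑ a, pd a (fun y => Real.sqrt (g y).det * ∑ b, (g y)⁻¹ a b * pd b u y) x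

/-- Conformal Laplacian `L_g`. -/
def confLap {n : ℕ} (g : Met n) (u : Pt n → ℝ) (x : Pt n) : ℝ :=
  laplaceBeltrami g u x + (((n : ℝ) - 2) / (4 * ((n : ℝ) - 1))) * scalarCurv g x * u x

/-- `f` is of class `C^{k+α}` on `s`: it is `C^k` there and its `k`-th order derivatives are
locally `α`-Hölder continuous. -/
def CHolderOn {n : ℕ} (k : ℕ) (α : ℝ) (s : Set (Pt n)) (f : Pt n → ℝ) : Prop :=
  ContDiffOn ℝ k f s ∧
    ∀ x ∈ s, ∃ C : NNReal, ∃ t ∈ nhdsWithin x s,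
      HolderOnWith C (Real.toNNReal α) (iteratedFDerivWithin ℝ k f s) t

/-- All entries of `g` are of class `C^{k+α}` on `s`. -/
def MetCHolderOn {n : ℕ} (k : ℕ) (α : ℝ) (s : Set (Pt n)) (g : Met n) : Prop :=
  ∀ a b, CHolderOn k α s fun x => g x a b

/-- Contracted Christoffel symbol `Γ^a = g^{bc} Γ^a_{bc}`. -/
def gammaUp {n : ℕ} (g : Met n) (a : Fin n) (x : Pt n) : ℝ :=
  ∑ b, ∑ c, (g x)⁻¹ b c * christoffel g a b c x

/-- Contracted Christoffel symbol `Γ_a = g_{ab} Γ^b`. -/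
def gammaLow {n : ℕ} (g : Met n) (a : Fin n) (x : Pt n) : ℝ :=
  ∑ b, g x a b * gammaUp g b x

/-- `g` satisfies the conformal harmonic gauge on `U`. -/
def ConfHarmonicGauge {n : ℕ} (g : Met n) (U : Set (Pt n)) : Prop :=
  ∃ f : Pt n → ℝ, ContDiffOn ℝ 2 f U ∧ (∀ x ∈ U, 0 < f x) ∧
    (∀ x ∈ U, confLap g f x = 0) ∧
    ∀ a : Fin n, ∀ x ∈ U, gammaLow g a x = 2 * pd a (fun y => Real.log (f y)) x

/-- Determinant-normalized metric `ĝ = (det g)^{-1/n} g`. -/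
def dnorm {n : ℕ} (g : Met n) : Met n :=
  fun x => ((g x).det ^ (-(1 : ℝ) / (n : ℝ))) • g x

/-- Jacobian matrix of a map `Z : ℝⁿ → ℝⁿ`. -/
def jac {n : ℕ} (Z : Pt n → Pt n) (x : Pt n) : Matrix (Fin n) (Fin n) ℝ :=
  Matrix.of fun i j => pd j (fun y => Z y i) x

/-- Riemann curvature tensor `R_{abc}{}^{d}`. -/
def riemannUp {n : ℕ} (g : Met n) (a b c d : Fin n) (x : Pt n) : ℝ :=
  pd a (christoffel g d b c) x - pd b (christoffel g d a c) x
    + (∑ e, christoffel g e b c x * christoffel g d a e x)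
    - (∑ e, christoffel g e a c x * christoffel g d b e x)

/-- Riemann curvature tensor `R_{abcd} = R_{abc}{}^{e} g_{ed}`. -/
def riemannLow {n : ℕ} (g : Met n) (a b c d : Fin n) (x : Pt n) : ℝ :=
  ∑ e, riemannUp g a b c e x * g x e d

/-- Schouten tensor `P_{ab}`. -/
def schouten {n : ℕ} (g : Met n) (a b : Fin n) (x : Pt n) : ℝ :=
  (1 / ((n : ℝ) - 2)) * (ricci g a b x - (scalarCurv g x / (2 * ((n : ℝ) - 1))) * g x a b)

/-- Weyl tensor `W_{abcd}`. -/
def weyl {n : ℕ} (g : Met n) (a b c d : Fin n) (x : Pt n) : ℝ :=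
  riemannLow g a b c d x + schouten g a c x * g x b d - schouten g b c x * g x a d
    + schouten g b d x * g x a c - schouten g a d x * g x b c

/-- Weyl tensor with raised last index, `W_{abc}{}^{d} = g^{de} W_{abce}`. -/
def weylUp {n : ℕ} (g : Met n) (a b c d : Fin n) (x : Pt n) : ℝ :=
  ∑ e, (g x)⁻¹ d e * weyl g a b c e x

/-- Covariant derivative of a 2-tensor: `(∇T)_{cab} = ∇_c T_{ab}`. -/
def cov2 {n : ℕ} (g : Met n) (T : Fin n → Fin n → Pt n → ℝ) (c a b : Fin n) (x : Pt n) : ℝ :=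
  pd c (T a b) x - (∑ d, christoffel g d c a x * T d b x)
    - ∑ d, christoffel g d c b x * T a d x

/-- Covariant derivative of a 3-tensor: `(∇T)_{dabc} = ∇_d T_{abc}`. -/
def cov3 {n : ℕ} (g : Met n) (T : Fin n → Fin n → Fin n → Pt n → ℝ) (d a b c : Fin n)
    (x : Pt n) : ℝ :=
  pd d (T a b c) x - (∑ e, christoffel g e d a x * T e b c x)
    - (∑ e, christoffel g e d b x * T a e c x)
    - ∑ e, christoffel g e d c x * T a b e x

/-- Cotton tensor `C_{abc} = ∇_a P_{bc} - ∇_b P_{ac}`. -/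
def cotton {n : ℕ} (g : Met n) (a b c : Fin n) (x : Pt n) : ℝ :=
  cov2 g (schouten g) a b c x - cov2 g (schouten g) b a c x

/-- Bach tensor `B_{ab}`. -/
def bach {n : ℕ} (g : Met n) (a b : Fin n) (x : Pt n) : ℝ :=
  (∑ c, ∑ d, (g x)⁻¹ c d *
      (cov3 g (cov2 g (schouten g)) d a b c x - cov3 g (cov2 g (schouten g)) d c a b x))
    + ∑ c, ∑ d, ∑ e, ∑ f, (g x)⁻¹ c e * (g x)⁻¹ d f * schouten g e f x * weyl g a c d b x

/-- `f` is locally `β`-Hölder around every point of `U`. -/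
def LocHolder {n : ℕ} (β : ℝ) (U : Set (Pt n)) (f : Pt n → ℝ) : Prop :=
  ∀ x ∈ U, ∃ C r : ℝ, 0 ≤ C ∧ 0 < r ∧ ∀ y ∈ Metric.ball x r, ∀ z ∈ Metric.ball x r,
    |f y - f z| ≤ C * ‖y - z‖ ^ β

/-- Inductive version of the class `C^{m+β}` through partial derivatives. -/
def CH {n : ℕ} : ℕ → ℝ → Set (Pt n) → (Pt n → ℝ) → Prop
  | 0, β, U, f => LocHolder β U f
  | m + 1, β, U, f => (∀ x ∈ U, DifferentiableAt ℝ f x) ∧ ∀ a, CH m β U (pd a f)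

section CHclass

variable {n : ℕ} {U : Set (Pt n)} {β : ℝ}

theorem pd_add {a : Fin n} {f g : Pt n → ℝ} {x : Pt n} (hf : DifferentiableAt ℝ f x)
    (hg : DifferentiableAt ℝ g x) : pd a (fun y => f y + g y) x = pd a f x + pd a g x := by
  simp only [pd]
  rw [fderiv_fun_add hf hg]; rfl

theorem pd_sub {a : Fin n} {f g : Pt n → ℝ} {x : Pt n} (hf : DifferentiableAt ℝ f x)
    (hg : DifferentiableAt ℝ g x) : pd a (fun y => f y - g y) x = pd a f x - pd a g x := by
  simp only [pd]
  rw [fderiv_fun_sub hf hg]; rfl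

theorem pd_mul {a : Fin n} {f g : Pt n → ℝ} {x : Pt n} (hf : DifferentiableAt ℝ f x)
    (hg : DifferentiableAt ℝ g x) :
    pd a (fun y => f y * g y) x = pd a f x * g x + f x * pd a g x := by
  simp only [pd]
  rw [fderiv_fun_mul hf hg]
  simp; ring

theorem pd_const {a : Fin n} {c : ℝ} {x : Pt n} : pd a (fun _ => c) x = 0 := by
  simp [pd]

theorem pd_const_mul {a : Fin n} {c : ℝ} {f : Pt n → ℝ} {x : Pt n}
    (hf : DifferentiableAt ℝ f x) : pd a (fun y => c * f y) x = c * pd a f x := by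
  rw [pd_mul (differentiableAt_const c) hf, pd_const]; ring

theorem pd_sum {a : Fin n} {ι : Type*} {s : Finset ι} {f : ι → Pt n → ℝ} {x : Pt n}
    (hf : ∀ i ∈ s, DifferentiableAt ℝ (f i) x) :
    pd a (fun y => ∑ i ∈ s, f i y) x = ∑ i ∈ s, pd a (f i) x := by
  simp only [pd]
  rw [fderiv_fun_sum hf]
  simp

theorem pd_comp {a : Fin n} {G : ℝ → ℝ} {G' : ℝ} {f : Pt n → ℝ} {x : Pt n}
    (hG : HasDerivAt G G' (f x)) (hf : DifferentiableAt ℝ f x) :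
    pd a (fun y => G (f y)) x = G' * pd a f x := by
  simp only [pd]
  have := (hG.comp_hasFDerivAt x hf.hasFDerivAt).fderiv
  have h2 : fderiv ℝ (fun y => G (f y)) x = G' • fderiv ℝ f x := this
  rw [h2]; simp

theorem pd_congr_on (hU : IsOpen U) {a : Fin n} {f g : Pt n → ℝ} (h : ∀ x ∈ U, f x = g x) :
    ∀ x ∈ U, pd a f x = pd a g x := by
  intro x hx
  have : f =ᶠ[nhds x] g := Filter.eventuallyEq_of_mem (hU.mem_nhds hx) h
  simp only [pd, this.fderiv_eq]

theorem pt_eq_sum (v : Pt n) : v = ∑ a, v a • (Pi.single a 1 : Pt n) := by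
  conv_lhs => rw [← Finset.univ_sum_single v]
  refine Finset.sum_congr rfl fun a _ => ?_
  rw [← Pi.single_smul]; simp

theorem fderiv_apply_eq_sum_pd (f : Pt n → ℝ) (x v : Pt n) :
    fderiv ℝ f x v = ∑ a, v a * pd a f x := by
  conv_lhs => rw [pt_eq_sum v]
  simp [pd]

theorem fderiv_eq_sum_pd (f : Pt n → ℝ) (x : Pt n) :
    fderiv ℝ f x = ∑ a, pd a f x • ContinuousLinearMap.proj (R := ℝ) (φ := fun _ : Fin n => ℝ) a := by
  ext1 v
  rw [fderiv_apply_eq_sum_pd]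
  simp [mul_comm]

theorem norm_fderiv_le (f : Pt n → ℝ) (x : Pt n) : ‖fderiv ℝ f x‖ ≤ ∑ a, |pd a f x| := by
  refine ContinuousLinearMap.opNorm_le_bound _ (Finset.sum_nonneg fun _ _ => abs_nonneg _) ?_
  intro v
  rw [fderiv_apply_eq_sum_pd, Finset.sum_mul]
  refine (Finset.abs_sum_le_sum_abs _ _).trans (Finset.sum_le_sum fun a _ => ?_)
  rw [abs_mul, mul_comm]
  exact mul_le_mul_of_nonneg_left (norm_le_pi_norm v a) (abs_nonneg _)

theorem LocHolder.congr (hU : IsOpen U) {f g : Pt n → ℝ} (hf : LocHolder β U f)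
    (h : ∀ x ∈ U, f x = g x) : LocHolder β U g := by
  intro x hx
  obtain ⟨C, r, hC, hr, H⟩ := hf x hx
  obtain ⟨r', hr', hb⟩ := Metric.isOpen_iff.1 hU x hx
  refine ⟨C, min r r', hC, lt_min hr hr', fun y hy z hz => ?_⟩
  rw [← h y (hb (Metric.ball_subset_ball (min_le_right _ _) hy)),
    ← h z (hb (Metric.ball_subset_ball (min_le_right _ _) hz))]
  exact H y (Metric.ball_subset_ball (min_le_left _ _) hy) z
    (Metric.ball_subset_ball (min_le_left _ _) hz)

theorem CH.congr (hU : IsOpen U) {m : ℕ} : ∀ {f g : Pt n → ℝ}, CH m β U f →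
    (∀ x ∈ U, f x = g x) → CH m β U g := by
  induction m with
  | zero => intro f g hf h; exact LocHolder.congr hU hf h
  | succ m ih =>
    intro f g hf h
    refine ⟨fun x hx => ?_, fun a => ih (hf.2 a) (pd_congr_on hU h)⟩
    exact (hf.1 x hx).congr_of_eventuallyEq
      (Filter.eventuallyEq_of_mem (hU.mem_nhds hx) fun y hy => (h y hy).symm)

/-- Membership in `CH` is a local property. -/
theorem CH.of_local {m : ℕ} : ∀ {f : Pt n → ℝ}, (∀ x ∈ U, ∃ V, x ∈ V ∧ CH m β V f) →
    CH m β U f := by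
  induction m with
  | zero => intro f h x hx; obtain ⟨V, hxV, hV⟩ := h x hx; exact hV x hxV
  | succ m ih =>
    intro f h
    refine ⟨fun x hx => ?_, fun a => ih fun x hx => ?_⟩
    · obtain ⟨V, hxV, hV⟩ := h x hx; exact hV.1 x hxV
    · obtain ⟨V, hxV, hV⟩ := h x hx; exact ⟨V, hxV, hV.2 a⟩

theorem LocHolder.continuousAt (hβ : 0 < β) {f : Pt n → ℝ} (hf : LocHolder β U f) {x : Pt n}
    (hx : x ∈ U) : ContinuousAt f x := by
  obtain ⟨C, r, hC, hr, H⟩ := hf x hx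
  rw [ContinuousAt, tendsto_iff_norm_sub_tendsto_zero]
  have h1 : Filter.Tendsto (fun y : Pt n => C * ‖y - x‖ ^ β) (nhds x) (nhds 0) := by
    have : ContinuousAt (fun y : Pt n => C * ‖y - x‖ ^ β) x := by
      refine ContinuousAt.mul continuousAt_const ?_
      refine ContinuousAt.rpow_const ?_ (Or.inr hβ.le)
      fun_prop
    have h2 := this.tendsto
    simpa [Real.zero_rpow hβ.ne'] using h2
  refine squeeze_zero' (Filter.Eventually.of_forall fun _ => norm_nonneg _) ?_ h1
  filter_upwards [Metric.ball_mem_nhds x hr] with y hy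
  exact H y hy x (Metric.mem_ball_self hr)

theorem ContinuousAt.exists_ball_bound {f : Pt n → ℝ} {x : Pt n} (hf : ContinuousAt f x) :
    ∃ r > 0, ∀ y ∈ Metric.ball x r, |f y| ≤ |f x| + 1 := by
  have := hf.abs.eventually (gt_mem_nhds (lt_add_one |f x|))
  obtain ⟨r, hr, h⟩ := Metric.eventually_nhds_iff_ball.1 this
  exact ⟨r, hr, fun y hy => (h y hy).le⟩

theorem LocHolder.mul (hβ : 0 < β) {f g : Pt n → ℝ} (hf : LocHolder β U f)
    (hg : LocHolder β U g) : LocHolder β U fun x => f x * g x := by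
  intro x hx
  obtain ⟨C, r, hC, hr, H⟩ := hf x hx
  obtain ⟨C', r', hC', hr', H'⟩ := hg x hx
  obtain ⟨s, hs, Hs⟩ := (hf.continuousAt hβ hx).exists_ball_bound
  obtain ⟨s', hs', Hs'⟩ := (hg.continuousAt hβ hx).exists_ball_bound
  refine ⟨C * (|g x| + 1) + (|f x| + 1) * C', min (min r r') (min s s'), by positivity,
    by positivity, fun y hy z hz => ?_⟩
  simp only [Metric.mem_ball, lt_min_iff] at hy hz
  have e : f y * g y - f z * g z = (f y - f z) * g y + f z * (g y - g z) := by ring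
  rw [e]
  refine (abs_add_le _ _).trans ?_
  rw [abs_mul, abs_mul, add_mul]
  have h1 := H y hy.1.1 z hz.1.1
  have h2 := H' y hy.1.2 z hz.1.2
  have h3 := Hs z hz.2.1
  have h4 := Hs' y hy.2.2
  have hp : 0 ≤ ‖y - z‖ ^ β := by positivity
  refine add_le_add ?_ ?_
  · calc _ ≤ (C * ‖y - z‖ ^ β) * (|g x| + 1) := by gcongr
      _ = _ := by ring
  · calc _ ≤ (|f x| + 1) * (C' * ‖y - z‖ ^ β) := by gcongr
      _ = _ := by ring

theorem LocHolder.add {f g : Pt n → ℝ} (hf : LocHolder β U f)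
    (hg : LocHolder β U g) : LocHolder β U fun x => f x + g x := by
  intro x hx
  obtain ⟨C, r, hC, hr, H⟩ := hf x hx
  obtain ⟨C', r', hC', hr', H'⟩ := hg x hx
  refine ⟨C + C', min r r', by positivity, by positivity, fun y hy z hz => ?_⟩
  simp only [Metric.mem_ball, lt_min_iff] at hy hz
  have e : f y + g y - (f z + g z) = (f y - f z) + (g y - g z) := by ring
  rw [e, add_mul]
  exact (abs_add_le _ _).trans (add_le_add (H y hy.1 z hz.1) (H' y hy.2 z hz.2))

theorem LocHolder.const (c : ℝ) : LocHolder β U fun _ : Pt n => c := by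
  intro x hx
  exact ⟨0, 1, le_rfl, one_pos, by simp⟩

theorem LocHolder.of_lipschitz {γ : ℝ} (hγ1 : γ ≤ 1) {f : Pt n → ℝ}
    (h : ∀ x ∈ U, ∃ C r : ℝ, 0 ≤ C ∧ 0 < r ∧ ∀ y ∈ Metric.ball x r, ∀ z ∈ Metric.ball x r,
      |f y - f z| ≤ C * ‖y - z‖) : LocHolder γ U f := by
  intro x hx
  obtain ⟨C, r, hC, hr, H⟩ := h x hx
  refine ⟨C, min r (1 / 2), hC, by positivity, fun y hy z hz => ?_⟩
  simp only [Metric.mem_ball, lt_min_iff] at hy hz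
  refine (H y hy.1 z hz.1).trans (mul_le_mul_of_nonneg_left ?_ hC)
  have hd : ‖y - z‖ ≤ 1 := by
    rw [← dist_eq_norm]
    have := dist_triangle_right y z x
    linarith [hy.2, hz.2]
  rcases eq_or_lt_of_le (norm_nonneg (y - z)) with h0 | h0
  · rw [← h0]; positivity
  · calc ‖y - z‖ = ‖y - z‖ ^ (1 : ℝ) := (Real.rpow_one _).symm
      _ ≤ _ := Real.rpow_le_rpow_of_exponent_ge h0 hd hγ1

/-- A differentiable function with locally bounded partial derivatives is locally Hölder. -/
theorem LocHolder.of_pd (hU : IsOpen U) {γ : ℝ} (hγ1 : γ ≤ 1) {f : Pt n → ℝ}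
    (hd : ∀ x ∈ U, DifferentiableAt ℝ f x) (hc : ∀ a, ∀ x ∈ U, ContinuousAt (pd a f) x) :
    LocHolder γ U f := by
  refine LocHolder.of_lipschitz hγ1 fun x hx => ?_
  choose r hr H using fun a => (hc a x hx).exists_ball_bound
  obtain ⟨r', hr', hb⟩ := Metric.isOpen_iff.1 hU x hx
  have : ∃ s > 0, s ≤ r' ∧ ∀ a, s ≤ r a := by
    rcases Finset.eq_empty_or_nonempty (Finset.univ : Finset (Fin n)) with h0 | h0
    · refine ⟨r', hr', le_rfl, fun a => ?_⟩
      have := Finset.mem_univ a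
      simp [h0] at this
    · refine ⟨min r' (Finset.univ.inf' h0 r), lt_min hr' ?_, min_le_left _ _, fun a =>
        (min_le_right _ _).trans (Finset.inf'_le _ (Finset.mem_univ a))⟩
      rw [Finset.lt_inf'_iff]
      exact fun a _ => hr a
  obtain ⟨s, hs, hsr, hsa⟩ := this
  refine ⟨∑ a, (|pd a f x| + 1), s, by positivity, hs, fun y hy z hz => ?_⟩
  refine (convex_ball x s).norm_image_sub_le_of_norm_fderiv_le (𝕜 := ℝ) (f := f)
    (fun w hw => hd w (hb (Metric.ball_subset_ball hsr hw))) (fun w hw => ?_) hz hy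
  exact (norm_fderiv_le f w).trans (Finset.sum_le_sum fun a _ =>
    H a w (Metric.ball_subset_ball (hsa a) hw))

theorem CH.continuousAt (hβ : 0 < β) : ∀ {m : ℕ} {f : Pt n → ℝ}, CH m β U f → ∀ {x : Pt n},
    x ∈ U → ContinuousAt f x
  | 0, _, hf, _, hx => LocHolder.continuousAt hβ hf hx
  | _ + 1, _, hf, _, hx => (hf.1 _ hx).continuousAt

/-- One derivative is worth any Hölder exponent. -/
theorem CH.lower (hU : IsOpen U) (hβ : 0 < β) {γ : ℝ} (hγ1 : γ ≤ 1) {m : ℕ} :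
    ∀ {f : Pt n → ℝ}, CH (m + 1) β U f → CH m γ U f := by
  induction m with
  | zero =>
    intro f hf
    exact LocHolder.of_pd hU hγ1 hf.1 fun a x hx => (hf.2 a).continuousAt hβ hx
  | succ m ih => intro f hf; exact ⟨hf.1, fun a => ih (hf.2 a)⟩

theorem CH.of_le (hU : IsOpen U) (hβ : 0 < β) (hβ1 : β ≤ 1) {m l : ℕ} (h : m ≤ l)
    {f : Pt n → ℝ} (hf : CH l β U f) : CH m β U f := by
  induction l, h using Nat.le_induction with
  | base => exact hf
  | succ l _ ih => exact ih (CH.lower hU hβ hβ1 hf)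

theorem LocHolder.exponent_le {γ : ℝ} (hγ : 0 < γ) (h : γ ≤ β) {f : Pt n → ℝ} (hf : LocHolder β U f) :
    LocHolder γ U f := by
  intro x hx
  obtain ⟨C, r, hC, hr, H⟩ := hf x hx
  refine ⟨C, min r (1 / 2), hC, by positivity, fun y hy z hz => ?_⟩
  simp only [Metric.mem_ball, lt_min_iff] at hy hz
  refine (H y hy.1 z hz.1).trans (mul_le_mul_of_nonneg_left ?_ hC)
  have hd : ‖y - z‖ ≤ 1 := by
    rw [← dist_eq_norm]
    have := dist_triangle_right y z x
    linarith [hy.2, hz.2]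
  rcases eq_or_lt_of_le (norm_nonneg (y - z)) with h0 | h0
  · rw [← h0, Real.zero_rpow hγ.ne', Real.zero_rpow (hγ.trans_le h).ne']
  · exact Real.rpow_le_rpow_of_exponent_ge h0 hd h

theorem CH.exponent_le {γ : ℝ} (hγ : 0 < γ) (h : γ ≤ β) {m : ℕ} :
    ∀ {f : Pt n → ℝ}, CH m β U f → CH m γ U f := by
  induction m with
  | zero => intro f hf; exact LocHolder.exponent_le hγ h hf
  | succ m ih => intro f hf; exact ⟨hf.1, fun a => ih (hf.2 a)⟩

theorem CH.add (hU : IsOpen U) {m : ℕ} : ∀ {f g : Pt n → ℝ}, CH m β U f → CH m β U g →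
    CH m β U fun x => f x + g x := by
  induction m with
  | zero => intro f g hf hg; exact LocHolder.add hf hg
  | succ m ih =>
    intro f g hf hg
    refine ⟨fun x hx => (hf.1 x hx).add (hg.1 x hx), fun a => ?_⟩
    exact (ih (hf.2 a) (hg.2 a)).congr hU fun x hx => (pd_add (hf.1 x hx) (hg.1 x hx)).symm

theorem CH.const (hU : IsOpen U) {m : ℕ} : ∀ (c : ℝ), CH m β U fun _ => c := by
  induction m with
  | zero => intro c; exact LocHolder.const c
  | succ m ih =>
    intro c
    exact ⟨fun x _ => differentiableAt_const c, fun a => (ih 0).congr hU fun x _ => pd_const.symm⟩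

theorem CH.mul (hU : IsOpen U) (hβ : 0 < β) (hβ1 : β ≤ 1) {m : ℕ} : ∀ {f g : Pt n → ℝ},
    CH m β U f → CH m β U g → CH m β U fun x => f x * g x := by
  induction m with
  | zero => intro f g hf hg; exact LocHolder.mul hβ hf hg
  | succ m ih =>
    intro f g hf hg
    refine ⟨fun x hx => (hf.1 x hx).mul (hg.1 x hx), fun a => ?_⟩
    refine ((ih (hf.2 a) (hg.lower hU hβ hβ1)).add hU (ih (hf.lower hU hβ hβ1) (hg.2 a))).congr hU
      fun x hx => (pd_mul (hf.1 x hx) (hg.1 x hx)).symm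

theorem CH.const_mul (hU : IsOpen U) (hβ : 0 < β) (hβ1 : β ≤ 1) {m : ℕ} (c : ℝ) {f : Pt n → ℝ}
    (hf : CH m β U f) : CH m β U fun x => c * f x :=
  (CH.const hU c).mul hU hβ hβ1 hf

theorem CH.neg (hU : IsOpen U) (hβ : 0 < β) (hβ1 : β ≤ 1) {m : ℕ} {f : Pt n → ℝ}
    (hf : CH m β U f) : CH m β U fun x => - f x :=
  (hf.const_mul hU hβ hβ1 (-1)).congr hU fun x _ => by ring

theorem CH.sub (hU : IsOpen U) (hβ : 0 < β) (hβ1 : β ≤ 1) {m : ℕ} {f g : Pt n → ℝ}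
    (hf : CH m β U f) (hg : CH m β U g) : CH m β U fun x => f x - g x :=
  (hf.add hU (hg.neg hU hβ hβ1)).congr hU fun x _ => by ring

theorem CH.sum (hU : IsOpen U) {m : ℕ} {ι : Type*} (s : Finset ι) {f : ι → Pt n → ℝ}
    (hf : ∀ i ∈ s, CH m β U (f i)) : CH m β U fun x => ∑ i ∈ s, f i x := by
  classical
  induction s using Finset.induction_on with
  | empty => simpa using CH.const hU 0
  | insert i s hi ih =>
    simp only [Finset.sum_insert hi]
    exact (hf i (Finset.mem_insert_self _ _)).add hU
      (ih fun j hj => hf j (Finset.mem_insert_of_mem hj))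

theorem CH.prod (hU : IsOpen U) (hβ : 0 < β) (hβ1 : β ≤ 1) {m : ℕ} {ι : Type*} (s : Finset ι)
    {f : ι → Pt n → ℝ} (hf : ∀ i ∈ s, CH m β U (f i)) : CH m β U fun x => ∏ i ∈ s, f i x := by
  classical
  induction s using Finset.induction_on with
  | empty => simpa using CH.const hU 1
  | insert i s hi ih =>
    simp only [Finset.prod_insert hi]
    exact (hf i (Finset.mem_insert_self _ _)).mul hU hβ hβ1
      (ih fun j hj => hf j (Finset.mem_insert_of_mem hj))

theorem CH.mvPolynomial (hU : IsOpen U) (hβ : 0 < β) (hβ1 : β ≤ 1) {m : ℕ} {ι : Type*}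
    {f : ι → Pt n → ℝ} (hf : ∀ i, CH m β U (f i)) (P : MvPolynomial ι ℝ) :
    CH m β U fun x => MvPolynomial.eval (fun i => f i x) P := by
  induction P using MvPolynomial.induction_on with
  | C c => simpa using CH.const hU c
  | add p q hp hq => simpa using hp.add hU hq
  | mul_X p i hp => simpa using hp.mul hU hβ hβ1 (hf i)

theorem CH.contDiffOn (hU : IsOpen U) (hβ : 0 < β) {m : ℕ} : ∀ {f : Pt n → ℝ}, CH m β U f →
    ContDiffOn ℝ m f U := by
  induction m with
  | zero =>
    intro f hf
    exact contDiffOn_zero.2 fun x hx => (hf.continuousAt hβ hx).continuousWithinAt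
  | succ m ih =>
    intro f hf
    push_cast
    rw [contDiffOn_succ_iff_fderiv_of_isOpen hU]
    refine ⟨fun x hx => (hf.1 x hx).differentiableWithinAt, by simp, ?_⟩
    have : fderiv ℝ f = fun x => ∑ a, pd a f x • ContinuousLinearMap.proj (R := ℝ)
        (φ := fun _ : Fin n => ℝ) a := funext fun x => fderiv_eq_sum_pd f x
    rw [this]
    exact ContDiffOn.sum fun a _ => (ih (hf.2 a)).smul contDiffOn_const

theorem ContDiffOn.pd (hU : IsOpen U) {m k : WithTop ℕ∞} (h : m + 1 ≤ k) {f : Pt n → ℝ}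
    (hf : ContDiffOn ℝ k f U) (a : Fin n) : ContDiffOn ℝ m (pd a f) U :=
  (hf.fderiv_of_isOpen hU h).clm_apply contDiffOn_const

theorem ContDiff.pd {m k : WithTop ℕ∞} (h : m + 1 ≤ k) {f : Pt n → ℝ}
    (hf : ContDiff ℝ k f) (a : Fin n) : ContDiff ℝ m (pd a f) :=
  (hf.fderiv_right h).clm_apply contDiff_const

theorem CH.of_contDiffOn (hU : IsOpen U) (hβ1 : β ≤ 1) {m : ℕ} : ∀ {f : Pt n → ℝ},
    ContDiffOn ℝ (m + 1 : ℕ) f U → CH m β U f := by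
  induction m with
  | zero =>
    intro f hf
    refine LocHolder.of_pd hU hβ1 (fun x hx => (hf.differentiableOn (by simp)).differentiableAt
      (hU.mem_nhds hx)) fun a x hx => ?_
    exact ((hf.pd (m := 0) hU (by simp) a).continuousOn).continuousAt (hU.mem_nhds hx)
  | succ m ih =>
    intro f hf
    refine ⟨fun x hx => (hf.differentiableOn (by simp)).differentiableAt (hU.mem_nhds hx),
      fun a => ih (hf.pd hU (by push_cast; exact le_rfl) a)⟩

theorem contDiffOn_infty_iff_CH (hU : IsOpen U) (hβ : 0 < β) (hβ1 : β ≤ 1) {f : Pt n → ℝ} :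
    ContDiffOn ℝ (⊤ : ℕ∞) f U ↔ ∀ m, CH m β U f := by
  constructor
  · intro h m
    exact CH.of_contDiffOn hU hβ1 (h.of_le (by exact_mod_cast le_top))
  · intro h
    exact contDiffOn_infty.2 fun m => (h m).contDiffOn hU hβ

theorem LocHolder.comp_C1 (hβ : 0 < β) {G G' : ℝ → ℝ} {f : Pt n → ℝ}
    (hG : ∀ t > 0, HasDerivAt G (G' t) t) (hG' : ∀ t > 0, ContinuousAt G' t)
    (hf : LocHolder β U f) (hp : ∀ x ∈ U, 0 < f x) : LocHolder β U fun x => G (f x) := by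
  intro x hx
  obtain ⟨C, r, hC, hr, H⟩ := hf x hx
  have h1 : ∀ᶠ t in nhds (f x), 0 < t ∧ |G' t| ≤ |G' (f x)| + 1 := by
    filter_upwards [lt_mem_nhds (hp x hx),
      (hG' _ (hp x hx)).abs.eventually (gt_mem_nhds (lt_add_one |G' (f x)|))] with t h1 h2
    exact ⟨h1, h2.le⟩
  obtain ⟨e, he, h2⟩ := Metric.eventually_nhds_iff_ball.1 h1
  obtain ⟨s, hs, h3⟩ := Metric.eventually_nhds_iff_ball.1
    ((hf.continuousAt hβ hx).eventually (Metric.ball_mem_nhds _ he))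
  refine ⟨(|G' (f x)| + 1) * C, min r s, by positivity, lt_min hr hs, fun y hy z hz => ?_⟩
  have hy' := h3 y (Metric.ball_subset_ball (min_le_right _ _) hy)
  have hz' := h3 z (Metric.ball_subset_ball (min_le_right _ _) hz)
  have h4 := (convex_ball (f x) e).norm_image_sub_le_of_norm_hasDerivWithin_le (f := G) (f' := G')
    (fun t ht => (hG t (h2 t ht).1).hasDerivWithinAt) (fun t ht => (h2 t ht).2) hz' hy'
  rw [mul_assoc]
  refine h4.trans (mul_le_mul_of_nonneg_left (H y (Metric.ball_subset_ball (min_le_left _ _) hy) z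
    (Metric.ball_subset_ball (min_le_left _ _) hz)) (by positivity))

theorem CH.rpow (hU : IsOpen U) (hβ : 0 < β) (hβ1 : β ≤ 1) {m : ℕ} : ∀ {f : Pt n → ℝ} (c : ℝ),
    CH m β U f → (∀ x ∈ U, 0 < f x) → CH m β U fun x => f x ^ c := by
  induction m with
  | zero =>
    intro f c hf hp
    exact LocHolder.comp_C1 (G := fun t => t ^ c) (G' := fun t => c * t ^ (c - 1)) hβ
      (fun t ht => Real.hasDerivAt_rpow_const (Or.inl ht.ne'))
      (fun t ht => continuousAt_const.mul (Real.continuousAt_rpow_const _ _ (Or.inl ht.ne'))) hf hp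
  | succ m ih =>
    intro f c hf hp
    refine ⟨fun x hx => (hf.1 x hx).rpow_const (Or.inl (hp x hx).ne'), fun a => ?_⟩
    have h1 := ((ih (c - 1) (hf.lower hU hβ hβ1) hp).const_mul hU hβ hβ1 c).mul hU hβ hβ1 (hf.2 a)
    refine h1.congr hU fun x hx => ?_
    exact (pd_comp (G := fun t => t ^ c)
      (Real.hasDerivAt_rpow_const (Or.inl (hp x hx).ne')) (hf.1 x hx)).symm

end CHclass

section CHolderOn

variable {n : ℕ} {U : Set (Pt n)} {β : ℝ}
variable {F G : Type*} [NormedAddCommGroup F] [NormedSpace ℝ F] [NormedAddCommGroup G]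
  [NormedSpace ℝ G]

/-- Vector-valued local Hölder condition. -/
def VHolder (β : ℝ) (U : Set (Pt n)) (f : Pt n → F) : Prop :=
  ∀ x ∈ U, ∃ C : NNReal, ∃ t ∈ nhdsWithin x U, HolderOnWith C β.toNNReal f t

/-- Vector-valued `C^{m+β}`. -/
def VCH (m : ℕ) (β : ℝ) (U : Set (Pt n)) (f : Pt n → F) : Prop :=
  ContDiffOn ℝ m f U ∧ VHolder β U (iteratedFDerivWithin ℝ m f U)

theorem VHolder.clm {f : Pt n → F} (hf : VHolder β U f) (L : F →L[ℝ] G) :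
    VHolder β U fun x => L (f x) := by
  intro x hx
  obtain ⟨C, t, ht, H⟩ := hf x hx
  refine ⟨‖L‖₊ * C, t, ht, ?_⟩
  have := L.lipschitz.holderWith.comp_holderOnWith H
  simp only [NNReal.coe_one, NNReal.rpow_one, one_mul] at this
  exact this

omit [NormedSpace ℝ F] in
theorem VHolder.add {f g : Pt n → F} (hf : VHolder β U f) (hg : VHolder β U g) :
    VHolder β U fun x => f x + g x := by
  intro x hx
  obtain ⟨C, t, ht, H⟩ := hf x hx
  obtain ⟨C', t', ht', H'⟩ := hg x hx
  refine ⟨C + C', t ∩ t', Filter.inter_mem ht ht', fun y hy z hz => ?_⟩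
  refine (edist_add_add_le _ _ _ _).trans ?_
  rw [ENNReal.coe_add, add_mul]
  exact add_le_add (H y hy.1 z hz.1) (H' y hy.2 z hz.2)

omit [NormedSpace ℝ F] in
theorem VHolder.congr {f g : Pt n → F} (hf : VHolder β U f) (h : ∀ x ∈ U, f x = g x) :
    VHolder β U g := by
  intro x hx
  obtain ⟨C, t, ht, H⟩ := hf x hx
  refine ⟨C, t ∩ U, Filter.inter_mem ht self_mem_nhdsWithin, fun y hy z hz => ?_⟩
  rw [← h y hy.2, ← h z hz.2]
  exact H y hy.1 z hz.1

theorem VCH.clm (hU : IsOpen U) {m : ℕ} {f : Pt n → F} (hf : VCH m β U f) (L : F →L[ℝ] G) :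
    VCH m β U fun x => L (f x) := by
  refine ⟨L.contDiff.comp_contDiffOn hf.1, ?_⟩
  refine (hf.2.clm (ContinuousLinearMap.compContinuousMultilinearMapL ℝ (fun _ : Fin m => Pt n) F G
    L)).congr fun x hx => ?_
  exact (L.iteratedFDerivWithin_comp_left (hf.1 x hx) hU.uniqueDiffOn hx le_rfl).symm

theorem VCH.add (hU : IsOpen U) {m : ℕ} {f g : Pt n → F} (hf : VCH m β U f) (hg : VCH m β U g) :
    VCH m β U fun x => f x + g x := by
  refine ⟨hf.1.add hg.1, (hf.2.add hg.2).congr fun x hx => ?_⟩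
  exact (fun_iteratedFDerivWithin_add_apply (hf.1 x hx) (hg.1 x hx) hU.uniqueDiffOn hx).symm

theorem VCH.zero {m : ℕ} : VCH m β U fun _ : Pt n => (0 : F) := by
  refine ⟨contDiffOn_const, ?_⟩
  have h : VHolder β U fun _ : Pt n => (0 : ContinuousMultilinearMap ℝ (fun _ : Fin m => Pt n) F) :=
    fun x hx => ⟨0, univ, Filter.univ_mem, fun y _ z _ => by simp⟩
  refine h.congr fun x hx => ?_
  rw [iteratedFDerivWithin_fun_zero]; rfl

theorem VCH.sum (hU : IsOpen U) {m : ℕ} {ι : Type*} (s : Finset ι) {f : ι → Pt n → F}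
    (hf : ∀ i ∈ s, VCH m β U (f i)) : VCH m β U fun x => ∑ i ∈ s, f i x := by
  classical
  induction s using Finset.induction_on with
  | empty => simpa using VCH.zero
  | insert i s hi ih =>
    simp only [Finset.sum_insert hi]
    exact (hf i (Finset.mem_insert_self _ _)).add hU
      (ih fun j hj => hf j (Finset.mem_insert_of_mem hj))

theorem VCH.congr {m : ℕ} {f g : Pt n → F} (hf : VCH m β U f)
    (h : ∀ x ∈ U, f x = g x) : VCH m β U g :=
  ⟨hf.1.congr fun x hx => (h x hx).symm, hf.2.congr fun x hx =>
    iteratedFDerivWithin_congr h hx m⟩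

theorem VCH_succ_iff (hU : IsOpen U) {m : ℕ} {f : Pt n → F} :
    VCH (m + 1) β U f ↔ (∀ x ∈ U, DifferentiableAt ℝ f x) ∧ VCH m β U (fderiv ℝ f) := by
  have key : ∀ x ∈ U, iteratedFDerivWithin ℝ (m + 1) f U x =
      (continuousMultilinearCurryRightEquiv' ℝ m (Pt n) F).symm
        (iteratedFDerivWithin ℝ m (fderiv ℝ f) U x) := by
    intro x hx
    rw [iteratedFDerivWithin_succ_eq_comp_right hU.uniqueDiffOn hx]
    simp only [Function.comp]
    congr 1
    exact iteratedFDerivWithin_congr (fun _ hy => fderivWithin_of_isOpen hU hy) hx m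
  have hc : ContDiffOn ℝ (m + 1 : ℕ) f U ↔ (∀ x ∈ U, DifferentiableAt ℝ f x) ∧
      ContDiffOn ℝ m (fderiv ℝ f) U := by
    push_cast
    rw [contDiffOn_succ_iff_fderiv_of_isOpen hU]
    constructor
    · rintro ⟨h1, -, h2⟩
      exact ⟨fun x hx => h1.differentiableAt (hU.mem_nhds hx), h2⟩
    · rintro ⟨h1, h2⟩
      exact ⟨fun x hx => (h1 x hx).differentiableWithinAt, by simp, h2⟩
  unfold VCH
  rw [hc, and_assoc]
  refine and_congr_right fun _ => and_congr_right fun _ => ⟨fun h => ?_, fun h => ?_⟩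
  · refine (h.clm ((continuousMultilinearCurryRightEquiv' ℝ m (Pt n) F).toContinuousLinearEquiv :
      _ →L[ℝ] _)).congr fun x hx => ?_
    rw [key x hx]
    simp
  · refine (h.clm ((continuousMultilinearCurryRightEquiv' ℝ m (Pt n) F).symm.toContinuousLinearEquiv :
      _ →L[ℝ] _)).congr fun x hx => ?_
    rw [key x hx]
    simp

theorem LocHolder_iff_VHolder (hU : IsOpen U) (hβ : 0 < β) {f : Pt n → ℝ} :
    LocHolder β U f ↔ VHolder β U f := by
  constructor
  · intro h x hx
    obtain ⟨C, r, hC, hr, H⟩ := h x hx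
    refine ⟨C.toNNReal, Metric.ball x r, mem_nhdsWithin_of_mem_nhds (Metric.ball_mem_nhds x hr),
      fun y hy z hz => ?_⟩
    have := H y hy z hz
    rw [edist_dist, edist_dist, ENNReal.ofReal_rpow_of_nonneg dist_nonneg (by positivity),
      ← ENNReal.ofReal_coe_nnreal, ← ENNReal.ofReal_mul (by positivity)]
    refine ENNReal.ofReal_le_ofReal ?_
    rw [Real.dist_eq, dist_eq_norm, Real.coe_toNNReal _ hC, Real.coe_toNNReal _ hβ.le]
    exact this
  · intro h x hx
    obtain ⟨C, t, ht, H⟩ := h x hx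
    rw [nhdsWithin_eq_nhds.2 (hU.mem_nhds hx)] at ht
    obtain ⟨r, hr, hb⟩ := Metric.mem_nhds_iff.1 ht
    refine ⟨C, r, C.2, hr, fun y hy z hz => ?_⟩
    have := H.dist_le (hb hy) (hb hz)
    rwa [Real.dist_eq, dist_eq_norm, Real.coe_toNNReal _ hβ.le] at this

theorem VCH_zero_iff {f : Pt n → F} (hβ : 0 < β) : VCH 0 β U f ↔ VHolder β U f := by
  constructor
  · intro h
    refine (h.2.clm ((continuousMultilinearCurryFin0 ℝ (Pt n) F).toContinuousLinearEquiv :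
      _ →L[ℝ] _)).congr fun x hx => ?_
    simp [iteratedFDerivWithin_zero_eq_comp]
  · intro h
    refine ⟨?_, ?_⟩
    · refine contDiffOn_zero.2 fun x hx => ?_
      obtain ⟨C, t, ht, H⟩ := h x hx
      have hxt : x ∈ t := mem_of_mem_nhdsWithin hx ht
      have := (H.uniformContinuousOn (by simpa using hβ)).continuousOn x hxt
      exact this.mono_of_mem_nhdsWithin ht
    · refine (h.clm ((continuousMultilinearCurryFin0 ℝ (Pt n) F).symm.toContinuousLinearEquiv :
      _ →L[ℝ] _)).congr fun x hx => ?_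
      simp [iteratedFDerivWithin_zero_eq_comp]

theorem VCH_iff_CH (hU : IsOpen U) (hβ : 0 < β) {m : ℕ} : ∀ {f : Pt n → ℝ},
    VCH m β U f ↔ CH m β U f := by
  induction m with
  | zero => intro f; rw [VCH_zero_iff hβ, ← LocHolder_iff_VHolder hU hβ]; rfl
  | succ m ih =>
    intro f
    rw [VCH_succ_iff hU]
    refine and_congr_right fun _ => ⟨fun h a => ?_, fun h => ?_⟩
    · rw [← ih]
      exact h.clm hU (ContinuousLinearMap.apply ℝ ℝ (Pi.single a 1 : Pt n))
    · have : VCH m β U fun x => ∑ a, ContinuousLinearMap.toSpanSingleton ℝ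
          (ContinuousLinearMap.proj (R := ℝ) (φ := fun _ : Fin n => ℝ) a) (pd a f x) :=
        VCH.sum hU _ fun a _ => (ih.2 (h a)).clm hU _
      refine this.congr fun x hx => ?_
      rw [fderiv_eq_sum_pd]
      simp [ContinuousLinearMap.toSpanSingleton_apply]

theorem CHolderOn_iff_CH (hU : IsOpen U) (hβ : 0 < β) {m : ℕ} {f : Pt n → ℝ} :
    CHolderOn m β U f ↔ CH m β U f :=
  VCH_iff_CH hU hβ

end CHolderOn

section HolderBanach

/-- The algebra of bounded globally `β`-Hölder functions. -/
def holderSubalgebra (n : ℕ) (β : ℝ) : Subalgebra ℝ (Pt n → ℝ) where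
  carrier := {f | (∃ C, ∀ x, |f x| ≤ C) ∧ ∃ C, ∀ x y, |f x - f y| ≤ C * ‖x - y‖ ^ β}
  mul_mem' := by
    rintro f g ⟨⟨A, hA⟩, B, hB⟩ ⟨⟨A', hA'⟩, B', hB'⟩
    have hA0 : 0 ≤ A := (abs_nonneg _).trans (hA 0)
    have hA0' : 0 ≤ A' := (abs_nonneg _).trans (hA' 0)
    refine ⟨⟨A * A', fun x => ?_⟩, B * A' + A * B', fun x y => ?_⟩
    · rw [Pi.mul_apply, abs_mul]
      exact mul_le_mul (hA x) (hA' x) (abs_nonneg _) hA0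
    · have e : (f * g) x - (f * g) y = (f x - f y) * g x + f y * (g x - g y) := by
        simp only [Pi.mul_apply]; ring
      rw [e]
      refine (abs_add_le _ _).trans ?_
      rw [abs_mul, abs_mul, add_mul]
      refine add_le_add ?_ ?_
      · have h := mul_le_mul (hB x y) (hA' x) (abs_nonneg _) ((abs_nonneg _).trans (hB x y))
        linarith
      · have h := mul_le_mul (hA y) (hB' x y) (abs_nonneg _) hA0
        linarith
  add_mem' := by
    rintro f g ⟨⟨A, hA⟩, B, hB⟩ ⟨⟨A', hA'⟩, B', hB'⟩
    refine ⟨⟨A + A', fun x => ?_⟩, B + B', fun x y => ?_⟩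
    · exact (abs_add_le _ _).trans (add_le_add (hA x) (hA' x))
    · have e : (f + g) x - (f + g) y = (f x - f y) + (g x - g y) := by
        simp only [Pi.add_apply]; ring
      rw [e, add_mul]
      exact (abs_add_le _ _).trans (add_le_add (hB x y) (hB' x y))
  algebraMap_mem' := by
    intro r
    refine ⟨⟨|r|, fun x => by simp⟩, 0, fun x y => by simp⟩

/-- The Banach algebra of bounded globally `β`-Hölder functions. -/
def HB (n : ℕ) (β : ℝ) : Type := holderSubalgebra n β

namespace HB

variable {n : ℕ} {β : ℝ}

instance : CommRing (HB n β) := inferInstanceAs (CommRing (holderSubalgebra n β))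
instance : Algebra ℝ (HB n β) := inferInstanceAs (Algebra ℝ (holderSubalgebra n β))

instance : CoeFun (HB n β) fun _ => Pt n → ℝ := ⟨fun f => f.1⟩

@[ext] theorem ext {f g : HB n β} (h : ∀ x, f x = g x) : f = g := Subtype.ext (funext h)

@[simp] theorem add_apply (f g : HB n β) (x : Pt n) : (f + g) x = f x + g x := rfl
@[simp] theorem sub_apply (f g : HB n β) (x : Pt n) : (f - g) x = f x - g x := rfl
@[simp] theorem neg_apply (f : HB n β) (x : Pt n) : (-f) x = - f x := rfl
@[simp] theorem mul_apply (f g : HB n β) (x : Pt n) : (f * g) x = f x * g x := rfl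
@[simp] theorem smul_apply (c : ℝ) (f : HB n β) (x : Pt n) : (c • f) x = c * f x := rfl
@[simp] theorem zero_apply (x : Pt n) : (0 : HB n β) x = 0 := rfl
@[simp] theorem one_apply (x : Pt n) : (1 : HB n β) x = 1 := rfl
@[simp] theorem algebraMap_apply (c : ℝ) (x : Pt n) : (algebraMap ℝ (HB n β) c) x = c := rfl

/-- Evaluation at a point as an algebra homomorphism. -/
def evalHom (x : Pt n) : HB n β →ₐ[ℝ] ℝ :=
  (Pi.evalAlgHom ℝ (fun _ : Pt n => ℝ) x).comp (holderSubalgebra n β).val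

@[simp] theorem evalHom_apply (x : Pt n) (f : HB n β) : evalHom x f = f x := rfl

@[simp] theorem sum_apply {ι : Type*} (s : Finset ι) (f : ι → HB n β) (x : Pt n) :
    (∑ i ∈ s, f i) x = ∑ i ∈ s, f i x :=
  map_sum (evalHom x) f s

/-- The supremum part of the norm. -/
def supN (f : HB n β) : ℝ := ⨆ x, |f x|

/-- The Hölder seminorm. -/
def holN (f : HB n β) : ℝ := ⨆ p : Pt n × Pt n, |f p.1 - f p.2| / ‖p.1 - p.2‖ ^ β

theorem abs_le_supN (f : HB n β) (x : Pt n) : |f x| ≤ supN f := by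
  obtain ⟨C, hC⟩ := f.2.1
  exact le_ciSup (f := fun x => |f x|) ⟨C, by rintro _ ⟨y, rfl⟩; exact hC y⟩ x

theorem supN_nonneg (f : HB n β) : 0 ≤ supN f := (abs_nonneg _).trans (abs_le_supN f 0)

theorem div_le_of_holder {C a t : ℝ} (hC : 0 ≤ C) (h : a ≤ C * t) (ht : 0 ≤ t) : a / t ≤ C := by
  rcases eq_or_lt_of_le ht with h0 | h0
  · rw [← h0, div_zero]; exact hC
  · rwa [div_le_iff₀ h0]

theorem sub_le_holN (f : HB n β) (x y : Pt n) : |f x - f y| ≤ holN f * ‖x - y‖ ^ β := by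
  obtain ⟨C, hC⟩ := f.2.2
  rcases eq_or_ne x y with rfl | hxy
  · simp only [sub_self, abs_zero]
    refine mul_nonneg (Real.iSup_nonneg fun p => by positivity) (by positivity)
  · have hp : 0 < ‖x - y‖ ^ β := Real.rpow_pos_of_pos (norm_pos_iff.2 (sub_ne_zero.2 hxy)) _
    rw [← div_le_iff₀ hp]
    refine le_ciSup (f := fun p : Pt n × Pt n => |f p.1 - f p.2| / ‖p.1 - p.2‖ ^ β)
      ⟨|C|, ?_⟩ (x, y)
    rintro _ ⟨p, rfl⟩
    refine div_le_of_holder (abs_nonneg _) ((hC _ _).trans ?_) (by positivity)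
    exact mul_le_mul_of_nonneg_right (le_abs_self C) (by positivity)

theorem holN_nonneg (f : HB n β) : 0 ≤ holN f := Real.iSup_nonneg fun p => by positivity

theorem supN_le {f : HB n β} {A : ℝ} (h : ∀ x, |f x| ≤ A) : supN f ≤ A := ciSup_le h

theorem holN_le {f : HB n β} {B : ℝ} (hB : 0 ≤ B) (h : ∀ x y, |f x - f y| ≤ B * ‖x - y‖ ^ β) :
    holN f ≤ B :=
  ciSup_le fun p => div_le_of_holder hB (h p.1 p.2) (by positivity)

instance : NormedCommRing (HB n β) where
  toCommRing := inferInstance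
  norm f := supN f + holN f
  dist f g := supN (f - g) + holN (f - g)
  dist_eq f g := by
    have : f - g = -(-f + g) := by ring
    have e1 : supN (f - g) = supN (-f + g) := by
      unfold supN; congr 1; ext x; rw [this, neg_apply, abs_neg]
    have e2 : holN (f - g) = holN (-f + g) := by
      unfold holN; congr 1; ext p; rw [this, neg_apply, neg_apply]
      congr 1; rw [← abs_neg]; congr 1; ring
    rw [e1, e2]
  dist_self f := by
    rw [sub_self]; simp [supN, holN]
  dist_comm f g := by
    have : f - g = -(g - f) := by ring
    have e1 : supN (f - g) = supN (g - f) := by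
      unfold supN; congr 1; ext x; rw [this, neg_apply, abs_neg]
    have e2 : holN (f - g) = holN (g - f) := by
      unfold holN; congr 1; ext p; rw [this, neg_apply, neg_apply]
      congr 1; rw [← abs_neg]; congr 1; ring
    rw [e1, e2]
  dist_triangle f g h := by
    have e1 : supN (f - h) ≤ supN (f - g) + supN (g - h) := by
      refine supN_le fun x => ?_
      have : (f - h) x = (f - g) x + (g - h) x := by simp
      rw [this]
      exact (abs_add_le _ _).trans (add_le_add (abs_le_supN _ _) (abs_le_supN _ _))
    have e2 : holN (f - h) ≤ holN (f - g) + holN (g - h) := by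
      refine holN_le (add_nonneg (holN_nonneg _) (holN_nonneg _)) fun x y => ?_
      have : (f - h) x - (f - h) y = ((f - g) x - (f - g) y) + ((g - h) x - (g - h) y) := by
        simp only [sub_apply]; ring
      rw [this, add_mul]
      exact (abs_add_le _ _).trans (add_le_add (sub_le_holN _ _ _) (sub_le_holN _ _ _))
    linarith
  eq_of_dist_eq_zero {f g} h := by
    have h1 : supN (f - g) = 0 := by
      have := supN_nonneg (f - g); have := holN_nonneg (f - g)
      have h : supN (f - g) + holN (f - g) = 0 := h
      linarith
    ext x
    have := abs_le_supN (f - g) x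
    rw [h1, sub_apply] at this
    exact sub_eq_zero.1 (abs_eq_zero.1 (le_antisymm this (abs_nonneg _)))
  norm_mul_le f g := by
    have e1 : supN (f * g) ≤ supN f * supN g := by
      refine supN_le fun x => ?_
      rw [mul_apply, abs_mul]
      exact mul_le_mul (abs_le_supN _ _) (abs_le_supN _ _) (abs_nonneg _) (supN_nonneg _)
    have e2 : holN (f * g) ≤ holN f * supN g + supN f * holN g := by
      have := holN_nonneg f; have := holN_nonneg g; have := supN_nonneg f; have := supN_nonneg g
      refine holN_le (by positivity) fun x y => ?_
      have : (f * g) x - (f * g) y = (f x - f y) * g x + f y * (g x - g y) := by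
        simp only [mul_apply]; ring
      rw [this]
      refine (abs_add_le _ _).trans ?_
      rw [abs_mul, abs_mul, add_mul]
      refine add_le_add ?_ ?_
      · have h := mul_le_mul (sub_le_holN f x y) (abs_le_supN g x) (abs_nonneg _) (by positivity)
        linarith
      · have h := mul_le_mul (abs_le_supN f y) (sub_le_holN g x y) (abs_nonneg _) (by positivity)
        linarith
    have := mul_nonneg (holN_nonneg f) (holN_nonneg g)
    nlinarith

theorem norm_def (f : HB n β) : ‖f‖ = supN f + holN f := rfl

theorem abs_le_norm (f : HB n β) (x : Pt n) : |f x| ≤ ‖f‖ :=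
  (abs_le_supN f x).trans (by rw [norm_def]; linarith [holN_nonneg f])

theorem sub_le_norm (f : HB n β) (x y : Pt n) : |f x - f y| ≤ ‖f‖ * ‖x - y‖ ^ β :=
  (sub_le_holN f x y).trans (mul_le_mul_of_nonneg_right
    (by rw [norm_def]; linarith [supN_nonneg f]) (by positivity))

theorem norm_le {f : HB n β} {A B : ℝ} (hB : 0 ≤ B) (hA : ∀ x, |f x| ≤ A)
    (h : ∀ x y, |f x - f y| ≤ B * ‖x - y‖ ^ β) : ‖f‖ ≤ A + B :=
  add_le_add (supN_le hA) (holN_le hB h)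

/-- Constructor from bounds. -/
def of (f : Pt n → ℝ) (h1 : ∃ C, ∀ x, |f x| ≤ C) (h2 : ∃ C, ∀ x y, |f x - f y| ≤ C * ‖x - y‖ ^ β) :
    HB n β := ⟨f, h1, h2⟩

@[simp] theorem of_apply (f : Pt n → ℝ) (h1) (h2) (x : Pt n) : (of f h1 h2 : HB n β) x = f x := rfl

instance : NormedAlgebra ℝ (HB n β) where
  norm_smul_le c f := by
    rw [norm_def f, mul_add]
    refine norm_le (mul_nonneg (norm_nonneg _) (holN_nonneg f)) (fun x => ?_) fun x y => ?_
    · rw [smul_apply, abs_mul]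
      exact mul_le_mul_of_nonneg_left (abs_le_supN f x) (abs_nonneg c)
    · rw [smul_apply, smul_apply, ← mul_sub, abs_mul, mul_assoc]
      exact mul_le_mul_of_nonneg_left (sub_le_holN f x y) (abs_nonneg c)

theorem tendsto_apply {u : ℕ → HB n β} {f : HB n β} (h : Filter.Tendsto u Filter.atTop (nhds f))
    (x : Pt n) : Filter.Tendsto (fun i => u i x) Filter.atTop (nhds (f x)) := by
  rw [tendsto_iff_norm_sub_tendsto_zero] at h ⊢
  exact squeeze_zero (fun _ => norm_nonneg _) (fun i => abs_le_norm (u i - f) x) h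

instance : CompleteSpace (HB n β) := by
  refine Metric.complete_of_cauchySeq_tendsto fun u hu => ?_
  have hb : ∀ ε > 0, ∃ N, ∀ i ≥ N, ∀ j ≥ N, ‖u i - u j‖ < ε := by
    intro ε hε
    obtain ⟨N, hN⟩ := Metric.cauchySeq_iff.1 hu ε hε
    exact ⟨N, fun i hi j hj => by rw [← dist_eq_norm]; exact hN i hi j hj⟩
  have hx : ∀ x, ∃ l, Filter.Tendsto (fun i => u i x) Filter.atTop (nhds l) := by
    intro x
    refine cauchySeq_tendsto_of_complete (Metric.cauchySeq_iff.2 fun ε hε => ?_)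
    obtain ⟨N, hN⟩ := hb ε hε
    refine ⟨N, fun i hi j hj => ?_⟩
    rw [Real.dist_eq]
    exact (abs_le_norm (u i - u j) x).trans_lt (hN i hi j hj)
  choose l hl using hx
  have key : ∀ ε > 0, ∃ N, ∀ i ≥ N, (∀ x, |l x - u i x| ≤ ε) ∧
      ∀ x y, |(l x - u i x) - (l y - u i y)| ≤ ε * ‖x - y‖ ^ β := by
    intro ε hε
    obtain ⟨N, hN⟩ := hb ε hε
    refine ⟨N, fun i hi => ⟨fun x => ?_, fun x y => ?_⟩⟩
    · refine le_of_tendsto (((hl x).sub_const (u i x)).abs) ?_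
      filter_upwards [Filter.eventually_ge_atTop N] with j hj
      exact (abs_le_norm (u j - u i) x).trans (hN j hj i hi).le
    · refine le_of_tendsto ((((hl x).sub_const (u i x)).sub ((hl y).sub_const (u i y))).abs) ?_
      filter_upwards [Filter.eventually_ge_atTop N] with j hj
      exact (sub_le_norm (u j - u i) x y).trans
        (mul_le_mul_of_nonneg_right (hN j hj i hi).le (by positivity))
  obtain ⟨N, hN⟩ := key 1 one_pos
  have hN := hN N le_rfl
  let L : HB n β := of l ⟨1 + ‖u N‖, fun x => by
      have h1 := hN.1 x; have h2 := abs_le_norm (u N) x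
      calc |l x| = |(l x - u N x) + u N x| := by ring_nf
        _ ≤ _ := (abs_add_le _ _).trans (add_le_add h1 h2)⟩ ⟨1 + ‖u N‖, fun x y => by
      have h1 := hN.2 x y; have h2 := sub_le_norm (u N) x y
      calc |l x - l y| = |((l x - u N x) - (l y - u N y)) + (u N x - u N y)| := by ring_nf
        _ ≤ _ := by rw [add_mul]; exact (abs_add_le _ _).trans (add_le_add h1 h2)⟩
  refine ⟨L, Metric.tendsto_atTop.2 fun ε hε => ?_⟩
  obtain ⟨N, hN⟩ := key (ε / 4) (by positivity)
  refine ⟨N, fun i hi => ?_⟩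
  rw [dist_comm, dist_eq_norm]
  have := norm_le (f := L - u i) (by positivity) (hN i hi).1 (hN i hi).2
  linarith

theorem continuous (hβ : 0 < β) (f : HB n β) : Continuous f := by
  have : HolderWith ‖f‖₊ β.toNNReal f := by
    intro x y
    rw [edist_dist, edist_dist, ENNReal.ofReal_rpow_of_nonneg dist_nonneg (by positivity),
      ← ENNReal.ofReal_coe_nnreal, ← ENNReal.ofReal_mul (by positivity)]
    refine ENNReal.ofReal_le_ofReal ?_
    rw [Real.dist_eq, dist_eq_norm, Real.coe_toNNReal _ hβ.le]
    exact sub_le_norm f x y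
  exact this.continuous (by simpa using hβ)

/-- Bounded Lipschitz functions are Hölder, with an interpolation estimate. -/
theorem holder_of_lipschitz (hβ : 0 ≤ β) (hβ1 : β ≤ 1) {f : Pt n → ℝ} {S Λ : ℝ} (hΛ0 : 0 ≤ Λ)
    (hS : ∀ x, |f x| ≤ S) (hΛ : ∀ x y, |f x - f y| ≤ Λ * ‖x - y‖) (x y : Pt n) :
    |f x - f y| ≤ (2 * S) ^ (1 - β) * Λ ^ β * ‖x - y‖ ^ β := by
  rcases eq_or_ne x y with rfl | hxy
  · simp only [sub_self, abs_zero]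
    have := (abs_nonneg _).trans (hS x)
    positivity
  · have h3 : 0 < ‖x - y‖ := norm_pos_iff.2 (sub_ne_zero.2 hxy)
    have hS0 := (abs_nonneg _).trans (hS x)
    have h1 : |f x - f y| ≤ 2 * S := by
      have := abs_sub (f x) (f y)
      linarith [hS x, hS y]
    have ha := abs_nonneg (f x - f y)
    calc |f x - f y| = |f x - f y| ^ (1 - β) * |f x - f y| ^ β := by
          rw [← Real.rpow_add_of_nonneg ha (by linarith) hβ]; simp
      _ ≤ (2 * S) ^ (1 - β) * (Λ * ‖x - y‖) ^ β :=
          mul_le_mul (Real.rpow_le_rpow ha h1 (by linarith)) (Real.rpow_le_rpow ha (hΛ x y) hβ)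
            (by positivity) (by positivity)
      _ = _ := by rw [Real.mul_rpow hΛ0 h3.le]; ring

/-- The element of `HB` given by a bounded Lipschitz function. -/
def ofLip (hβ : 0 ≤ β) (hβ1 : β ≤ 1) (f : Pt n → ℝ) {S Λ : ℝ} (hΛ0 : 0 ≤ Λ)
    (hS : ∀ x, |f x| ≤ S) (hΛ : ∀ x y, |f x - f y| ≤ Λ * ‖x - y‖) : HB n β :=
  of f ⟨S, hS⟩ ⟨_, holder_of_lipschitz hβ hβ1 hΛ0 hS hΛ⟩

theorem norm_ofLip_le (hβ : 0 ≤ β) (hβ1 : β ≤ 1) {f : HB n β} {S Λ : ℝ} (hΛ0 : 0 ≤ Λ)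
    (hS : ∀ x, |f x| ≤ S) (hΛ : ∀ x y, |f x - f y| ≤ Λ * ‖x - y‖) :
    ‖f‖ ≤ S + (2 * S) ^ (1 - β) * Λ ^ β := by
  have := (abs_nonneg _).trans (hS 0)
  exact norm_le (by positivity) hS (holder_of_lipschitz hβ hβ1 hΛ0 hS hΛ)

end HB

end HolderBanach

section Operators

open MeasureTheory

variable {n : ℕ} {β : ℝ}

/-- Smooth compactly supported functions. -/
def IsTest (f : Pt n → ℝ) : Prop := ContDiff ℝ (⊤ : ℕ∞) f ∧ HasCompactSupport f

theorem pd_eq_zero_of_notMem_tsupport {f : Pt n → ℝ} {a : Fin n} {x : Pt n} (hx : x ∉ tsupport f) :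
    pd a f x = 0 := by
  have : f =ᶠ[nhds x] fun _ => 0 := notMem_tsupport_iff_eventuallyEq.1 hx
  simp [pd, this.fderiv_eq]

theorem HasCompactSupport.pd {f : Pt n → ℝ} (hf : HasCompactSupport f) (a : Fin n) :
    HasCompactSupport (pd a f) :=
  HasCompactSupport.intro hf fun _ hx => pd_eq_zero_of_notMem_tsupport hx

theorem IsTest.pd {f : Pt n → ℝ} (hf : IsTest f) (a : Fin n) : IsTest (pd a f) :=
  ⟨ContDiff.pd (by norm_cast) hf.1 a, hf.2.pd a⟩

theorem IsTest.continuous {f : Pt n → ℝ} (hf : IsTest f) : Continuous f := hf.1.continuous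

theorem IsTest.differentiable {f : Pt n → ℝ} (hf : IsTest f) : Differentiable ℝ f :=
  hf.1.differentiable (by simp)

theorem integrable_of_cpt {f : Pt n → ℝ} (h : Continuous f) (hf : HasCompactSupport f) :
    Integrable f := h.integrable_of_hasCompactSupport hf

theorem IsTest.integrable_mul {f d : Pt n → ℝ} (hf : IsTest f) (hd : Continuous d) :
    Integrable fun z => f z * d z :=
  integrable_of_cpt (hf.continuous.mul hd) hf.2.mul_right

theorem IsTest.integrable {f : Pt n → ℝ} (hf : IsTest f) : Integrable f :=
  integrable_of_cpt hf.continuous hf.2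

theorem IsTest.exists_lip {f : Pt n → ℝ} (hf : IsTest f) :
    ∃ L, 0 ≤ L ∧ ∀ x y, |f x - f y| ≤ L * ‖x - y‖ := by
  obtain ⟨C, hC⟩ := (hf.1.of_le (m := 1) (by exact_mod_cast le_top)).lipschitzWith_of_hasCompactSupport
    hf.2 one_ne_zero
  refine ⟨C, C.2, fun x y => ?_⟩
  have := hC.dist_le_mul x y
  rwa [Real.dist_eq, dist_eq_norm] at this

theorem HasCompactSupport.exists_radius {f : Pt n → ℝ} (hf : HasCompactSupport f) :
    ∃ ρ, 0 < ρ ∧ ∀ z, ρ < ‖z‖ → f z = 0 := by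
  obtain ⟨ρ, hρ, h⟩ := hf.isCompact.isBounded.exists_pos_norm_le
  refine ⟨ρ, hρ, fun z hz => ?_⟩
  by_contra h0
  exact absurd (h z (subset_tsupport f h0)) (not_le.2 hz)

theorem IsTest.exists_bound {f : Pt n → ℝ} (hf : IsTest f) : ∃ C, ∀ x, |f x| ≤ C :=
  hf.2.exists_bound_of_continuous hf.continuous

/-- The rescaled convolution `∫ K(z) d(x - s z) dz`. -/
def innerInt (K d : Pt n → ℝ) (s : ℝ) (x : Pt n) : ℝ := ∫ z, K z * d (x - s • z)

theorem innerInt_integrable {K d : Pt n → ℝ} (hK : IsTest K) (hd : Continuous d) (s : ℝ) (x : Pt n) :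
    Integrable fun z => K z * d (x - s • z) :=
  hK.integrable_mul (by fun_prop)

theorem innerInt_add {K : Pt n → ℝ} (hK : IsTest K) {d e : Pt n → ℝ} (hd : Continuous d)
    (he : Continuous e) (s : ℝ) (x : Pt n) :
    innerInt K (fun y => d y + e y) s x = innerInt K d s x + innerInt K e s x := by
  unfold innerInt
  rw [← integral_add (innerInt_integrable hK hd s x) (innerInt_integrable hK he s x)]
  congr 1; ext z; ring

theorem innerInt_smul {K : Pt n → ℝ} (c : ℝ) (d : Pt n → ℝ) (s : ℝ) (x : Pt n) :
    innerInt K (fun y => c * d y) s x = c * innerInt K d s x := by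
  unfold innerInt
  rw [← integral_const_mul]
  congr 1; ext z; ring

theorem innerInt_continuous {K d : Pt n → ℝ} (hK : IsTest K) (hd : Continuous d) {C : ℝ}
    (hC : ∀ x, |d x| ≤ C) : Continuous fun p : ℝ × Pt n => innerInt K d p.1 p.2 := by
  unfold innerInt
  refine continuous_of_dominated (bound := fun z => |K z| * C)
    (fun p => (innerInt_integrable hK hd p.1 p.2).aestronglyMeasurable) (fun p => ?_)
    (hK.integrable.abs.mul_const C) ?_
  · refine Filter.Eventually.of_forall fun z => ?_
    rw [Real.norm_eq_abs, abs_mul]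
    exact mul_le_mul_of_nonneg_left (hC _) (abs_nonneg _)
  · exact Filter.Eventually.of_forall fun z => by fun_prop

theorem abs_innerInt_le_sup {K d : Pt n → ℝ} (hK : IsTest K) {C : ℝ}
    (hC : ∀ x, |d x| ≤ C) (s : ℝ) (x : Pt n) : |innerInt K d s x| ≤ (∫ z, |K z|) * C := by
  unfold innerInt
  rw [← integral_mul_const]
  rw [← Real.norm_eq_abs]
  refine norm_integral_le_of_norm_le (hK.integrable.abs.mul_const C)
    (Filter.Eventually.of_forall fun z => ?_)
  rw [Real.norm_eq_abs, abs_mul]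
  exact mul_le_mul_of_nonneg_left (hC _) (abs_nonneg _)

theorem IsTest.integrable_abs_mul_rpow {K : Pt n → ℝ} (hK : IsTest K) (hβ : 0 < β) :
    Integrable fun z => |K z| * ‖z‖ ^ β :=
  integrable_of_cpt (hK.continuous.abs.mul (continuous_norm.rpow_const fun _ => Or.inr hβ.le))
    hK.2.abs.mul_right

theorem abs_innerInt_le {K : Pt n → ℝ} (hK : IsTest K) (hK0 : ∫ z, K z = 0) (hβ : 0 < β)
    (d : HB n β) {s : ℝ} (hs : 0 ≤ s) (x : Pt n) :
    |innerInt K d s x| ≤ (∫ z, |K z| * ‖z‖ ^ β) * ‖d‖ * s ^ β := by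
  have e : innerInt K d s x = ∫ z, K z * (d (x - s • z) - d x) := by
    simp_rw [mul_sub]
    rw [integral_sub (innerInt_integrable hK (d.continuous hβ) s x) (hK.integrable.mul_const _),
      integral_mul_const, hK0]
    simp [innerInt]
  rw [e, mul_assoc, ← integral_mul_const]
  rw [← Real.norm_eq_abs]
  refine norm_integral_le_of_norm_le ((hK.integrable_abs_mul_rpow hβ).mul_const _)
    (Filter.Eventually.of_forall fun z => ?_)
  rw [Real.norm_eq_abs, abs_mul, mul_assoc]
  refine mul_le_mul_of_nonneg_left ?_ (abs_nonneg _)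
  refine (d.sub_le_norm _ _).trans (le_of_eq ?_)
  have : ‖x - s • z - x‖ = s * ‖z‖ := by
    rw [sub_sub_cancel_left, norm_neg, norm_smul, Real.norm_of_nonneg hs]
  rw [this, Real.mul_rpow hs (norm_nonneg _)]
  ring

theorem exists_innerInt_sub_le {K : Pt n → ℝ} (hK : IsTest K) (hβ : 0 < β) :
    ∃ C, 0 ≤ C ∧ ∀ (d : HB n β) (s : ℝ) (x y : Pt n), 0 < s → ‖x - y‖ ≤ s →
      |innerInt K d s x - innerInt K d s y| ≤ C * ‖d‖ * (s ^ (β - 1) * ‖x - y‖) := by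
  obtain ⟨L, hL0, hL⟩ := hK.exists_lip
  obtain ⟨ρ, hρ, hρK⟩ := hK.2.exists_radius
  set V : ℝ := (volume (Metric.closedBall (0 : Pt n) (ρ + 1))).toReal
  refine ⟨L * (ρ + 1) ^ β * V, by positivity, fun d s x y hs hxy => ?_⟩
  have hd := d.continuous hβ
  set h : Pt n := s⁻¹ • (y - x) with hh
  have hh1 : ‖h‖ = s⁻¹ * ‖x - y‖ := by
    rw [hh, norm_smul, Real.norm_of_nonneg (inv_nonneg.2 hs.le), norm_sub_rev]
  have hh2 : ‖h‖ ≤ 1 := by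
    rw [hh1, inv_mul_le_iff₀ hs]; linarith
  have hxz : ∀ z, y - s • (z + h) = x - s • z := by
    intro z
    ext i
    simp only [hh, Pi.sub_apply, Pi.smul_apply, Pi.add_apply, smul_eq_mul]
    field_simp
    ring
  have e1 : innerInt K d s y = ∫ z, K (z + h) * d (x - s • z) := by
    unfold innerInt
    rw [← integral_add_right_eq_self (fun z => K z * d (y - s • z)) h]
    congr 1; ext z
    rw [hxz]
  have hKh : Integrable fun z => K (z + h) := hK.integrable.comp_add_right h
  have i1 := innerInt_integrable hK hd s x
  have i2 : Integrable fun z => K (z + h) * d (x - s • z) := by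
    have := (innerInt_integrable hK hd s y).comp_add_right h
    refine this.congr (Filter.Eventually.of_forall fun z => ?_)
    simp only
    rw [hxz]
  have e2 : innerInt K d s x - innerInt K d s y =
      ∫ z, (K z - K (z + h)) * (d (x - s • z) - d x) := by
    have e3 : ∀ z, (K z - K (z + h)) * (d (x - s • z) - d x) =
        (K z * d (x - s • z) - K (z + h) * d (x - s • z)) - (K z * d x - K (z + h) * d x) :=
      fun z => by ring
    simp_rw [e3]
    have i3 : Integrable fun z => K z * d x := hK.integrable.mul_const _
    have i4 : Integrable fun z => K (z + h) * d x := hKh.mul_const _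
    have i5 : Integrable fun z => K z * d (x - s • z) - K (z + h) * d (x - s • z) := i1.sub i2
    have i6 : Integrable fun z => K z * d x - K (z + h) * d x := i3.sub i4
    have e4 := integral_sub i5 i6
    have e5 := integral_sub i1 i2
    have e6 := integral_sub i3 i4
    have e7 : ∫ z, K (z + h) * d x = ∫ z, K z * d x := by
      rw [integral_mul_const, integral_mul_const, integral_add_right_eq_self K h]
    rw [e4, e5, e6, e1, e7, sub_self, sub_zero]
    rfl
  rw [e2]
  have hb : ∀ z, ‖(K z - K (z + h)) * (d (x - s • z) - d x)‖ ≤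
      (Metric.closedBall (0 : Pt n) (ρ + 1)).indicator
        (fun _ => L * ‖h‖ * (‖d‖ * (s * (ρ + 1)) ^ β)) z := by
    intro z
    by_cases hz : z ∈ Metric.closedBall (0 : Pt n) (ρ + 1)
    · rw [Set.indicator_of_mem hz, Real.norm_eq_abs, abs_mul]
      have hz' : ‖z‖ ≤ ρ + 1 := by simpa using hz
      refine mul_le_mul ?_ ?_ (abs_nonneg _) (by positivity)
      · have := hL z (z + h)
        rwa [sub_add_cancel_left, norm_neg] at this
      · refine (d.sub_le_norm _ _).trans (mul_le_mul_of_nonneg_left ?_ (norm_nonneg _))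
        refine Real.rpow_le_rpow (norm_nonneg _) ?_ hβ.le
        rw [sub_sub_cancel_left, norm_neg, norm_smul, Real.norm_of_nonneg hs.le]
        exact mul_le_mul_of_nonneg_left hz' hs.le
    · rw [Set.indicator_of_notMem hz]
      have hz' : ρ + 1 < ‖z‖ := by simpa using hz
      have h1 : K z = 0 := hρK z (by linarith)
      have h2 : K (z + h) = 0 := hρK _ (by
        have := norm_sub_le (z + h) h
        rw [add_sub_cancel_right] at this
        linarith)
      simp [h1, h2]
  refine (norm_integral_le_of_norm_le ?_ (Filter.Eventually.of_forall hb)).trans (le_of_eq ?_)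
  · exact (integrable_indicator_iff measurableSet_closedBall).2
      (integrableOn_const (measure_closedBall_lt_top.ne))
  · rw [integral_indicator measurableSet_closedBall, setIntegral_const, smul_eq_mul, Measure.real,
      hh1, Real.mul_rpow hs.le (by positivity), Real.rpow_sub_one hs.ne']
    simp only [V]
    field_simp

/-- The singular integral `∫_0^1 ω(s) ∫ K(z) d(x - s z) dz ds`. -/
def singInt (K : Pt n → ℝ) (ω : ℝ → ℝ) (d : Pt n → ℝ) (x : Pt n) : ℝ :=
  ∫ s in Ioc (0 : ℝ) 1, ω s * innerInt K d s x

/-- Admissible weights. -/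
def IsWeight (ω : ℝ → ℝ) : Prop := Measurable ω ∧ ∀ s ∈ Ioc (0 : ℝ) 1, |ω s| ≤ s⁻¹

theorem integrableOn_rpow_Ioc {γ : ℝ} (hγ : -1 < γ) {t : ℝ} (ht : 0 ≤ t) :
    IntegrableOn (fun s : ℝ => s ^ γ) (Ioc 0 t) := by
  have := intervalIntegral.intervalIntegrable_rpow' (a := 0) (b := t) hγ
  rwa [intervalIntegrable_iff_integrableOn_Ioc_of_le ht] at this

theorem integral_rpow_Ioc {γ : ℝ} (hγ : 0 < γ) {t : ℝ} (ht : 0 ≤ t) :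
    ∫ s in Ioc 0 t, s ^ (γ - 1) = t ^ γ / γ := by
  rw [← intervalIntegral.integral_of_le ht, integral_rpow (Or.inl (by linarith))]
  simp [Real.zero_rpow hγ.ne']

theorem weight_mul_le {ω : ℝ → ℝ} (hω : IsWeight ω) {s : ℝ} (hs : s ∈ Ioc (0 : ℝ) 1) {a A : ℝ}
    (ha : |a| ≤ A * s ^ β) : |ω s * a| ≤ A * s ^ (β - 1) := by
  rw [abs_mul]
  calc _ ≤ s⁻¹ * (A * s ^ β) := mul_le_mul (hω.2 s hs) ha (abs_nonneg _) (inv_nonneg.2 hs.1.le)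
    _ = _ := by rw [Real.rpow_sub_one hs.1.ne']; ring

theorem singInt_integrable {K : Pt n → ℝ} (hK : IsTest K) (hK0 : ∫ z, K z = 0) (hβ : 0 < β)
    {ω : ℝ → ℝ} (hω : IsWeight ω) (d : HB n β) (x : Pt n) :
    IntegrableOn (fun s => ω s * innerInt K d s x) (Ioc 0 1) := by
  refine Integrable.mono' (g := fun s => ((∫ z, |K z| * ‖z‖ ^ β) * ‖d‖) * s ^ (β - 1))
    ((integrableOn_rpow_Ioc (by linarith) zero_le_one).const_mul _) ?_ ?_
  · have h := (innerInt_continuous hK (d.continuous hβ) d.abs_le_norm).comp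
      (Continuous.prodMk continuous_id (continuous_const (y := x)))
    exact (hω.1.mul h.measurable).aestronglyMeasurable
  · refine (ae_restrict_iff' measurableSet_Ioc).2 (Filter.Eventually.of_forall fun s hs => ?_)
    exact weight_mul_le hω hs (abs_innerInt_le hK hK0 hβ d hs.1.le x)

theorem abs_singInt_le {K : Pt n → ℝ} (hK : IsTest K) (hK0 : ∫ z, K z = 0) (hβ : 0 < β)
    {ω : ℝ → ℝ} (hω : IsWeight ω) (d : HB n β) (x : Pt n) :
    |singInt K ω d x| ≤ (∫ z, |K z| * ‖z‖ ^ β) / β * ‖d‖ := by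
  have h := norm_integral_le_of_norm_le (μ := volume.restrict (Ioc (0 : ℝ) 1))
    (f := fun s => ω s * innerInt K d s x)
    (g := fun s => ((∫ z, |K z| * ‖z‖ ^ β) * ‖d‖) * s ^ (β - 1))
    ((integrableOn_rpow_Ioc (by linarith) zero_le_one).const_mul _)
    ((ae_restrict_iff' measurableSet_Ioc).2 (Filter.Eventually.of_forall fun s hs =>
      weight_mul_le hω hs (abs_innerInt_le hK hK0 hβ d hs.1.le x)))
  refine h.trans (le_of_eq ?_)
  rw [integral_const_mul, integral_rpow_Ioc hβ zero_le_one, Real.one_rpow]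
  ring

theorem exists_singInt_sub_le {K : Pt n → ℝ} (hK : IsTest K) (hK0 : ∫ z, K z = 0) (hβ : 0 < β)
    (hβ1 : β < 1) {ω : ℝ → ℝ} (hω : IsWeight ω) :
    ∃ C, 0 ≤ C ∧ ∀ (d : HB n β) (x y : Pt n),
      |singInt K ω d x - singInt K ω d y| ≤ C * ‖d‖ * ‖x - y‖ ^ β := by
  obtain ⟨C2, hC2, H2⟩ := exists_innerInt_sub_le (β := β) hK hβ
  set C1 : ℝ := ∫ z, |K z| * ‖z‖ ^ β
  have hC1 : 0 ≤ C1 := integral_nonneg fun z => by positivity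
  have h1β : 0 < 1 - β := by linarith
  refine ⟨2 * C1 / β + C2 / (1 - β), by positivity, fun d x y => ?_⟩
  rcases eq_or_ne x y with rfl | hxy
  · simp only [sub_self, abs_zero]; positivity
  set t := ‖x - y‖
  have ht : 0 < t := norm_pos_iff.2 (sub_ne_zero.2 hxy)
  have e : singInt K ω d x - singInt K ω d y =
      ∫ s in Ioc (0 : ℝ) 1, ω s * (innerInt K d s x - innerInt K d s y) := by
    unfold singInt
    rw [← integral_sub (singInt_integrable hK hK0 hβ hω d x) (singInt_integrable hK hK0 hβ hω d y)]
    congr 1; ext s; ring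
  let g : ℝ → ℝ := (Ioc 0 t).indicator (fun s => 2 * C1 * ‖d‖ * s ^ (β - 1)) +
    (Ioi t).indicator (fun s => C2 * ‖d‖ * t * s ^ (β - 2))
  have g1 : IntegrableOn (fun s => 2 * C1 * ‖d‖ * s ^ (β - 1)) (Ioc 0 t) :=
    (integrableOn_rpow_Ioc (by linarith) ht.le).const_mul _
  have g2 : IntegrableOn (fun s => C2 * ‖d‖ * t * s ^ (β - 2)) (Ioi t) :=
    (integrableOn_Ioi_rpow_of_lt (by linarith) ht).const_mul _
  have gi : Integrable g :=
    ((integrable_indicator_iff measurableSet_Ioc).2 g1).add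
      ((integrable_indicator_iff measurableSet_Ioi).2 g2)
  have g0 : ∀ s, 0 ≤ g s := by
    intro s
    refine add_nonneg (Set.indicator_nonneg (fun r hr => ?_) s)
      (Set.indicator_nonneg (fun r hr => ?_) s)
    · have : 0 ≤ r := hr.1.le
      positivity
    · have : 0 ≤ r := (ht.trans hr).le
      positivity
  have hb : ∀ s ∈ Ioc (0 : ℝ) 1, ‖ω s * (innerInt K d s x - innerInt K d s y)‖ ≤ g s := by
    intro s hs
    rw [Real.norm_eq_abs]
    rcases le_or_gt s t with hst | hst
    · have : g s = 2 * C1 * ‖d‖ * s ^ (β - 1) := by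
        simp only [g, Pi.add_apply]
        rw [Set.indicator_of_mem (show s ∈ Ioc 0 t from ⟨hs.1, hst⟩),
          Set.indicator_of_notMem (show s ∉ Ioi t from not_lt.2 hst), add_zero]
      rw [this]
      refine weight_mul_le hω hs ?_
      have h1 := abs_innerInt_le hK hK0 hβ d hs.1.le x
      have h2 := abs_innerInt_le hK hK0 hβ d hs.1.le y
      have h3 := abs_sub (innerInt K d s x) (innerInt K d s y)
      calc _ ≤ _ := h3
        _ ≤ _ := add_le_add h1 h2
        _ = _ := by ring
    · have : g s = C2 * ‖d‖ * t * s ^ (β - 2) := by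
        simp only [g, Pi.add_apply]
        rw [Set.indicator_of_notMem (show s ∉ Ioc 0 t from fun h => absurd h.2 (not_le.2 hst)),
          Set.indicator_of_mem (show s ∈ Ioi t from hst), zero_add]
      rw [this]
      have h1 := weight_mul_le (β := β - 1) hω hs (A := C2 * ‖d‖ * t)
        ((H2 d s x y hs.1 hst.le).trans (le_of_eq (by ring)))
      rwa [show β - 1 - 1 = β - 2 by ring] at h1
  rw [e]
  refine (norm_integral_le_of_norm_le (μ := volume.restrict (Ioc (0 : ℝ) 1)) gi.integrableOn
    ((ae_restrict_iff' measurableSet_Ioc).2 (Filter.Eventually.of_forall hb))).trans ?_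
  refine (setIntegral_le_integral gi (Filter.Eventually.of_forall g0)).trans (le_of_eq ?_)
  have : ∫ s, g s = (∫ s in Ioc 0 t, 2 * C1 * ‖d‖ * s ^ (β - 1)) +
      ∫ s in Ioi t, C2 * ‖d‖ * t * s ^ (β - 2) := by
    simp only [g, Pi.add_apply]
    rw [integral_add ((integrable_indicator_iff measurableSet_Ioc).2 g1)
      ((integrable_indicator_iff measurableSet_Ioi).2 g2), integral_indicator measurableSet_Ioc,
      integral_indicator measurableSet_Ioi]
  rw [this, integral_const_mul, integral_const_mul, integral_rpow_Ioc hβ ht.le,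
    integral_Ioi_rpow_of_lt (by linarith) ht]
  have e3 : t ^ (β - 2 + 1) = t ^ β / t := by
    rw [show β - 2 + 1 = β - 1 by ring, Real.rpow_sub_one ht.ne']
  rw [e3]
  have h4 : β - 2 + 1 ≠ 0 := by linarith
  have h5 : -(t ^ β / t) / (β - 2 + 1) = t ^ β / t / (1 - β) := by
    rw [show β - 2 + 1 = -(1 - β) by ring, neg_div_neg_eq]
  rw [h5]
  field_simp

/-- The singular integral operator on the Hölder algebra. -/
theorem exists_singOp {K : Pt n → ℝ} (hK : IsTest K) (hK0 : ∫ z, K z = 0) (hβ : 0 < β)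
    (hβ1 : β < 1) {ω : ℝ → ℝ} (hω : IsWeight ω) :
    ∃ T : HB n β →L[ℝ] HB n β, ∀ d x, T d x = singInt K ω d x := by
  obtain ⟨C, hC, H⟩ := exists_singInt_sub_le hK hK0 hβ hβ1 hω
  let T : HB n β →ₗ[ℝ] HB n β :=
    { toFun := fun d => HB.of (singInt K ω d) ⟨_, abs_singInt_le hK hK0 hβ hω d⟩ ⟨_, H d⟩
      map_add' := fun d e => by
        ext x
        simp only [HB.of_apply, HB.add_apply, singInt]
        rw [← integral_add (singInt_integrable hK hK0 hβ hω d x)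
          (singInt_integrable hK hK0 hβ hω e x)]
        congr 1; ext s
        rw [← mul_add, ← innerInt_add hK (d.continuous hβ) (e.continuous hβ)]
        rfl
      map_smul' := fun c d => by
        ext x
        simp only [HB.of_apply, HB.smul_apply, singInt, RingHom.id_apply]
        rw [← integral_const_mul]
        congr 1; ext s
        have : innerInt K (c • d : HB n β) s x = c * innerInt K d s x :=
          innerInt_smul c d s x
        rw [this]; ring }
  refine ⟨T.mkContinuous ((∫ z, |K z| * ‖z‖ ^ β) / β + C) fun d => ?_, fun d x => rfl⟩
  rw [add_mul]
  exact HB.norm_le (by positivity) (abs_singInt_le hK hK0 hβ hω d) (H d)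

/-- Convolution with a test function as an operator on the Hölder algebra. -/
theorem exists_convOp {K : Pt n → ℝ} (hK : IsTest K) (hβ : 0 < β) :
    ∃ T : HB n β →L[ℝ] HB n β, ∀ d x, T d x = innerInt K d 1 x := by
  have H : ∀ (d : HB n β) (x y : Pt n), |innerInt K d 1 x - innerInt K d 1 y| ≤
      (∫ z, |K z|) * ‖d‖ * ‖x - y‖ ^ β := by
    intro d x y
    unfold innerInt
    rw [← integral_sub (innerInt_integrable hK (d.continuous hβ) 1 x)
      (innerInt_integrable hK (d.continuous hβ) 1 y), mul_assoc, ← integral_mul_const]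
    rw [← Real.norm_eq_abs]
    refine norm_integral_le_of_norm_le (hK.integrable.abs.mul_const _)
      (Filter.Eventually.of_forall fun z => ?_)
    rw [← mul_sub, Real.norm_eq_abs, abs_mul]
    refine mul_le_mul_of_nonneg_left ?_ (abs_nonneg _)
    refine (d.sub_le_norm _ _).trans (le_of_eq ?_)
    rw [sub_sub_sub_cancel_right]
  have hC : 0 ≤ ∫ z, |K z| := integral_nonneg fun z => abs_nonneg _
  let T : HB n β →ₗ[ℝ] HB n β :=
    { toFun := fun d => HB.of (innerInt K d 1) ⟨_, abs_innerInt_le_sup hK d.abs_le_norm 1⟩ ⟨_, H d⟩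
      map_add' := fun d e => by
        ext x
        exact innerInt_add hK (d.continuous hβ) (e.continuous hβ) 1 x
      map_smul' := fun c d => by
        ext x
        exact innerInt_smul c d 1 x }
  refine ⟨T.mkContinuous ((∫ z, |K z|) + ∫ z, |K z|) fun d => ?_, fun d x => rfl⟩
  rw [add_mul]
  exact HB.norm_le (by positivity) (abs_innerInt_le_sup hK d.abs_le_norm 1) (H d)

end Operators

section Kernel

open MeasureTheory

variable {n : ℕ}

theorem pd_comm {f : Pt n → ℝ} {x : Pt n} (hf : ContDiffAt ℝ 2 f x) (a b : Fin n) :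
    pd a (pd b f) x = pd b (pd a f) x := by
  have h1 : DifferentiableAt ℝ (fderiv ℝ f) x :=
    (hf.fderiv_right (m := 1) (by norm_num)).differentiableAt (by simp)
  have key : ∀ c d : Fin n, pd c (pd d f) x =
      fderiv ℝ (fderiv ℝ f) x (Pi.single c 1) (Pi.single d 1) := by
    intro c d
    have h2 := h1.hasFDerivAt.clm_apply (hasFDerivAt_const (Pi.single d (1 : ℝ) : Pt n) x)
    have h3 : fderiv ℝ (pd d f) x = _ := h2.fderiv
    rw [pd, h3]
    simp
  rw [key, key]
  exact (hf.isSymmSndFDerivAt (by simp)) _ _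

theorem two_le_smooth : (2 : WithTop ℕ∞) ≤ ((⊤ : ℕ∞) : WithTop ℕ∞) := by
  have : ((2 : ℕ∞) : WithTop ℕ∞) ≤ ((⊤ : ℕ∞) : WithTop ℕ∞) := by exact_mod_cast le_top
  exact this

/-- The space of smooth functions. -/
def smoothSub (n : ℕ) : Submodule ℝ (Pt n → ℝ) where
  carrier := {f | ContDiff ℝ (⊤ : ℕ∞) f}
  add_mem' := by
    intro f g hf hg
    exact ContDiff.add (mem_ofPred_eq ▸ hf) (mem_ofPred_eq ▸ hg)
  zero_mem' := by
    have : ContDiff ℝ (⊤ : ℕ∞) (fun _ : Pt n => (0 : ℝ)) := contDiff_const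
    exact this
  smul_mem' := by
    intro c f hf
    exact ContDiff.const_smul c (mem_ofPred_eq ▸ hf)

theorem mem_smoothSub {f : Pt n → ℝ} : f ∈ smoothSub n ↔ ContDiff ℝ (⊤ : ℕ∞) f := Iff.rfl

theorem smoothSub_contDiff (f : smoothSub n) : ContDiff ℝ (⊤ : ℕ∞) f.1 := f.2

/-- Partial differentiation as an endomorphism of the smooth functions. -/
def smoothPd (a : Fin n) : Module.End ℝ (smoothSub n) where
  toFun f := ⟨pd a f.1, mem_smoothSub.2 (ContDiff.pd (by norm_cast) (smoothSub_contDiff f) a)⟩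
  map_add' f g := by
    ext x
    exact pd_add ((smoothSub_contDiff f).differentiable (by simp) x) ((smoothSub_contDiff g).differentiable (by simp) x)
  map_smul' c f := by
    ext x
    exact pd_const_mul ((smoothSub_contDiff f).differentiable (by simp) x)

theorem smoothPd_comm (a b : Fin n) : smoothPd a * smoothPd b = smoothPd b * smoothPd a := by
  ext f x
  exact pd_comm ((smoothSub_contDiff f).of_le (two_le_smooth)).contDiffAt a b

open scoped IsMulCommutative in
/-- A quartic form vanishing identically gives a vanishing differential operator. -/
theorem quartic_symbol_zero {T : Fin n → Fin n → Fin n → Fin n → ℝ}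
    (hT : ∀ ξ : Pt n, ∑ i, ∑ j, ∑ k, ∑ l, T i j k l * (ξ i * ξ j * ξ k * ξ l) = 0)
    {f : Pt n → ℝ} (hf : ContDiff ℝ (⊤ : ℕ∞) f) (x : Pt n) :
    ∑ i, ∑ j, ∑ k, ∑ l, T i j k l * pd i (pd j (pd k (pd l f))) x = 0 := by
  let S : Set (Module.End ℝ (smoothSub n)) := Set.range smoothPd
  have hS : ∀ a ∈ S, ∀ b ∈ S, a * b = b * a := by
    rintro _ ⟨a, rfl⟩ _ ⟨b, rfl⟩; exact smoothPd_comm a b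
  have := Algebra.isMulCommutative_adjoin ℝ hS
  let X : Fin n → Algebra.adjoin ℝ S := fun i => ⟨smoothPd i, Algebra.subset_adjoin ⟨i, rfl⟩⟩
  let p : MvPolynomial (Fin n) ℝ := ∑ i, ∑ j, ∑ k, ∑ l, MvPolynomial.C (T i j k l) *
    (MvPolynomial.X i * MvPolynomial.X j * MvPolynomial.X k * MvPolynomial.X l)
  have hp : p = 0 := by
    apply MvPolynomial.funext
    intro ξ
    simpa [p] using hT ξ
  have h0 : MvPolynomial.aeval X p = 0 := by rw [hp, map_zero]
  have h1 : ((MvPolynomial.aeval X p : Algebra.adjoin ℝ S) : Module.End ℝ (smoothSub n)) =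
      ∑ i, ∑ j, ∑ k, ∑ l, T i j k l • (smoothPd i * smoothPd j * smoothPd k * smoothPd l) := by
    simp only [p, map_sum, map_mul, MvPolynomial.aeval_X, MvPolynomial.aeval_C]
    push_cast
    simp only [X, Algebra.smul_def]
  rw [h0] at h1
  have h2 := congrArg (fun E : Module.End ℝ (smoothSub n) => (E ⟨f, hf⟩).1 x) h1
  simp only [LinearMap.sum_apply, LinearMap.smul_apply, Module.End.mul_apply] at h2
  have h3 : ∀ (s : Finset (Fin n)) (g : Fin n → smoothSub n),
      (∑ i ∈ s, g i).1 x = ∑ i ∈ s, (g i).1 x := by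
    intro s g; simp
  simp only [h3] at h2
  exact h2.symm

/-- A smooth function vanishing beyond `1` with nonnegative nontrivial second derivative. -/
theorem exists_profile : ∃ H : ℝ → ℝ, ContDiff ℝ (⊤ : ℕ∞) H ∧ (∀ s, 1 ≤ s → H s = 0) ∧
    (∀ s, 0 ≤ deriv (deriv H) s) ∧ 0 < deriv (deriv H) 0 := by
  have prim : ∀ b : ℝ → ℝ, ContDiff ℝ (⊤ : ℕ∞) b → (∀ s, 1 ≤ s → b s = 0) →
      ∃ B : ℝ → ℝ, ContDiff ℝ (⊤ : ℕ∞) B ∧ (∀ s, 1 ≤ s → B s = 0) ∧ deriv B = b := by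
    intro b hb h0
    have hd : ∀ s, HasDerivAt (fun s => ∫ t in (1 : ℝ)..s, b t) (b s) s := fun s =>
      intervalIntegral.integral_hasDerivAt_right (hb.continuous.intervalIntegrable _ _)
        hb.continuous.stronglyMeasurable.stronglyMeasurableAtFilter hb.continuous.continuousAt
    have hd' : deriv (fun s => ∫ t in (1 : ℝ)..s, b t) = b := funext fun s => (hd s).deriv
    refine ⟨_, contDiff_infty_iff_deriv.2 ⟨fun s => (hd s).differentiableAt, ?_⟩, ?_, hd'⟩
    · rw [hd']; exact hb
    · intro s hs
      rw [intervalIntegral.integral_of_le hs, setIntegral_eq_zero_of_forall_eq_zero]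
      intro t ht
      exact h0 t ht.1.le
  obtain ⟨B, hB, hB0, hBd⟩ := prim (fun s => Real.smoothTransition (1 - s))
    (Real.smoothTransition.contDiff.comp (contDiff_const.sub contDiff_id))
    (fun s hs => Real.smoothTransition.zero_of_nonpos (by linarith))
  obtain ⟨H, hH, hH0, hHd⟩ := prim B hB hB0
  refine ⟨H, hH, hH0, fun s => ?_, ?_⟩
  · rw [hHd, hBd]; exact Real.smoothTransition.nonneg _
  · rw [hHd, hBd]; exact Real.smoothTransition.pos_of_pos (by norm_num)

/-- The quadratic form of a matrix. -/
def qf (G : Fin n → Fin n → ℝ) (z : Pt n) : ℝ := ∑ i, ∑ j, G i j * z i * z j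

theorem qf_contDiff (G : Fin n → Fin n → ℝ) : ContDiff ℝ (⊤ : ℕ∞) (qf G) := by
  unfold qf; fun_prop

theorem pd_coord (a i : Fin n) (x : Pt n) : pd a (fun z : Pt n => z i) x = if i = a then 1 else 0 := by
  have : HasFDerivAt (fun z : Pt n => z i) (ContinuousLinearMap.proj (R := ℝ) i) x :=
    (ContinuousLinearMap.proj (R := ℝ) (φ := fun _ : Fin n => ℝ) i).hasFDerivAt
  rw [pd, this.fderiv]
  simp [Pi.single_apply]

theorem pd_lin (c : Fin n → ℝ) (a : Fin n) (x : Pt n) : pd a (fun z : Pt n => ∑ m, c m * z m) x = c a := by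
  rw [pd_sum (fun i _ => by fun_prop)]
  have : ∀ m, pd a (fun z : Pt n => c m * z m) x = c m * if m = a then 1 else 0 := fun m => by
    rw [pd_const_mul (by fun_prop), pd_coord]
  simp [this]

theorem pd_qf {G : Fin n → Fin n → ℝ} (hG : ∀ i j, G i j = G j i) (a : Fin n) (x : Pt n) :
    pd a (qf G) x = 2 * ∑ m, G a m * x m := by
  have e : qf G = fun z => ∑ i, z i * ∑ j, G i j * z j := by
    ext z; unfold qf
    exact Finset.sum_congr rfl fun i _ => by
      rw [Finset.mul_sum]; exact Finset.sum_congr rfl fun j _ => by ring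
  rw [e, pd_sum (fun i _ => by fun_prop)]
  have : ∀ i, pd a (fun z : Pt n => z i * ∑ j, G i j * z j) x =
      (if i = a then 1 else 0) * (∑ j, G i j * x j) + x i * G i a := fun i => by
    rw [pd_mul (by fun_prop) (by fun_prop), pd_coord, pd_lin]
  simp only [this, Finset.sum_add_distrib, ite_mul, one_mul, zero_mul, Finset.sum_ite_eq',
    Finset.mem_univ, if_true]
  rw [two_mul]
  congr 1
  exact Finset.sum_congr rfl fun i _ => by rw [hG i a]; ring

theorem pd_radial {G : Fin n → Fin n → ℝ} (hG : ∀ i j, G i j = G j i) {h : ℝ → ℝ}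
    (hh : Differentiable ℝ h) (a : Fin n) :
    pd a (fun z => h (qf G z)) = fun z => deriv h (qf G z) * (2 * ∑ m, G a m * z m) := by
  ext x
  rw [pd_comp (hh _).hasDerivAt ((qf_contDiff G).differentiable (by simp) x), pd_qf hG]

theorem deriv_smooth {h : ℝ → ℝ} (hh : ContDiff ℝ (⊤ : ℕ∞) h) : ContDiff ℝ (⊤ : ℕ∞) (deriv h) :=
  (contDiff_infty_iff_deriv.1 hh).2

theorem lap_radial {G γ : Fin n → Fin n → ℝ} (hG : ∀ i j, G i j = G j i)
    (hγ : ∀ i k, ∑ j, γ i j * G j k = if i = k then 1 else 0) {h : ℝ → ℝ}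
    (hh : ContDiff ℝ (⊤ : ℕ∞) h) (x : Pt n) :
    ∑ i, ∑ j, γ i j * pd i (pd j fun z => h (qf G z)) x =
      4 * qf G x * deriv (deriv h) (qf G x) + 2 * n * deriv h (qf G x) := by
  have h1 := (contDiff_infty_iff_deriv.1 hh).1
  have h2 := deriv_smooth hh
  have h3 := (contDiff_infty_iff_deriv.1 h2).1
  have e : ∀ i j, pd i (pd j fun z => h (qf G z)) x =
      deriv (deriv h) (qf G x) * (2 * ∑ m, G i m * x m) * (2 * ∑ m, G j m * x m) +
        deriv h (qf G x) * (2 * G i j) := by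
    intro i j
    rw [pd_radial hG h1, pd_mul]
    · rw [pd_radial hG h3, pd_const_mul (by fun_prop), pd_lin, hG i j]
    · exact (h3 _).comp x ((qf_contDiff G).differentiable (by simp) x)
    · fun_prop
  simp only [e]
  have e1 : ∀ i, ∑ j, γ i j * ∑ m, G j m * x m = x i := by
    intro i
    simp_rw [Finset.mul_sum]
    rw [Finset.sum_comm]
    simp_rw [← mul_assoc, ← Finset.sum_mul, hγ]
    simp
  have e2 : ∀ i, ∑ j, γ i j * G i j = 1 := by
    intro i
    have := hγ i i
    simp only [if_true] at this
    rw [← this]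
    exact Finset.sum_congr rfl fun j _ => by rw [hG i j]
  have e3 : ∀ i, ∑ j, γ i j * (deriv (deriv h) (qf G x) * (2 * ∑ m, G i m * x m) *
      (2 * ∑ m, G j m * x m) + deriv h (qf G x) * (2 * G i j)) =
      4 * deriv (deriv h) (qf G x) * (x i * ∑ m, G i m * x m) + 2 * deriv h (qf G x) := by
    intro i
    have : ∀ j, γ i j * (deriv (deriv h) (qf G x) * (2 * ∑ m, G i m * x m) *
      (2 * ∑ m, G j m * x m) + deriv h (qf G x) * (2 * G i j)) =
      4 * deriv (deriv h) (qf G x) * (∑ m, G i m * x m) * (γ i j * ∑ m, G j m * x m) +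
        2 * deriv h (qf G x) * (γ i j * G i j) := fun j => by ring
    simp_rw [this, Finset.sum_add_distrib, ← Finset.mul_sum, e1, e2]
    ring
  simp_rw [e3, Finset.sum_add_distrib, ← Finset.mul_sum]
  have e4 : ∑ i, x i * ∑ m, G i m * x m = qf G x := by
    unfold qf
    exact Finset.sum_congr rfl fun i _ => by
      rw [Finset.mul_sum]; exact Finset.sum_congr rfl fun j _ => by ring
  rw [e4]
  simp
  ring

theorem qf_ge {G : Fin n → Fin n → ℝ} (hpos : ∀ z : Pt n, z ≠ 0 → 0 < qf G z) :
    ∃ c, 0 < c ∧ ∀ z, c * ‖z‖ ^ 2 ≤ qf G z := by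
  have hcont := (qf_contDiff G).continuous
  have hs : ∀ (t : ℝ) z, qf G (t • z) = t ^ 2 * qf G z := by
    intro t z
    simp only [qf, Finset.mul_sum, Pi.smul_apply, smul_eq_mul]
    exact Finset.sum_congr rfl fun i _ => Finset.sum_congr rfl fun j _ => by ring
  rcases (Metric.sphere (0 : Pt n) 1).eq_empty_or_nonempty with he | hne
  · refine ⟨1, one_pos, fun z => ?_⟩
    rcases eq_or_ne z 0 with rfl | hz
    · have := hs 0 0
      simp at this
      simp [this]
    · have : ‖z‖⁻¹ • z ∈ Metric.sphere (0 : Pt n) 1 := by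
        simp [norm_smul, hz]
      rw [he] at this
      exact absurd this (Set.notMem_empty _)
  · obtain ⟨w, hw, hmin⟩ := (isCompact_sphere (0 : Pt n) 1).exists_isMinOn hne hcont.continuousOn
    have hw0 : w ≠ 0 := by rintro rfl; simp at hw
    refine ⟨qf G w, hpos w hw0, fun z => ?_⟩
    rcases eq_or_ne z 0 with rfl | hz
    · have := hs 0 0
      simp at this
      simp [this]
    · have hm : ‖z‖⁻¹ • z ∈ Metric.sphere (0 : Pt n) 1 := by
        simp [norm_smul, hz]
      have h1 : qf G w ≤ qf G (‖z‖⁻¹ • z) := hmin hm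
      have hz' := norm_pos_iff.2 hz
      rw [hs, inv_pow, inv_mul_eq_div, le_div_iff₀ (by positivity)] at h1
      exact h1

theorem radial_isTest {G : Fin n → Fin n → ℝ} (hpos : ∀ z : Pt n, z ≠ 0 → 0 < qf G z) {h : ℝ → ℝ}
    (hh : ContDiff ℝ (⊤ : ℕ∞) h) (h0 : ∀ s, 1 ≤ s → h s = 0) : IsTest fun z => h (qf G z) := by
  refine ⟨hh.comp (qf_contDiff G), ?_⟩
  obtain ⟨c, hc, hq⟩ := qf_ge hpos
  refine HasCompactSupport.intro (isCompact_closedBall (0 : Pt n) (c⁻¹ + 1)) fun z hz => h0 _ ?_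
  have h1 : c⁻¹ + 1 < ‖z‖ := by simpa using hz
  have hci : 0 < c⁻¹ := inv_pos.2 hc
  refine le_trans ?_ (hq z)
  have h2 : c⁻¹ ≤ ‖z‖ ^ 2 := by nlinarith
  calc (1 : ℝ) = c * c⁻¹ := (mul_inv_cancel₀ hc.ne').symm
    _ ≤ _ := mul_le_mul_of_nonneg_left h2 hc.le

theorem deriv_zero_beyond {h : ℝ → ℝ} (hh : ContDiff ℝ (⊤ : ℕ∞) h) (h0 : ∀ s, 1 ≤ s → h s = 0) :
    ∀ s, 1 ≤ s → deriv h s = 0 := by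
  have h1 : ∀ s, 1 < s → deriv h s = 0 := by
    intro s hs
    have : h =ᶠ[nhds s] fun _ => 0 := by
      filter_upwards [Ioi_mem_nhds hs] with t ht using h0 t (le_of_lt ht)
    rw [this.deriv_eq, deriv_const]
  intro s hs
  have hc : ContinuousWithinAt (deriv h) (Ioi s) s :=
    (deriv_smooth hh).continuous.continuousAt.continuousWithinAt
  have h2 : Filter.Tendsto (deriv h) (nhdsWithin s (Ioi s)) (nhds 0) :=
    tendsto_const_nhds.congr' (by
      filter_upwards [self_mem_nhdsWithin] with t ht using (h1 t (lt_of_le_of_lt hs ht)).symm)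
  exact tendsto_nhds_unique hc h2

theorem integral_pd_test {f : Pt n → ℝ} (hf : IsTest f) (a : Fin n) : ∫ z, pd a f z = 0 := by
  have := integral_mul_fderiv_eq_neg_fderiv_mul_of_integrable (μ := (volume : Measure (Pt n)))
    (f := fun _ : Pt n => (1 : ℝ)) (g := f) (v := Pi.single a 1) (by simp)
    (by simp only [one_mul]; exact (hf.pd a).integrable) (by simpa using hf.integrable) (fun _ _ => by fun_prop)
    (fun x _ => hf.differentiable x)
  simpa [pd] using this

theorem IsTest.coord_mul {f : Pt n → ℝ} (hf : IsTest f) (a : Fin n) : IsTest fun z => z a * f z :=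
  ⟨ContDiff.mul (by fun_prop) hf.1, hf.2.mul_left⟩

theorem IsTest.const_mul {f : Pt n → ℝ} (hf : IsTest f) (c : ℝ) : IsTest fun z => c * f z :=
  ⟨contDiff_const.mul hf.1, hf.2.mul_left⟩

theorem IsTest.add {f g : Pt n → ℝ} (hf : IsTest f) (hg : IsTest g) : IsTest fun z => f z + g z :=
  ⟨hf.1.add hg.1, hf.2.add hg.2⟩

theorem IsTest.zero : IsTest fun _ : Pt n => (0 : ℝ) :=
  ⟨contDiff_const, HasCompactSupport.zero⟩

theorem IsTest.sum {ι : Type*} (s : Finset ι) {f : ι → Pt n → ℝ} (hf : ∀ i, IsTest (f i)) :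
    IsTest fun z => ∑ i ∈ s, f i z := by
  classical
  induction s using Finset.induction_on with
  | empty => simpa using IsTest.zero
  | insert i s hi ih =>
    simp only [Finset.sum_insert hi]
    exact (hf i).add ih

/-- The basic identity behind the parametrix: an approximate identity whose radial derivative is
the square of a Laplacian of a test function. -/
theorem exists_kernel {G γ : Fin n → Fin n → ℝ} (hG : ∀ i j, G i j = G j i)
    (hγ : ∀ i k, ∑ j, γ i j * G j k = if i = k then 1 else 0)
    (hpos : ∀ z : Pt n, z ≠ 0 → 0 < qf G z) :
    ∃ η φ : Pt n → ℝ, IsTest η ∧ IsTest φ ∧ ∫ z, φ z = 1 ∧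
      ∀ x, ∑ i, pd i (fun z => z i * φ z) x =
        ∑ i, ∑ j, γ i j * pd i (pd j fun y => ∑ k, ∑ l, γ k l * pd k (pd l η) y) x := by
  obtain ⟨H, hH, hH0, hHn, hHp⟩ := exists_profile
  have h1 := deriv_smooth hH
  have h2 := deriv_smooth h1
  have h3 := deriv_smooth h2
  have z1 := deriv_zero_beyond hH hH0
  have z2 := deriv_zero_beyond h1 z1
  let k : ℝ → ℝ := fun s => 4 * s * deriv (deriv H) s + 2 * n * deriv H s
  have hk : ContDiff ℝ (⊤ : ℕ∞) k :=
    ((contDiff_const.mul contDiff_id).mul h2).add (contDiff_const.mul h1)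
  have hk0 : ∀ s, 1 ≤ s → k s = 0 := fun s hs => by simp [k, z1 s hs, z2 s hs]
  have hk1 := deriv_smooth hk
  have zk1 := deriv_zero_beyond hk hk0
  let ρ := qf G
  have hφt : IsTest fun z => deriv k (ρ z) := radial_isTest hpos hk1 zk1
  have hm : IsTest fun z => deriv (deriv H) (ρ z) := radial_isTest hpos h2 z2
  have dρ : ∀ x, DifferentiableAt ℝ ρ x := (qf_contDiff G).differentiable (by simp)
  have hqs : ∀ x : Pt n, ∑ i, x i * (2 * ∑ m, G i m * x m) = 2 * ρ x := by
    intro x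
    simp only [ρ, qf, Finset.mul_sum]
    exact Finset.sum_congr rfl fun i _ => Finset.sum_congr rfl fun j _ => by ring
  -- divergence of a radial field
  have hdiv : ∀ (h : ℝ → ℝ), ContDiff ℝ (⊤ : ℕ∞) h → ∀ x, ∑ i, pd i (fun z => z i * h (ρ z)) x =
      n * h (ρ x) + 2 * ρ x * deriv h (ρ x) := by
    intro h hh x
    have hd := (contDiff_infty_iff_deriv.1 hh).1
    have : ∀ i, pd i (fun z => z i * h (ρ z)) x =
        h (ρ x) + deriv h (ρ x) * (x i * (2 * ∑ m, G i m * x m)) := by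
      intro i
      rw [pd_mul (f := fun z : Pt n => z i) (g := fun z => h (ρ z)) (by fun_prop)
        ((hd _).comp x (dρ x)), pd_coord]
      have := congrFun (pd_radial hG hd i) x
      simp only [ρ] at this ⊢
      rw [this]; simp; ring
    simp_rw [this, Finset.sum_add_distrib, ← Finset.mul_sum, hqs]
    simp; ring
  -- the integral
  have hI : ∫ z, deriv k (ρ z) = 4 * ∫ z, deriv (deriv H) (ρ z) := by
    have hdk : ∀ s, deriv k s = 4 * deriv (deriv H) s + 4 * s * deriv (deriv (deriv H)) s +
        2 * n * deriv (deriv H) s := by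
      intro s
      have a2 := ((contDiff_infty_iff_deriv.1 h2).1 s).hasDerivAt
      have a1 := ((contDiff_infty_iff_deriv.1 h1).1 s).hasDerivAt
      have a0 : HasDerivAt (fun s : ℝ => 4 * s) 4 s := by
        simpa using (hasDerivAt_id s).const_mul 4
      exact ((a0.mul a2).add (a1.const_mul (2 * (n : ℝ)))).deriv
    have hd := hdiv _ h2
    have : ∀ z, deriv k (ρ z) = 4 * deriv (deriv H) (ρ z) +
        2 * ∑ i, pd i (fun z => z i * deriv (deriv H) (ρ z)) z := by
      intro z; rw [hd, hdk]; ring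
    simp_rw [this]
    have ti : ∀ i, IsTest fun z => z i * deriv (deriv H) (ρ z) := fun i => hm.coord_mul i
    rw [integral_add (hm.integrable.const_mul 4)
      ((integrable_finsetSum _ fun i _ => ((ti i).pd i).integrable).const_mul 2),
      integral_const_mul, integral_const_mul,
      integral_finsetSum _ fun i _ => ((ti i).pd i).integrable]
    simp [integral_pd_test (ti _)]
  have hmpos : 0 < ∫ z, deriv (deriv H) (ρ z) := by
    refine hm.continuous.integral_pos_of_hasCompactSupport_nonneg_nonzero hm.2
      (fun z => hHn _) (x := 0) ?_
    have : ρ 0 = 0 := by simp [ρ, qf]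
    rw [this]; exact hHp.ne'
  set c : ℝ := 4 * ∫ z, deriv (deriv H) (ρ z)
  have hc : c ≠ 0 := by positivity
  refine ⟨fun z => c⁻¹ * H (ρ z) * (1 / 2), fun z => c⁻¹ * deriv k (ρ z), ?_,
    hφt.const_mul _, ?_, ?_⟩
  · have := (radial_isTest hpos hH hH0).const_mul (c⁻¹ * (1 / 2))
    convert this using 2
    ring
  · rw [integral_const_mul, hI, inv_mul_cancel₀ hc]
  · intro x
    have hη : ∀ l, pd l (fun z => c⁻¹ * H (ρ z) * (1 / 2)) =
        fun y => c⁻¹ * (1 / 2) * pd l (fun z => H (ρ z)) y := by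
      intro l
      ext y
      rw [← pd_const_mul ((radial_isTest hpos hH hH0).differentiable y)]
      congr 1; ext z; ring
    have hη2 : ∀ k l y, pd k (pd l fun z => c⁻¹ * H (ρ z) * (1 / 2)) y =
        c⁻¹ * (1 / 2) * pd k (pd l fun z => H (ρ z)) y := by
      intro k l y
      rw [hη, pd_const_mul (((radial_isTest hpos hH hH0).pd l).differentiable y)]
    have hin : (fun y => ∑ k, ∑ l, γ k l * pd k (pd l fun z => c⁻¹ * H (ρ z) * (1 / 2)) y) =
        fun y => c⁻¹ * (1 / 2) * k (ρ y) := by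
      ext y
      have := lap_radial hG hγ hH y
      simp_rw [hη2]
      simp only [k, ρ]
      rw [← this, Finset.mul_sum]
      simp_rw [Finset.mul_sum]
      exact Finset.sum_congr rfl fun i _ => Finset.sum_congr rfl fun j _ => by ring
    rw [hin]
    have hkt := radial_isTest hpos hk hk0
    have hη3 : ∀ i j, pd i (pd j fun z => c⁻¹ * (1 / 2) * k (ρ z)) x =
        c⁻¹ * (1 / 2) * pd i (pd j fun z => k (ρ z)) x := by
      intro i j
      have : pd j (fun z => c⁻¹ * (1 / 2) * k (ρ z)) =
          fun y => c⁻¹ * (1 / 2) * pd j (fun z => k (ρ z)) y := by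
        ext y; exact pd_const_mul (hkt.differentiable y)
      rw [this, pd_const_mul ((hkt.pd j).differentiable x)]
    have e1 : ∑ i, ∑ j, γ i j * pd i (pd j fun z => c⁻¹ * (1 / 2) * k (ρ z)) x =
        c⁻¹ * (1 / 2) * ∑ i, ∑ j, γ i j * pd i (pd j fun z => k (ρ z)) x := by
      simp_rw [hη3, Finset.mul_sum]
      exact Finset.sum_congr rfl fun i _ => Finset.sum_congr rfl fun j _ => by ring
    rw [e1, lap_radial hG hγ hk x]
    have e2 : ∀ i, pd i (fun z => z i * (c⁻¹ * deriv k (ρ z))) x =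
        c⁻¹ * pd i (fun z => z i * deriv k (ρ z)) x := by
      intro i
      rw [← pd_const_mul ((hφt.coord_mul i).differentiable x)]
      congr 1; ext z; ring
    simp_rw [e2, ← Finset.mul_sum]
    rw [hdiv _ hk1 x]
    simp only [ρ]
    ring

end Kernel

section Parametrix

open MeasureTheory

variable {n : ℕ} {ι σ : Type*} [Fintype ι] [DecidableEq ι] [Fintype σ]

/-- A homogeneous second order operator with constant coefficients. -/
def opA (A : σ → ι → Fin n → Fin n → ℝ) (v : ι → Pt n → ℝ) (s : σ) (x : Pt n) : ℝ :=
  ∑ J, ∑ i, ∑ j, A s J i j * pd i (pd j (v J)) x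

/-- Overdetermined ellipticity: the symbol has a left inverse, up to the square of a positive
definite quadratic form, by quadratic forms. -/
def Elliptic (A : σ → ι → Fin n → Fin n → ℝ) : Prop :=
  ∃ (G γ : Fin n → Fin n → ℝ) (Q : ι → σ → Fin n → Fin n → ℝ),
    (∀ i j, G i j = G j i) ∧ (∀ i k, ∑ j, γ i j * G j k = if i = k then 1 else 0) ∧
    (∀ z : Pt n, z ≠ 0 → 0 < qf G z) ∧
    ∀ I J (ξ : Pt n), ∑ s, (∑ k, ∑ l, Q I s k l * (ξ k * ξ l)) *
      (∑ i, ∑ j, A s J i j * (ξ i * ξ j)) = if I = J then (qf γ ξ) ^ 2 else 0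

/-- The kernels `φ`, `κ` satisfy the identity which makes `s ↦ s⁻ʲ ∫ φ(z) v(x - s z) dz`
differentiable with derivative expressed through `opA A v`. -/
def IsKer (A : σ → ι → Fin n → Fin n → ℝ) (I : ι) (j : ℕ) (φ : Pt n → ℝ) (κ : σ → Pt n → ℝ) : Prop :=
  IsTest φ ∧ (∀ s, IsTest (κ s)) ∧ (∀ s, ∫ z, κ s z = 0) ∧
    ∀ J x, ∑ s, ∑ i, ∑ l, A s J i l * pd i (pd l (κ s)) x =
      if J = I then ∑ i, pd i (fun z => z i * φ z) x + j * φ x else 0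

theorem IsTest.pd_comm {f : Pt n → ℝ} (hf : IsTest f) (a b : Fin n) :
    _root_.pd a (_root_.pd b f) = _root_.pd b (_root_.pd a f) := by
  ext x; exact _root_.pd_comm (hf.1.of_le two_le_smooth).contDiffAt a b

theorem IsKer.pd {A : σ → ι → Fin n → Fin n → ℝ} {I : ι} {j : ℕ} {φ : Pt n → ℝ} {κ : σ → Pt n → ℝ}
    (h : IsKer A I j φ κ) (e : Fin n) : IsKer A I (j + 1) (pd e φ) fun s => pd e (κ s) := by
  obtain ⟨h1, h2, h3, h4⟩ := h
  refine ⟨h1.pd e, fun s => (h2 s).pd e, fun s => integral_pd_test (h2 s) e, fun J x => ?_⟩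
  have h5 := congrArg (_root_.pd e · x) (funext (h4 J))
  have e1 : ∀ s i l, _root_.pd i (_root_.pd l (_root_.pd e (κ s))) x =
      _root_.pd e (_root_.pd i (_root_.pd l (κ s))) x := by
    intro s i l
    rw [(h2 s).pd_comm l e, ((h2 s).pd l).pd_comm i e]
  have e2 : _root_.pd e (fun x => ∑ s, ∑ i, ∑ l, A s J i l * _root_.pd i (_root_.pd l (κ s)) x) x =
      ∑ s, ∑ i, ∑ l, A s J i l * _root_.pd e (_root_.pd i (_root_.pd l (κ s))) x := by
    have hd : ∀ s i l, DifferentiableAt ℝ (fun x => A s J i l * _root_.pd i (_root_.pd l (κ s)) x) x :=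
      fun s i l => ((((h2 s).pd l).pd i).differentiable x).const_mul _
    rw [pd_sum fun s _ => DifferentiableAt.fun_sum fun i _ => DifferentiableAt.fun_sum fun l _ => hd s i l]
    refine Finset.sum_congr rfl fun s _ => ?_
    rw [pd_sum fun i _ => DifferentiableAt.fun_sum fun l _ => hd s i l]
    refine Finset.sum_congr rfl fun i _ => ?_
    rw [pd_sum fun l _ => hd s i l]
    exact Finset.sum_congr rfl fun l _ => pd_const_mul ((((h2 s).pd l).pd i).differentiable x)
  simp only [e1]
  beta_reduce at h5
  rw [← e2, h5]
  by_cases hJ : J = I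
  · simp only [hJ, if_true]
    have t1 : ∀ i, IsTest fun z => z i * φ z := fun i => h1.coord_mul i
    rw [pd_add (DifferentiableAt.fun_sum fun i _ => ((t1 i).pd i).differentiable x)
      ((h1.differentiable x).const_mul _), pd_sum fun i _ => ((t1 i).pd i).differentiable x,
      pd_const_mul (h1.differentiable x)]
    have e3 : ∀ i, _root_.pd e (_root_.pd i fun z => z i * φ z) x =
        (if i = e then _root_.pd e φ x else 0) + _root_.pd i (fun z => z i * _root_.pd e φ z) x := by
      intro i
      rw [(t1 i).pd_comm]
      have : _root_.pd e (fun z => z i * φ z) =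
          fun z => (if i = e then 1 else 0) * φ z + z i * _root_.pd e φ z := by
        ext z
        rw [pd_mul (by fun_prop) (h1.differentiable z), pd_coord]
      rw [this, pd_add ((h1.differentiable x).const_mul _)
        (((h1.pd e).coord_mul i).differentiable x), pd_const_mul (h1.differentiable x)]
      by_cases hi : i = e
      · simp [hi]
      · simp [hi]
    simp_rw [e3, Finset.sum_add_distrib]
    simp only [Finset.sum_ite_eq', Finset.mem_univ, if_true]
    push_cast
    ring
  · simp only [hJ, if_false]
    exact pd_const

theorem exists_isKer {A : σ → ι → Fin n → Fin n → ℝ} (hA : Elliptic A) :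
    ∃ (φ : Pt n → ℝ) (κ : ι → σ → Pt n → ℝ), ∫ z, φ z = 1 ∧ ∀ I, IsKer A I 0 φ (κ I) := by
  obtain ⟨G, γ, Q, hG, hγ, hpos, hsym⟩ := hA
  obtain ⟨η, φ, hη, hφ, hφ1, hid⟩ := exists_kernel hG hγ hpos
  have tη : ∀ k l, IsTest (pd k (pd l η)) := fun k l => (hη.pd l).pd k
  have tin : ∀ c : Fin n → Fin n → ℝ, IsTest fun z => ∑ k, ∑ l, c k l * pd k (pd l η) z := fun c =>
    IsTest.sum _ fun k => IsTest.sum _ fun l => (tη k l).const_mul _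
  -- pulling constants out of two further derivatives
  have pull : ∀ (c : Fin n → Fin n → ℝ) i j x,
      pd i (pd j fun z => ∑ k, ∑ l, c k l * pd k (pd l η) z) x =
        ∑ k, ∑ l, c k l * pd i (pd j (pd k (pd l η))) x := by
    intro c i j x
    have step : ∀ (a : Fin n) (F : Fin n → Fin n → Pt n → ℝ), (∀ k l, IsTest (F k l)) →
        pd a (fun z => ∑ k, ∑ l, c k l * F k l z) = fun z => ∑ k, ∑ l, c k l * pd a (F k l) z := by
      intro a F hF
      ext z
      have hd : ∀ k l, DifferentiableAt ℝ (fun z => c k l * F k l z) z :=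
        fun k l => ((hF k l).differentiable z).const_mul _
      rw [pd_sum fun k _ => DifferentiableAt.fun_sum fun l _ => hd k l]
      refine Finset.sum_congr rfl fun k _ => ?_
      rw [pd_sum fun l _ => hd k l]
      exact Finset.sum_congr rfl fun l _ => pd_const_mul ((hF k l).differentiable z)
    rw [step j _ tη, step i _ fun k l => (tη k l).pd j]
  refine ⟨φ, fun I s z => ∑ k, ∑ l, Q I s k l * pd k (pd l η) z, hφ1, fun I =>
    ⟨hφ, fun s => tin _, fun s => ?_, fun J x => ?_⟩⟩
  · rw [integral_finsetSum _ fun k _ => (IsTest.sum _ fun l => (tη k l).const_mul _).integrable]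
    refine Finset.sum_eq_zero fun k _ => ?_
    rw [integral_finsetSum _ fun l _ => ((tη k l).const_mul _).integrable]
    refine Finset.sum_eq_zero fun l _ => ?_
    rw [integral_const_mul, integral_pd_test (hη.pd l), mul_zero]
  · simp_rw [pull]
    have h0 := quartic_symbol_zero (T := fun i j k l => (∑ s, A s J i j * Q I s k l) -
      (if I = J then 1 else 0) * (γ i j * γ k l)) (f := η) (fun ξ => by
        have e1 : ∑ i, ∑ j, ∑ k, ∑ l, ((∑ s, A s J i j * Q I s k l) -
            (if I = J then 1 else 0) * (γ i j * γ k l)) * (ξ i * ξ j * ξ k * ξ l) =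
            (∑ s, (∑ i, ∑ j, A s J i j * (ξ i * ξ j)) * (∑ k, ∑ l, Q I s k l * (ξ k * ξ l))) -
            (if I = J then 1 else 0) * (qf γ ξ) ^ 2 := by
          have : (∑ s, (∑ i, ∑ j, A s J i j * (ξ i * ξ j)) * (∑ k, ∑ l, Q I s k l * (ξ k * ξ l))) =
              ∑ i, ∑ j, ∑ k, ∑ l, (∑ s, A s J i j * Q I s k l) * (ξ i * ξ j * ξ k * ξ l) := by
            simp_rw [Finset.sum_mul, Finset.mul_sum]
            rw [Finset.sum_comm]
            refine Finset.sum_congr rfl fun i _ => ?_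
            rw [Finset.sum_comm]
            refine Finset.sum_congr rfl fun j _ => ?_
            rw [Finset.sum_comm]
            refine Finset.sum_congr rfl fun k _ => ?_
            rw [Finset.sum_comm]
            refine Finset.sum_congr rfl fun l _ => ?_
            exact Finset.sum_congr rfl fun s _ => by ring
          rw [this]
          have h2 : (qf γ ξ) ^ 2 = ∑ i, ∑ j, ∑ k, ∑ l, γ i j * γ k l * (ξ i * ξ j * ξ k * ξ l) := by
            unfold qf
            rw [sq]
            simp_rw [Finset.sum_mul, Finset.mul_sum]
            exact Finset.sum_congr rfl fun i _ => Finset.sum_congr rfl fun j _ =>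
              Finset.sum_congr rfl fun k _ => Finset.sum_congr rfl fun l _ => by ring
          rw [h2]
          simp_rw [Finset.mul_sum, ← Finset.sum_sub_distrib]
          exact Finset.sum_congr rfl fun i _ => Finset.sum_congr rfl fun j _ =>
              Finset.sum_congr rfl fun k _ => Finset.sum_congr rfl fun l _ => by ring
        rw [e1]
        have h3 := hsym I J ξ
        simp_rw [mul_comm (∑ i, ∑ j, A _ J i j * (ξ i * ξ j))]
        rw [h3]
        split_ifs <;> ring) hη.1 x
    have e2 : ∑ i, ∑ j, ∑ k, ∑ l, ((∑ s, A s J i j * Q I s k l) -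
        (if I = J then 1 else 0) * (γ i j * γ k l)) * pd i (pd j (pd k (pd l η))) x =
        (∑ s, ∑ i, ∑ j, A s J i j * ∑ k, ∑ l, Q I s k l * pd i (pd j (pd k (pd l η))) x) -
        (if I = J then 1 else 0) *
          ∑ i, ∑ j, γ i j * ∑ k, ∑ l, γ k l * pd i (pd j (pd k (pd l η))) x := by
      have : (∑ s, ∑ i, ∑ j, A s J i j * ∑ k, ∑ l, Q I s k l * pd i (pd j (pd k (pd l η))) x) =
          ∑ i, ∑ j, ∑ k, ∑ l, (∑ s, A s J i j * Q I s k l) * pd i (pd j (pd k (pd l η))) x := by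
        simp_rw [Finset.sum_mul, Finset.mul_sum]
        rw [Finset.sum_comm]
        refine Finset.sum_congr rfl fun i _ => ?_
        rw [Finset.sum_comm]
        refine Finset.sum_congr rfl fun j _ => ?_
        rw [Finset.sum_comm]
        refine Finset.sum_congr rfl fun k _ => ?_
        rw [Finset.sum_comm]
        refine Finset.sum_congr rfl fun l _ => ?_
        exact Finset.sum_congr rfl fun s _ => by ring
      rw [this]
      simp_rw [Finset.mul_sum, ← Finset.sum_sub_distrib]
      exact Finset.sum_congr rfl fun i _ => Finset.sum_congr rfl fun j _ =>
          Finset.sum_congr rfl fun k _ => Finset.sum_congr rfl fun l _ => by ring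
    rw [e2, sub_eq_zero] at h0
    rw [h0, hid x]
    simp_rw [pull]
    by_cases h : I = J
    · simp [h]
    · have h' : ¬ J = I := fun e => h e.symm
      simp [h, h']

theorem innerInt_pd {κ v : Pt n → ℝ} (hκ : IsTest κ) (hv : ContDiff ℝ 1 v) {s : ℝ} (hs : s ≠ 0)
    (i : Fin n) (x : Pt n) : innerInt κ (pd i v) s x = s⁻¹ * innerInt (pd i κ) v s x := by
  have hvd := hv.differentiable one_ne_zero
  have hd : ∀ z, DifferentiableAt ℝ (fun z : Pt n => v (x - s • z)) z := fun z =>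
    (hvd _).comp z (by fun_prop)
  have e : ∀ z, pd i (fun z : Pt n => v (x - s • z)) z = -s * pd i v (x - s • z) := by
    intro z
    have h1 : HasFDerivAt (fun z : Pt n => x - s • z) (-(s • ContinuousLinearMap.id ℝ (Pt n))) z :=
      ((hasFDerivAt_id z).const_smul s).const_sub x
    have h2 := (hvd (x - s • z)).hasFDerivAt.comp z h1
    have h3 : fderiv ℝ (fun z : Pt n => v (x - s • z)) z = _ := h2.fderiv
    rw [pd, h3]
    simp [pd]
  have hc : Continuous (pd i v) := (ContDiff.pd (m := 0) (by norm_num) hv i).continuous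
  have h1 := innerInt_integrable hκ hc s x
  have h2 := innerInt_integrable (hκ.pd i) hv.continuous s x
  have h3 := innerInt_integrable hκ hv.continuous s x
  have key := integral_mul_fderiv_eq_neg_fderiv_mul_of_integrable (μ := (volume : Measure (Pt n)))
    (f := κ) (g := fun z => v (x - s • z)) (v := Pi.single i 1) h2
    (by
      refine (h1.const_mul (-s)).congr (Filter.Eventually.of_forall fun z => ?_)
      have := e z
      simp only [pd] at this ⊢
      rw [this]; ring) h3 (fun z _ => hκ.differentiable z) (fun z _ => hd z)
  have e2 : ∫ z, κ z * fderiv ℝ (fun z : Pt n => v (x - s • z)) z (Pi.single i 1) =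
      -s * innerInt κ (pd i v) s x := by
    unfold innerInt
    rw [← integral_const_mul]
    congr 1; ext z
    have := e z
    simp only [pd] at this ⊢
    rw [this]; ring
  rw [e2] at key
  have e3 : ∫ z, fderiv ℝ κ z (Pi.single i 1) * v (x - s • z) = innerInt (pd i κ) v s x := rfl
  rw [e3] at key
  field_simp
  linarith

theorem innerInt_sum_left {τ : Type*} (t : Finset τ) {K : τ → Pt n → ℝ} (hK : ∀ k, IsTest (K k))
    {v : Pt n → ℝ} (hv : Continuous v) (s : ℝ) (x : Pt n) :
    innerInt (fun z => ∑ k ∈ t, K k z) v s x = ∑ k ∈ t, innerInt (K k) v s x := by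
  unfold innerInt
  rw [← integral_finsetSum _ fun k _ => innerInt_integrable (hK k) hv s x]
  simp_rw [Finset.sum_mul]

theorem innerInt_sum_right {τ : Type*} (t : Finset τ) {K : Pt n → ℝ} (hK : IsTest K)
    {v : τ → Pt n → ℝ} (hv : ∀ k, Continuous (v k)) (s : ℝ) (x : Pt n) :
    innerInt K (fun z => ∑ k ∈ t, v k z) s x = ∑ k ∈ t, innerInt K (v k) s x := by
  unfold innerInt
  rw [← integral_finsetSum _ fun k _ => innerInt_integrable hK (hv k) s x]
  simp_rw [Finset.mul_sum]

theorem innerInt_const_mul_left {K v : Pt n → ℝ} (c s : ℝ) (x : Pt n) :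
    innerInt (fun z => c * K z) v s x = c * innerInt K v s x := by
  unfold innerInt
  rw [← integral_const_mul]
  simp_rw [mul_assoc]

theorem innerInt_hasDerivAt {φ v : Pt n → ℝ} (hφ : IsTest φ) (hv : ContDiff ℝ 1 v)
    (hvc : HasCompactSupport v) (s : ℝ) (x : Pt n) :
    HasDerivAt (fun s => innerInt φ v s x)
      (-∑ i, innerInt (fun z => z i * φ z) (pd i v) s x) s := by
  have hvd := hv.differentiable one_ne_zero
  have hc : ∀ i, Continuous (pd i v) := fun i =>
    (ContDiff.pd (m := 0) (by norm_num) hv i).continuous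
  choose C hC using fun i => (hvc.pd i).exists_bound_of_continuous (hc i)
  have key := hasDerivAt_integral_of_dominated_loc_of_deriv_le (𝕜 := ℝ) (μ := (volume : Measure (Pt n)))
    (F := fun s z => φ z * v (x - s • z))
    (F' := fun s z => -∑ i, (z i * φ z) * pd i v (x - s • z)) (x₀ := s) (s := univ)
    (bound := fun z => ∑ i, |z i * φ z| * C i) Filter.univ_mem
    (Filter.Eventually.of_forall fun t =>
      (innerInt_integrable hφ hv.continuous t x).aestronglyMeasurable)
    (innerInt_integrable hφ hv.continuous s x)
    ((integrable_finsetSum _ fun i _ =>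
      innerInt_integrable (hφ.coord_mul i) (hc i) s x).neg.aestronglyMeasurable)
    (Filter.Eventually.of_forall fun z t _ => by
      rw [norm_neg]
      refine (norm_sum_le _ _).trans (Finset.sum_le_sum fun i _ => ?_)
      rw [norm_mul]
      exact mul_le_mul_of_nonneg_left (hC i _) (norm_nonneg _))
    (integrable_finsetSum _ fun i _ => (hφ.coord_mul i).integrable.abs.mul_const _)
    (Filter.Eventually.of_forall fun z t _ => by
      have h1 : HasDerivAt (fun t : ℝ => x - t • z) (-z) t := by
        simpa using ((hasDerivAt_id t).smul_const z).const_sub x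
      have h2 := ((hvd (x - t • z)).hasFDerivAt.comp_hasDerivAt t h1).const_mul (φ z)
      refine h2.congr_deriv ?_
      rw [map_neg, fderiv_apply_eq_sum_pd, mul_neg, Finset.mul_sum]
      congr 1
      exact Finset.sum_congr rfl fun i _ => by ring)
  refine key.2.congr_deriv ?_
  rw [integral_neg, integral_finsetSum _ fun i _ => innerInt_integrable (hφ.coord_mul i) (hc i) s x]
  rfl

/-- The weight `s¹⁻ʲ`. -/
def wt (j : ℕ) (s : ℝ) : ℝ := s * (s ^ j)⁻¹

theorem wt_isWeight {j : ℕ} (hj : j ≤ 2) : IsWeight (wt j) := by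
  refine ⟨measurable_id.mul (measurable_id.pow_const j).inv, fun s hs => ?_⟩
  have h0 := hs.1
  have h1 := hs.2
  unfold wt
  rw [abs_of_nonneg (by positivity)]
  have : s⁻¹ = s * (s ^ 2)⁻¹ := by field_simp
  rw [this]
  refine mul_le_mul_of_nonneg_left ?_ h0.le
  exact inv_anti₀ (by positivity) (pow_le_pow_of_le_one h0.le h1 hj)

theorem representation {A : σ → ι → Fin n → Fin n → ℝ} {I : ι} {j : ℕ} (hj : j ≤ 2)
    {φ : Pt n → ℝ} {κ : σ → Pt n → ℝ} (h : IsKer A I j φ κ) {β : ℝ} (hβ : 0 < β)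
    {v : ι → Pt n → ℝ} (hv : ∀ J, ContDiff ℝ 2 (v J)) (hvc : ∀ J, HasCompactSupport (v J))
    {d : σ → HB n β} (hd : ∀ s x, d s x = opA A v s x) {x : Pt n} {P : ℝ}
    (hP : Filter.Tendsto (fun s => (s ^ j)⁻¹ * innerInt φ (v I) s x) (nhdsWithin 0 (Ioi 0)) (nhds P)) :
    P = innerInt φ (v I) 1 x + ∑ s, singInt (κ s) (wt j) (d s) x := by
  obtain ⟨h1, h2, h3, h4⟩ := h
  have hv1 : ∀ J, ContDiff ℝ 1 (v J) := fun J => (hv J).of_le (by norm_num)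
  have hv2 : ∀ J l, ContDiff ℝ 1 (pd l (v J)) := fun J l => ContDiff.pd (by norm_num) (hv J) l
  have hv3 : ∀ J i l, Continuous (pd i (pd l (v J))) := fun J i l =>
    (ContDiff.pd (m := 0) (by norm_num) (hv2 J l) i).continuous
  have t1 : ∀ i, IsTest fun z => z i * φ z := fun i => h1.coord_mul i
  have hin : ∀ s : ℝ, 0 < s → ∑ σ', innerInt (κ σ') (d σ') s x =
      (s⁻¹) ^ 2 * innerInt (fun z => ∑ i, pd i (fun z => z i * φ z) z + j * φ z) (v I) s x := by
    intro s hs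
    have e1 : ∀ σ', innerInt (κ σ') (d σ') s x =
        ∑ J, ∑ i, ∑ l, A σ' J i l * ((s⁻¹) ^ 2 * innerInt (pd i (pd l (κ σ'))) (v J) s x) := by
      intro σ'
      have : ((d σ' : HB n β) : Pt n → ℝ) = fun x => opA A v σ' x := funext (hd σ')
      rw [this]
      unfold opA
      rw [innerInt_sum_right _ (h2 σ') fun J => by fun_prop]
      refine Finset.sum_congr rfl fun J _ => ?_
      rw [innerInt_sum_right _ (h2 σ') fun i => by fun_prop]
      refine Finset.sum_congr rfl fun i _ => ?_
      rw [innerInt_sum_right _ (h2 σ') fun i => by fun_prop]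
      refine Finset.sum_congr rfl fun l _ => ?_
      rw [innerInt_smul, innerInt_pd (h2 σ') (hv2 J l) hs.ne', innerInt_pd ((h2 σ').pd i) (hv1 J) hs.ne',
        (h2 σ').pd_comm l i]
      ring
    simp_rw [e1]
    rw [Finset.sum_comm]
    have e2 : ∀ J, ∑ σ', ∑ i, ∑ l, A σ' J i l *
        ((s⁻¹) ^ 2 * innerInt (pd i (pd l (κ σ'))) (v J) s x) =
        (s⁻¹) ^ 2 * innerInt (fun z => ∑ σ', ∑ i, ∑ l, A σ' J i l * pd i (pd l (κ σ')) z) (v J) s x := by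
      intro J
      have tt : ∀ σ' i l, IsTest fun z => A σ' J i l * pd i (pd l (κ σ')) z := fun σ' i l =>
        (((h2 σ').pd l).pd i).const_mul _
      rw [innerInt_sum_left _ (fun σ' => IsTest.sum _ fun i => IsTest.sum _ fun l => tt σ' i l)
        (hv J).continuous, Finset.mul_sum]
      refine Finset.sum_congr rfl fun σ' _ => ?_
      rw [innerInt_sum_left _ (fun i => IsTest.sum _ fun l => tt σ' i l) (hv J).continuous,
        Finset.mul_sum]
      refine Finset.sum_congr rfl fun i _ => ?_
      rw [innerInt_sum_left _ (fun l => tt σ' i l) (hv J).continuous, Finset.mul_sum]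
      refine Finset.sum_congr rfl fun l _ => ?_
      rw [innerInt_const_mul_left]
      ring
    simp_rw [e2, h4]
    rw [Finset.sum_eq_single I]
    · simp
    · intro J _ hJ
      simp [hJ, innerInt]
    · simp
  have hder : ∀ s ∈ Ioo (0 : ℝ) 1, HasDerivAt (fun s => (s ^ j)⁻¹ * innerInt φ (v I) s x)
      (-∑ σ', wt j s * innerInt (κ σ') (d σ') s x) s := by
    intro s hs
    have hs0 : s ≠ 0 := hs.1.ne'
    have a1 := innerInt_hasDerivAt h1 (hv1 I) (hvc I) s x
    have a2 : HasDerivAt (fun s : ℝ => (s ^ j)⁻¹) (-(j * s ^ (j - 1)) / (s ^ j) ^ 2) s :=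
      (hasDerivAt_pow j s).fun_inv (pow_ne_zero _ hs0)
    refine (a2.mul a1).congr_deriv ?_
    rw [← Finset.mul_sum, hin s hs.1]
    have e3 : innerInt (fun z => ∑ i, pd i (fun z => z i * φ z) z + j * φ z) (v I) s x =
        ∑ i, innerInt (pd i fun z => z i * φ z) (v I) s x + j * innerInt φ (v I) s x := by
      rw [← innerInt_const_mul_left, ← innerInt_sum_left _ (fun i => (t1 i).pd i) (hv I).continuous]
      unfold innerInt
      rw [← integral_add]
      · congr 1; ext z; ring
      · exact innerInt_integrable (IsTest.sum _ fun i => (t1 i).pd i) (hv I).continuous s x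
      · exact innerInt_integrable (h1.const_mul _) (hv I).continuous s x
    rw [e3]
    simp_rw [fun i => innerInt_pd (t1 i) (hv1 I) hs0 i x, ← Finset.mul_sum]
    have e4 : (j : ℝ) * s ^ (j - 1) = j * s ^ j * s⁻¹ := by
      cases j with
      | zero => simp
      | succ m => simp only [Nat.add_sub_cancel, pow_succ]; field_simp
    rw [e4]
    unfold wt
    have : s ^ j ≠ 0 := pow_ne_zero _ hs0
    field_simp
    ring
  have hInt : ∀ σ', IntegrableOn (fun s => wt j s * innerInt (κ σ') (d σ') s x) (Ioc 0 1) :=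
    fun σ' => singInt_integrable (h2 σ') (h3 σ') hβ (wt_isWeight hj) (d σ') x
  have hF := intervalIntegral.integral_eq_sub_of_hasDerivAt_of_tendsto (zero_lt_one' ℝ) hder
    (by
      rw [intervalIntegrable_iff_integrableOn_Ioc_of_le zero_le_one]
      exact (integrable_finsetSum _ fun σ' _ => hInt σ').neg) hP
    (fb := innerInt φ (v I) 1 x) (by
      have a1 := (innerInt_hasDerivAt h1 (hv1 I) (hvc I) 1 x).continuousAt
      have a2 : ContinuousAt (fun s : ℝ => (s ^ j)⁻¹) 1 :=
        ((continuous_pow j).continuousAt).inv₀ (by simp)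
      have := (a2.fun_mul a1).tendsto.mono_left (nhdsWithin_le_nhds (s := Iio 1))
      simpa using this)
  rw [intervalIntegral.integral_of_le zero_le_one, integral_neg,
    integral_finsetSum _ fun σ' _ => hInt σ'] at hF
  unfold singInt
  linarith

/-- Multi-indices of order at most two. -/
abbrev Jet (n : ℕ) := Option (Fin n × Option (Fin n))

/-- The derivative of `v` along a multi-index of order at most two. -/
def jet : Jet n → (Pt n → ℝ) → Pt n → ℝ
  | none, v => v
  | some (k, none), v => pd k v
  | some (k, some l), v => pd k (pd l v)

/-- The order of a multi-index. -/
def jord : Jet n → ℕ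
  | none => 0
  | some (_, none) => 1
  | some (_, some _) => 2

theorem jord_le (μ : Jet n) : jord μ ≤ 2 := by
  rcases μ with _ | ⟨k, _ | l⟩ <;> simp [jord]

theorem innerInt_zero {φ v : Pt n → ℝ} (x : Pt n) : innerInt φ v 0 x = (∫ z, φ z) * v x := by
  simp [innerInt, integral_mul_const]

theorem exists_parametrix {A : σ → ι → Fin n → Fin n → ℝ} (hA : Elliptic A) :
    ∃ (φ : Jet n → Pt n → ℝ) (κ : ι → σ → Jet n → Pt n → ℝ), (∀ μ, IsTest (φ μ)) ∧
      (∀ I s μ, IsTest (κ I s μ)) ∧ (∀ I s μ, ∫ z, κ I s μ z = 0) ∧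
      ∀ (β : ℝ), 0 < β → ∀ v : ι → Pt n → ℝ, (∀ J, ContDiff ℝ 2 (v J)) →
        (∀ J, HasCompactSupport (v J)) → ∀ d : σ → HB n β, (∀ s x, d s x = opA A v s x) →
        ∀ I μ x, jet μ (v I) x = innerInt (φ μ) (v I) 1 x +
          ∑ s, singInt (κ I s μ) (wt (jord μ)) (d s) x := by
  obtain ⟨φ, κ, hφ1, hker⟩ := exists_isKer hA
  by_cases hι : IsEmpty ι
  · exact ⟨fun _ _ => 0, fun I => hι.elim I, fun _ => IsTest.zero, fun I => hι.elim I,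
      fun I => hι.elim I, fun _ _ _ _ _ _ _ I => hι.elim I⟩
  have hφ : IsTest φ := by
    obtain ⟨I⟩ := not_isEmpty_iff.1 hι
    exact (hker I).1
  have hjet : ∀ I μ, IsKer A I (jord μ) (jet μ φ) fun s => jet μ (κ I s) := by
    intro I μ
    rcases μ with _ | ⟨k, _ | l⟩
    · exact hker I
    · exact (hker I).pd k
    · exact ((hker I).pd l).pd k
  refine ⟨fun μ => jet μ φ, fun I s μ => jet μ (κ I s), fun μ => ?_, fun I s μ => (hjet I μ).2.1 s,
    fun I s μ => (hjet I μ).2.2.1 s, fun β hβ v hv hvc d hd I μ x => ?_⟩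
  · obtain ⟨I⟩ := not_isEmpty_iff.1 hι
    exact (hjet I μ).1
  have hv1 : ∀ J, ContDiff ℝ 1 (v J) := fun J => (hv J).of_le (by norm_num)
  have hv2 : ∀ J l, ContDiff ℝ 1 (pd l (v J)) := fun J l => ContDiff.pd (by norm_num) (hv J) l
  have lim : ∀ w : Pt n → ℝ, Continuous w → HasCompactSupport w →
      Filter.Tendsto (fun s => innerInt φ w s x) (nhdsWithin 0 (Ioi 0)) (nhds (w x)) := by
    intro w hw hwc
    obtain ⟨C, hC⟩ := hwc.exists_bound_of_continuous hw
    have := (innerInt_continuous hφ hw hC).comp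
      (Continuous.prodMk continuous_id (continuous_const (y := x)))
    have := (this.tendsto 0).mono_left (nhdsWithin_le_nhds (s := Ioi 0))
    have h' : Filter.Tendsto (fun s => innerInt φ w s x) (nhdsWithin 0 (Ioi 0))
        (nhds (innerInt φ w 0 x)) := this
    rwa [innerInt_zero, hφ1, one_mul] at h'
  refine representation (jord_le μ) (hjet I μ) hβ hv hvc hd ?_
  rcases μ with _ | ⟨k, _ | l⟩
  · simpa [jord, jet] using lim (v I) (hv I).continuous (hvc I)
  · have := lim (pd k (v I)) ((ContDiff.pd (m := 0) (by norm_num) (hv1 I) k).continuous) ((hvc I).pd k)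
    refine this.congr' ?_
    filter_upwards [self_mem_nhdsWithin] with s hs
    have hs0 : s ≠ 0 := (show (0 : ℝ) < s from hs).ne'
    rw [innerInt_pd hφ (hv1 I) hs0]
    simp [jord, jet]
  · have := lim (pd k (pd l (v I))) ((ContDiff.pd (m := 0) (by norm_num) (hv2 I l) k).continuous)
      (((hvc I).pd l).pd k)
    refine this.congr' ?_
    filter_upwards [self_mem_nhdsWithin] with s hs
    have hs0 : s ≠ 0 := (show (0 : ℝ) < s from hs).ne'
    rw [innerInt_pd hφ (hv2 I l) hs0, innerInt_pd (hφ.pd k) (hv1 I) hs0, hφ.pd_comm l k]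
    simp only [jord, jet]
    field_simp

end Parametrix

section FixedPoints

variable {E F : Type*} [NormedAddCommGroup E] [NormedSpace ℝ E] [NormedAddCommGroup F] [NormedSpace ℝ F]

theorem affine_fixedPoint_unique {K : E →L[ℝ] E} (hK : ‖K‖ ≤ 1 / 2) {h p q : E} (hp : p = h + K p)
    (hq : q = h + K q) : p = q := by
  have h1 : p - q = K (p - q) := by
    conv_lhs => rw [hp, hq]
    rw [map_sub]; abel
  have h2 : ‖p - q‖ ≤ 1 / 2 * ‖p - q‖ := by
    conv_lhs => rw [h1]
    exact (K.le_opNorm _).trans (by gcongr)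
  have h3 : ‖p - q‖ ≤ 0 := by linarith
  exact sub_eq_zero.1 (norm_le_zero_iff.1 h3)

/-- A triangular affine system preserving a closed set has its fixed point in this set. -/
theorem exists_fixedPoint_mem [CompleteSpace E] [CompleteSpace F] {K : E →L[ℝ] E} {L : F →L[ℝ] F}
    (hK : ‖K‖ ≤ 1 / 2) (hL : ‖L‖ ≤ 1 / 2) (S : E →L[ℝ] F) (h : E) (h' : F) {D : Set (E × F)}
    (hD : IsClosed D) (hD0 : D.Nonempty)
    (hmaps : ∀ p r, (p, r) ∈ D → (h + K p, h' + S p + L r) ∈ D) :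
    ∃ p r, (p, r) ∈ D ∧ p = h + K p ∧ r = h' + S p + L r := by
  obtain ⟨κ, hκ, hκS⟩ : ∃ κ : ℝ, 0 < κ ∧ κ * ‖S‖ ≤ 1 / 4 := by
    refine ⟨1 / (4 * (‖S‖ + 1)), by positivity, ?_⟩
    rw [div_mul_eq_mul_div, div_le_iff₀ (by positivity)]
    linarith [norm_nonneg S]
  let f : E × F → E × F := fun x => (h + K x.1, κ • h' + κ • S x.1 + L x.2)
  let s : Set (E × F) := (fun x : E × F => (x.1, κ⁻¹ • x.2)) ⁻¹' D
  have hs : IsClosed s := hD.preimage (by fun_prop)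
  have hf : ContractingWith (3 / 4) f := by
    refine ⟨by rw [div_lt_one (by norm_num)]; norm_num, LipschitzWith.of_dist_le_mul fun x y => ?_⟩
    rw [dist_eq_norm, dist_eq_norm, Prod.norm_def, Prod.norm_def]
    have e1 : (f x - f y).1 = K (x - y).1 := by simp [f]
    have e2 : (f x - f y).2 = κ • S (x - y).1 + L (x - y).2 := by
      simp only [f, Prod.snd_sub, Prod.fst_sub, map_sub, smul_sub]; abel
    rw [e1, e2]
    generalize (x - y).1 = p, (x - y).2 = r
    have hm1 := le_max_left ‖p‖ ‖r‖
    have hm2 := le_max_right ‖p‖ ‖r‖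
    have hn := norm_nonneg p
    have hn' := norm_nonneg r
    have h1 : ‖K p‖ ≤ 1 / 2 * ‖p‖ := (K.le_opNorm _).trans (by gcongr)
    have h2 : ‖L r‖ ≤ 1 / 2 * ‖r‖ := (L.le_opNorm _).trans (by gcongr)
    have h3 : ‖κ • S p‖ ≤ 1 / 4 * ‖p‖ := by
      rw [norm_smul, Real.norm_of_nonneg hκ.le]
      calc _ ≤ κ * (‖S‖ * ‖p‖) := by gcongr; exact S.le_opNorm _
        _ = κ * ‖S‖ * ‖p‖ := by ring
        _ ≤ _ := by gcongr
    have h4 := norm_add_le (κ • S p) (L r)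
    simp only [NNReal.coe_div, NNReal.coe_ofNat]
    refine max_le ?_ ?_ <;> linarith
  have hmap : MapsTo f s s := by
    intro x hx
    have := hmaps _ _ hx
    show (_, _) ∈ D
    convert this using 2
    simp only [f, smul_add, map_smul, smul_smul, inv_mul_cancel₀ hκ.ne', one_smul]
  obtain ⟨⟨p, r⟩, hpr⟩ := hD0
  have hx0 : (p, κ • r) ∈ s := by
    show (_, _) ∈ D
    simpa [smul_smul, inv_mul_cancel₀ hκ.ne'] using hpr
  obtain ⟨y, hy, hfy, -⟩ := ContractingWith.exists_fixedPoint' hs.isComplete hmap (hf.restrict hmap) hx0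
    (edist_ne_top _ _)
  have hfy' : f y = y := hfy
  refine ⟨y.1, κ⁻¹ • y.2, hy, (congrArg Prod.fst hfy').symm, ?_⟩
  have e2 : κ • h' + κ • S y.1 + L y.2 = y.2 := congrArg Prod.snd hfy'
  conv_lhs => rw [← e2]
  simp only [smul_add, map_smul, smul_smul, inv_mul_cancel₀ hκ.ne', one_smul]

theorem exists_affine_fixedPoint [CompleteSpace E] {K : E →L[ℝ] E} (hK : ‖K‖ ≤ 1 / 2) (h : E) :
    ∃ p, p = h + K p := by
  obtain ⟨p, -, -, hp, -⟩ := exists_fixedPoint_mem hK hK 0 h 0 (D := univ) isClosed_univ univ_nonempty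
    fun _ _ _ => mem_univ _
  exact ⟨p, hp⟩

end FixedPoints

section Localization

variable {n : ℕ} {U : Set (Pt n)} {β : ℝ}

/-- Locally Hölder functions with compact support are globally Hölder. -/
theorem LocHolder.exists_HB (hβ : 0 < β) {f : Pt n → ℝ} (hf : LocHolder β univ f)
    (hc : HasCompactSupport f) : ∃ F : HB n β, ∀ x, F x = f x := by
  have hcont : Continuous f := continuous_iff_continuousAt.2 fun x => hf.continuousAt hβ (mem_univ x)
  obtain ⟨S, hS⟩ := hc.exists_bound_of_continuous hcont
  simp only [Real.norm_eq_abs] at hS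
  have hS0 : 0 ≤ S := (abs_nonneg _).trans (hS 0)
  choose! C r hC hr H using fun x => hf x (mem_univ x)
  obtain ⟨t, -, ht⟩ := hc.isCompact.elim_nhds_subcover (fun x => Metric.ball x (r x / 2))
    fun x _ => Metric.ball_mem_nhds x (half_pos (hr x))
  obtain ⟨δ, hδ, hδt⟩ : ∃ δ, 0 < δ ∧ ∀ x ∈ t, δ ≤ r x / 2 := by
    rcases t.eq_empty_or_nonempty with rfl | hne
    · exact ⟨1, one_pos, by simp⟩
    · obtain ⟨x0, -, h⟩ := t.exists_min_image (fun x => r x / 2) hne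
      exact ⟨r x0 / 2, half_pos (hr x0), h⟩
  refine ⟨HB.of f ⟨S, hS⟩ ⟨∑ x ∈ t, C x + 2 * S / δ ^ β, fun y z => ?_⟩, fun x => rfl⟩
  have hCs : 0 ≤ ∑ x ∈ t, C x := Finset.sum_nonneg fun x _ => hC x
  by_cases hyz : ‖y - z‖ < δ
  · have key : ∀ y z, ‖y - z‖ < δ → y ∈ tsupport f → |f y - f z| ≤ (∑ x ∈ t, C x) * ‖y - z‖ ^ β := by
      intro y z hyz hy
      obtain ⟨x, hx, hyx⟩ := mem_iUnion₂.1 (ht hy)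
      rw [Metric.mem_ball] at hyx
      refine (H x y (Metric.mem_ball.2 (by linarith [hr x])) z (Metric.mem_ball.2 ?_)).trans ?_
      · have := dist_triangle z y x
        rw [dist_comm z y, dist_eq_norm y z] at this
        linarith [hδt x hx]
      · gcongr
        exact Finset.single_le_sum (f := C) (fun x _ => hC x) hx
    refine le_trans ?_ (mul_le_mul_of_nonneg_right (le_add_of_nonneg_right
      (by positivity : (0 : ℝ) ≤ 2 * S / δ ^ β)) (by positivity))
    by_cases hy : y ∈ tsupport f
    · exact key y z hyz hy
    by_cases hz : z ∈ tsupport f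
    · rw [abs_sub_comm, norm_sub_rev]
      rw [norm_sub_rev] at hyz
      exact key z y hyz hz
    · rw [image_eq_zero_of_notMem_tsupport hy, image_eq_zero_of_notMem_tsupport hz]
      simp only [sub_self, abs_zero]
      positivity
  · rw [not_lt] at hyz
    calc |f y - f z| ≤ 2 * S := by linarith [abs_sub (f y) (f z), hS y, hS z]
      _ = 2 * S / δ ^ β * δ ^ β := by field_simp
      _ ≤ 2 * S / δ ^ β * ‖y - z‖ ^ β := by gcongr
      _ ≤ _ := by gcongr; linarith

/-- Extension by zero of a localized function. -/
theorem CH.of_tsupport {m : ℕ} {f : Pt n → ℝ} (hf : CH m β U f) (hs : tsupport f ⊆ U) :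
    CH m β univ f := by
  refine CH.of_local fun x _ => ?_
  by_cases hx : x ∈ U
  · exact ⟨U, hx, hf⟩
  · have ho : IsOpen (tsupport f)ᶜ := (isClosed_tsupport f).isOpen_compl
    exact ⟨(tsupport f)ᶜ, fun h => hx (hs h), (CH.const ho 0).congr ho fun y hy =>
      (image_eq_zero_of_notMem_tsupport hy).symm⟩

theorem IsTest.CH {χ : Pt n → ℝ} (hχ : IsTest χ) (hU : IsOpen U) (hβ1 : β ≤ 1) {m : ℕ} : CH m β U χ :=
  CH.of_contDiffOn hU hβ1 ((hχ.1.of_le (by exact_mod_cast le_top)).contDiffOn)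

theorem CH.test_mul (hU : IsOpen U) (hβ : 0 < β) (hβ1 : β ≤ 1) {m : ℕ} {f χ : Pt n → ℝ}
    (hf : CH m β U f) (hχ : IsTest χ) (hs : tsupport χ ⊆ U) : CH m β univ fun x => χ x * f x :=
  CH.of_tsupport ((hχ.CH hU hβ1).mul hU hβ hβ1 hf) ((tsupport_mul_subset_left).trans hs)

/-- Smooth cutoff functions at every scale, with controlled gradient. -/
theorem exists_cutoff (n : ℕ) : ∃ M : ℝ, 0 ≤ M ∧ ∀ (x0 : Pt n) (r : ℝ), 0 < r → ∃ χ : Pt n → ℝ,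
    IsTest χ ∧ (∀ x ∈ Metric.ball x0 r, χ x = 1) ∧ tsupport χ ⊆ Metric.closedBall x0 (2 * r) ∧
      (∀ x, |χ x| ≤ 1) ∧ ∀ x y, |χ x - χ y| ≤ M / r * ‖x - y‖ := by
  let b : ContDiffBump (0 : Pt n) := ⟨1, 2, one_pos, one_lt_two⟩
  have hb : IsTest b := ⟨b.contDiff, b.hasCompactSupport⟩
  obtain ⟨M, hM, hL⟩ := hb.exists_lip
  refine ⟨M, hM, fun x0 r hr => ⟨fun x => b (r⁻¹ • (x - x0)), ⟨?_, ?_⟩, fun x hx => ?_, ?_, fun x => ?_,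
    fun x y => ?_⟩⟩
  · exact hb.1.comp (by fun_prop)
  · refine HasCompactSupport.intro (isCompact_closedBall x0 (2 * r)) fun x hx => ?_
    refine b.zero_of_le_dist ?_
    rw [Metric.mem_closedBall, not_le, dist_eq_norm] at hx
    rw [dist_zero_right, norm_smul, norm_inv, Real.norm_of_nonneg hr.le, inv_mul_eq_div,
      le_div_iff₀ hr]
    exact hx.le
  · refine b.one_of_mem_closedBall ?_
    rw [Metric.mem_ball, dist_eq_norm] at hx
    rw [mem_closedBall_zero_iff, norm_smul, norm_inv, Real.norm_of_nonneg hr.le, inv_mul_eq_div,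
      div_le_iff₀ hr]
    show _ ≤ (1 : ℝ) * r
    linarith
  · refine closure_minimal (fun x hx => ?_) Metric.isClosed_closedBall
    by_contra hx2
    refine hx (b.zero_of_le_dist ?_)
    rw [Metric.mem_closedBall, not_le, dist_eq_norm] at hx2
    rw [dist_zero_right, norm_smul, norm_inv, Real.norm_of_nonneg hr.le, inv_mul_eq_div,
      le_div_iff₀ hr]
    exact hx2.le
  · rw [abs_of_nonneg b.nonneg]
    exact b.le_one
  · refine (hL _ _).trans (le_of_eq ?_)
    rw [← smul_sub, sub_sub_sub_cancel_right, norm_smul, norm_inv, Real.norm_of_nonneg hr.le]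
    ring

end Localization

section Gradients

open MeasureTheory

variable {n : ℕ} {β : ℝ}

/-- `q` is the gradient of `f`. -/
def HasGrad (f : Pt n → ℝ) (q : Fin n → Pt n → ℝ) : Prop :=
  ∀ x, HasFDerivAt f (∑ e, q e x • (ContinuousLinearMap.proj e : Pt n →L[ℝ] ℝ)) x

theorem HasGrad.pd_eq {f : Pt n → ℝ} {q : Fin n → Pt n → ℝ} (h : HasGrad f q) (e : Fin n) :
    pd e f = q e := by
  ext x
  rw [pd, (h x).fderiv]
  simp [Pi.single_apply]

theorem hasGrad_of_differentiable {f : Pt n → ℝ} (h : Differentiable ℝ f) : HasGrad f fun e => pd e f := by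
  intro x
  have := (h x).hasFDerivAt
  rwa [fderiv_eq_sum_pd] at this

theorem HasGrad.differentiable {f : Pt n → ℝ} {q : Fin n → Pt n → ℝ} (h : HasGrad f q) :
    Differentiable ℝ f := fun x => (h x).differentiableAt

theorem HasGrad.add {f g : Pt n → ℝ} {q r : Fin n → Pt n → ℝ} (hf : HasGrad f q) (hg : HasGrad g r) :
    HasGrad (fun x => f x + g x) fun e x => q e x + r e x := by
  intro x
  refine ((hf x).add (hg x)).congr_fderiv ?_
  rw [← Finset.sum_add_distrib]
  simp_rw [add_smul]

theorem HasGrad.mul {f g : Pt n → ℝ} {q r : Fin n → Pt n → ℝ} (hf : HasGrad f q) (hg : HasGrad g r) :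
    HasGrad (fun x => f x * g x) fun e x => q e x * g x + f x * r e x := by
  intro x
  refine ((hf x).mul (hg x)).congr_fderiv ?_
  simp_rw [add_smul, mul_smul, Finset.sum_add_distrib, Finset.smul_sum]
  rw [add_comm]
  congr 1
  exact Finset.sum_congr rfl fun e _ => smul_comm _ _ _

theorem HasGrad.sum {τ : Type*} {s : Finset τ} {f : τ → Pt n → ℝ} {q : τ → Fin n → Pt n → ℝ}
    (hf : ∀ i ∈ s, HasGrad (f i) (q i)) : HasGrad (fun x => ∑ i ∈ s, f i x) fun e x => ∑ i ∈ s, q i e x := by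
  intro x
  refine (HasFDerivAt.fun_sum fun i hi => hf i hi x).congr_fderiv ?_
  rw [Finset.sum_comm]
  simp_rw [Finset.sum_smul]

theorem integrable_sum_smul {α E : Type*} [MeasurableSpace α] {μ : Measure α} [NormedAddCommGroup E]
    [NormedSpace ℝ E] [CompleteSpace E] {q : Fin n → α → ℝ} (hq : ∀ e, Integrable (q e) μ) (P : Fin n → E) :
    Integrable (fun z => ∑ e, q e z • P e) μ ∧ ∫ z, ∑ e, q e z • P e ∂μ = ∑ e, (∫ z, q e z ∂μ) • P e := by
  have h : ∀ e, Integrable (fun z => q e z • P e) μ := fun e => (hq e).smul_const _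
  refine ⟨integrable_finsetSum _ fun e _ => h e, ?_⟩
  rw [integral_finsetSum _ fun e _ => h e]
  exact Finset.sum_congr rfl fun e _ => integral_smul_const _ _

theorem norm_sum_smul_le {E : Type*} [NormedAddCommGroup E] [NormedSpace ℝ E] {q b : Fin n → ℝ}
    (h : ∀ e, |q e| ≤ b e) (P : Fin n → E) : ‖∑ e, q e • P e‖ ≤ ∑ e, b e * ‖P e‖ := by
  refine (norm_sum_le _ _).trans (Finset.sum_le_sum fun e _ => ?_)
  rw [norm_smul, Real.norm_eq_abs]
  exact mul_le_mul_of_nonneg_right (h e) (norm_nonneg _)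

theorem hasGrad_integral {α : Type*} [MeasurableSpace α] {μ : Measure α} {F : Pt n → α → ℝ}
    {q : Fin n → Pt n → α → ℝ} {b : Fin n → α → ℝ} (hF : ∀ x, Integrable (F x) μ)
    (hq : ∀ e x, Integrable (q e x) μ) (hb : ∀ e, Integrable (b e) μ)
    (hqb : ∀ᵐ z ∂μ, ∀ e x, |q e x z| ≤ b e z) (hd : ∀ᵐ z ∂μ, HasGrad (fun x => F x z) fun e x => q e x z) :
    HasGrad (fun x => ∫ z, F x z ∂μ) fun e x => ∫ z, q e x z ∂μ := by
  intro x
  let P : Fin n → (Pt n →L[ℝ] ℝ) := fun e => ContinuousLinearMap.proj e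
  have hsum := integrable_sum_smul (fun e => hq e x) P
  have hbd : Integrable (fun z => ∑ e, b e z * ‖P e‖) μ :=
    integrable_finsetSum _ fun e _ => (hb e).mul_const _
  have hle : ∀ᵐ z ∂μ, ∀ y ∈ (univ : Set (Pt n)), ‖∑ e, q e y z • P e‖ ≤ ∑ e, b e z * ‖P e‖ := by
    filter_upwards [hqb] with z hz y _ using norm_sum_smul_le (fun e => hz e y) P
  have hder : ∀ᵐ z ∂μ, ∀ y ∈ (univ : Set (Pt n)), HasFDerivAt (fun x => F x z)
      (∑ e, q e y z • P e) y := by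
    filter_upwards [hd] with z hz y _ using hz y
  have key := hasFDerivAt_integral_of_dominated_of_fderiv_le Filter.univ_mem
    (Filter.Eventually.of_forall fun y => (hF y).aestronglyMeasurable) (hF x)
    hsum.1.aestronglyMeasurable hle hbd hder
  exact key.congr_fderiv hsum.2

theorem hasGrad_innerInt {K d : Pt n → ℝ} {q : Fin n → Pt n → ℝ} (hK : IsTest K) (h : HasGrad d q)
    (hq : ∀ e, Continuous (q e)) {C : Fin n → ℝ} (hC : ∀ e x, |q e x| ≤ C e) (s : ℝ) :
    HasGrad (innerInt K d s) fun e => innerInt K (q e) s := by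
  refine hasGrad_integral (b := fun e z => |K z| * C e)
    (fun x => innerInt_integrable hK h.differentiable.continuous s x)
    (fun e x => innerInt_integrable hK (hq e) s x) (fun e => hK.integrable.abs.mul_const _)
    (Filter.Eventually.of_forall fun z e x => ?_) (Filter.Eventually.of_forall fun z y => ?_)
  · rw [abs_mul]
    exact mul_le_mul_of_nonneg_left (hC e _) (abs_nonneg _)
  · have h1 : HasFDerivAt (fun y : Pt n => y - s • z) (ContinuousLinearMap.id ℝ _) y :=
      (hasFDerivAt_id y).sub_const _
    refine (((h (y - s • z)).comp y h1).const_mul (K z)).congr_fderiv ?_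
    rw [ContinuousLinearMap.comp_id, Finset.smul_sum]
    simp_rw [mul_smul]

theorem hasGrad_singInt {K : Pt n → ℝ} (hK : IsTest K) (hK0 : ∫ z, K z = 0) (hβ : 0 < β)
    {ω : ℝ → ℝ} (hω : IsWeight ω) {d : HB n β} {q : Fin n → HB n β} (h : HasGrad d fun e => q e) :
    HasGrad (singInt K ω d) fun e => singInt K ω (q e) := by
  refine hasGrad_integral
    (b := fun e s => ((∫ z, |K z| * ‖z‖ ^ β) * ‖q e‖) * s ^ (β - 1))
    (fun x => singInt_integrable hK hK0 hβ hω d x) (fun e x => singInt_integrable hK hK0 hβ hω (q e) x)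
    (fun e => (integrableOn_rpow_Ioc (by linarith) zero_le_one).const_mul _)
    ((ae_restrict_iff' measurableSet_Ioc).2 (Filter.Eventually.of_forall fun s hs e y =>
      weight_mul_le hω hs (abs_innerInt_le hK hK0 hβ (q e) hs.1.le y)))
    (Filter.Eventually.of_forall fun s y => ?_)
  refine ((hasGrad_innerInt hK h (fun e => (q e).continuous hβ) (fun e => (q e).abs_le_norm) s y).const_mul
    (ω s)).congr_fderiv ?_
  rw [Finset.smul_sum]
  simp_rw [mul_smul]

theorem isClosed_hasGrad (n : ℕ) (β : ℝ) :
    IsClosed {x : HB n β × (Fin n → HB n β) | HasGrad x.1 fun e => x.2 e} := by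
  refine IsSeqClosed.isClosed fun u y hu hy => ?_
  have h1 : Filter.Tendsto (fun k => (u k).1) Filter.atTop (nhds y.1) := (continuous_fst.tendsto _).comp hy
  have h2 : Filter.Tendsto (fun k => (u k).2) Filter.atTop (nhds y.2) := (continuous_snd.tendsto _).comp hy
  refine hasFDerivAt_of_tendstoUniformly (f := fun k => ((u k).1 : Pt n → ℝ))
    (f' := fun k x => ∑ e, (u k).2 e x • (ContinuousLinearMap.proj e : Pt n →L[ℝ] ℝ)) ?_ hu
    fun x => HB.tendsto_apply h1 x
  rw [Metric.tendstoUniformly_iff]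
  intro ε hε
  set M : ℝ := ∑ e : Fin n, ‖(ContinuousLinearMap.proj e : Pt n →L[ℝ] ℝ)‖
  have hM : 0 ≤ M := Finset.sum_nonneg fun e _ => norm_nonneg _
  filter_upwards [(Metric.tendsto_nhds.1 h2) (ε / (M + 1)) (by positivity)] with k hk x
  rw [dist_eq_norm, ← Finset.sum_sub_distrib]
  calc _ ≤ ∑ e : Fin n, ‖y.2 - (u k).2‖ * ‖(ContinuousLinearMap.proj e : Pt n →L[ℝ] ℝ)‖ := by
        refine (norm_sum_le _ _).trans (Finset.sum_le_sum fun e _ => ?_)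
        rw [← sub_smul, norm_smul, Real.norm_eq_abs]
        gcongr
        exact (HB.abs_le_norm (y.2 e - (u k).2 e) x).trans (norm_le_pi_norm (y.2 - (u k).2) e)
    _ = ‖y.2 - (u k).2‖ * M := by rw [Finset.mul_sum]
    _ < ε := by
      rw [dist_comm, dist_eq_norm, lt_div_iff₀ (by positivity)] at hk
      nlinarith [norm_nonneg (y.2 - (u k).2)]

end Gradients

section LinearRegularity

open MeasureTheory

variable {n : ℕ} {U : Set (Pt n)} {β : ℝ}

theorem exists_small_cutoff_coeff (hU : IsOpen U) {γ : ℝ} (hγ : 0 < γ) {a : Pt n → ℝ} (ha : CH 1 γ U a)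
    {x0 : Pt n} (hx0 : x0 ∈ U) (hβ : 0 < β) (hβ1 : β < 1) {M : ℝ} (hM : 0 ≤ M) {ε : ℝ} (hε : 0 < ε) :
    ∃ r0 > 0, ∀ r, 0 < r → r ≤ r0 → ∀ ψ : Pt n → ℝ, tsupport ψ ⊆ Metric.closedBall x0 (2 * r) →
      (∀ x, |ψ x| ≤ 1) → (∀ x y, |ψ x - ψ y| ≤ M / r * ‖x - y‖) →
      ∃ c : HB n β, (∀ x, c x = ψ x * (a x0 - a x)) ∧ ‖c‖ ≤ ε := by
  obtain ⟨K, t, ht, hK⟩ := ((ha.contDiffOn hU hγ).contDiffAt (hU.mem_nhds hx0)).exists_lipschitzOnWith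
  obtain ⟨ρ, hρ, hρt⟩ := Metric.mem_nhds_iff.1 ht
  set Λ : ℝ := (2 * M + 1) * K
  have hΛ : 0 ≤ Λ := by positivity
  obtain ⟨s0, hs0, hs⟩ : ∃ s0 : ℝ, 0 < s0 ∧ s0 + (2 * s0) ^ (1 - β) * Λ ^ β ≤ ε := by
    have hc : Continuous fun s : ℝ => s + (2 * s) ^ (1 - β) * Λ ^ β :=
      continuous_id.add (((continuous_const.mul continuous_id).rpow_const
        fun _ => Or.inr (by linarith)).mul continuous_const)
    have h0 := hc.tendsto 0
    simp only [mul_zero, Real.zero_rpow (by linarith : 1 - β ≠ 0), zero_mul, add_zero] at h0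
    obtain ⟨δ, hδ, h⟩ := Metric.eventually_nhds_iff.1 (h0.eventually (gt_mem_nhds hε))
    refine ⟨δ / 2, by positivity, (h ?_).le⟩
    rw [Real.dist_eq, sub_zero, abs_of_pos (by positivity)]
    linarith
  refine ⟨min (ρ / 4) (s0 / (2 * K + 1)), by positivity, fun r hr hr0 ψ hψs hψ1 hψL => ?_⟩
  have hr1 : r ≤ ρ / 4 := hr0.trans (min_le_left _ _)
  have hr2 : 2 * r * K ≤ s0 := by
    have := (le_div_iff₀ (by positivity : (0 : ℝ) < 2 * K + 1)).1 (hr0.trans (min_le_right _ _))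
    nlinarith [K.2]
  have hin : ∀ x ∈ Metric.closedBall x0 (2 * r), x ∈ t := fun x hx => hρt (by
    rw [Metric.mem_closedBall] at hx
    rw [Metric.mem_ball]
    linarith)
  have hlip : ∀ x ∈ Metric.closedBall x0 (2 * r), ∀ y ∈ Metric.closedBall x0 (2 * r),
      |a x - a y| ≤ K * ‖x - y‖ := fun x hx y hy => by
    have := hK.dist_le_mul x (hin x hx) y (hin y hy)
    rwa [Real.dist_eq, dist_eq_norm] at this
  have hx0b : x0 ∈ Metric.closedBall x0 (2 * r) := Metric.mem_closedBall_self (by linarith)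
  have hout : ∀ x, x ∉ Metric.closedBall x0 (2 * r) → ψ x = 0 := fun x hx =>
    image_eq_zero_of_notMem_tsupport fun h => hx (hψs h)
  have ha0 : ∀ x ∈ Metric.closedBall x0 (2 * r), |a x0 - a x| ≤ 2 * r * K := fun x hx => by
    refine (hlip x0 hx0b x hx).trans ?_
    rw [Metric.mem_closedBall, dist_comm, dist_eq_norm] at hx
    nlinarith [K.2]
  have hsup : ∀ x, |ψ x * (a x0 - a x)| ≤ s0 := by
    intro x
    by_cases hx : x ∈ Metric.closedBall x0 (2 * r)
    · rw [abs_mul]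
      calc _ ≤ 1 * (2 * r * K) := mul_le_mul (hψ1 x) (ha0 x hx) (abs_nonneg _) zero_le_one
        _ ≤ s0 := by linarith
    · rw [hout x hx, zero_mul, abs_zero]; exact hs0.le
  have hMr : 0 ≤ M / r := by positivity
  have key : ∀ x y, x ∈ Metric.closedBall x0 (2 * r) →
      |ψ x * (a x0 - a x) - ψ y * (a x0 - a y)| ≤ Λ * ‖x - y‖ := by
    intro x y hx
    have h1 : |(ψ x - ψ y) * (a x0 - a x)| ≤ 2 * M * K * ‖x - y‖ := by
      rw [abs_mul]
      calc _ ≤ (M / r * ‖x - y‖) * (2 * r * K) :=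
            mul_le_mul (hψL x y) (ha0 x hx) (abs_nonneg _) (by positivity)
        _ = _ := by field_simp
    have h2 : |ψ y * (a x - a y)| ≤ K * ‖x - y‖ := by
      by_cases hy : y ∈ Metric.closedBall x0 (2 * r)
      · rw [abs_mul]
        calc _ ≤ 1 * (K * ‖x - y‖) := mul_le_mul (hψ1 y) (hlip x hx y hy) (abs_nonneg _) zero_le_one
          _ = _ := one_mul _
      · rw [hout y hy, zero_mul, abs_zero]; positivity
    have e : ψ x * (a x0 - a x) - ψ y * (a x0 - a y) =
        (ψ x - ψ y) * (a x0 - a x) - ψ y * (a x - a y) := by ring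
    rw [e]
    refine (abs_sub _ _).trans ((add_le_add h1 h2).trans (le_of_eq ?_))
    simp only [Λ]; ring
  have hL : ∀ x y, |ψ x * (a x0 - a x) - ψ y * (a x0 - a y)| ≤ Λ * ‖x - y‖ := by
    intro x y
    by_cases hx : x ∈ Metric.closedBall x0 (2 * r)
    · exact key x y hx
    by_cases hy : y ∈ Metric.closedBall x0 (2 * r)
    · rw [abs_sub_comm, norm_sub_rev]; exact key y x hy
    · rw [hout x hx, hout y hy]
      simp only [zero_mul, sub_self, abs_zero]
      positivity
  refine ⟨HB.ofLip hβ.le hβ1.le _ hΛ hsup hL, fun x => rfl, ?_⟩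
  exact (HB.norm_ofLip_le hβ.le hβ1.le hΛ hsup hL).trans hs

variable {ι σ : Type*} [Fintype ι] [DecidableEq ι] [Fintype σ]

/-- Index set for second derivatives. -/
abbrev HIdx (n : ℕ) (ι : Type*) := ι × Fin n × Fin n

/-- The second derivatives. -/
def hess (v : ι → Pt n → ℝ) (t : HIdx n ι) : Pt n → ℝ := pd t.2.1 (pd t.2.2 (v t.1))

/-- Composition of singular integral operators with multiplications. -/
def parOp (T : HIdx n ι → σ → HB n β →L[ℝ] HB n β) (c : σ → HIdx n ι → HB n β) :
    (HIdx n ι → HB n β) →L[ℝ] (HIdx n ι → HB n β) :=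
  ContinuousLinearMap.pi fun t => ∑ s, (T t s).comp
    (∑ t', (ContinuousLinearMap.mul ℝ (HB n β) (c s t')).comp (ContinuousLinearMap.proj t'))

omit [DecidableEq ι] in
theorem parOp_apply (T : HIdx n ι → σ → HB n β →L[ℝ] HB n β) (c : σ → HIdx n ι → HB n β)
    (p : HIdx n ι → HB n β) (t : HIdx n ι) : parOp T c p t = ∑ s, T t s (∑ t', c s t' * p t') := by
  simp [parOp]

omit [DecidableEq ι] in
theorem norm_parOp_le (T : HIdx n ι → σ → HB n β →L[ℝ] HB n β) {c : σ → HIdx n ι → HB n β} {ε : ℝ}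
    (hε : 0 ≤ ε) (hc : ∀ s t, ‖c s t‖ ≤ ε) :
    ‖parOp T c‖ ≤ (∑ t, ∑ s, ‖T t s‖) * (Fintype.card (HIdx n ι) * ε) := by
  refine ContinuousLinearMap.opNorm_le_bound _ (by positivity) fun p => ?_
  refine (pi_norm_le_iff_of_nonneg (by positivity)).2 fun t => ?_
  rw [parOp_apply]
  have h1 : ∀ s, ‖∑ t', c s t' * p t'‖ ≤ Fintype.card (HIdx n ι) * ε * ‖p‖ := by
    intro s
    refine (norm_sum_le _ _).trans ?_
    calc _ ≤ ∑ t' : HIdx n ι, ε * ‖p‖ := Finset.sum_le_sum fun t' _ =>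
          (norm_mul_le _ _).trans (mul_le_mul (hc s t') (norm_le_pi_norm p t') (norm_nonneg _) hε)
      _ = _ := by simp [mul_assoc]
  calc _ ≤ ∑ s, ‖T t s‖ * (Fintype.card (HIdx n ι) * ε * ‖p‖) := (norm_sum_le _ _).trans
        (Finset.sum_le_sum fun s _ => ((T t s).le_opNorm _).trans (by gcongr; exact h1 s))
    _ = (∑ s, ‖T t s‖) * (Fintype.card (HIdx n ι) * ε) * ‖p‖ := by rw [← Finset.sum_mul]; ring
    _ ≤ _ := by
      gcongr
      exact Finset.single_le_sum (f := fun t => ∑ s, ‖T t s‖)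
        (fun t _ => Finset.sum_nonneg fun s _ => norm_nonneg _) (Finset.mem_univ t)

/-- The full second order operator. -/
def opX (a : σ → ι → Fin n → Fin n → Pt n → ℝ) (v : ι → Pt n → ℝ) (s : σ) (x : Pt n) : ℝ :=
  ∑ J, ∑ i, ∑ j, a s J i j x * pd i (pd j (v J)) x

omit [DecidableEq ι] [Fintype σ] in
theorem opX_cutoff (hU : IsOpen U) {α : ℝ} {a : σ → ι → Fin n → Fin n → Pt n → ℝ} {u : ι → Pt n → ℝ}
    {F : σ → Pt n → ℝ} (hα : 0 < α) (hα1 : α ≤ 1) (hu : ∀ J, CH 2 α U (u J))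
    (heq : ∀ s, ∀ x ∈ U, opX a u s x = F s x) {χ : Pt n → ℝ} (hχ : IsTest χ) (s : σ) {x : Pt n} (hx : x ∈ U) :
    opX a (fun J y => χ y * u J y) s x = χ x * F s x + ∑ J, ∑ i, ∑ j, a s J i j x *
      (pd i χ x * pd j (u J) x + pd j χ x * pd i (u J) x + pd i (pd j χ) x * u J x) := by
  have e : ∀ J i j, pd i (pd j fun y => χ y * u J y) x = χ x * pd i (pd j (u J)) x +
      (pd i χ x * pd j (u J) x + pd j χ x * pd i (u J) x + pd i (pd j χ) x * u J x) := by
    intro J i j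
    have h1 : ∀ y ∈ U, pd j (fun y => χ y * u J y) y = pd j χ y * u J y + χ y * pd j (u J) y :=
      fun y hy => pd_mul (hχ.differentiable y) ((hu J).1 y hy)
    rw [pd_congr_on hU h1 x hx, pd_add
      (((hχ.pd j).differentiable x).fun_mul ((hu J).1 x hx))
      ((hχ.differentiable x).fun_mul (((hu J).2 j).1 x hx)),
      pd_mul ((hχ.pd j).differentiable x) ((hu J).1 x hx),
      pd_mul (hχ.differentiable x) (((hu J).2 j).1 x hx)]
    ring
  rw [← heq s x hx]
  unfold opX
  simp_rw [e, Finset.mul_sum, ← Finset.sum_add_distrib]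
  exact Finset.sum_congr rfl fun J _ => Finset.sum_congr rfl fun i _ => Finset.sum_congr rfl fun j _ => by
    ring

omit [DecidableEq ι] [Fintype σ] in
theorem CH_opX_cutoff (hU : IsOpen U) {α : ℝ} {a : σ → ι → Fin n → Fin n → Pt n → ℝ} {u : ι → Pt n → ℝ}
    {F : σ → Pt n → ℝ} (hα : 0 < α) (hα1 : α ≤ 1) (hu : ∀ J, CH 2 α U (u J))
    (heq : ∀ s, ∀ x ∈ U, opX a u s x = F s x) {χ : Pt n → ℝ} (hχ : IsTest χ) (hs : tsupport χ ⊆ U)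
    (hβ : 0 < β) (hβ1 : β ≤ 1) {m : ℕ} (ha : ∀ s J i j, CH m β U (a s J i j)) (hF : ∀ s, CH m β U (F s))
    (hu' : ∀ J, CH (m + 1) β U (u J)) (s : σ) :
    CH m β univ (opX a (fun J y => χ y * u J y) s) ∧
      HasCompactSupport (opX a (fun J y => χ y * u J y) s) := by
  have h0 : ∀ x, x ∉ tsupport χ → opX a (fun J y => χ y * u J y) s x = 0 := by
    intro x hx
    have ho : IsOpen (tsupport χ)ᶜ := (isClosed_tsupport χ).isOpen_compl
    have h1 : ∀ J, ∀ y ∈ (tsupport χ)ᶜ, χ y * u J y = 0 := fun J y hy => by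
      rw [image_eq_zero_of_notMem_tsupport hy, zero_mul]
    have h2 : ∀ J j, ∀ y ∈ (tsupport χ)ᶜ, pd j (fun y => χ y * u J y) y = 0 := fun J j y hy => by
      rw [pd_congr_on ho (h1 J) y hy, pd_const]
    unfold opX
    refine Finset.sum_eq_zero fun J _ => Finset.sum_eq_zero fun i _ => Finset.sum_eq_zero fun j _ => ?_
    rw [pd_congr_on ho (h2 J j) x hx, pd_const, mul_zero]
  refine ⟨CH.of_tsupport (U := U) ?_ ((closure_minimal (fun x hx => by
    by_contra h; exact hx (h0 x h)) (isClosed_tsupport χ)).trans hs), HasCompactSupport.intro hχ.2 h0⟩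
  refine CH.congr hU ?_ fun x hx => (opX_cutoff hU hα hα1 hu heq hχ s hx).symm
  have hu0 : ∀ J, CH m β U (u J) := fun J => (hu' J).of_le hU hβ hβ1 (Nat.le_succ m)
  exact ((hχ.CH hU hβ1).mul hU hβ hβ1 (hF s)).add hU (CH.sum hU _ fun J _ => CH.sum hU _ fun i _ =>
    CH.sum hU _ fun j _ => (ha s J i j).mul hU hβ hβ1 (((((hχ.pd i).CH hU hβ1).mul hU hβ hβ1
      ((hu' J).2 j)).add hU (((hχ.pd j).CH hU hβ1).mul hU hβ hβ1 ((hu' J).2 i))).add hU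
      ((((hχ.pd j).pd i).CH hU hβ1).mul hU hβ hβ1 (hu0 J))))

end LinearRegularity

section LinearRegularityLocal

open MeasureTheory

variable {n : ℕ} {U : Set (Pt n)} {α β : ℝ} {ι σ : Type*} [Fintype ι] [DecidableEq ι] [Fintype σ]

theorem HB.exists_exponent_le (hα : 0 < α) (h : α ≤ β) (f : HB n β) : ∃ F : HB n α, ∀ x, F x = f x := by
  refine ⟨HB.of f ⟨_, f.abs_le_norm⟩ ⟨2 * ‖f‖, fun x y => ?_⟩, fun x => rfl⟩
  have hf := norm_nonneg f
  rcases le_or_gt ‖x - y‖ 1 with h1 | h1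
  · refine (f.sub_le_norm x y).trans ?_
    rcases (norm_nonneg (x - y)).eq_or_lt with h0 | h0
    · rw [← h0, Real.zero_rpow hα.ne', Real.zero_rpow (hα.trans_le h).ne']; simp
    · have := Real.rpow_le_rpow_of_exponent_ge h0 h1 h
      have h2 : 0 ≤ ‖x - y‖ ^ α := by positivity
      nlinarith
  · have h2 : 1 ≤ ‖x - y‖ ^ α := Real.one_le_rpow h1.le hα.le
    have := abs_sub (f x) (f y)
    nlinarith [f.abs_le_norm x, f.abs_le_norm y]

/-- Localization data around a point for the system `opX a u = F`. -/
structure LocData (a : σ → ι → Fin n → Fin n → Pt n → ℝ) (U : Set (Pt n)) (x0 : Pt n) where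
  χ : Pt n → ℝ
  ψ : Pt n → ℝ
  χ_test : IsTest χ
  ψ_test : IsTest ψ
  χ_sub : tsupport χ ⊆ U
  ψ_sub : tsupport ψ ⊆ U
  χ_one : ∃ ρ > 0, Metric.ball x0 ρ ⊆ U ∧ ∀ x ∈ Metric.ball x0 ρ, χ x = 1
  ψ_one : ∀ x ∈ tsupport χ, ψ x = 1
  φ : HIdx n ι → Pt n → ℝ
  κ : HIdx n ι → σ → Pt n → ℝ
  φ_test : ∀ t, IsTest (φ t)
  κ_test : ∀ t s, IsTest (κ t s)
  κ_zero : ∀ t s, ∫ z, κ t s z = 0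
  rep : ∀ δ, 0 < δ → ∀ v : ι → Pt n → ℝ, (∀ J, ContDiff ℝ 2 (v J)) → (∀ J, HasCompactSupport (v J)) →
    ∀ d : σ → HB n δ, (∀ s x, d s x = opA (fun s J i j => a s J i j x0) v s x) →
      ∀ t x, hess v t x = innerInt (φ t) (v t.1) 1 x + ∑ s, singInt (κ t s) (wt 2) (d s) x

/-- The perturbation operator at exponent `δ` is a contraction. -/
def LocData.Good {a : σ → ι → Fin n → Fin n → Pt n → ℝ} {x0 : Pt n} (D : LocData a U x0) (δ : ℝ) : Prop :=
  ∃ (T : HIdx n ι → σ → HB n δ →L[ℝ] HB n δ) (c : σ → HIdx n ι → HB n δ),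
    (∀ t s d x, T t s d x = singInt (D.κ t s) (wt 2) d x) ∧
    (∀ s t x, c s t x = D.ψ x * (a s t.1 t.2.1 t.2.2 x0 - a s t.1 t.2.1 t.2.2 x)) ∧
    ‖parOp T c‖ ≤ 1 / 2

theorem exists_locData (hU : IsOpen U) {γ : ℝ} (hγ : 0 < γ) {a : σ → ι → Fin n → Fin n → Pt n → ℝ}
    (ha : ∀ s J i j, CH 1 γ U (a s J i j)) {x0 : Pt n} (hx0 : x0 ∈ U)
    (hell : Elliptic fun s J i j => a s J i j x0) (hα : 0 < α) (hα1 : α < 1) (hβ : 0 < β) (hβ1 : β < 1) :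
    ∃ D : LocData a U x0, D.Good α ∧ D.Good β := by
  obtain ⟨φ, κ, hφ, hκ, hκ0, hrep⟩ := exists_parametrix hell
  obtain ⟨M, hM, hcut⟩ := exists_cutoff n
  let μ : HIdx n ι → Jet n := fun t => some (t.2.1, some t.2.2)
  have main : ∀ δ, 0 < δ → δ < 1 → ∃ T : HIdx n ι → σ → HB n δ →L[ℝ] HB n δ,
      (∀ t s d x, T t s d x = singInt (κ t.1 s (μ t)) (wt 2) d x) ∧ ∃ r0 > 0, ∀ r, 0 < r → r ≤ r0 →
      ∀ ψ : Pt n → ℝ, tsupport ψ ⊆ Metric.closedBall x0 (2 * r) →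
      (∀ x, |ψ x| ≤ 1) → (∀ x y, |ψ x - ψ y| ≤ M / r * ‖x - y‖) →
      ∃ c : σ → HIdx n ι → HB n δ,
        (∀ s t x, c s t x = ψ x * (a s t.1 t.2.1 t.2.2 x0 - a s t.1 t.2.1 t.2.2 x)) ∧
        ‖parOp T c‖ ≤ 1 / 2 := by
    intro δ hδ hδ1
    choose T hT using fun (t : HIdx n ι) s =>
      exists_singOp (hκ t.1 s (μ t)) (hκ0 t.1 s (μ t)) hδ hδ1 (wt_isWeight le_rfl)
    refine ⟨T, hT, ?_⟩
    set N : ℝ := (∑ t, ∑ s, ‖T t s‖) * Fintype.card (HIdx n ι)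
    have hN : 0 ≤ N := by positivity
    have hε : 0 < 1 / (2 * (N + 1)) := by positivity
    choose R hR0 hR using fun (p : σ × HIdx n ι) => exists_small_cutoff_coeff hU hγ
      (ha p.1 p.2.1 p.2.2.1 p.2.2.2) hx0 hδ hδ1 hM hε
    obtain ⟨r0, hr0, hr0R⟩ : ∃ r0 > 0, ∀ p, r0 ≤ R p := by
      by_cases he : Nonempty (σ × HIdx n ι)
      · obtain ⟨p, hp⟩ := Finite.exists_min R
        exact ⟨R p, hR0 p, hp⟩
      · exact ⟨1, one_pos, fun p => (he ⟨p⟩).elim⟩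
    refine ⟨r0, hr0, fun r hr hrr ψ h1 h2 h3 => ?_⟩
    choose c hc hcε using fun p => hR p r hr (hrr.trans (hr0R p)) ψ h1 h2 h3
    refine ⟨fun s t => c (s, t), fun s t x => hc (s, t) x, ?_⟩
    refine (norm_parOp_le T hε.le fun s t => hcε (s, t)).trans ?_
    rw [← mul_assoc, mul_one_div, div_le_div_iff₀ (by positivity) (by positivity)]
    linarith
  obtain ⟨Tα, hTα, rα, hrα, hα'⟩ := main α hα hα1
  obtain ⟨Tβ, hTβ, rβ, hrβ, hβ'⟩ := main β hβ hβ1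
  obtain ⟨ρ, hρ, hρU⟩ := Metric.isOpen_iff.1 hU x0 hx0
  set r := min (min rα rβ) (ρ / 4)
  have hr : 0 < r := by positivity
  have hr1 : r ≤ rα := (min_le_left _ _).trans (min_le_left _ _)
  have hr2 : r ≤ rβ := (min_le_left _ _).trans (min_le_right _ _)
  have hr3 : r ≤ ρ / 4 := min_le_right _ _
  have hsub : Metric.closedBall x0 (2 * r) ⊆ U := fun x hx => hρU (by
    rw [Metric.mem_closedBall] at hx; rw [Metric.mem_ball]; linarith)
  obtain ⟨ψ, hψ, hψ1, hψs, hψb, hψL⟩ := hcut x0 r hr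
  obtain ⟨χ, hχ, hχ1, hχs, -, -⟩ := hcut x0 (r / 4) (by positivity)
  obtain ⟨cα, hcα, hnα⟩ := hα' r hr hr1 ψ hψs hψb hψL
  obtain ⟨cβ, hcβ, hnβ⟩ := hβ' r hr hr2 ψ hψs hψb hψL
  have hχr : tsupport χ ⊆ Metric.ball x0 r := fun x hx => by
    have := hχs hx
    rw [Metric.mem_closedBall] at this; rw [Metric.mem_ball]; linarith
  have hball : Metric.ball x0 r ⊆ U := fun x hx => hsub (by
    rw [Metric.mem_ball] at hx; rw [Metric.mem_closedBall]; linarith)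
  refine ⟨⟨χ, ψ, hχ, hψ, hχr.trans hball, hψs.trans hsub, ⟨r / 4, by positivity,
    (Metric.ball_subset_ball (by linarith)).trans hball, hχ1⟩, fun x hx => hψ1 x (hχr hx), fun t => φ (μ t),
    fun t s => κ t.1 s (μ t), fun t => hφ _, fun t s => hκ _ _ _, fun t s => hκ0 _ _ _,
    fun δ hδ v hv hvc d hd t x => hrep δ hδ v hv hvc d hd t.1 (μ t) x⟩, ⟨Tα, cα, hTα, hcα, hnα⟩,
    ⟨Tβ, cβ, hTβ, hcβ, hnβ⟩⟩

omit [Fintype ι] [DecidableEq ι] [Fintype σ] in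
theorem hess_eq_zero_of_notMem {χ : Pt n → ℝ} {u : ι → Pt n → ℝ} {x : Pt n} (hx : x ∉ tsupport χ) (t : HIdx n ι) :
    hess (fun J y => χ y * u J y) t x = 0 := by
  have ho : IsOpen (tsupport χ)ᶜ := (isClosed_tsupport χ).isOpen_compl
  have h1 : ∀ J, ∀ y ∈ (tsupport χ)ᶜ, χ y * u J y = 0 := fun J y hy => by
    rw [image_eq_zero_of_notMem_tsupport hy, zero_mul]
  have h2 : ∀ J j, ∀ y ∈ (tsupport χ)ᶜ, pd j (fun y => χ y * u J y) y = 0 := fun J j y hy => by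
    rw [pd_congr_on ho (h1 J) y hy, pd_const]
  unfold hess
  rw [pd_congr_on ho (h2 _ _) x hx, pd_const]

omit [DecidableEq ι] in
theorem LocData.opA_eq {a : σ → ι → Fin n → Fin n → Pt n → ℝ} {x0 : Pt n} (D : LocData a U x0)
    (u : ι → Pt n → ℝ) (s : σ) (x : Pt n) :
    opA (fun s J i j => a s J i j x0) (fun J y => D.χ y * u J y) s x =
      opX a (fun J y => D.χ y * u J y) s x + ∑ t : HIdx n ι,
        D.ψ x * (a s t.1 t.2.1 t.2.2 x0 - a s t.1 t.2.1 t.2.2 x) * hess (fun J y => D.χ y * u J y) t x := by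
  have e : ∀ t : HIdx n ι, D.ψ x * (a s t.1 t.2.1 t.2.2 x0 - a s t.1 t.2.1 t.2.2 x) *
      hess (fun J y => D.χ y * u J y) t x =
      (a s t.1 t.2.1 t.2.2 x0 - a s t.1 t.2.1 t.2.2 x) * hess (fun J y => D.χ y * u J y) t x := by
    intro t
    by_cases hx : x ∈ tsupport D.χ
    · rw [D.ψ_one x hx, one_mul]
    · rw [hess_eq_zero_of_notMem hx, mul_zero, mul_zero]
  simp_rw [e]
  rw [Fintype.sum_prod_type]
  simp_rw [Fintype.sum_prod_type]
  unfold opA opX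
  simp_rw [← Finset.sum_add_distrib]
  refine Finset.sum_congr rfl fun J _ => Finset.sum_congr rfl fun i _ => Finset.sum_congr rfl fun j _ => ?_
  simp only [hess]
  ring

omit [DecidableEq ι] in
theorem LocData.hess_eq {a : σ → ι → Fin n → Fin n → Pt n → ℝ} {x0 : Pt n} (D : LocData a U x0) {δ : ℝ}
    (hδ : 0 < δ) {T : HIdx n ι → σ → HB n δ →L[ℝ] HB n δ} {c : σ → HIdx n ι → HB n δ}
    (hT : ∀ t s d x, T t s d x = singInt (D.κ t s) (wt 2) d x)
    (hc : ∀ s t x, c s t x = D.ψ x * (a s t.1 t.2.1 t.2.2 x0 - a s t.1 t.2.1 t.2.2 x))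
    {u : ι → Pt n → ℝ} (hv2 : ∀ J, ContDiff ℝ 2 fun y => D.χ y * u J y)
    {F : σ → HB n δ} (hF : ∀ s x, F s x = opX a (fun J y => D.χ y * u J y) s x)
    {p : HIdx n ι → HB n δ} (hp : ∀ t x, p t x = hess (fun J y => D.χ y * u J y) t x)
    {h : HIdx n ι → HB n δ} (hh : ∀ t x, h t x = innerInt (D.φ t) (fun y => D.χ y * u t.1 y) 1 x +
      ∑ s, singInt (D.κ t s) (wt 2) (F s) x) : p = h + parOp T c p := by
  ext t x
  rw [hp t x, Pi.add_apply, HB.add_apply, parOp_apply, hh]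
  have h1 := D.rep δ hδ (fun J y => D.χ y * u J y) hv2 (fun J => D.χ_test.2.mul_right)
    (fun s => F s + ∑ t', c s t' * p t') (fun s x => by
      rw [D.opA_eq, HB.add_apply, hF, HB.sum_apply]
      simp only [HB.mul_apply, hc, hp]) t x
  rw [h1, HB.sum_apply, add_assoc, ← Finset.sum_add_distrib]
  congr 1
  refine Finset.sum_congr rfl fun s _ => ?_
  rw [← hT, ← hT, map_add, HB.add_apply]

end LinearRegularityLocal

section LinearRegularityMain

open MeasureTheory

variable {n : ℕ} {U : Set (Pt n)} {α β : ℝ} {ι σ : Type*} [Fintype ι] [DecidableEq ι] [Fintype σ]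

omit [Fintype ι] [DecidableEq ι] in
theorem contDiff_cutoff (hU : IsOpen U) (hα : 0 < α) (hα1 : α ≤ 1) {χ : Pt n → ℝ} (hχ : IsTest χ)
    (hs : tsupport χ ⊆ U) {m : ℕ} {u : ι → Pt n → ℝ} (hu : ∀ J, CH m α U (u J)) (J : ι) :
    ContDiff ℝ m fun y => χ y * u J y :=
  contDiffOn_univ.1 (((hu J).test_mul hU hα hα1 hχ hs).contDiffOn isOpen_univ hα)

omit [Fintype ι] [DecidableEq ι] in
theorem CH.exists_HB_hess {δ : ℝ} (hU : IsOpen U) (hδ : 0 < δ) (hδ1 : δ ≤ 1) {χ : Pt n → ℝ} (hχ : IsTest χ)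
    (hs : tsupport χ ⊆ U) {u : ι → Pt n → ℝ} (hu : ∀ J, CH 2 δ U (u J)) (t : HIdx n ι) :
    ∃ p : HB n δ, ∀ x, p x = hess (fun J y => χ y * u J y) t x := by
  refine LocHolder.exists_HB hδ ((((hu t.1).test_mul hU hδ hδ1 hχ hs).2 t.2.2).2 t.2.1) ?_
  exact HasCompactSupport.intro hχ.2 fun x hx => hess_eq_zero_of_notMem hx t

/-- Improvement of the Hölder exponent for second derivatives. -/
theorem linear_zero (hU : IsOpen U) {γ : ℝ} (hγ : 0 < γ) {a : σ → ι → Fin n → Fin n → Pt n → ℝ}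
    (ha : ∀ s J i j, CH 1 γ U (a s J i j)) (hell : ∀ x ∈ U, Elliptic fun s J i j => a s J i j x)
    (hα : 0 < α) (hαβ : α ≤ β) (hβ1 : β < 1) {u : ι → Pt n → ℝ} (hu : ∀ J, CH 2 α U (u J))
    {F : σ → Pt n → ℝ} (hF : ∀ s, CH 0 β U (F s)) (heq : ∀ s, ∀ x ∈ U, opX a u s x = F s x) (J : ι) :
    CH 2 β U (u J) := by
  have hβ : 0 < β := hα.trans_le hαβ
  have hα1 : α < 1 := hαβ.trans_lt hβ1
  refine CH.of_local fun x0 hx0 => ?_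
  obtain ⟨D, ⟨Tα, cα, hTα, hcα, hnα⟩, ⟨Tβ, cβ, hTβ, hcβ, hnβ⟩⟩ :=
    exists_locData hU hγ ha hx0 (hell x0 hx0) hα hα1 hβ hβ1
  have hu1 : ∀ J, CH 1 β U (u J) := fun J => (hu J).lower hU hα hβ1.le
  have hv2 := fun J => contDiff_cutoff hU hα hα1.le D.χ_test D.χ_sub hu J
  have hX := CH_opX_cutoff hU hα hα1.le hu heq D.χ_test D.χ_sub hβ hβ1.le (m := 0)
    (fun s J i j => (ha s J i j).lower hU hγ hβ1.le) hF hu1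
  choose Fβ hFβ using fun s => LocHolder.exists_HB hβ (hX s).1 (hX s).2
  choose V hV using fun J => LocHolder.exists_HB hβ
    ((hu1 J).of_le hU hβ hβ1.le (Nat.zero_le 1) |>.test_mul hU hβ hβ1.le D.χ_test D.χ_sub)
    D.χ_test.2.mul_right
  choose C hC using fun t => exists_convOp (D.φ_test t) hβ
  let hb : HIdx n ι → HB n β := fun t => C t (V t.1) + ∑ s, Tβ t s (Fβ s)
  obtain ⟨p, hp⟩ := exists_affine_fixedPoint hnβ hb
  choose Fα hFα using fun s => (Fβ s).exists_exponent_le hα hαβ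
  choose pα hpα using fun t => (p t).exists_exponent_le hα hαβ
  choose ha' hha' using fun t => (hb t).exists_exponent_le hα hαβ
  choose q hq using fun t => CH.exists_HB_hess hU hα hα1.le D.χ_test D.χ_sub hu t
  have hVf : ∀ J, (V J : Pt n → ℝ) = fun y => D.χ y * u J y := fun J => funext (hV J)
  have eFα : ∀ s, (Fα s : Pt n → ℝ) = Fβ s := fun s => funext (hFα s)
  have h1 : q = ha' + parOp Tα cα q := D.hess_eq hα hTα hcα hv2 (fun s x => by rw [hFα, hFβ]) hq
    fun t x => by
      rw [hha', HB.add_apply, HB.sum_apply, hC, hVf]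
      simp only [hTβ, eFα]
  have h2 : pα = ha' + parOp Tα cα pα := by
    ext t x
    have hpt : p t x = hb t x + parOp Tβ cβ p t x := by
      conv_lhs => rw [hp]
      rfl
    have hqt : (ha' + parOp Tα cα pα) t x = ha' t x + parOp Tα cα pα t x := rfl
    rw [hpα, hpt, hqt, ← hha', parOp_apply, parOp_apply, HB.sum_apply, HB.sum_apply]
    congr 1
    refine Finset.sum_congr rfl fun s _ => ?_
    rw [hTα, hTβ]
    congr 1
    ext y
    simp only [HB.sum_apply, HB.mul_apply, hcα, hcβ, hpα]
  have h3 := affine_fixedPoint_unique hnα h1 h2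
  obtain ⟨ρ, hρ, hρU, hχ1⟩ := D.χ_one
  refine ⟨Metric.ball x0 ρ, Metric.mem_ball_self hρ, ?_⟩
  refine ⟨fun x hx => (hu J).1 x (hρU hx), fun j => ⟨fun x hx => ((hu J).2 j).1 x (hρU hx), fun i => ?_⟩⟩
  refine LocHolder.congr (f := p (J, i, j)) Metric.isOpen_ball (fun x _ => ?_) fun x hx => ?_
  · exact ⟨‖p (J, i, j)‖, 1, norm_nonneg _, one_pos, fun y _ z _ => (p (J, i, j)).sub_le_norm y z⟩
  · rw [← hpα, ← h3, hq]
    have e1 : ∀ y ∈ Metric.ball x0 ρ, D.χ y * u J y = u J y := fun y hy => by rw [hχ1 y hy, one_mul]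
    exact pd_congr_on Metric.isOpen_ball (pd_congr_on Metric.isOpen_ball e1) x hx

theorem CH.exists_HB_grad (hβ : 0 < β) (hβ1 : β ≤ 1) {f : Pt n → ℝ} (hf : CH 1 β univ f)
    (hc : HasCompactSupport f) : ∃ (F : HB n β) (F' : Fin n → HB n β), (∀ x, F x = f x) ∧
      (∀ e x, F' e x = pd e f x) ∧ HasGrad F fun e => F' e := by
  obtain ⟨F, hF⟩ := LocHolder.exists_HB hβ (hf.of_le isOpen_univ hβ hβ1 (Nat.zero_le 1)) hc
  choose F' hF' using fun e => LocHolder.exists_HB hβ (hf.2 e) (hc.pd e)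
  refine ⟨F, F', hF, hF', ?_⟩
  have e1 : (F : Pt n → ℝ) = f := funext hF
  have e2 : (fun e => (F' e : Pt n → ℝ)) = fun e => pd e f := funext fun e => funext (hF' e)
  rw [e1, e2]
  exact hasGrad_of_differentiable fun x => hf.1 x (mem_univ x)

omit [DecidableEq ι] in
theorem norm_pi_comp_proj_le {δ : ℝ} {K : (HIdx n ι → HB n δ) →L[ℝ] (HIdx n ι → HB n δ)} :
    ‖(ContinuousLinearMap.pi fun e : Fin n => K.comp (ContinuousLinearMap.proj e) :
      (Fin n → HIdx n ι → HB n δ) →L[ℝ] (Fin n → HIdx n ι → HB n δ))‖ ≤ ‖K‖ := by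
  refine ContinuousLinearMap.opNorm_le_bound _ (norm_nonneg _) fun r => ?_
  refine (pi_norm_le_iff_of_nonneg (by positivity)).2 fun e => ?_
  exact (K.le_opNorm _).trans (by gcongr; exact norm_le_pi_norm r e)

theorem HB.hasGrad_add {f g : HB n β} {f' g' : Fin n → HB n β} (hf : HasGrad f fun e => f' e)
    (hg : HasGrad g fun e => g' e) : HasGrad (f + g : HB n β) fun e => (f' e + g' e : HB n β) :=
  hf.add hg

theorem HB.hasGrad_zero : HasGrad (0 : HB n β) fun _ : Fin n => (0 : HB n β) := by
  intro x
  have h : HasFDerivAt (fun _ : Pt n => (0 : ℝ)) (0 : Pt n →L[ℝ] ℝ) x := hasFDerivAt_const 0 x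
  refine h.congr_fderiv ?_
  exact (Finset.sum_eq_zero fun e _ => zero_smul ℝ _).symm

theorem HB.hasGrad_mul {f g : HB n β} {f' g' : Fin n → HB n β} (hf : HasGrad f fun e => f' e)
    (hg : HasGrad g fun e => g' e) : HasGrad (f * g : HB n β) fun e => (f' e * g + f * g' e : HB n β) :=
  hf.mul hg

theorem HB.hasGrad_sum {τ : Type*} {S : Finset τ} {f : τ → HB n β} {f' : τ → Fin n → HB n β}
    (h : ∀ i ∈ S, HasGrad (f i) fun e => f' i e) :
    HasGrad (∑ i ∈ S, f i : HB n β) fun e => (∑ i ∈ S, f' i e : HB n β) := by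
  have e1 : ((∑ i ∈ S, f i : HB n β) : Pt n → ℝ) = fun x => ∑ i ∈ S, f i x :=
    funext fun x => HB.sum_apply _ _ _
  have e2 : (fun e => ((∑ i ∈ S, f' i e : HB n β) : Pt n → ℝ)) = fun e x => ∑ i ∈ S, f' i e x :=
    funext fun e => funext fun x => HB.sum_apply _ _ _
  rw [e1, e2]
  exact HasGrad.sum h

omit [DecidableEq ι] in
theorem hasGrad_parOp {T : HIdx n ι → σ → HB n β →L[ℝ] HB n β}
    (hT : ∀ t s (d : HB n β) (d' : Fin n → HB n β), (HasGrad d fun e => d' e) →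
      HasGrad (T t s d) fun e => T t s (d' e))
    {c : σ → HIdx n ι → HB n β} {c' : σ → HIdx n ι → Fin n → HB n β}
    (hc : ∀ s t, HasGrad (c s t) fun e => c' s t e) {p : HIdx n ι → HB n β} {r : Fin n → HIdx n ι → HB n β}
    (hp : ∀ t, HasGrad (p t) fun e => r e t) (t : HIdx n ι) :
    HasGrad (parOp T c p t) fun e => (parOp T (fun s t => c' s t e) p t + parOp T c (r e) t : HB n β) := by
  have k3 := HB.hasGrad_sum (S := Finset.univ) fun s _ => hT t s _ _
    (HB.hasGrad_sum (S := Finset.univ) fun t' _ => HB.hasGrad_mul (hc s t') (hp t'))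
  have k4 : ∀ e, (∑ s, T t s (∑ t', (c' s t' e * p t' + c s t' * r e t')) : HB n β) =
      parOp T (fun s t => c' s t e) p t + parOp T c (r e) t := by
    intro e
    rw [parOp_apply, parOp_apply, ← Finset.sum_add_distrib]
    refine Finset.sum_congr rfl fun s _ => ?_
    rw [← map_add, ← Finset.sum_add_distrib]
  simp only [k4] at k3
  rw [parOp_apply]
  exact k3

omit [DecidableEq ι] in
theorem exists_fixedPoint_hasGrad {T : HIdx n ι → σ → HB n β →L[ℝ] HB n β}
    (hT : ∀ t s (d : HB n β) (d' : Fin n → HB n β), (HasGrad d fun e => d' e) →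
      HasGrad (T t s d) fun e => T t s (d' e))
    {c : σ → HIdx n ι → HB n β} {c' : σ → HIdx n ι → Fin n → HB n β}
    (hc : ∀ s t, HasGrad (c s t) fun e => c' s t e) (hn : ‖parOp T c‖ ≤ 1 / 2) {hb : HIdx n ι → HB n β}
    {hb' : Fin n → HIdx n ι → HB n β} (hhb : ∀ t, HasGrad (hb t) fun e => hb' e t) :
    ∃ (p : HIdx n ι → HB n β) (r : Fin n → HIdx n ι → HB n β), (∀ t, HasGrad (p t) fun e => r e t) ∧
      p = hb + parOp T c p := by
  let S : (HIdx n ι → HB n β) →L[ℝ] (Fin n → HIdx n ι → HB n β) :=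
    ContinuousLinearMap.pi fun e => parOp T fun s t => c' s t e
  let Dset : Set ((HIdx n ι → HB n β) × (Fin n → HIdx n ι → HB n β)) :=
    {x | ∀ t, HasGrad (x.1 t) fun e => x.2 e t}
  have hDc : IsClosed Dset := by
    have : Dset = ⋂ t, (fun x : (HIdx n ι → HB n β) × (Fin n → HIdx n ι → HB n β) =>
        (x.1 t, fun e => x.2 e t)) ⁻¹' {y : HB n β × (Fin n → HB n β) | HasGrad y.1 fun e => y.2 e} := by
      ext x
      rw [mem_iInter]
      rfl
    rw [this]
    exact isClosed_iInter fun t => (isClosed_hasGrad n β).preimage (by fun_prop)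
  have hD0 : Dset.Nonempty := ⟨0, fun t => HB.hasGrad_zero⟩
  let L : (Fin n → HIdx n ι → HB n β) →L[ℝ] (Fin n → HIdx n ι → HB n β) :=
    ContinuousLinearMap.pi fun e => (parOp T c).comp (ContinuousLinearMap.proj e)
  have hL : ‖L‖ ≤ 1 / 2 := norm_pi_comp_proj_le.trans hn
  have hm : ∀ p r, (p, r) ∈ Dset → (hb + parOp T c p, hb' + S p + L r) ∈ Dset := by
    intro p r hpr t
    have k5 := HB.hasGrad_add (hhb t) (hasGrad_parOp hT hc hpr t)
    simp only [← add_assoc] at k5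
    exact k5
  have key := exists_fixedPoint_mem hn hL S hb hb' hDc hD0 hm
  exact key.elim fun p h => h.elim fun r h => ⟨p, r, h.1, h.2.1⟩

/-- One more derivative. -/
theorem linear_one (hU : IsOpen U) {a : σ → ι → Fin n → Fin n → Pt n → ℝ}
    (hβ : 0 < β) (hβ1 : β < 1)
    (ha : ∀ s J i j, CH 1 β U (a s J i j)) (hell : ∀ x ∈ U, Elliptic fun s J i j => a s J i j x)
    {u : ι → Pt n → ℝ} (hu : ∀ J, CH 2 β U (u J))
    {F : σ → Pt n → ℝ} (hF : ∀ s, CH 1 β U (F s)) (heq : ∀ s, ∀ x ∈ U, opX a u s x = F s x) (J : ι) :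
    CH 3 β U (u J) := by
  refine CH.of_local fun x0 hx0 => ?_
  obtain ⟨D, ⟨T, c, hT, hc, hn⟩, -⟩ := exists_locData hU hβ ha hx0 (hell x0 hx0) hβ hβ1 hβ hβ1
  have hv2 := fun J => contDiff_cutoff hU hβ hβ1.le D.χ_test D.χ_sub hu J
  have hX := CH_opX_cutoff hU hβ hβ1.le hu heq D.χ_test D.χ_sub hβ hβ1.le (m := 1) ha hF hu
  choose Fb Fg hFb _hFg hFgrad using fun s => CH.exists_HB_grad hβ hβ1.le (hX s).1 (hX s).2
  choose V Vg hV _hVg hVgrad using fun J => CH.exists_HB_grad hβ hβ1.le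
    (((hu J).of_le hU hβ hβ1.le one_le_two).test_mul hU hβ hβ1.le D.χ_test D.χ_sub) D.χ_test.2.mul_right
  have hcg : ∀ s t, ∃ c' : Fin n → HB n β, HasGrad (c s t) fun e => c' e := by
    intro s t
    have h1 : CH 1 β univ fun x => D.ψ x * (a s t.1 t.2.1 t.2.2 x0 - a s t.1 t.2.1 t.2.2 x) :=
      ((CH.const hU _).sub hU hβ hβ1.le (ha s t.1 t.2.1 t.2.2)).test_mul hU hβ hβ1.le D.ψ_test D.ψ_sub
    obtain ⟨G, G', hG, -, hGg⟩ := CH.exists_HB_grad hβ hβ1.le h1 D.ψ_test.2.mul_right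
    have : G = c s t := HB.ext fun x => by rw [hG, hc]
    exact ⟨G', this ▸ hGg⟩
  choose c' hc' using hcg
  choose C hC using fun t => exists_convOp (D.φ_test t) hβ
  choose q hq using fun t => CH.exists_HB_hess hU hβ hβ1.le D.χ_test D.χ_sub hu t
  let hb : HIdx n ι → HB n β := fun t => C t (V t.1) + ∑ s, T t s (Fb s)
  let hb' : Fin n → HIdx n ι → HB n β := fun e t => C t (Vg t.1 e) + ∑ s, T t s (Fg s e)
  have hVf : ∀ J, (V J : Pt n → ℝ) = fun y => D.χ y * u J y := fun J => funext (hV J)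
  have h1 : q = hb + parOp T c q := D.hess_eq hβ hT hc hv2 hFb hq fun t x => by
    simp only [hb]
    rw [HB.add_apply, HB.sum_apply, hC, hVf]
    simp only [hT]
  have hTgrad : ∀ t s (d : HB n β) (d' : Fin n → HB n β), (HasGrad d fun e => d' e) →
      HasGrad (T t s d) fun e => T t s (d' e) := by
    intro t s d d' h
    have e1 : ∀ d, (T t s d : Pt n → ℝ) = singInt (D.κ t s) (wt 2) d := fun d => funext (hT t s d)
    simp only [e1]
    exact hasGrad_singInt (D.κ_test t s) (D.κ_zero t s) hβ (wt_isWeight le_rfl) h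
  have hCgrad : ∀ t (d : HB n β) (d' : Fin n → HB n β), (HasGrad d fun e => d' e) →
      HasGrad (C t d) fun e => C t (d' e) := by
    intro t d d' h
    have e1 : ∀ d, (C t d : Pt n → ℝ) = innerInt (D.φ t) d 1 := fun d => funext (hC t d)
    simp only [e1]
    exact hasGrad_innerInt (D.φ_test t) h (fun e => (d' e).continuous hβ) (fun e => (d' e).abs_le_norm) 1
  obtain ⟨p, r, hpr, hp⟩ := exists_fixedPoint_hasGrad hTgrad hc' hn (hb := hb) (hb' := hb')
    fun t => HB.hasGrad_add (hCgrad t _ _ (hVgrad t.1)) (HB.hasGrad_sum fun s _ => hTgrad t s _ _ (hFgrad s))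
  have h3 := affine_fixedPoint_unique hn h1 hp
  obtain ⟨ρ, hρ, hρU, hχ1⟩ := D.χ_one
  refine ⟨Metric.ball x0 ρ, Metric.mem_ball_self hρ, ?_⟩
  refine ⟨fun x hx => (hu J).1 x (hρU hx), fun j => ⟨fun x hx => ((hu J).2 j).1 x (hρU hx), fun i => ?_⟩⟩
  refine CH.congr (f := p (J, i, j)) Metric.isOpen_ball ⟨fun x _ => (hpr (J, i, j)).differentiable x,
    fun e => ?_⟩ fun x hx => ?_
  · rw [(hpr (J, i, j)).pd_eq e]
    exact fun x _ => ⟨‖r e (J, i, j)‖, 1, norm_nonneg _, one_pos, fun y _ z _ =>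
      (r e (J, i, j)).sub_le_norm y z⟩
  · rw [← h3, hq]
    have e1 : ∀ y ∈ Metric.ball x0 ρ, D.χ y * u J y = u J y := fun y hy => by rw [hχ1 y hy, one_mul]
    exact pd_congr_on Metric.isOpen_ball (pd_congr_on Metric.isOpen_ball e1) x hx

end LinearRegularityMain

section QuasilinearRegularity

variable {n : ℕ} {U : Set (Pt n)} {α β : ℝ} {ι σ : Type*} [Fintype ι] [DecidableEq ι] [Fintype σ]

/-- Schauder regularity for overdetermined linear second-order elliptic systems. -/
theorem linear_regularity (hU : IsOpen U) {a : σ → ι → Fin n → Fin n → Pt n → ℝ} (hβ : 0 < β)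
    (hβ1 : β < 1) (hell : ∀ x ∈ U, Elliptic fun s J i j => a s J i j x) {m : ℕ} :
    ∀ {u : ι → Pt n → ℝ} {F : σ → Pt n → ℝ}, (∀ s J i j, CH (m + 1) β U (a s J i j)) →
      (∀ J, CH 2 β U (u J)) → (∀ s, CH m β U (F s)) → (∀ s, ∀ x ∈ U, opX a u s x = F s x) →
      ∀ J, CH (m + 2) β U (u J) := by
  induction m with
  | zero => intro u F _ hu _ _; exact hu
  | succ m ih =>
    intro u F ha hu hF heq J
    have ha' : ∀ s J i j, CH (m + 1) β U (a s J i j) := fun s J i j =>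
      (ha s J i j).of_le hU hβ hβ1.le (Nat.le_succ _)
    have hu3 := linear_one hU hβ hβ1 (fun s J i j => (ha s J i j).of_le hU hβ hβ1.le (by omega)) hell hu
      (fun s => (hF s).of_le hU hβ hβ1.le (by omega)) heq
    have hum := ih ha' hu (fun s => (hF s).of_le hU hβ hβ1.le (Nat.le_succ _)) heq
    refine ⟨(hu J).1, fun e => ?_⟩
    have hC3 : ∀ J, ContDiffOn ℝ 3 (u J) U := fun J => (hu3 J).contDiffOn hU hβ
    refine ih (u := fun J => pd e (u J))
      (F := fun s x => pd e (F s) x - ∑ J, ∑ i, ∑ j, pd e (a s J i j) x * pd i (pd j (u J)) x) ha'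
      (fun J => (hu3 J).2 e) (fun s => ?_) (fun s x hx => ?_) J
    · refine ((hF s).2 e).sub hU hβ hβ1.le ?_
      refine CH.sum hU _ fun J _ => CH.sum hU _ fun i _ => CH.sum hU _ fun j _ => ?_
      exact (((ha s J i j).2 e).of_le hU hβ hβ1.le (Nat.le_succ _)).mul hU hβ hβ1.le (((hum J).2 j).2 i)
    · have hda : ∀ J i j, DifferentiableAt ℝ (a s J i j) x := fun J i j => (ha s J i j).1 x hx
      have hdu : ∀ J i j, DifferentiableAt ℝ (pd i (pd j (u J))) x := fun J i j => (((hu3 J).2 j).2 i).1 x hx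
      have h1 : pd e (F s) x = pd e (opX a u s) x :=
        (pd_congr_on hU (fun y hy => heq s y hy) x hx).symm
      have h2 : pd e (opX a u s) x = ∑ J, ∑ i, ∑ j, (pd e (a s J i j) x * pd i (pd j (u J)) x +
          a s J i j x * pd e (pd i (pd j (u J))) x) := by
        unfold opX
        rw [pd_sum fun J _ => DifferentiableAt.fun_sum fun i _ => DifferentiableAt.fun_sum fun j _ =>
          (hda J i j).fun_mul (hdu J i j)]
        refine Finset.sum_congr rfl fun J _ => ?_
        rw [pd_sum fun i _ => DifferentiableAt.fun_sum fun j _ => (hda J i j).fun_mul (hdu J i j)]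
        refine Finset.sum_congr rfl fun i _ => ?_
        rw [pd_sum fun j _ => (hda J i j).fun_mul (hdu J i j)]
        exact Finset.sum_congr rfl fun j _ => pd_mul (hda J i j) (hdu J i j)
      have h3 : ∀ J i j, pd e (pd i (pd j (u J))) x = pd i (pd j (pd e (u J))) x := by
        intro J i j
        have hxU := hU.mem_nhds hx
        rw [pd_comm (((hC3 J).pd hU (m := 2) le_rfl j).contDiffAt hxU) e i]
        refine pd_congr_on hU (fun y hy => ?_) x hx
        exact pd_comm (((hC3 J).of_le (by norm_num)).contDiffAt (hU.mem_nhds hy)) e j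
      simp only [h1, h2, Finset.sum_add_distrib, opX, h3]
      ring

/-- A quasilinear second-order system with polynomial coefficients whose lower-order part is
quadratic in the gradient. -/
structure QLSystem (n : ℕ) (ι σ : Type*) where
  A : σ → ι → Fin n → Fin n → MvPolynomial ι ℝ
  L : σ → MvPolynomial (ι ⊕ ι × Fin n) ℝ
  homog : ∀ s (c : ℝ) (u : ι → ℝ) (V : ι × Fin n → ℝ),
    MvPolynomial.eval (Sum.elim u fun p => c * V p) (L s) = c ^ 2 * MvPolynomial.eval (Sum.elim u V) (L s)

namespace QLSystem

variable (P : QLSystem n ι σ)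

/-- The coefficients evaluated at a value of the unknown. -/
def coeff (v : ι → ℝ) (s : σ) (J : ι) (i j : Fin n) : ℝ := MvPolynomial.eval v (P.A s J i j)

/-- The lower-order part along a map. -/
def low (u : ι → Pt n → ℝ) (s : σ) (x : Pt n) : ℝ :=
  MvPolynomial.eval (Sum.elim (fun J => u J x) fun p => pd p.2 (u p.1) x) (P.L s)

/-- The quasilinear operator. -/
def op (u : ι → Pt n → ℝ) (s : σ) (x : Pt n) : ℝ :=
  opX (fun s J i j x => P.coeff (fun K => u K x) s J i j) u s x + P.low u s x

omit [Fintype ι] [DecidableEq ι] [Fintype σ] in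
theorem CH_coeff (hU : IsOpen U) (hβ : 0 < β) (hβ1 : β ≤ 1) {m : ℕ} {u : ι → Pt n → ℝ}
    (hu : ∀ J, CH m β U (u J)) (s : σ) (J : ι) (i j : Fin n) :
    CH m β U fun x => P.coeff (fun K => u K x) s J i j :=
  CH.mvPolynomial hU hβ hβ1 hu _

omit [Fintype ι] [DecidableEq ι] [Fintype σ] in
theorem CH_low (hU : IsOpen U) (hβ : 0 < β) (hβ1 : β ≤ 1) {m : ℕ} {u : ι → Pt n → ℝ}
    (hu : ∀ J, CH (m + 1) β U (u J)) (s : σ) : CH m β U (P.low u s) := by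
  refine (CH.mvPolynomial hU hβ hβ1 (f := Sum.elim u fun p => pd p.2 (u p.1)) ?_ (P.L s)).congr hU ?_
  · rintro (J | p)
    · exact (hu J).of_le hU hβ hβ1 (Nat.le_succ _)
    · exact (hu p.1).2 p.2
  · intro x _
    unfold low
    congr 2
    ext (J | p) <;> rfl

/-- Elliptic regularity for quasilinear systems. -/
theorem regularity (hU : IsOpen U) (hα : 0 < α) (hα1 : α < 1) (hβ : 0 < β) (hβ1 : β < 1)
    {u : ι → Pt n → ℝ} (hu : ∀ J, CH 2 α U (u J)) (hell : ∀ x ∈ U, Elliptic (P.coeff fun K => u K x))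
    {m : ℕ} {f : σ → Pt n → ℝ} (hf : ∀ s, CH m β U (f s)) (heq : ∀ s, ∀ x ∈ U, P.op u s x = f s x) :
    ∀ J, CH (m + 2) β U (u J) := by
  have heq' : ∀ s, ∀ x ∈ U, opX (fun s J i j x => P.coeff (fun K => u K x) s J i j) u s x =
      f s x - P.low u s x := fun s x hx => by rw [← heq s x hx, op, add_sub_cancel_right]
  have h0 : ∀ J, CH 2 β U (u J) := by
    rcases le_total β α with h | h
    · exact fun J => (hu J).exponent_le hβ h
    · refine linear_zero hU hα (fun s J i j => P.CH_coeff hU hα hα1.le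
        (fun J => (hu J).of_le hU hα hα1.le one_le_two) s J i j) hell hα h hβ1 hu (fun s => ?_) heq'
      exact ((hf s).of_le hU hβ hβ1.le (Nat.zero_le m)).sub hU hβ hβ1.le
        ((P.CH_low hU hα hα1.le (m := 1) hu s).lower hU hα hβ1.le)
  have key : ∀ j ≤ m, ∀ J, CH (j + 2) β U (u J) := by
    intro j
    induction j with
    | zero => exact fun _ => h0
    | succ j ih =>
      intro hj
      have hj' := ih (by omega)
      refine linear_regularity hU hβ hβ1 hell (m := j + 1) (fun s J i k => P.CH_coeff hU hβ hβ1.le hj' s J i k)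
        h0 (fun s => ?_) heq'
      exact ((hf s).of_le hU hβ hβ1.le hj).sub hU hβ hβ1.le (P.CH_low hU hβ hβ1.le hj' s)
  exact key m le_rfl

end QLSystem

end QuasilinearRegularity

section SmallnessInHB

open MeasureTheory

variable {n : ℕ} {β : ℝ}

theorem HB.norm_le_of_lipschitz (hβ : 0 < β) (hβ1 : β < 1) {f : HB n β} {S : ℝ} (hS0 : 0 ≤ S)
    (hS : ∀ x, |f x| ≤ S) (hΛ : ∀ x y, |f x - f y| ≤ S * ‖x - y‖) : ‖f‖ ≤ 3 * S := by
  have h := HB.norm_ofLip_le hβ.le hβ1.le hS0 hS hΛ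
  have h2 : (2 * S) ^ (1 - β) * S ^ β ≤ 2 * S := by
    calc (2 * S) ^ (1 - β) * S ^ β ≤ (2 * S) ^ (1 - β) * (2 * S) ^ β := by
          gcongr; linarith
      _ = 2 * S := by
          rw [← Real.rpow_add_of_nonneg (by positivity) (by linarith) hβ.le]
          simp
  linarith

theorem innerInt_one_eq (K d : Pt n → ℝ) (x : Pt n) : innerInt K d 1 x = ∫ y, K (x - y) * d y := by
  unfold innerInt
  rw [← integral_sub_left_eq_self (fun y => K (x - y) * d y) volume x]
  simp

/-- Convolution operators composed with a multiplication by a function of small support are small. -/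
theorem exists_norm_conv_mul_le (hn : 0 < n) {K : Pt n → ℝ} (hK : IsTest K) (hβ : 0 < β) (hβ1 : β < 1)
    {T : HB n β →L[ℝ] HB n β} (hT : ∀ d x, T d x = innerInt K d 1 x) {ε : ℝ} (hε : 0 < ε) :
    ∃ ρ0 > 0, ∀ ρ, 0 < ρ → ρ ≤ ρ0 → ∀ ψ : HB n β, (∀ x, |ψ x| ≤ 1) → (∀ x, ρ < ‖x‖ → ψ x = 0) →
      ∀ d, ‖T (ψ * d)‖ ≤ ε * ‖d‖ := by
  obtain ⟨M, hM⟩ := hK.exists_bound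
  obtain ⟨Λ, hΛ0, hΛ⟩ := hK.exists_lip
  set R : ℝ := max M Λ
  have hR : 0 ≤ R := hΛ0.trans (le_max_right _ _)
  have hvol : Filter.Tendsto (fun ρ : ℝ => 3 * (R * (2 * (2 * ρ)) ^ n)) (nhds 0) (nhds 0) := by
    have : Continuous fun ρ : ℝ => 3 * (R * (2 * (2 * ρ)) ^ n) := by fun_prop
    have h := this.tendsto 0
    simpa [hn.ne'] using h
  obtain ⟨ρ0, hρ0, hρ⟩ := Metric.eventually_nhds_iff.1 (hvol.eventually (gt_mem_nhds hε))
  refine ⟨ρ0 / 2, by positivity, fun ρ hρp hρle ψ hψ1 hψ0 d => ?_⟩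
  have hV : volume.real (Metric.ball (0 : Pt n) (2 * ρ)) = (2 * (2 * ρ)) ^ n := by
    rw [Measure.real, Real.volume_pi_ball _ (by positivity), Fintype.card_fin,
      ENNReal.toReal_ofReal (by positivity)]
  have hbound : ∀ (k : Pt n → ℝ) (c : ℝ), 0 ≤ c → (∀ y, |k y| ≤ c) →
      |∫ y, k y * (ψ y * d y)| ≤ c * ‖d‖ * (2 * (2 * ρ)) ^ n := by
    intro k c hc hk
    have e : ∫ y, k y * (ψ y * d y) = ∫ y in Metric.ball (0 : Pt n) (2 * ρ), k y * (ψ y * d y) := by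
      refine (setIntegral_eq_integral_of_forall_compl_eq_zero fun y hy => ?_).symm
      rw [hψ0 y ?_, zero_mul, mul_zero]
      rw [mem_ball_zero_iff, not_lt] at hy
      linarith
    rw [e, ← hV, ← Real.norm_eq_abs]
    refine norm_setIntegral_le_of_norm_le_const measure_ball_lt_top fun y _ => ?_
    rw [norm_mul, norm_mul]
    calc ‖k y‖ * (‖ψ y‖ * ‖d y‖) ≤ c * (1 * ‖d‖) := by
          gcongr
          · exact hk y
          · exact hψ1 y
          · exact d.abs_le_norm y
      _ = c * ‖d‖ := by ring
  have hTe : ∀ x, T (ψ * d) x = ∫ y, K (x - y) * (ψ y * d y) := fun x => by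
    rw [hT, innerInt_one_eq]; rfl
  have hInt : ∀ x, Integrable fun y => K (x - y) * (ψ y * d y) := fun x =>
    integrable_of_cpt ((hK.continuous.comp (by fun_prop)).mul
      ((ψ.continuous hβ).mul (d.continuous hβ)))
      (HasCompactSupport.mul_left (HasCompactSupport.mul_right
        (HasCompactSupport.intro (isCompact_closedBall (0 : Pt n) ρ) fun y hy => hψ0 y (by
          simpa using hy))))
  have hfin := HB.norm_le_of_lipschitz hβ hβ1 (f := T (ψ * d)) (S := R * ‖d‖ * (2 * (2 * ρ)) ^ n)
    (by positivity) (fun x => ?_) (fun x x' => ?_)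
  · refine hfin.trans ?_
    have h1 : 3 * (R * (2 * (2 * ρ)) ^ n) < ε := hρ (by
      rw [dist_zero_right, Real.norm_eq_abs, abs_of_pos hρp]; linarith)
    nlinarith [norm_nonneg d]
  · rw [hTe]
    exact hbound _ _ hR fun y => (hM _).trans (le_max_left _ _)
  · rw [hTe, hTe, ← integral_sub (hInt x) (hInt x')]
    have e2 : ∀ y, K (x - y) * (ψ y * d y) - K (x' - y) * (ψ y * d y) =
      (K (x - y) - K (x' - y)) * (ψ y * d y) := fun y => by ring
    simp only [e2]
    refine (hbound _ (R * ‖x - x'‖) (by positivity) fun y => ?_).trans (le_of_eq (by ring))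
    refine (hΛ _ _).trans ?_
    rw [sub_sub_sub_cancel_right]
    gcongr
    exact le_max_right _ _

theorem pd_eq_fderiv_uncurry {E : Type*} [NormedAddCommGroup E] [NormedSpace ℝ E] {F : E × Pt n → ℝ}
    {p : E} {y : Pt n} (hF : DifferentiableAt ℝ F (p, y)) (i : Fin n) :
    pd i (fun y => F (p, y)) y = fderiv ℝ F (p, y) (0, Pi.single i 1) := by
  have h1 : HasFDerivAt (fun y : Pt n => (p, y)) (ContinuousLinearMap.inr ℝ E (Pt n)) y :=
    hasFDerivAt_prodMk_right p y
  have h2 := (hF.hasFDerivAt.comp y h1).fderiv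
  have h3 : (F ∘ fun y : Pt n => (p, y)) = fun y => F (p, y) := rfl
  rw [pd, ← h3, h2]
  rfl

/-- Smooth families of functions vanishing at the base parameter and outside of a compact set. -/
structure SmoothFamily {n : ℕ} {E : Type*} [NormedAddCommGroup E] [NormedSpace ℝ E]
    (F : E × Pt n → ℝ) : Prop where
  smooth : ContDiff ℝ (⊤ : ℕ∞) F
  zero : ∀ y, F (0, y) = 0
  cpt : ∃ K : Set (Pt n), IsCompact K ∧ ∀ p, ∀ y ∉ K, F (p, y) = 0

namespace SmoothFamily

variable {E : Type*} [NormedAddCommGroup E] [NormedSpace ℝ E] {F : E × Pt n → ℝ}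

theorem pd (hF : SmoothFamily F) (i : Fin n) :
    SmoothFamily fun q : E × Pt n => _root_.pd i (fun y => F (q.1, y)) q.2 := by
  refine ⟨?_, fun y => ?_, ?_⟩
  · have e : (fun q : E × Pt n => _root_.pd i (fun y => F (q.1, y)) q.2) =
        fun q => fderiv ℝ F q (0, Pi.single i 1) :=
      funext fun q => pd_eq_fderiv_uncurry (hF.smooth.differentiable (by simp) _) i
    rw [e]
    exact (hF.smooth.fderiv_right (by norm_cast)).clm_apply contDiff_const
  · have e : (fun y => F (0, y)) = fun _ => 0 := funext hF.zero
    simp only [e, pd_const]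
  · obtain ⟨K, hK, h⟩ := hF.cpt
    refine ⟨K, hK, fun p y hy => ?_⟩
    have := pd_congr_on hK.isClosed.isOpen_compl (a := i) (f := fun y => F (p, y)) (g := fun _ => 0)
      (fun y hy => h p y hy) y hy
    exact this.trans pd_const

theorem jet (hF : SmoothFamily F) (μ : Jet n) :
    SmoothFamily fun q : E × Pt n => _root_.jet μ (fun y => F (q.1, y)) q.2 := by
  rcases μ with _ | ⟨i, _ | j⟩
  · exact hF
  · exact hF.pd i
  · exact (hF.pd j).pd i

theorem exists_HB (hF : SmoothFamily F) (hβ : 0 < β) (hβ1 : β < 1) :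
    ∃ f : E → HB n β, (∀ p y, f p y = F (p, y)) ∧ Filter.Tendsto f (nhds 0) (nhds 0) := by
  obtain ⟨K, hK, hKF⟩ := hF.cpt
  have hsm : ∀ p, ContDiff ℝ (⊤ : ℕ∞) fun y => F (p, y) := fun p => hF.smooth.comp (by fun_prop)
  have htest : ∀ p, IsTest fun y => F (p, y) := fun p => ⟨hsm p, HasCompactSupport.intro hK (hKF p)⟩
  have hex : ∀ p, ∃ f : HB n β, ∀ y, f y = F (p, y) := by
    intro p
    obtain ⟨C, hC⟩ := (htest p).exists_bound
    obtain ⟨L, hL0, hL⟩ := (htest p).exists_lip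
    exact ⟨HB.ofLip hβ.le hβ1.le _ hL0 hC hL, fun y => rfl⟩
  choose f hf using hex
  refine ⟨f, hf, ?_⟩
  have hev : ∀ (G : E × Pt n → ℝ), SmoothFamily G → ∀ δ > 0, ∀ᶠ p in nhds (0 : E), ∀ y, |G (p, y)| ≤ δ := by
    intro G hG δ hδ
    obtain ⟨K', hK', hKG⟩ := hG.cpt
    have h1 := hK'.eventually_forall_of_forall_eventually (x₀ := (0 : E))
      (P := fun p y => |G (p, y)| < δ) fun y _ => by
        have : Continuous fun z : E × Pt n => |G (z.1, z.2)| := hG.smooth.continuous.abs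
        exact this.continuousAt.eventually_lt continuousAt_const (by simpa [hG.zero] using hδ)
    filter_upwards [h1] with p hp y
    by_cases hy : y ∈ K'
    · exact (hp y hy).le
    · rw [hKG p y hy, abs_zero]; exact hδ.le
  rw [Metric.tendsto_nhds]
  intro ε hε
  have hδ : 0 < ε / 6 / (n + 1) := by positivity
  have hall : ∀ᶠ p in nhds (0 : E), ∀ i y, |_root_.pd i (fun y => F (p, y)) y| ≤ ε / 6 / (n + 1) :=
    Filter.eventually_all.2 fun i => hev _ (hF.pd i) _ hδ
  filter_upwards [hev F hF (ε / 6) (by positivity), hall] with p h1 h2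
  rw [dist_zero_right]
  have hLip : ∀ x y, |F (p, x) - F (p, y)| ≤ ε / 6 * ‖x - y‖ := by
    intro x y
    have hb : ∀ z ∈ (univ : Set (Pt n)), ‖fderiv ℝ (fun y => F (p, y)) z‖ ≤ ε / 6 := fun z _ => by
      refine (norm_fderiv_le _ _).trans ((Finset.sum_le_card_nsmul _ _ _ fun i _ => h2 i z).trans ?_)
      rw [Finset.card_fin, nsmul_eq_mul, mul_div_assoc', div_le_iff₀ (by positivity)]
      nlinarith
    exact convex_univ.norm_image_sub_le_of_norm_fderiv_le
      (fun z _ => (hsm p).differentiable (by simp) z) hb (mem_univ y) (mem_univ x)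
  have := HB.norm_le_of_lipschitz hβ hβ1 (f := f p) (S := ε / 6) (by positivity)
    (fun x => by rw [hf]; exact h1 x) (fun x y => by rw [hf, hf]; exact hLip x y)
  linarith

end SmoothFamily

end SmallnessInHB

section AnalyticSetup

open scoped ContDiff

variable {n : ℕ} {β : ℝ} {ι σ : Type*}

theorem pd_comp_shift {v χ : Pt n → ℝ} (hv : Differentiable ℝ v) (hχ : Differentiable ℝ χ) (l : Pt n)
    (a : Fin n) (y : Pt n) : pd a (fun y => v (y + χ y • l)) y =
      pd a v (y + χ y • l) + ∑ i, l i * (pd a χ y * pd i v (y + χ y • l)) := by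
  have h1 : HasFDerivAt (fun y => y + χ y • l)
      (ContinuousLinearMap.id ℝ (Pt n) + (fderiv ℝ χ y).smulRight l) y :=
    (hasFDerivAt_id y).add ((hχ y).hasFDerivAt.smul_const l)
  have h2 := ((hv (y + χ y • l)).hasFDerivAt.comp y h1).fderiv
  have h3 : (v ∘ fun y => y + χ y • l) = fun y => v (y + χ y • l) := rfl
  rw [pd, ← h3, h2]
  simp only [ContinuousLinearMap.comp_apply, _root_.add_apply, ContinuousLinearMap.id_apply, map_add,
    ContinuousLinearMap.smulRight_apply, map_smul, smul_eq_mul]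
  rw [fderiv_apply_eq_sum_pd v _ l, Finset.mul_sum]
  simp only [pd]
  congr 1
  exact Finset.sum_congr rfl fun i _ => by ring

/-- The correction relating the jets of `v ∘ θ` to the jets of `v` along `θ`, where `θ y = y + χ y • l`,
as a function of the jets `χd` of `χ`. -/
def shiftRem {R : Type*} [CommRing R] [Algebra ℝ R] (χd : Jet n → R) (l : Pt n) (V : Jet n → R) : Jet n → R
  | none => 0
  | some (a, none) => ∑ i, l i • (χd (some (a, none)) * V (some (i, none)))
  | some (a, some c) => ∑ j, l j • (χd (some (a, none)) * V (some (j, some c))) +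
      ∑ i, l i • (χd (some (a, some c)) * V (some (i, none)) + χd (some (c, none)) *
        (V (some (a, some i)) + ∑ j, l j • (χd (some (a, none)) * V (some (j, some i)))))

theorem shiftRem_zero {R : Type*} [CommRing R] [Algebra ℝ R] (χd : Jet n → R) (V : Jet n → R) (μ : Jet n) :
    shiftRem χd 0 V μ = 0 := by
  rcases μ with _ | ⟨a, _ | c⟩ <;> simp [shiftRem]

theorem jet_comp_shift {v χ : Pt n → ℝ} (hv : ContDiff ℝ (⊤ : ℕ∞) v) (hχ : ContDiff ℝ (⊤ : ℕ∞) χ) (l : Pt n)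
    (μ : Jet n) (y : Pt n) : jet μ (fun y => v (y + χ y • l)) y = jet μ v (y + χ y • l) +
      shiftRem (fun ν => jet ν χ y) l (fun ν => jet ν v (y + χ y • l)) μ := by
  have hd : ∀ {w : Pt n → ℝ}, ContDiff ℝ (⊤ : ℕ∞) w → Differentiable ℝ w := fun h => h.differentiable (by simp)
  have hp : ∀ {w : Pt n → ℝ} (i : Fin n), ContDiff ℝ (⊤ : ℕ∞) w → ContDiff ℝ (⊤ : ℕ∞) (pd i w) :=
    fun i h => ContDiff.pd (by norm_cast) h i
  rcases μ with _ | ⟨a, _ | c⟩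
  · simp [jet, shiftRem]
  · simp only [jet, shiftRem, smul_eq_mul]
    exact pd_comp_shift (hd hv) (hd hχ) l a y
  · have h1 : pd c (fun y => v (y + χ y • l)) = fun y =>
        pd c v (y + χ y • l) + ∑ i, l i * (pd c χ y * pd i v (y + χ y • l)) :=
      funext fun y => pd_comp_shift (hd hv) (hd hχ) l c y
    have hθ : Differentiable ℝ fun y => y + χ y • l := by have := hd hχ; fun_prop
    have hc : ∀ i, Differentiable ℝ fun y => pd i v (y + χ y • l) := fun i => (hd (hp i hv)).comp hθ
    have hm : ∀ i, Differentiable ℝ fun y => pd c χ y * pd i v (y + χ y • l) := fun i =>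
      (hd (hp c hχ)).mul (hc i)
    simp only [jet, shiftRem, smul_eq_mul]
    rw [h1, pd_add (hc c y) (DifferentiableAt.fun_sum fun i _ => (hm i y).const_mul _),
      pd_comp_shift (hd (hp c hv)) (hd hχ), pd_sum fun i _ => (hm i y).const_mul _, add_assoc]
    congr 2
    refine Finset.sum_congr rfl fun i _ => ?_
    rw [pd_const_mul (hm i y), pd_mul (hd (hp c hχ) y) (hc i y), pd_comp_shift (hd (hp i hv)) (hd hχ)]

theorem shiftRem_map {R S : Type*} [CommRing R] [Algebra ℝ R] [CommRing S] [Algebra ℝ S] (f : R →ₐ[ℝ] S)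
    (χd : Jet n → R) (l : Pt n) (V : Jet n → R) (μ : Jet n) :
    f (shiftRem χd l V μ) = shiftRem (fun ν => f (χd ν)) l (fun ν => f (V ν)) μ := by
  rcases μ with _ | ⟨a, _ | c⟩ <;> simp [shiftRem]

theorem contDiff_aeval {E τ : Type*} [NormedAddCommGroup E] [NormedSpace ℝ E] {f : E → τ → HB n β}
    (hf : ∀ i, ContDiff ℝ ω fun z => f z i) (p : MvPolynomial τ ℝ) :
    ContDiff ℝ ω fun z => MvPolynomial.aeval (f z) p := by
  induction p using MvPolynomial.induction_on with
  | C c => simpa using contDiff_const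
  | add p q hp hq => simpa using hp.add hq
  | mul_X p i hp => simpa using hp.mul (hf i)

theorem contDiff_shiftRem {E : Type*} [NormedAddCommGroup E] [NormedSpace ℝ E] (χd : Jet n → HB n β)
    {l : E → Pt n} (hl : ContDiff ℝ ω l) {V : E → Jet n → HB n β} (hV : ∀ μ, ContDiff ℝ ω fun z => V z μ)
    (μ : Jet n) : ContDiff ℝ ω fun z => shiftRem χd (l z) (V z) μ := by
  have hl' : ∀ i, ContDiff ℝ ω fun z => l z i := fun i => contDiff_pi.1 hl i
  rcases μ with _ | ⟨a, _ | c⟩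
  · exact contDiff_const
  · exact ContDiff.sum fun i _ => (hl' i).smul (contDiff_const.mul (hV _))
  · refine ContDiff.add (ContDiff.sum fun i _ => (hl' i).smul (contDiff_const.mul (hV _)))
      (ContDiff.sum fun i _ => (hl' i).smul ((contDiff_const.mul (hV _)).add (contDiff_const.mul
        ((hV _).add (ContDiff.sum fun j _ => (hl' j).smul (contDiff_const.mul (hV _)))))))

variable [Fintype ι] [DecidableEq ι] [Fintype σ]

namespace QLSystem

variable (P : QLSystem n ι σ)

/-- The nonlinear part of the operator at `v0 + V`, where `V` is a family of jets. -/
def nonlin {R : Type*} [CommRing R] [Algebra ℝ R] (v0 : ι → ℝ) (V : ι × Jet n → R) (s : σ) : R :=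
  (∑ J, ∑ i, ∑ j, (MvPolynomial.aeval (fun K => algebraMap ℝ R (v0 K) + V (K, none)) (P.A s J i j) -
      algebraMap ℝ R (P.coeff v0 s J i j)) * V (J, some (i, some j))) +
    MvPolynomial.aeval (Sum.elim (fun K => algebraMap ℝ R (v0 K) + V (K, none))
      fun p => V (p.1, some (p.2, none))) (P.L s)

omit [DecidableEq ι] [Fintype σ] in
theorem nonlin_map {R S : Type*} [CommRing R] [Algebra ℝ R] [CommRing S] [Algebra ℝ S] (f : R →ₐ[ℝ] S)
    (v0 : ι → ℝ) (V : ι × Jet n → R) (s : σ) :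
    f (P.nonlin v0 V s) = P.nonlin v0 (fun t => f (V t)) s := by
  unfold nonlin
  have e : ∀ x, f (Sum.elim (fun K => algebraMap ℝ R (v0 K) + V (K, none))
      (fun p : ι × Fin n => V (p.1, some (p.2, none))) x) = Sum.elim (fun K => algebraMap ℝ S (v0 K) +
        f (V (K, none))) (fun p => f (V (p.1, some (p.2, none)))) x := by
    rintro (K | p) <;> simp
  simp only [map_add, map_sum, map_mul, map_sub, AlgHom.commutes, MvPolynomial.comp_aeval_apply, e]

omit [DecidableEq ι] [Fintype σ] in
theorem op_eq_nonlin {u : ι → Pt n → ℝ} (hu : ∀ J, Differentiable ℝ (u J)) (v0 : ι → ℝ) (s : σ) (x : Pt n) :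
    P.op (fun J y => v0 J + u J y) s x = opA (P.coeff v0) u s x +
      P.nonlin v0 (fun t => jet t.2 (u t.1) x) s := by
  have h1 : ∀ J i, pd i (fun y => v0 J + u J y) = pd i (u J) := fun J i => funext fun y => by
    rw [pd_add (differentiableAt_const _) (hu J y), pd_const, zero_add]
  have e1 : ∀ (f : ι → ℝ) (p : MvPolynomial ι ℝ), MvPolynomial.aeval f p = MvPolynomial.eval f p :=
    fun f p => rfl
  have e2 : ∀ (f : ι ⊕ ι × Fin n → ℝ) (p : MvPolynomial _ ℝ), MvPolynomial.aeval f p = MvPolynomial.eval f p :=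
    fun f p => rfl
  simp only [op, opX, low, opA, nonlin, h1, e1, e2, coeff, jet, sub_mul, Finset.sum_sub_distrib,
    Algebra.algebraMap_self, RingHom.id_apply]
  ring

omit [DecidableEq ι] [Fintype σ] in
theorem nonlin_zero (v0 : ι → ℝ) (s : σ) :
    P.nonlin v0 (fun _ => (0 : ℝ)) s = 0 := by
  have h := P.homog s 0 v0 0
  simp only [zero_mul, Pi.zero_apply, ne_eq, OfNat.ofNat_ne_zero, not_false_eq_true, zero_pow] at h
  simp only [nonlin, mul_zero, Finset.sum_const_zero, zero_add, add_zero]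
  exact h

omit [DecidableEq ι] [Fintype σ] in
theorem contDiff_nonlin {E : Type*} [NormedAddCommGroup E] [NormedSpace ℝ E] (v0 : ι → ℝ)
    {V : E → ι × Jet n → HB n β} (hV : ∀ t, ContDiff ℝ ω fun z => V z t) (s : σ) :
    ContDiff ℝ ω fun z => P.nonlin v0 (V z) s := by
  unfold nonlin
  refine ContDiff.add (ContDiff.sum fun J _ => ContDiff.sum fun i _ => ContDiff.sum fun j _ =>
    ContDiff.mul (ContDiff.sub (contDiff_aeval (fun K => contDiff_const.add (hV _)) _) contDiff_const) (hV _)) ?_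
  refine contDiff_aeval ?_ _
  rintro (K | p)
  · exact contDiff_const.add (hV _)
  · exact hV _

end QLSystem

end AnalyticSetup

section AnalyticImplicit

open scoped ContDiff

variable {n : ℕ} {β : ℝ} {ι σ : Type*} 

theorem hasFDerivAt_zero_of_superlinear {E F : Type*} [NormedAddCommGroup E] [NormedSpace ℝ E]
    [NormedAddCommGroup F] [NormedSpace ℝ F] {f : E → F} (hf : DifferentiableAt ℝ f 0)
    (h : ∀ v, ∃ g : ℝ → F, ContinuousAt g 0 ∧ g 0 = 0 ∧ ∀ c, f (c • v) = c • g c) :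
    HasFDerivAt f (0 : E →L[ℝ] F) 0 := by
  have key : fderiv ℝ f 0 = 0 := by
    ext v
    obtain ⟨g, hg, hg0, hfg⟩ := h v
    have hf0 : f 0 = 0 := by simpa using hfg 0
    have h1 : HasDerivAt (fun c : ℝ => c • v) v 0 := by
      simpa using (hasDerivAt_id (0 : ℝ)).smul_const v
    have h2 : HasDerivAt (fun c : ℝ => f (c • v)) (fderiv ℝ f 0 v) 0 := by
      have h3 : HasFDerivAt f (fderiv ℝ f 0) ((0 : ℝ) • v) := by rw [zero_smul]; exact hf.hasFDerivAt
      exact h3.comp_hasDerivAt 0 h1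
    have h4 : HasDerivAt (fun c : ℝ => f (c • v)) 0 0 := by
      rw [hasDerivAt_iff_tendsto_slope_zero]
      have h5 : Filter.Tendsto g (nhdsWithin 0 {0}ᶜ) (nhds 0) := by
        have := hg.tendsto
        rw [hg0] at this
        exact this.mono_left nhdsWithin_le_nhds
      refine h5.congr' ?_
      filter_upwards [self_mem_nhdsWithin] with c hc
      rw [zero_add, zero_smul, hf0, sub_zero, hfg, smul_smul, inv_mul_cancel₀ hc, one_smul]
    exact h2.unique h4
  rw [← key]
  exact hf.hasFDerivAt

variable [Fintype ι] [Fintype σ]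

namespace QLSystem

variable (P : QLSystem n ι σ)

omit [Fintype ι] [Fintype σ] in
theorem homog_HB (s : σ) (c : ℝ) (u : ι → HB n β) (V : ι × Fin n → HB n β) :
    MvPolynomial.aeval (Sum.elim u fun p => c • V p) (P.L s) =
      c ^ 2 • MvPolynomial.aeval (Sum.elim u V) (P.L s) := by
  ext x
  have e : ∀ (W : ι ⊕ ι × Fin n → HB n β), MvPolynomial.aeval W (P.L s) x =
      MvPolynomial.eval (Sum.elim (fun K => W (Sum.inl K) x) fun p => W (Sum.inr p) x) (P.L s) := by
    intro W
    rw [← HB.evalHom_apply, MvPolynomial.comp_aeval_apply]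
    change MvPolynomial.eval _ _ = _
    congr 2
    ext (K | p) <;> rfl
  rw [HB.smul_apply, e, e]
  exact P.homog s c _ _

omit [Fintype σ] in
theorem hasFDerivAt_nonlin (v0 : ι → ℝ) (s : σ) :
    HasFDerivAt (fun V : ι × Jet n → HB n β => P.nonlin v0 V s)
      (0 : (ι × Jet n → HB n β) →L[ℝ] HB n β) 0 := by
  have hsm := P.contDiff_nonlin (n := n) (β := β) v0 (V := fun V : ι × Jet n → HB n β => V)
    (fun t => contDiff_apply _ _ t) s
  refine hasFDerivAt_zero_of_superlinear ((hsm.differentiable (by simp)) 0) fun V => ?_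
  let a : ℝ → ι → HB n β := fun c K => algebraMap ℝ (HB n β) (v0 K) + c • V (K, none)
  have ha : ∀ K, ContDiff ℝ ω fun c => a c K := fun K =>
    contDiff_const.add (contDiff_id.smul contDiff_const)
  let g : ℝ → HB n β := fun c => (∑ J, ∑ i, ∑ j, (MvPolynomial.aeval (a c) (P.A s J i j) -
      algebraMap ℝ (HB n β) (P.coeff v0 s J i j)) * V (J, some (i, some j))) +
    c • MvPolynomial.aeval (Sum.elim (a c) fun p => V (p.1, some (p.2, none))) (P.L s)
  have hg : ContDiff ℝ ω g := by
    refine ContDiff.add (ContDiff.sum fun J _ => ContDiff.sum fun i _ => ContDiff.sum fun j _ =>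
      ((contDiff_aeval ha _).sub contDiff_const).mul contDiff_const) (contDiff_id.smul (contDiff_aeval ?_ _))
    rintro (K | p)
    · exact ha K
    · exact contDiff_const
  refine ⟨g, hg.continuous.continuousAt, ?_, fun c => ?_⟩
  · have h0 : a 0 = fun K => algebraMap ℝ (HB n β) (v0 K) := funext fun K => by simp [a]
    have h1 : ∀ p : MvPolynomial ι ℝ, MvPolynomial.aeval (fun K => algebraMap ℝ (HB n β) (v0 K)) p =
        algebraMap ℝ (HB n β) (MvPolynomial.eval v0 p) := fun p => MvPolynomial.aeval_algebraMap_apply _ v0 p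
    simp only [g, h0, h1, zero_smul, add_zero, coeff, sub_self, zero_mul, Finset.sum_const_zero]
  · simp only [nonlin, g, smul_add, Finset.smul_sum]
    congr 1
    · refine Finset.sum_congr rfl fun J _ => Finset.sum_congr rfl fun i _ => Finset.sum_congr rfl fun j _ => ?_
      rw [Pi.smul_apply, mul_smul_comm]
      rfl
    · rw [smul_smul, ← sq, ← P.homog_HB]
      rfl

omit [Fintype σ] in
theorem nonlin_HB_zero (v0 : ι → ℝ) (s : σ) : P.nonlin v0 (0 : ι × Jet n → HB n β) s = 0 := by
  ext x
  rw [← HB.evalHom_apply, nonlin_map]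
  simpa using P.nonlin_zero v0 s

/-- The difference of the frozen operator and the operator. -/
def defect (v0 : ι → ℝ) (χd : Jet n → HB n β) (l : Pt n) (b W : ι × Jet n → HB n β) (s : σ) : HB n β :=
  (∑ J, ∑ i, ∑ j, P.coeff v0 s J i j • shiftRem χd l (fun ν => b (J, ν) + W (J, ν)) (some (i, some j))) -
    (P.nonlin v0 (b + W) s - P.nonlin v0 b s)

/-- The equation satisfied by the increments of the jets. -/
def incr (v0 : ι → ℝ) (χd : Jet n → HB n β) (C : Jet n → HB n β →L[ℝ] HB n β)
    (T : ι × Jet n → σ → HB n β →L[ℝ] HB n β) (z : (Pt n × (ι × Jet n → HB n β)) × (ι × Jet n → HB n β))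
    (t : ι × Jet n) : HB n β :=
  z.2 t + shiftRem χd z.1.1 (fun ν => z.1.2 (t.1, ν) + z.2 (t.1, ν)) t.2 - C t.2 (z.2 (t.1, none)) -
    ∑ s, T t s (P.defect v0 χd z.1.1 z.1.2 z.2 s)

variable (v0 : ι → ℝ) (χd : Jet n → HB n β) (C : Jet n → HB n β →L[ℝ] HB n β)
    (T : ι × Jet n → σ → HB n β →L[ℝ] HB n β)

omit [Fintype σ] in
theorem contDiff_defect {E : Type*} [NormedAddCommGroup E] [NormedSpace ℝ E] {l : E → Pt n}
    {b W : E → ι × Jet n → HB n β} (hl : ContDiff ℝ ω l) (hb : ∀ t, ContDiff ℝ ω fun z => b z t)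
    (hW : ∀ t, ContDiff ℝ ω fun z => W z t) (s : σ) :
    ContDiff ℝ ω fun z => P.defect v0 χd (l z) (b z) (W z) s := by
  have h4 := fun J μ => contDiff_shiftRem χd hl (fun ν => (hb (J, ν)).add (hW (J, ν))) μ
  have h5 := P.contDiff_nonlin v0 (V := fun z => b z + W z) (fun t => (hb t).add (hW t)) s
  have h6 := P.contDiff_nonlin v0 hb s
  have h7 : ∀ J i j, ContDiff ℝ ω fun z => P.coeff v0 s J i j •
      shiftRem χd (l z) (fun ν => b z (J, ν) + W z (J, ν)) (some (i, some j)) :=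
    fun J i j => (h4 J (some (i, some j))).const_smul _
  have h8 : ContDiff ℝ ω fun z => ∑ J, ∑ i, ∑ j, P.coeff v0 s J i j •
      shiftRem χd (l z) (fun ν => b z (J, ν) + W z (J, ν)) (some (i, some j)) :=
    ContDiff.sum fun J _ => ContDiff.sum fun i _ => ContDiff.sum fun j _ => h7 J i j
  simp only [defect]
  exact h8.sub (h5.sub h6)

theorem contDiff_incr_comp {E : Type*} [NormedAddCommGroup E] [NormedSpace ℝ E] {l : E → Pt n}
    {b W : E → ι × Jet n → HB n β} (hl : ContDiff ℝ ω l) (hb : ∀ t, ContDiff ℝ ω fun z => b z t)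
    (hW : ∀ t, ContDiff ℝ ω fun z => W z t) (t : ι × Jet n) :
    ContDiff ℝ ω fun z => P.incr v0 χd C T ((l z, b z), W z) t := by
  have h4 := contDiff_shiftRem χd hl (fun ν => (hb (t.1, ν)).add (hW (t.1, ν))) t.2
  have h5 := fun s => P.contDiff_defect v0 χd hl hb hW s
  have h6 : ContDiff ℝ ω fun z => C t.2 (W z (t.1, none)) := (C t.2).contDiff.comp (hW _)
  have h7 : ContDiff ℝ ω fun z => ∑ s, T t s (P.defect v0 χd (l z) (b z) (W z) s) :=
    ContDiff.sum fun s _ => (T t s).contDiff.comp (h5 s)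
  exact (((hW t).add h4).sub h6).sub h7

theorem contDiff_incr : ContDiff ℝ ω (P.incr v0 χd C T) := by
  have h1 : ContDiff ℝ ω fun z : (Pt n × (ι × Jet n → HB n β)) × (ι × Jet n → HB n β) => z.1.1 :=
    contDiff_fst.fst
  have h2 : ContDiff ℝ ω fun z : (Pt n × (ι × Jet n → HB n β)) × (ι × Jet n → HB n β) => z.1.2 :=
    contDiff_fst.snd
  have h3 : ContDiff ℝ ω fun z : (Pt n × (ι × Jet n → HB n β)) × (ι × Jet n → HB n β) => z.2 :=
    contDiff_snd
  exact contDiff_pi.2 fun t =>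
    P.contDiff_incr_comp v0 χd C T h1 (contDiff_pi.1 h2) (contDiff_pi.1 h3) t

theorem incr_zero_left (W : ι × Jet n → HB n β) (t : ι × Jet n) :
    P.incr v0 χd C T (0, W) t = W t - C t.2 (W (t.1, none)) + ∑ s, T t s (P.nonlin v0 W s) := by
  have h1 : ∀ s, P.defect v0 χd 0 0 W s = - P.nonlin v0 W s := fun s => by
    unfold defect
    simp only [shiftRem_zero, smul_zero, Finset.sum_const_zero, zero_add, nonlin_HB_zero, sub_zero, zero_sub]
  simp only [incr, Prod.fst_zero, Prod.snd_zero, shiftRem_zero, h1, map_neg, Finset.sum_neg_distrib, add_zero,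
    sub_neg_eq_add]

/-- The linear part of the equation. -/
def convPart : (ι × Jet n → HB n β) →L[ℝ] (ι × Jet n → HB n β) :=
  ContinuousLinearMap.pi fun t => (C t.2).comp (ContinuousLinearMap.proj (t.1, none))

omit [Fintype σ] in
theorem norm_convPart_le (hC : ∀ μ d, ‖C μ d‖ ≤ 1 / 2 * ‖d‖) : ‖convPart (ι := ι) C‖ ≤ 1 / 2 := by
  refine ContinuousLinearMap.opNorm_le_bound _ (by norm_num) fun W => ?_
  refine (pi_norm_le_iff_of_nonneg (by positivity)).2 fun t => ?_
  exact (hC t.2 _).trans (by gcongr; exact norm_le_pi_norm W _)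

theorem hasFDerivAt_incr : HasFDerivAt (fun W => P.incr v0 χd C T (0, W)) (1 - convPart C) 0 := by
  have h1 : (fun W => P.incr v0 χd C T (0, W)) = fun W => ((1 - convPart C) W) +
      fun t => ∑ s, T t s (P.nonlin v0 W s) := by
    funext W t
    rw [incr_zero_left]
    rfl
  have h2 : HasFDerivAt (fun (W : ι × Jet n → HB n β) (t : ι × Jet n) => ∑ s, T t s (P.nonlin v0 W s))
      (0 : (ι × Jet n → HB n β) →L[ℝ] (ι × Jet n → HB n β)) 0 := by
    refine hasFDerivAt_pi'.2 fun t => ?_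
    have h3 := HasFDerivAt.fun_sum (u := Finset.univ) fun s _ =>
      (T t s).hasFDerivAt.comp (0 : ι × Jet n → HB n β) (P.hasFDerivAt_nonlin (β := β) v0 s)
    refine h3.congr_fderiv ?_
    ext
    simp
  rw [h1]
  refine ((1 - convPart C : (ι × Jet n → HB n β) →L[ℝ] (ι × Jet n → HB n β)).hasFDerivAt.add h2).congr_fderiv ?_
  rw [add_zero]

theorem exists_implicit (hC : ∀ μ d, ‖C μ d‖ ≤ 1 / 2 * ‖d‖) :
    ∃ Φ : Pt n × (ι × Jet n → HB n β) → (ι × Jet n → HB n β), AnalyticAt ℝ Φ 0 ∧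
      ∀ᶠ z in nhds (0 : (Pt n × (ι × Jet n → HB n β)) × (ι × Jet n → HB n β)),
        P.incr v0 χd C T z = 0 → z.2 = Φ z.1 := by
  have cdf : ContDiffAt ℝ ω (P.incr v0 χd C T) 0 := (P.contDiff_incr v0 χd C T).contDiffAt
  have hd : (fderiv ℝ (P.incr v0 χd C T) 0).comp (ContinuousLinearMap.inr ℝ _ _) = 1 - convPart C := by
    have h1 := (cdf.differentiableAt (by simp)).hasFDerivAt
    have h2 := HasFDerivAt.comp (g := P.incr v0 χd C T) (0 : ι × Jet n → HB n β) h1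
      (hasFDerivAt_prodMk_right (0 : Pt n × (ι × Jet n → HB n β)) (0 : ι × Jet n → HB n β))
    exact h2.unique (P.hasFDerivAt_incr v0 χd C T)
  have hlt : ‖convPart (ι := ι) C‖ < 1 := (norm_convPart_le C hC).trans_lt (by norm_num)
  have hu : IsUnit (1 - convPart (ι := ι) C) :=
    isUnit_one_sub_of_norm_lt_one (R := (ι × Jet n → HB n β) →L[ℝ] (ι × Jet n → HB n β)) hlt
  have hinv : ((fderiv ℝ (P.incr v0 χd C T) 0).comp (ContinuousLinearMap.inr ℝ _ _)).IsInvertible := by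
    rw [hd]
    obtain ⟨e, he⟩ := hu
    exact ⟨ContinuousLinearEquiv.unitsEquiv ℝ _ e, by rw [← he]; rfl⟩
  have h0 : P.incr v0 χd C T 0 = 0 := by
    funext t
    have := P.incr_zero_left v0 χd C T 0 t
    simp only [nonlin_HB_zero, Pi.zero_apply, map_zero, Finset.sum_const_zero, sub_zero, add_zero] at this
    exact this
  refine ⟨cdf.implicitFunction (by simp) hinv, (cdf.contDiffAt_implicitFunction (by simp) hinv).analyticAt, ?_⟩
  filter_upwards [cdf.eventually_apply_eq_iff_implicitFunction (by simp) hinv] with z hz hz0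
  exact (hz.1 (hz0.trans h0.symm)).symm

end QLSystem

end AnalyticImplicit

section AnalyticLocal

open scoped ContDiff

variable {n : ℕ} {β : ℝ} {ι σ : Type*}

theorem IsTest.jet {v : Pt n → ℝ} (hv : IsTest v) (μ : Jet n) : IsTest (_root_.jet μ v) := by
  rcases μ with _ | ⟨i, _ | j⟩
  · exact hv
  · exact hv.pd i
  · exact (hv.pd j).pd i

theorem jet_sub {f g : Pt n → ℝ} (hf : ContDiff ℝ (⊤ : ℕ∞) f) (hg : ContDiff ℝ (⊤ : ℕ∞) g) (μ : Jet n)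
    (y : Pt n) : jet μ (fun x => f x - g x) y = jet μ f y - jet μ g y := by
  have hd : ∀ {w : Pt n → ℝ}, ContDiff ℝ (⊤ : ℕ∞) w → Differentiable ℝ w := fun h => h.differentiable (by simp)
  have hp : ∀ {w : Pt n → ℝ} (i : Fin n), ContDiff ℝ (⊤ : ℕ∞) w → ContDiff ℝ (⊤ : ℕ∞) (pd i w) :=
    fun i h => ContDiff.pd (by norm_cast) h i
  have e : ∀ i, pd i (fun x => f x - g x) = fun x => pd i f x - pd i g x :=
    fun i => funext fun x => pd_sub (hd hf x) (hd hg x)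
  rcases μ with _ | ⟨i, _ | j⟩
  · rfl
  · exact congrFun (e i) y
  · simp only [jet, e]
    exact pd_sub (hd (hp j hf) y) (hd (hp j hg) y)

theorem IsTest.exists_HB {v : Pt n → ℝ} (hv : IsTest v) (hβ : 0 < β) (hβ1 : β < 1) :
    ∃ f : HB n β, ∀ y, f y = v y := by
  have hF : SmoothFamily fun q : ℝ × Pt n => q.1 * v q.2 :=
    ⟨contDiff_fst.mul (hv.1.comp contDiff_snd), fun y => by simp, tsupport v, hv.2, fun p y hy => by
      simp [image_eq_zero_of_notMem_tsupport hy]⟩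
  obtain ⟨f, hf, -⟩ := hF.exists_HB hβ hβ1
  exact ⟨f 1, fun y => by simp [hf]⟩

theorem smoothFamily_shift {v χ : Pt n → ℝ} (hv : IsTest v) (hχ : IsTest χ) :
    SmoothFamily fun q : Pt n × Pt n => v (q.2 + χ q.2 • q.1) - v q.2 := by
  have h1 := hv.1
  have h2 := hχ.1
  refine ⟨by fun_prop, fun y => by simp, tsupport χ, hχ.2, fun p y hy => ?_⟩
  simp [image_eq_zero_of_notMem_tsupport hy]

variable [Fintype ι]

theorem opA_eq_zero_of_eventually {A : σ → ι → Fin n → Fin n → ℝ} {v : ι → Pt n → ℝ} {U : Set (Pt n)}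
    (hU : IsOpen U) (h : ∀ J, ∀ x ∈ U, v J x = 0) (s : σ) {x : Pt n} (hx : x ∈ U) : opA A v s x = 0 := by
  have h1 : ∀ J j, ∀ x ∈ U, pd j (v J) x = 0 := fun J j x hx => by
    rw [pd_congr_on hU (g := fun _ => 0) (h J) x hx, pd_const]
  have h2 : ∀ J i j, pd i (pd j (v J)) x = 0 := fun J i j => by
    rw [pd_congr_on hU (g := fun _ => 0) (h1 J j) x hx, pd_const]
  simp [opA, h2]

variable [Fintype σ]

namespace QLSystem

variable (P : QLSystem n ι σ)

omit [Fintype σ] in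
theorem defect_apply {u : ι → Pt n → ℝ} (hu : ∀ J, IsTest (u J)) {χ : Pt n → ℝ} (hχ : IsTest χ)
    (v0 : ι → ℝ) {χd : Jet n → HB n β} (hχd : ∀ ν y, χd ν y = jet ν χ y) (l : Pt n)
    {b W : ι × Jet n → HB n β} (hb : ∀ t y, b t y = jet t.2 (u t.1) y)
    (hW : ∀ t y, W t y = jet t.2 (u t.1) (y + χ y • l) - jet t.2 (u t.1) y) (s : σ) {y : Pt n}
    (h1 : P.op (fun J y => v0 J + u J y) s y = 0)
    (h2 : P.op (fun J y => v0 J + u J y) s (y + χ y • l) = 0) :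
    P.defect v0 χd l b W s y = opA (P.coeff v0) (fun J y => u J (y + χ y • l) - u J y) s y := by
  rw [P.op_eq_nonlin fun J => (hu J).differentiable] at h1 h2
  have hbW : ∀ t, b t y + W t y = jet t.2 (u t.1) (y + χ y • l) := fun t => by rw [hb, hW]; ring
  have hS : ∀ J μ, shiftRem χd l (fun ν => b (J, ν) + W (J, ν)) μ y =
      shiftRem (fun ν => jet ν χ y) l (fun ν => jet ν (u J) (y + χ y • l)) μ := fun J μ => by
    rw [← HB.evalHom_apply, shiftRem_map]
    simp only [map_add, HB.evalHom_apply, hbW, hχd]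
  have e1 : P.defect v0 χd l b W s y = (∑ J, ∑ i, ∑ j, P.coeff v0 s J i j *
      shiftRem (fun ν => jet ν χ y) l (fun ν => jet ν (u J) (y + χ y • l)) (some (i, some j))) -
      (P.nonlin v0 (fun t => jet t.2 (u t.1) (y + χ y • l)) s - P.nonlin v0 (fun t => jet t.2 (u t.1) y) s) := by
    rw [← HB.evalHom_apply]
    have hbW' : ∀ t : ι × Jet n, jet t.2 (u t.1) y + W t y = jet t.2 (u t.1) (y + χ y • l) := fun t => by
      rw [hW]; ring
    simp only [defect, map_sub, map_sum, map_smul, nonlin_map, smul_eq_mul, Pi.add_apply, map_add,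
      HB.evalHom_apply, hS, hb, hbW']
  have e2 : ∀ J i j, pd i (pd j fun y => u J (y + χ y • l) - u J y) y =
      pd i (pd j (u J)) (y + χ y • l) - pd i (pd j (u J)) y +
      shiftRem (fun ν => jet ν χ y) l (fun ν => jet ν (u J) (y + χ y • l)) (some (i, some j)) := fun J i j => by
    have h3 := jet_sub (f := fun y => u J (y + χ y • l)) (g := u J)
      ((hu J).1.comp (contDiff_id.add (hχ.1.smul contDiff_const))) (hu J).1 (some (i, some j)) y
    rw [jet_comp_shift (hu J).1 hχ.1] at h3
    refine h3.trans ?_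
    simp only [jet]
    ring
  have e3 : opA (P.coeff v0) (fun J y => u J (y + χ y • l) - u J y) s y = opA (P.coeff v0) u s (y + χ y • l) -
      opA (P.coeff v0) u s y + ∑ J, ∑ i, ∑ j, P.coeff v0 s J i j *
      shiftRem (fun ν => jet ν χ y) l (fun ν => jet ν (u J) (y + χ y • l)) (some (i, some j)) := by
    simp only [opA, e2, mul_add, mul_sub, Finset.sum_add_distrib, Finset.sum_sub_distrib]
  rw [e1, e3]
  linarith

theorem incr_eq_zero {u : ι → Pt n → ℝ} (hu : ∀ J, IsTest (u J)) {χ : Pt n → ℝ} (hχ : IsTest χ)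
    (v0 : ι → ℝ) {χd : Jet n → HB n β} (hχd : ∀ ν y, χd ν y = jet ν χ y) (l : Pt n)
    {b W : ι × Jet n → HB n β} (hb : ∀ t y, b t y = jet t.2 (u t.1) y)
    (hW : ∀ t y, W t y = jet t.2 (u t.1) (y + χ y • l) - jet t.2 (u t.1) y)
    {φ : Jet n → Pt n → ℝ} {κ : ι → σ → Jet n → Pt n → ℝ} 
    (hrep : ∀ v : ι → Pt n → ℝ, (∀ J, ContDiff ℝ 2 (v J)) →
        (∀ J, HasCompactSupport (v J)) → ∀ d : σ → HB n β, (∀ s x, d s x = opA (P.coeff v0) v s x) →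
        ∀ I μ x, jet μ (v I) x = innerInt (φ μ) (v I) 1 x +
          ∑ s, singInt (κ I s μ) (wt (jord μ)) (d s) x)
    {C : Jet n → HB n β →L[ℝ] HB n β} {T : ι × Jet n → σ → HB n β →L[ℝ] HB n β} {ψ : HB n β}
    (hψ : ∀ y, ψ y * χ y = χ y)
    (hC : ∀ μ d y, C μ d y = innerInt (φ μ) (ψ * d : HB n β) 1 y)
    (hT : ∀ t s d y, T t s d y = singInt (κ t.1 s t.2) (wt (jord t.2)) (ψ * d : HB n β) y)
    (hdef : ∀ s y, ψ y * P.defect v0 χd l b W s y =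
      opA (P.coeff v0) (fun J y => u J (y + χ y • l) - u J y) s y) :
    P.incr v0 χd C T ((l, b), W) = 0 := by
  have hsm : ∀ J, ContDiff ℝ (⊤ : ℕ∞) fun y => u J (y + χ y • l) := fun J =>
    (hu J).1.comp (contDiff_id.add (hχ.1.smul contDiff_const))
  have hw0 : ∀ J, ∀ y, y ∉ tsupport χ → u J (y + χ y • l) - u J y = 0 := fun J y hy => by
    simp [image_eq_zero_of_notMem_tsupport hy]
  have hψW : ∀ J, ⇑(ψ * W (J, none)) = fun y => u J (y + χ y • l) - u J y := fun J => by
    funext y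
    rw [HB.mul_apply, hW]
    simp only [jet]
    by_cases hy : χ y = 0
    · simp [hy]
    · have : ψ y = 1 := mul_right_cancel₀ hy ((hψ y).trans (one_mul _).symm)
      rw [this, one_mul]
  have hr := hrep (fun J y => u J (y + χ y • l) - u J y)
    (fun J => ((hsm J).sub (hu J).1).of_le (by norm_cast))
    (fun J => HasCompactSupport.intro hχ.2 (hw0 J)) (fun s => ψ * P.defect v0 χd l b W s)
    (fun s y => by rw [HB.mul_apply]; exact hdef s y)
  funext t
  ext y
  have h3 := hr t.1 t.2 y
  rw [jet_sub (hsm _) (hu _).1, jet_comp_shift (hu _).1 hχ.1] at h3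
  have hS : shiftRem χd l (fun ν => b (t.1, ν) + W (t.1, ν)) t.2 y =
      shiftRem (fun ν => jet ν χ y) l (fun ν => jet ν (u t.1) (y + χ y • l)) t.2 := by
    have hbW : ∀ t, b t y + W t y = jet t.2 (u t.1) (y + χ y • l) := fun t => by rw [hb, hW]; ring
    rw [← HB.evalHom_apply, shiftRem_map]
    simp only [map_add, HB.evalHom_apply, hbW, hχd]
  have e : P.incr v0 χd C T ((l, b), W) t y = W t y + shiftRem χd l (fun ν => b (t.1, ν) + W (t.1, ν)) t.2 y -
      C t.2 (W (t.1, none)) y - ∑ s, T t s (P.defect v0 χd l b W s) y := by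
    rw [← HB.evalHom_apply]
    simp only [incr, map_sub, map_add, map_sum, HB.evalHom_apply]
  rw [e, hS, hC, hψW, hW]
  simp only [hT]
  change _ = (0 : ℝ)
  linarith

end QLSystem

end AnalyticLocal

section AnalyticLocalExistence

open scoped ContDiff

variable {n : ℕ} {ι σ : Type*} [Fintype ι] [Fintype σ]

theorem exists_uniform_conv (hn : 0 < n) {φ : Jet n → Pt n → ℝ} (hφ : ∀ μ, IsTest (φ μ)) {β : ℝ} (hβ : 0 < β)
    (hβ1 : β < 1) :
    ∃ C0 : Jet n → HB n β →L[ℝ] HB n β, (∀ μ d x, C0 μ d x = innerInt (φ μ) d 1 x) ∧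
      ∃ ρ > 0, ∀ ψ : HB n β, (∀ x, |ψ x| ≤ 1) → (∀ x, ρ < ‖x‖ → ψ x = 0) →
        ∀ μ d, ‖C0 μ (ψ * d)‖ ≤ 1 / 2 * ‖d‖ := by
  choose C0 hC0 using fun μ => exists_convOp (hφ μ) hβ
  choose ρ0 hρ0 hρ using fun μ => exists_norm_conv_mul_le hn (hφ μ) hβ hβ1 (hC0 μ) (one_half_pos (α := ℝ))
  obtain ⟨μ0, hμ0⟩ := Finite.exists_min ρ0
  exact ⟨C0, hC0, ρ0 μ0, hρ0 μ0, fun ψ h1 h2 μ d => hρ μ _ (hρ0 μ0) (hμ0 μ) ψ h1 h2 d⟩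

theorem HB.analyticAt_apply {β : ℝ} {E : Type*} [NormedAddCommGroup E] [NormedSpace ℝ E] {f : E → HB n β} {p : E}
    (hf : AnalyticAt ℝ f p) (x : Pt n) : AnalyticAt ℝ (fun q => f q x) p := by
  let ev : HB n β →L[ℝ] ℝ := (evalHom x).toLinearMap.mkContinuous 1 fun f => by
    rw [one_mul]; exact HB.abs_le_norm f x
  exact (ev.analyticAt _).comp hf

namespace QLSystem

variable (P : QLSystem n ι σ)

theorem exists_analytic (hn : 0 < n) [DecidableEq ι] (v0 : ι → ℝ) (hell : Elliptic (P.coeff v0)) :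
    ∃ ρ > 0, ∃ η > 0, ∀ u : ι → Pt n → ℝ, (∀ J, IsTest (u J)) → ∀ b : ι × Jet n → HB n (1 / 2), ‖b‖ < η →
      (∀ t x, b t x = jet t.2 (u t.1) x) →
      (∀ s, ∀ x ∈ Metric.ball (0 : Pt n) ρ, P.op (fun J y => v0 J + u J y) s x = 0) →
      ∀ J, AnalyticAt ℝ (u J) 0 := by
  have hβ : (0 : ℝ) < 1 / 2 := by norm_num
  have hβ1 : (1 / 2 : ℝ) < 1 := by norm_num
  obtain ⟨φ, κ, hφ, hκ, hκ0, hrep⟩ := exists_parametrix hell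
  obtain ⟨C0, hC0, ρ, hρ, hCρ⟩ := exists_uniform_conv hn hφ hβ hβ1
  choose T0 hT0 using fun (t : ι × Jet n) (s : σ) =>
    exists_singOp (hκ t.1 s t.2) (hκ0 t.1 s t.2) hβ hβ1 (wt_isWeight (jord_le t.2))
  obtain ⟨_, _, hcut⟩ := exists_cutoff n
  obtain ⟨ψ', hψt, hψ1, hψs, hψb, -⟩ := hcut 0 (ρ / 4) (by positivity)
  obtain ⟨χ, hχt, hχ1, hχs, hχb, -⟩ := hcut 0 (ρ / 16) (by positivity)
  obtain ⟨ψ, hψ⟩ := hψt.exists_HB hβ hβ1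
  choose χd hχd using fun ν => (hχt.jet ν).exists_HB hβ hβ1
  have hψz : ∀ x, ρ / 2 < ‖x‖ → ψ x = 0 := fun x hx => by
    rw [hψ]
    refine image_eq_zero_of_notMem_tsupport fun h => ?_
    have := mem_closedBall_zero_iff.1 (hψs h)
    linarith
  have hχz : ∀ x, x ∈ tsupport χ → ‖x‖ ≤ ρ / 8 := fun x h => by
    have := mem_closedBall_zero_iff.1 (hχs h)
    linarith
  have hψone : ∀ x, ‖x‖ < ρ / 4 → ψ x = 1 := fun x h => by
    rw [hψ]; exact hψ1 x (mem_ball_zero_iff.2 h)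
  let m : HB n (1 / 2) →L[ℝ] HB n (1 / 2) := ContinuousLinearMap.mul ℝ (HB n (1 / 2)) ψ
  let C : Jet n → HB n (1 / 2) →L[ℝ] HB n (1 / 2) := fun μ => (C0 μ).comp m
  let T : ι × Jet n → σ → HB n (1 / 2) →L[ℝ] HB n (1 / 2) := fun t s => (T0 t s).comp m
  have hC : ∀ μ d, ‖C μ d‖ ≤ 1 / 2 * ‖d‖ := fun μ d =>
    hCρ ψ (fun x => by rw [hψ]; exact hψb x) (fun x hx => hψz x (by linarith)) μ d
  obtain ⟨Φ, hΦ, himp⟩ := P.exists_implicit v0 χd C T hC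
  obtain ⟨δ1, hδ1, hΦ1⟩ := Metric.eventually_nhds_iff_ball.1 hΦ.eventually_analyticAt
  obtain ⟨δ2, hδ2, himp2⟩ := Metric.eventually_nhds_iff_ball.1 himp
  refine ⟨ρ, hρ, min δ1 δ2, lt_min hδ1 hδ2, fun u hu b hbη hb hop J => ?_⟩
  choose f hf hf0 using fun t : ι × Jet n => (smoothFamily_shift ((hu t.1).jet t.2) hχt).exists_HB hβ hβ1
  let W : Pt n → ι × Jet n → HB n (1 / 2) := fun l t => f t l
  have hW0 : Filter.Tendsto W (nhds 0) (nhds 0) := tendsto_pi_nhds.2 hf0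
  have hψχ : ∀ y, ψ y * χ y = χ y := fun y => by
    by_cases hy : y ∈ tsupport χ
    · rw [hψone y ((hχz y hy).trans_lt (by linarith)), one_mul]
    · rw [image_eq_zero_of_notMem_tsupport hy, mul_zero]
  have hinc : ∀ l : Pt n, ‖l‖ < ρ / 2 → P.incr v0 χd C T ((l, b), W l) = 0 := by
    intro l hl
    refine P.incr_eq_zero hu hχt v0 hχd l hb (fun t y => hf t l y) (hrep _ hβ) hψχ (fun μ d y => hC0 _ _ _)
      (fun t s d y => hT0 _ _ _ _) fun s y => ?_
    by_cases hy : ‖y‖ ≤ ρ / 2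
    · have hy1 : y ∈ Metric.ball (0 : Pt n) ρ := mem_ball_zero_iff.2 (by linarith)
      have hy2 : y + χ y • l ∈ Metric.ball (0 : Pt n) ρ := by
        refine mem_ball_zero_iff.2 ((norm_add_le _ _).trans_lt ?_)
        have : ‖χ y • l‖ ≤ 1 * ‖l‖ := by
          rw [norm_smul]
          exact mul_le_mul_of_nonneg_right (hχb y) (norm_nonneg _)
        linarith
      rw [P.defect_apply hu hχt v0 hχd l hb (fun t y => hf t l y) s (hop s y hy1) (hop s _ hy2)]
      by_cases hyt : y ∈ tsupport χ
      · rw [hψone y ((hχz y hyt).trans_lt (by linarith)), one_mul]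
      · rw [opA_eq_zero_of_eventually (isClosed_tsupport χ).isOpen_compl (fun J x hx => by
          simp [image_eq_zero_of_notMem_tsupport hx]) s hyt, mul_zero]
    · push Not at hy
      have hyt : y ∉ tsupport χ := fun h => by have := hχz y h; linarith
      rw [opA_eq_zero_of_eventually (isClosed_tsupport χ).isOpen_compl (fun J x hx => by
          simp [image_eq_zero_of_notMem_tsupport hx]) s hyt, hψz y hy, zero_mul]
  have hWΦ : ∀ᶠ l in nhds (0 : Pt n), W l = Φ (l, b) := by
    have e1 : ∀ᶠ l in nhds (0 : Pt n), ‖W l‖ < δ2 := by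
      have := (hW0.norm).eventually_lt_const (u := δ2) (by rwa [norm_zero])
      exact this
    have e2 : ∀ᶠ l in nhds (0 : Pt n), ‖l‖ < min δ2 (ρ / 2) := by
      filter_upwards [Metric.ball_mem_nhds (0 : Pt n) (show 0 < min δ2 (ρ / 2) by positivity)] with l hl
      exact mem_ball_zero_iff.1 hl
    filter_upwards [e1, e2] with l h1 h2
    have h3 := lt_min_iff.1 h2
    refine himp2 ((l, b), W l) (mem_ball_zero_iff.2 ?_) (hinc l h3.2)
    exact max_lt (max_lt h3.1 (hbη.trans_le (min_le_right _ _))) h1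
  have hΦb : AnalyticAt ℝ Φ (0, b) := hΦ1 _ (mem_ball_zero_iff.2 (max_lt (by rwa [norm_zero])
    (hbη.trans_le (min_le_left _ _))))
  have hcomp : AnalyticAt ℝ (fun l : Pt n => Φ (l, b)) 0 :=
    AnalyticAt.fun_comp (f := fun l : Pt n => (l, b)) hΦb (analyticAt_id.prod analyticAt_const)
  have hcoord : AnalyticAt ℝ (fun l : Pt n => Φ (l, b) (J, none)) 0 :=
    ((ContinuousLinearMap.proj (R := ℝ) (φ := fun _ : ι × Jet n => HB n (1 / 2)) (J, none)).analyticAt _).comp hcomp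
  have hev := HB.analyticAt_apply hcoord 0
  have hfin : AnalyticAt ℝ (fun l : Pt n => u J 0 + Φ (l, b) (J, none) 0) 0 := analyticAt_const.add hev
  refine hfin.congr ?_
  filter_upwards [hWΦ] with l hl
  rw [← hl]
  change u J 0 + f (J, none) l 0 = _
  rw [hf, hχ1 0 (Metric.mem_ball_self (by positivity))]
  simp [jet]

end QLSystem

end AnalyticLocalExistence

section AnalyticRegularity

open scoped ContDiff

variable {n : ℕ} {ι σ : Type*} [Fintype ι]

theorem pd_comp_affine {f : Pt n → ℝ} (hf : Differentiable ℝ f) (x0 : Pt n) (ε : ℝ) (i : Fin n) (y : Pt n) :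
    pd i (fun y => f (x0 + ε • y)) y = ε * pd i f (x0 + ε • y) := by
  have h1 : HasFDerivAt (fun y : Pt n => x0 + ε • y) (ε • ContinuousLinearMap.id ℝ (Pt n)) y :=
    ((hasFDerivAt_id y).const_smul ε).const_add x0
  have h2 := ((hf (x0 + ε • y)).hasFDerivAt.comp y h1).fderiv
  rw [Function.comp_def] at h2
  rw [pd, h2]
  simp [pd]

theorem HasCompactSupport.isTest_of_contDiffOn {f : Pt n → ℝ} {U : Set (Pt n)} (hU : IsOpen U)
    (hf : ContDiffOn ℝ (⊤ : ℕ∞) f U) (hc : HasCompactSupport f) (hs : tsupport f ⊆ U) : IsTest f :=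
  ⟨contDiff_iff_contDiffAt.2 fun x => by
    by_cases hx : x ∈ tsupport f
    · exact hf.contDiffAt (hU.mem_nhds (hs hx))
    · exact (contDiffAt_const (c := (0 : ℝ))).congr_of_eventuallyEq (notMem_tsupport_iff_eventuallyEq.1 hx), hc⟩

namespace QLSystem

variable (P : QLSystem n ι σ)

theorem op_congr_on {U : Set (Pt n)} (hU : IsOpen U) {u v : ι → Pt n → ℝ} (h : ∀ J, ∀ x ∈ U, u J x = v J x)
    (s : σ) {x : Pt n} (hx : x ∈ U) : P.op u s x = P.op v s x := by
  have h1 : ∀ J j, ∀ x ∈ U, pd j (u J) x = pd j (v J) x := fun J j => pd_congr_on hU (h J)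
  have h2 : ∀ J i j, pd i (pd j (u J)) x = pd i (pd j (v J)) x := fun J i j => pd_congr_on hU (h1 J j) x hx
  simp only [op, opX, low, h1 _ _ x hx, h2, h _ x hx]

theorem op_comp_affine {u : ι → Pt n → ℝ} (hu : ∀ J, ContDiff ℝ (⊤ : ℕ∞) (u J)) (x0 : Pt n) (ε : ℝ) (s : σ)
    (y : Pt n) : P.op (fun J y => u J (x0 + ε • y)) s y = ε ^ 2 * P.op u s (x0 + ε • y) := by
  have hd : ∀ {w : Pt n → ℝ}, ContDiff ℝ (⊤ : ℕ∞) w → Differentiable ℝ w := fun h => h.differentiable (by simp)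
  have hp : ∀ J i, ContDiff ℝ (⊤ : ℕ∞) (pd i (u J)) := fun J i => ContDiff.pd (by norm_cast) (hu J) i
  have h1 : ∀ J j, pd j (fun y => u J (x0 + ε • y)) = fun y => ε * pd j (u J) (x0 + ε • y) := fun J j =>
    funext fun y => pd_comp_affine (hd (hu J)) x0 ε j y
  have h2 : ∀ J i j, pd i (fun y => ε * pd j (u J) (x0 + ε • y)) y = ε * (ε * pd i (pd j (u J)) (x0 + ε • y)) :=
    fun J i j => by
      have hd' : DifferentiableAt ℝ (fun y => pd j (u J) (x0 + ε • y)) y :=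
        (hd (hp J j)).comp (by fun_prop : Differentiable ℝ fun y : Pt n => x0 + ε • y) y
      rw [pd_const_mul hd', pd_comp_affine (hd (hp J j))]
  have h3 := P.homog s ε (fun J => u J (x0 + ε • y)) (fun p => pd p.2 (u p.1) (x0 + ε • y))
  simp only [op, opX, low, h1, h2]
  rw [mul_add]
  refine congrArg₂ (· + ·) ?_ h3
  simp only [Finset.mul_sum]
  refine Finset.sum_congr rfl fun J _ => Finset.sum_congr rfl fun i _ => Finset.sum_congr rfl fun j _ => ?_
  ring

/-- Analyticity of smooth solutions of quasilinear overdetermined elliptic systems. -/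
theorem analytic [Fintype σ] [DecidableEq ι] (hn : 0 < n) {U : Set (Pt n)} (hU : IsOpen U) {u : ι → Pt n → ℝ}
    (hu : ∀ J, ContDiffOn ℝ (⊤ : ℕ∞) (u J) U) (hell : ∀ x ∈ U, Elliptic (P.coeff fun K => u K x))
    (heq : ∀ s, ∀ x ∈ U, P.op u s x = 0) (J : ι) : AnalyticOnNhd ℝ (u J) U := by
  intro x0 hx0
  have hβ : (0 : ℝ) < 1 / 2 := by norm_num
  have hβ1 : (1 / 2 : ℝ) < 1 := by norm_num
  set v0 : ι → ℝ := fun K => u K x0 with hv0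
  obtain ⟨ρ, hρ, η, hη, hloc⟩ := P.exists_analytic hn v0 (hell x0 hx0)
  obtain ⟨R, hR, hRU⟩ := Metric.isOpen_iff.1 hU x0 hx0
  obtain ⟨_, _, hcut⟩ := exists_cutoff n
  obtain ⟨χ1, hTa, hχ1, hSa, -⟩ := hcut x0 (R / 4) (by positivity)
  obtain ⟨χ2, hTb, hχ2, -⟩ := hcut 0 ρ hρ
  have hsU : tsupport χ1 ⊆ U := fun x hx => hRU (by
    have := Metric.mem_closedBall.1 (hSa hx)
    exact Metric.mem_ball.2 (by linarith))
  let w : ι → Pt n → ℝ := fun J x => χ1 x * (u J x - v0 J)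
  have hw : ∀ J, IsTest (w J) := fun J =>
    HasCompactSupport.isTest_of_contDiffOn hU (hTa.1.contDiffOn.mul ((hu J).sub contDiffOn_const))
      (hTa.2.mul_right) (tsupport_mul_subset_left.trans hsU)
  have hw1 : ∀ J, ∀ x ∈ Metric.ball x0 (R / 4), v0 J + w J x = u J x := fun J x hx => by
    simp only [w, hχ1 x hx]; ring
  have hw0 : ∀ J, w J x0 = 0 := fun J => by simp [w, hv0]
  have hF : ∀ J, SmoothFamily fun q : ℝ × Pt n => χ2 q.2 * w J (x0 + q.1 • q.2) := fun J => by
    have h1 := (hw J).1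
    have h2 := hTb.1
    refine ⟨by fun_prop, fun y => by simp [hw0], tsupport χ2, hTb.2, fun p y hy => ?_⟩
    simp [image_eq_zero_of_notMem_tsupport hy]
  choose f hf hf0 using fun t : ι × Jet n => ((hF t.1).jet t.2).exists_HB hβ hβ1
  have hb0 : Filter.Tendsto (fun ε t => f t ε) (nhds 0) (nhds 0) := tendsto_pi_nhds.2 hf0
  have e1 : ∀ᶠ ε : ℝ in nhds 0, ‖fun t => f t ε‖ < η :=
    hb0.norm.eventually_lt_const (u := η) (by rwa [norm_zero])
  have e2 : ∀ᶠ ε : ℝ in nhds 0, |ε| < R / (4 * ρ) := by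
    filter_upwards [Metric.ball_mem_nhds (0 : ℝ) (show 0 < R / (4 * ρ) by positivity)] with ε h
    simpa using h
  obtain ⟨ε, ⟨h1, h2⟩, h3⟩ := (((e1.and e2).filter_mono nhdsWithin_le_nhds).and
    (self_mem_nhdsWithin (a := (0 : ℝ)) (s := {0}ᶜ))).exists
  have hε : ε ≠ 0 := h3
  have hball : ∀ y ∈ Metric.ball (0 : Pt n) ρ, x0 + ε • y ∈ Metric.ball x0 (R / 4) := fun y hy => by
    rw [mem_ball_iff_norm, add_sub_cancel_left, norm_smul, Real.norm_eq_abs]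
    have := mem_ball_zero_iff.1 hy
    calc |ε| * ‖y‖ ≤ |ε| * ρ := by gcongr
      _ < R / (4 * ρ) * ρ := by gcongr
      _ = R / 4 := by field_simp
  have hv : ∀ J, IsTest fun y => χ2 y * w J (x0 + ε • y) := fun J => by
    have h1 := (hw J).1
    have h2 := hTb.1
    exact ⟨by fun_prop, hTb.2.mul_right⟩
  have han := hloc (fun J y => χ2 y * w J (x0 + ε • y)) hv (fun t => f t ε) h1 (fun t y => hf t ε y)
    (fun s y hy => by
      rw [P.op_congr_on Metric.isOpen_ball (v := fun J y => v0 J + w J (x0 + ε • y))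
        (fun J x hx => by rw [hχ2 x hx, one_mul]) s hy,
        P.op_comp_affine (u := fun J x => v0 J + w J x) (fun J => contDiff_const.add (hw J).1),
        P.op_congr_on Metric.isOpen_ball hw1 s (hball y hy), heq s _ (hRU ?_), mul_zero]
      exact Metric.ball_subset_ball (by linarith) (hball y hy)) J
  have hz : ε⁻¹ • (x0 - x0) = 0 := by simp
  have hcomp : AnalyticAt ℝ (fun x : Pt n => v0 J + χ2 (ε⁻¹ • (x - x0)) * w J (x0 + ε • ε⁻¹ • (x - x0))) x0 := by
    refine analyticAt_const.add ?_
    refine AnalyticAt.fun_comp (g := fun y => χ2 y * w J (x0 + ε • y)) (f := fun x : Pt n => ε⁻¹ • (x - x0))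
      (by rw [hz]; exact han) ?_
    exact ContDiffAt.analyticAt (by fun_prop)
  refine hcomp.congr ?_
  have hcont : Filter.Tendsto (fun x => ε⁻¹ • (x - x0)) (nhds x0) (nhds 0) := by
    have : Continuous fun x : Pt n => ε⁻¹ • (x - x0) := by fun_prop
    simpa [hz] using this.tendsto x0
  filter_upwards [hcont (Metric.ball_mem_nhds 0 hρ)] with x hx
  have h5 := hball _ hx
  rw [hχ2 _ hx, one_mul, hw1 J _ h5, smul_smul, mul_inv_cancel₀ hε, one_smul, add_sub_cancel]

end QLSystem

end AnalyticRegularity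

section TensorAlgebra

variable {n : ℕ}

/-- Full contraction `M^{ab} T_{ab}`. -/
def ctr (M T : Fin n → Fin n → ℝ) : ℝ := ∑ a, ∑ b, M a b * T a b

theorem ctr_add (M T S : Fin n → Fin n → ℝ) :
    ctr M (fun a b => T a b + S a b) = ctr M T + ctr M S := by
  simp only [ctr, mul_add, Finset.sum_add_distrib]

theorem ctr_sub (M T S : Fin n → Fin n → ℝ) :
    ctr M (fun a b => T a b - S a b) = ctr M T - ctr M S := by
  simp only [ctr, mul_sub, Finset.sum_sub_distrib]

theorem ctr_neg (M T : Fin n → Fin n → ℝ) : ctr M (fun a b => -T a b) = -ctr M T := by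
  simp only [ctr, mul_neg, Finset.sum_neg_distrib]

theorem ctr_const_mul (M T : Fin n → Fin n → ℝ) (c : ℝ) :
    ctr M (fun a b => c * T a b) = c * ctr M T := by
  simp only [ctr, Finset.mul_sum]
  exact Finset.sum_congr rfl fun a _ => Finset.sum_congr rfl fun b _ => by ring

theorem ctr_mul_const (M T : Fin n → Fin n → ℝ) (c : ℝ) :
    ctr M (fun a b => T a b * c) = ctr M T * c := by
  simp only [ctr, Finset.sum_mul]
  exact Finset.sum_congr rfl fun a _ => Finset.sum_congr rfl fun b _ => by ring

theorem ctr_scale (M T : Fin n → Fin n → ℝ) (c : ℝ) :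
    ctr (fun a b => c * M a b) T = c * ctr M T := by
  simp only [ctr, Finset.mul_sum]
  exact Finset.sum_congr rfl fun a _ => Finset.sum_congr rfl fun b _ => by ring

theorem ctr_swap {M : Fin n → Fin n → ℝ} (hM : ∀ a b, M a b = M b a) (T : Fin n → Fin n → ℝ) :
    ctr M (fun a b => T b a) = ctr M T := by
  unfold ctr
  rw [Finset.sum_comm]
  exact Finset.sum_congr rfl fun a _ => Finset.sum_congr rfl fun b _ => by rw [hM]

/-- The inner product `γ^{ab} x_a y_b`. -/
def ip (γ : Fin n → Fin n → ℝ) (x y : Fin n → ℝ) : ℝ := ctr γ fun a b => x a * y b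

theorem ip_add_left (γ : Fin n → Fin n → ℝ) (x x' y : Fin n → ℝ) :
    ip γ (fun a => x a + x' a) y = ip γ x y + ip γ x' y := by
  simp only [ip, add_mul, ctr_add]

theorem ip_sub_left (γ : Fin n → Fin n → ℝ) (x x' y : Fin n → ℝ) :
    ip γ (fun a => x a - x' a) y = ip γ x y - ip γ x' y := by
  simp only [ip, sub_mul, ctr_sub]

theorem ip_const_mul_left (γ : Fin n → Fin n → ℝ) (c : ℝ) (x y : Fin n → ℝ) :
    ip γ (fun a => c * x a) y = c * ip γ x y := by
  simp only [ip, mul_assoc, ctr_const_mul]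

theorem ip_add_right (γ : Fin n → Fin n → ℝ) (x y y' : Fin n → ℝ) :
    ip γ x (fun a => y a + y' a) = ip γ x y + ip γ x y' := by
  simp only [ip, mul_add, ctr_add]

theorem ip_sub_right (γ : Fin n → Fin n → ℝ) (x y y' : Fin n → ℝ) :
    ip γ x (fun a => y a - y' a) = ip γ x y - ip γ x y' := by
  simp only [ip, mul_sub, ctr_sub]

theorem ip_const_mul_right (γ : Fin n → Fin n → ℝ) (c : ℝ) (x y : Fin n → ℝ) :
    ip γ x (fun a => c * y a) = c * ip γ x y := by
  simp only [ip, mul_left_comm, ctr_const_mul]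

theorem ip_comm {γ : Fin n → Fin n → ℝ} (hγ : ∀ a b, γ a b = γ b a) (x y : Fin n → ℝ) :
    ip γ x y = ip γ y x := by
  unfold ip
  rw [← ctr_swap hγ]
  simp only [mul_comm]

theorem ip_scale (γ : Fin n → Fin n → ℝ) (c : ℝ) (x y : Fin n → ℝ) :
    ip (fun a b => c * γ a b) x y = c * ip γ x y := ctr_scale _ _ _

/-- `h` is symmetric with symmetric inverse `γ`. -/
structure InvPair (h γ : Fin n → Fin n → ℝ) : Prop where
  symm : ∀ a b, h a b = h b a
  symm' : ∀ a b, γ a b = γ b a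
  inv : ∀ a c, ∑ b, γ a b * h b c = if a = c then 1 else 0

namespace InvPair

variable {h γ : Fin n → Fin n → ℝ} (P : InvPair h γ)
include P

theorem inv' (a c : Fin n) : ∑ b, h a b * γ b c = if a = c then 1 else 0 := by
  have := P.inv c a
  rw [show (if a = c then (1 : ℝ) else 0) = if c = a then 1 else 0 by simp only [eq_comm], ← this]
  exact Finset.sum_congr rfl fun b _ => by rw [P.symm a b, P.symm' b c, mul_comm]

theorem ip_left (d : Fin n) (y : Fin n → ℝ) : ip γ (fun e => h e d) y = y d := by
  unfold ip ctr
  rw [Finset.sum_comm]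
  have : ∀ b, ∑ a, γ a b * (h a d * y b) = (if b = d then 1 else 0) * y b := by
    intro b
    rw [← P.inv b d, Finset.sum_mul]
    exact Finset.sum_congr rfl fun a _ => by rw [P.symm' a b]; ring
  simp [this]

theorem ip_left' (d : Fin n) (y : Fin n → ℝ) : ip γ (fun e => h d e) y = y d := by
  simp only [P.symm d, P.ip_left]

theorem ip_right (d : Fin n) (y : Fin n → ℝ) : ip γ y (fun e => h e d) = y d := by
  rw [ip_comm P.symm', P.ip_left]

theorem ip_right' (d : Fin n) (y : Fin n → ℝ) : ip γ y (fun e => h d e) = y d := by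
  rw [ip_comm P.symm', P.ip_left']

theorem ctr_self : ctr γ h = n := by
  unfold ctr
  have : ∀ a, ∑ b, γ a b * h a b = 1 := by
    intro a
    have := P.inv a a
    rw [if_pos rfl] at this
    rw [← this]
    exact Finset.sum_congr rfl fun b _ => by rw [P.symm a b]
  simp [this]

theorem ctr_left (b : Fin n) (T : Fin n → ℝ) : ctr γ (fun a d => h b d * T a) = T b := by
  have := P.ip_right' b T
  unfold ip at this
  rw [← this]
  simp only [mul_comm]

theorem ctr_right (b : Fin n) (T : Fin n → ℝ) : ctr γ (fun a d => h a b * T d) = T b :=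
  P.ip_left b T

end InvPair

/-- Christoffel symbols of the first kind, as a function of the lowered index. -/
def chl (V : Fin n → Fin n → Fin n → ℝ) (a d : Fin n) : Fin n → ℝ :=
  fun e => (1 / 2) * (V a d e + V d a e - V e a d)

/-- Second-order part of the lowered Riemann tensor. -/
def rlin (H : Fin n → Fin n → Fin n → Fin n → ℝ) (a b c d : Fin n) : ℝ :=
  (1 / 2) * (H a c b d + H b d a c - H a d b c - H b c a d)

/-- First-order part of the lowered Riemann tensor. -/
def rquad (γ : Fin n → Fin n → ℝ) (V : Fin n → Fin n → Fin n → ℝ) (a b c d : Fin n) : ℝ :=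
  ip γ (chl V b d) (chl V a c) - ip γ (chl V a d) (chl V b c)

/-- The Ricci contraction of a curvature-like tensor. -/
def ricC (γ : Fin n → Fin n → ℝ) (R : Fin n → Fin n → Fin n → Fin n → ℝ) (b c : Fin n) : ℝ :=
  ctr γ fun a d => R a b c d

/-- The scalar contraction of a curvature-like tensor. -/
def scalC (γ : Fin n → Fin n → ℝ) (R : Fin n → Fin n → Fin n → Fin n → ℝ) : ℝ :=
  ctr γ (ricC γ R)

/-- The Weyl part of a curvature-like tensor. -/
def weylC (h γ : Fin n → Fin n → ℝ) (R : Fin n → Fin n → Fin n → Fin n → ℝ) (a b c d : Fin n) : ℝ :=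
  R a b c d + (1 / ((n : ℝ) - 2)) * (ricC γ R a c * h b d - ricC γ R b c * h a d
    + ricC γ R b d * h a c - ricC γ R a d * h b c)
    - scalC γ R / (((n : ℝ) - 1) * ((n : ℝ) - 2)) * (h a c * h b d - h b c * h a d)

/-- The Weyl part with its last index raised. -/
def weylCU (h γ : Fin n → Fin n → ℝ) (R : Fin n → Fin n → Fin n → Fin n → ℝ) (a b c d : Fin n) : ℝ :=
  ∑ e, γ d e * weylC h γ R a b c e

/-- The Kulkarni–Nomizu type product of `h` with `X`. -/
def kn (h X : Fin n → Fin n → ℝ) (a b c d : Fin n) : ℝ :=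
  h a d * X b c - h b d * X a c + h b c * X a d - h a c * X b d

section
variable {h γ X : Fin n → Fin n → ℝ} (P : InvPair h γ)
include P

theorem ricC_kn (b c : Fin n) :
    ricC γ (kn h X) b c = ((n : ℝ) - 2) * X b c + h b c * ctr γ X := by
  unfold ricC kn
  rw [ctr_sub, ctr_add, ctr_sub, ctr_mul_const, ctr_const_mul]
  rw [P.ctr_self, P.ctr_left b (fun a => X a c), P.ctr_right c (fun d => X b d)]
  ring

theorem scalC_kn : scalC γ (kn h X) = 2 * ((n : ℝ) - 1) * ctr γ X := by
  unfold scalC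
  rw [show ricC γ (kn h X) = fun b c => ((n : ℝ) - 2) * X b c + h b c * ctr γ X from
    funext fun b => funext fun c => ricC_kn P b c, ctr_add, ctr_const_mul, ctr_mul_const, P.ctr_self]
  ring

theorem weylC_kn (hn : 3 ≤ n) (a b c d : Fin n) : weylC h γ (kn h X) a b c d = 0 := by
  have h1 : (n : ℝ) - 1 ≠ 0 := by
    have : (3 : ℝ) ≤ n := by exact_mod_cast hn
    linarith
  have h2 : (n : ℝ) - 2 ≠ 0 := by
    have : (3 : ℝ) ≤ n := by exact_mod_cast hn
    linarith
  unfold weylC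
  simp only [ricC_kn P, scalC_kn P]
  unfold kn
  rw [P.symm a d, P.symm b d, P.symm b c, P.symm a c]
  field_simp
  ring

end

theorem ricC_add (γ : Fin n → Fin n → ℝ) (R S : Fin n → Fin n → Fin n → Fin n → ℝ) (b c : Fin n) :
    ricC γ (fun a b c d => R a b c d + S a b c d) b c = ricC γ R b c + ricC γ S b c := ctr_add _ _ _

theorem scalC_add (γ : Fin n → Fin n → ℝ) (R S : Fin n → Fin n → Fin n → Fin n → ℝ) :
    scalC γ (fun a b c d => R a b c d + S a b c d) = scalC γ R + scalC γ S := by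
  unfold scalC
  rw [← ctr_add]
  simp only [← ricC_add]

theorem weylC_add (h γ : Fin n → Fin n → ℝ) (R S : Fin n → Fin n → Fin n → Fin n → ℝ)
    (a b c d : Fin n) : weylC h γ (fun a b c d => R a b c d + S a b c d) a b c d =
      weylC h γ R a b c d + weylC h γ S a b c d := by
  unfold weylC
  simp only [ricC_add, scalC_add]
  ring

theorem weylCU_add (h γ : Fin n → Fin n → ℝ) (R S : Fin n → Fin n → Fin n → Fin n → ℝ)
    (a b c d : Fin n) : weylCU h γ (fun a b c d => R a b c d + S a b c d) a b c d =
      weylCU h γ R a b c d + weylCU h γ S a b c d := by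
  unfold weylCU
  simp only [weylC_add, mul_add, Finset.sum_add_distrib]

theorem ricC_conf (γ : Fin n → Fin n → ℝ) {φ : ℝ} (hφ : φ ≠ 0)
    (R : Fin n → Fin n → Fin n → Fin n → ℝ) (b c : Fin n) :
    ricC (fun a b => φ⁻¹ * γ a b) (fun a b c d => φ * R a b c d) b c = ricC γ R b c := by
  unfold ricC
  rw [ctr_scale, ctr_const_mul, inv_mul_cancel_left₀ hφ]

theorem scalC_conf (γ : Fin n → Fin n → ℝ) {φ : ℝ} (hφ : φ ≠ 0)
    (R : Fin n → Fin n → Fin n → Fin n → ℝ) :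
    scalC (fun a b => φ⁻¹ * γ a b) (fun a b c d => φ * R a b c d) = φ⁻¹ * scalC γ R := by
  unfold scalC
  rw [ctr_scale]
  congr 2
  funext b c
  exact ricC_conf γ hφ R b c

theorem weylCU_conf (h γ : Fin n → Fin n → ℝ) {φ : ℝ} (hφ : φ ≠ 0)
    (R : Fin n → Fin n → Fin n → Fin n → ℝ) (a b c d : Fin n) :
    weylCU (fun a b => φ * h a b) (fun a b => φ⁻¹ * γ a b) (fun a b c d => φ * R a b c d) a b c d =
      weylCU h γ R a b c d := by
  unfold weylCU
  refine Finset.sum_congr rfl fun e _ => ?_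
  unfold weylC
  simp only [ricC_conf γ hφ, scalC_conf γ hφ]
  field_simp

/-- The tensor governing the conformal change of curvature. -/
def confX (h γ : Fin n → Fin n → ℝ) (V : Fin n → Fin n → Fin n → ℝ) (υ : Fin n → ℝ)
    (N : Fin n → Fin n → ℝ) (a b : Fin n) : ℝ :=
  -N a b + ip γ (chl V a b) υ + υ a * υ b - (1 / 2) * ip γ υ υ * h a b

theorem riem_conf {h γ : Fin n → Fin n → ℝ} (P : InvPair h γ) {V : Fin n → Fin n → Fin n → ℝ}
    {H : Fin n → Fin n → Fin n → Fin n → ℝ} {φ : ℝ} (hφ : φ ≠ 0) {υ : Fin n → ℝ}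
    {N : Fin n → Fin n → ℝ} (hV : ∀ c a b, V c a b = V c b a)
    (a b c d : Fin n) :
    rlin (fun i j a b => φ * (H i j a b + 2 * υ i * V j a b + 2 * υ j * V i a b
        + (2 * N i j + 4 * υ i * υ j) * h a b)) a b c d
      + rquad (fun a b => φ⁻¹ * γ a b) (fun c a b => φ * (V c a b + 2 * υ c * h a b)) a b c d
    = φ * ((rlin H a b c d + rquad γ V a b c d) + kn h (confX h γ V υ N) a b c d) := by
  have hC : ∀ a d, chl (fun c a b => φ * (V c a b + 2 * υ c * h a b)) a d =
      fun e => φ * (chl V a d e + υ a * h d e + υ d * h a e - h a d * υ e) := by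
    intro a d
    funext e
    unfold chl
    ring
  unfold rquad
  simp only [hC, ip_scale, ip_const_mul_left, ip_const_mul_right, ip_add_left, ip_add_right, ip_sub_left,
    ip_sub_right, P.ip_left', P.ip_right', ip_comm P.symm' υ (chl V _ _)]
  unfold rlin kn confX
  generalize ip γ (chl V b d) (chl V a c) = i1
  generalize ip γ (chl V a d) (chl V b c) = i2
  generalize ip γ (chl V b c) υ = j1
  generalize ip γ (chl V a c) υ = j2
  generalize ip γ (chl V a d) υ = j3
  generalize ip γ (chl V b d) υ = j4
  generalize ip γ υ υ = k
  unfold chl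
  beta_reduce
  simp only [P.symm b a, P.symm c a, P.symm c b, hV c b a, hV a c b, hV b c a, hV a d b, hV a d c,
    hV b d c, hV b d a, hV d b a]
  field_simp
  ring

theorem ctr_confX {h γ : Fin n → Fin n → ℝ} (P : InvPair h γ) (V : Fin n → Fin n → Fin n → ℝ)
    (υ : Fin n → ℝ) (N : Fin n → Fin n → ℝ) : ctr γ (confX h γ V υ N) =
      -ctr γ N + ctr γ (fun a b => ip γ (chl V a b) υ) - ((n : ℝ) - 2) / 2 * ip γ υ υ := by
  have := ctr_sub γ (fun a b => -N a b + ip γ (chl V a b) υ + υ a * υ b)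
    (fun a b => (1 / 2) * ip γ υ υ * h a b)
  unfold confX
  rw [this, ctr_add, ctr_add, ctr_neg, ctr_const_mul, P.ctr_self]
  change _ + ip γ υ υ - _ = _
  ring

end TensorAlgebra

section CoordinateCurvature

variable {n : ℕ} {U : Set (Pt n)}

theorem contDiffOn_det {g : Met n} {k : WithTop ℕ∞} (hg : ∀ a b, ContDiffOn ℝ k (fun x => g x a b) U) :
    ContDiffOn ℝ k (fun x => (g x).det) U := by
  simp only [Matrix.det_apply]
  exact ContDiffOn.sum fun σ _ => ContDiffOn.const_smul _ (contDiffOn_prod fun i _ => hg _ _)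

theorem contDiffOn_adjugate {g : Met n} {k : WithTop ℕ∞}
    (hg : ∀ a b, ContDiffOn ℝ k (fun x => g x a b) U) (a b : Fin n) :
    ContDiffOn ℝ k (fun x => (g x).adjugate a b) U := by
  simp only [Matrix.adjugate_apply]
  refine contDiffOn_det (g := fun x => (g x).updateRow b (Pi.single a 1)) fun i j => ?_
  by_cases h : i = b
  · subst h
    simp only [Matrix.updateRow_self]
    exact contDiffOn_const
  · simp only [Matrix.updateRow_ne h]
    exact hg i j

theorem contDiffOn_matrix_inv {g : Met n} {k : WithTop ℕ∞} (hg : ∀ a b, ContDiffOn ℝ k (fun x => g x a b) U)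
    (hd : ∀ x ∈ U, (g x).det ≠ 0) (a b : Fin n) : ContDiffOn ℝ k (fun x => (g x)⁻¹ a b) U := by
  simp only [Matrix.inv_def, Ring.inverse_eq_inv', Matrix.smul_apply, smul_eq_mul]
  exact ((contDiffOn_det hg).inv hd).mul (contDiffOn_adjugate hg a b)

/-- Jacobi's formula. -/
theorem pd_det {g : Met n} {x : Pt n} (hg : ∀ a b, DifferentiableAt ℝ (fun x => g x a b) x) (c : Fin n) :
    pd c (fun y => (g y).det) x = ∑ a, ∑ b, (g x).adjugate a b * pd c (fun y => g y b a) x := by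
  have h1 : ∀ a, ∑ b, (g x).adjugate a b * pd c (fun y => g y b a) x =
      ((g x).updateCol a fun b => pd c (fun y => g y b a) x).det := by
    intro a
    rw [← Matrix.cramer_apply, Matrix.cramer_eq_adjugate_mulVec]
    rfl
  simp only [h1, Matrix.det_apply']
  rw [Finset.sum_comm]
  have h2 : ∀ σ : Equiv.Perm (Fin n), HasFDerivAt (fun y => ∏ i, g y (σ i) i)
      (∑ i, (∏ j ∈ Finset.univ.erase i, g x (σ j) j) • fderiv ℝ (fun y => g y (σ i) i) x) x :=
    fun σ => HasFDerivAt.finsetProd fun i _ => (hg (σ i) i).hasFDerivAt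
  rw [pd_sum fun σ _ => (h2 σ).differentiableAt.const_mul _]
  refine Finset.sum_congr rfl fun σ _ => ?_
  rw [pd_const_mul (h2 σ).differentiableAt]
  unfold pd
  rw [(h2 σ).fderiv, ← Finset.mul_sum]
  congr 1
  rw [_root_.sum_apply]
  refine Finset.sum_congr rfl fun i _ => ?_
  rw [← Finset.mul_prod_erase _ _ (Finset.mem_univ i), Matrix.updateCol_self,
    _root_.smul_apply, smul_eq_mul, mul_comm]
  congr 1
  refine Finset.prod_congr rfl fun j hj => ?_
  rw [Matrix.updateCol_ne (Finset.ne_of_mem_erase hj)]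

theorem invPair_of_symm {A : Matrix (Fin n) (Fin n) ℝ} (hs : A.IsSymm) (hd : A.det ≠ 0) :
    InvPair (fun a b => A a b) (fun a b => A⁻¹ a b) := by
  refine ⟨fun a b => (hs.apply b a), fun a b => ?_, fun a c => ?_⟩
  · have : (A⁻¹).IsSymm := by
      unfold Matrix.IsSymm
      rw [Matrix.transpose_nonsing_inv, hs.eq]
    exact this.apply b a
  · have := Matrix.nonsing_inv_mul A (isUnit_iff_ne_zero.2 hd)
    have h2 := congrFun (congrFun this a) c
    rw [Matrix.mul_apply, Matrix.one_apply] at h2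
    exact h2

/-- The inverse metric, as a function of two indices. -/
def ginv (g : Met n) (x : Pt n) (a b : Fin n) : ℝ := (g x)⁻¹ a b

/-- First derivatives of the metric. -/
def jetV (g : Met n) (x : Pt n) (c a b : Fin n) : ℝ := pd c (fun y => g y a b) x

/-- Second derivatives of the metric. -/
def jetH (g : Met n) (x : Pt n) (i j a b : Fin n) : ℝ := pd i (fun y => jetV g y j a b) x

/-- `g` is a `C²` field of symmetric invertible matrices on the open set `U`. -/
structure GoodMet (g : Met n) (U : Set (Pt n)) : Prop where
  isOpen : IsOpen U
  smooth : ∀ a b, ContDiffOn ℝ 2 (fun x => g x a b) U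
  det_ne : ∀ x ∈ U, (g x).det ≠ 0
  symm : ∀ x ∈ U, (g x).IsSymm

namespace GoodMet

variable {g : Met n} (G : GoodMet g U)
include G

theorem pair {x : Pt n} (hx : x ∈ U) : InvPair (fun a b => g x a b) (ginv g x) :=
  invPair_of_symm (G.symm x hx) (G.det_ne x hx)

theorem diff {x : Pt n} (hx : x ∈ U) (a b : Fin n) : DifferentiableAt ℝ (fun x => g x a b) x :=
  ((G.smooth a b).contDiffAt (G.isOpen.mem_nhds hx)).differentiableAt (by norm_num)

theorem inv_smooth (a b : Fin n) : ContDiffOn ℝ 2 (fun x => ginv g x a b) U :=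
  contDiffOn_matrix_inv G.smooth G.det_ne a b

theorem inv_diff {x : Pt n} (hx : x ∈ U) (a b : Fin n) :
    DifferentiableAt ℝ (fun x => ginv g x a b) x :=
  ((G.inv_smooth a b).contDiffAt (G.isOpen.mem_nhds hx)).differentiableAt (by norm_num)

theorem jetV_smooth (c a b : Fin n) : ContDiffOn ℝ 1 (fun x => jetV g x c a b) U :=
  ContDiffOn.pd G.isOpen (by norm_num : (1 : WithTop ℕ∞) + 1 ≤ 2) (G.smooth a b) c

theorem jetV_diff {x : Pt n} (hx : x ∈ U) (c a b : Fin n) :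
    DifferentiableAt ℝ (fun x => jetV g x c a b) x :=
  ((G.jetV_smooth c a b).contDiffAt (G.isOpen.mem_nhds hx)).differentiableAt (by norm_num)

theorem jetV_symm {x : Pt n} (hx : x ∈ U) (c a b : Fin n) : jetV g x c a b = jetV g x c b a :=
  pd_congr_on G.isOpen (fun _ hy => (G.pair hy).symm a b) x hx

theorem jetH_symm {x : Pt n} (hx : x ∈ U) (i j a b : Fin n) : jetH g x i j a b = jetH g x i j b a :=
  pd_congr_on G.isOpen (fun _ hy => G.jetV_symm hy j a b) x hx

theorem jetH_comm {x : Pt n} (hx : x ∈ U) (i j a b : Fin n) : jetH g x i j a b = jetH g x j i a b :=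
  pd_comm ((G.smooth a b).contDiffAt (G.isOpen.mem_nhds hx)) i j

/-- Derivative of the inverse metric. -/
theorem pd_inv {x : Pt n} (hx : x ∈ U) (d a b : Fin n) : pd d (fun y => ginv g y a b) x =
    -∑ e, ∑ f, ginv g x a e * jetV g x d e f * ginv g x f b := by
  have h1 : ∀ c, ∑ f, (pd d (fun y => ginv g y a f) x * g x f c + ginv g x a f * jetV g x d f c) = 0 := by
    intro c
    have := pd_congr_on (a := d) G.isOpen (fun y hy => (G.pair hy).inv a c) x hx
    rw [pd_const, pd_sum fun f _ => (G.inv_diff hx a f).fun_mul (G.diff hx f c)] at this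
    rw [← this]
    exact Finset.sum_congr rfl fun f _ => (pd_mul (G.inv_diff hx a f) (G.diff hx f c)).symm
  have h2 : ∑ c, (∑ f, (pd d (fun y => ginv g y a f) x * g x f c + ginv g x a f * jetV g x d f c)) *
      ginv g x c b = 0 := by
    simp only [h1, zero_mul, Finset.sum_const_zero]
  simp only [Finset.sum_add_distrib, add_mul] at h2
  have h3 : ∑ c, (∑ f, pd d (fun y => ginv g y a f) x * g x f c) * ginv g x c b =
      pd d (fun y => ginv g y a b) x := by
    simp only [Finset.sum_mul, mul_assoc]
    rw [Finset.sum_comm]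
    simp only [← Finset.mul_sum, (G.pair hx).inv']
    simp
  rw [h3] at h2
  rw [eq_neg_of_add_eq_zero_left h2, neg_inj]
  simp only [Finset.sum_mul]
  rw [Finset.sum_comm]

omit G in
theorem christoffel_eq (x : Pt n) (c a b : Fin n) :
    christoffel g c a b x = ∑ d, ginv g x c d * chl (jetV g x) a b d := by
  unfold christoffel chl jetV ginv
  rw [Finset.mul_sum]
  exact Finset.sum_congr rfl fun d _ => by ring

theorem low_christoffel {x : Pt n} (hx : x ∈ U) (e a b : Fin n) :
    ∑ c, g x c e * christoffel g c a b x = chl (jetV g x) a b e := by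
  simp only [christoffel_eq, Finset.mul_sum]
  rw [Finset.sum_comm]
  simp only [← mul_assoc, ← Finset.sum_mul, (G.pair hx).symm _ e, (G.pair hx).inv']
  simp

theorem chl_diff {x : Pt n} (hx : x ∈ U) (a b d : Fin n) :
    DifferentiableAt ℝ (fun y => chl (jetV g y) a b d) x := by
  unfold chl
  exact (((G.jetV_diff hx _ _ _).fun_add (G.jetV_diff hx _ _ _)).fun_sub (G.jetV_diff hx _ _ _)).const_mul _

theorem christoffel_diff {x : Pt n} (hx : x ∈ U) (c a b : Fin n) :
    DifferentiableAt ℝ (christoffel g c a b) x := by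
  rw [show christoffel g c a b = fun x => ∑ d, ginv g x c d * chl (jetV g x) a b d from
    funext fun x => christoffel_eq x c a b]
  exact DifferentiableAt.fun_sum fun d _ => (G.inv_diff hx c d).fun_mul (G.chl_diff hx a b d)

theorem pd_chl {x : Pt n} (hx : x ∈ U) (c a b d : Fin n) :
    pd c (fun y => chl (jetV g y) a b d) x =
      (1 / 2) * (jetH g x c a b d + jetH g x c b a d - jetH g x c d a b) := by
  unfold chl
  rw [pd_const_mul (((G.jetV_diff hx _ _ _).fun_add (G.jetV_diff hx _ _ _)).fun_sub (G.jetV_diff hx _ _ _)),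
    pd_sub ((G.jetV_diff hx _ _ _).fun_add (G.jetV_diff hx _ _ _)) (G.jetV_diff hx _ _ _),
    pd_add (G.jetV_diff hx _ _ _) (G.jetV_diff hx _ _ _)]
  rfl

theorem low_pd_christoffel {x : Pt n} (hx : x ∈ U) (c d a b : Fin n) :
    ∑ e, pd c (christoffel g e a b) x * g x e d =
      (1 / 2) * (jetH g x c a b d + jetH g x c b a d - jetH g x c d a b)
        - ∑ e, jetV g x c e d * christoffel g e a b x := by
  have := pd_congr_on (a := c) G.isOpen (fun y hy => G.low_christoffel hy d a b) x hx
  rw [G.pd_chl hx, pd_sum fun e _ => (G.diff hx e d).fun_mul (G.christoffel_diff hx e a b)] at this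
  rw [← this, ← Finset.sum_sub_distrib]
  refine Finset.sum_congr rfl fun e _ => ?_
  rw [pd_mul (G.diff hx e d) (G.christoffel_diff hx e a b)]
  unfold jetV
  ring

theorem jetV_eq_chl {x : Pt n} (hx : x ∈ U) (a d e : Fin n) :
    jetV g x a e d = chl (jetV g x) a e d + chl (jetV g x) a d e := by
  unfold chl
  rw [G.jetV_symm hx a d e, G.jetV_symm hx e a d]
  rw [G.jetV_symm hx d a e]
  ring

omit G in
theorem sum_chl_christoffel (x : Pt n) (a d b c : Fin n) :
    ∑ e, chl (jetV g x) a d e * christoffel g e b c x =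
      ip (ginv g x) (chl (jetV g x) a d) (chl (jetV g x) b c) := by
  unfold ip ctr
  simp only [christoffel_eq, Finset.mul_sum]
  exact Finset.sum_congr rfl fun e _ => Finset.sum_congr rfl fun f _ => by ring

theorem riemannLow_eq {x : Pt n} (hx : x ∈ U) (a b c d : Fin n) : riemannLow g a b c d x =
    rlin (jetH g x) a b c d + rquad (ginv g x) (jetV g x) a b c d := by
  have h1 : riemannLow g a b c d x = ∑ e, pd a (christoffel g e b c) x * g x e d
      - ∑ e, pd b (christoffel g e a c) x * g x e d
      + ∑ e, (∑ f, christoffel g f b c x * christoffel g e a f x) * g x e d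
      - ∑ e, (∑ f, christoffel g f a c x * christoffel g e b f x) * g x e d := by
    unfold riemannLow riemannUp
    simp only [sub_mul, add_mul, Finset.sum_sub_distrib, Finset.sum_add_distrib]
  have h2 : ∀ a b c, ∑ e, (∑ f, christoffel g f b c x * christoffel g e a f x) * g x e d =
      ∑ f, chl (jetV g x) a f d * christoffel g f b c x := by
    intro a b c
    simp only [Finset.sum_mul]
    rw [Finset.sum_comm]
    refine Finset.sum_congr rfl fun f _ => ?_
    rw [← G.low_christoffel hx, Finset.sum_mul]
    exact Finset.sum_congr rfl fun e _ => by ring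
  have h3 : ∀ a b c, ∑ e, jetV g x a e d * christoffel g e b c x =
      ∑ e, chl (jetV g x) a e d * christoffel g e b c x
        + ip (ginv g x) (chl (jetV g x) a d) (chl (jetV g x) b c) := by
    intro a b c
    rw [← sum_chl_christoffel, ← Finset.sum_add_distrib]
    refine Finset.sum_congr rfl fun e _ => ?_
    rw [G.jetV_eq_chl hx]
    ring
  rw [h1, G.low_pd_christoffel hx, G.low_pd_christoffel hx, h2, h2, h3, h3]
  unfold rlin rquad
  rw [G.jetH_comm hx b a c d]
  ring

theorem ricci_eq {x : Pt n} (hx : x ∈ U) (b c : Fin n) :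
    ricci g b c x = ricC (ginv g x) (fun a b c d => riemannLow g a b c d x) b c := by
  have h1 : ricC (ginv g x) (fun a b c d => riemannLow g a b c d x) b c = ∑ a, riemannUp g a b c a x := by
    unfold ricC ctr riemannLow
    refine Finset.sum_congr rfl fun a _ => ?_
    simp only [Finset.mul_sum]
    rw [Finset.sum_comm]
    have : ∀ e, ∑ d, ginv g x a d * (riemannUp g a b c e x * g x e d) =
        (if a = e then 1 else 0) * riemannUp g a b c e x := by
      intro e
      rw [← (G.pair hx).inv a e, Finset.sum_mul]
      exact Finset.sum_congr rfl fun d _ => by rw [(G.pair hx).symm e d]; ring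
    simp [this]
  rw [h1]
  unfold ricci riemannUp
  simp only [Finset.sum_sub_distrib, Finset.sum_add_distrib]
  rw [Finset.sum_comm (f := fun a e => christoffel g e b c x * christoffel g a a e x)]

theorem curv_eq {x : Pt n} (hx : x ∈ U) : (fun a b c d => riemannLow g a b c d x) =
    fun a b c d => rlin (jetH g x) a b c d + rquad (ginv g x) (jetV g x) a b c d :=
  funext fun a => funext fun b => funext fun c => funext fun d => G.riemannLow_eq hx a b c d

theorem scalarCurv_eq {x : Pt n} (hx : x ∈ U) : scalarCurv g x = scalC (ginv g x)
    fun a b c d => rlin (jetH g x) a b c d + rquad (ginv g x) (jetV g x) a b c d := by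
  rw [← G.curv_eq hx]
  unfold scalarCurv scalC ctr
  simp only [G.ricci_eq hx]
  rfl

theorem weylUp_eq (hn : 3 ≤ n) {x : Pt n} (hx : x ∈ U) (a b c d : Fin n) :
    weylUp g a b c d x = weylCU (fun a b => g x a b) (ginv g x)
      (fun a b c d => rlin (jetH g x) a b c d + rquad (ginv g x) (jetV g x) a b c d) a b c d := by
  have h0 : (3 : ℝ) ≤ n := by exact_mod_cast hn
  have h1 : (n : ℝ) - 1 ≠ 0 := by linarith
  have h2 : (n : ℝ) - 2 ≠ 0 := by linarith
  unfold weylUp weylCU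
  refine Finset.sum_congr rfl fun e _ => ?_
  congr 1
  unfold weyl weylC schouten
  rw [G.scalarCurv_eq hx]
  simp only [G.ricci_eq hx, G.riemannLow_eq hx]
  rw [(G.pair hx).symm b c, (G.pair hx).symm a c]
  rw [(G.pair hx).symm b e, (G.pair hx).symm a e]
  field_simp
  ring

end GoodMet

end CoordinateCurvature

section CurvatureFormulas

variable {n : ℕ} {U : Set (Pt n)}

/-- The contraction `γ^{ae} γ^{bf} W_{ef} S_{ab}`. -/
def ctr₂ (γ W S : Fin n → Fin n → ℝ) : ℝ := ctr (fun a b => ∑ e, ∑ f, γ a e * W e f * γ f b) S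

namespace GoodMet

variable {g : Met n} (G : GoodMet g U)
include G

theorem pd_ctr {T : Fin n → Fin n → Pt n → ℝ} {x : Pt n} (hx : x ∈ U)
    (hT : ∀ a b, DifferentiableAt ℝ (T a b) x) (d : Fin n) :
    pd d (fun y => ctr (ginv g y) fun a b => T a b y) x =
      ctr (ginv g x) (fun a b => pd d (T a b) x)
        - ctr₂ (ginv g x) (jetV g x d) fun a b => T a b x := by
  unfold ctr₂ ctr
  have h1 : ∀ a b, DifferentiableAt ℝ (fun y => ginv g y a b * T a b y) x :=
    fun a b => (G.inv_diff hx a b).fun_mul (hT a b)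
  rw [pd_sum fun a _ => DifferentiableAt.fun_sum fun b _ => h1 a b, ← Finset.sum_sub_distrib]
  refine Finset.sum_congr rfl fun a _ => ?_
  rw [pd_sum fun b _ => h1 a b, ← Finset.sum_sub_distrib]
  refine Finset.sum_congr rfl fun b _ => ?_
  rw [pd_mul (G.inv_diff hx a b) (hT a b), G.pd_inv hx]
  ring

theorem gammaLow_eq {x : Pt n} (hx : x ∈ U) (a : Fin n) :
    gammaLow g a x = ctr (ginv g x) fun c d => chl (jetV g x) c d a := by
  have h1 : gammaLow g a x = ∑ c, ∑ d, ∑ b, ginv g x c d * (g x b a * christoffel g b c d x) := by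
    unfold gammaLow gammaUp
    simp only [Finset.mul_sum]
    rw [Finset.sum_comm]
    refine Finset.sum_congr rfl fun c _ => ?_
    rw [Finset.sum_comm]
    refine Finset.sum_congr rfl fun d _ => Finset.sum_congr rfl fun b _ => ?_
    rw [(G.pair hx).symm a b]
    unfold ginv
    ring
  rw [h1]
  simp only [← Finset.mul_sum, G.low_christoffel hx]
  rfl

theorem gammaLow_eq' {x : Pt n} (hx : x ∈ U) (a : Fin n) :
    gammaLow g a x = ctr (ginv g x) (fun c d => jetV g x c d a)
      - (1 / 2) * ctr (ginv g x) (jetV g x a) := by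
  rw [G.gammaLow_eq hx]
  unfold chl
  rw [ctr_const_mul, ctr_sub, ctr_add, ctr_swap (G.pair hx).symm' (fun c d => jetV g x c d a)]
  ring

theorem pd_det_eq {x : Pt n} (hx : x ∈ U) (c : Fin n) :
    pd c (fun y => (g y).det) x = (g x).det * ctr (ginv g x) (jetV g x c) := by
  rw [pd_det (G.diff hx)]
  unfold ctr
  simp only [Finset.mul_sum]
  refine Finset.sum_congr rfl fun a _ => Finset.sum_congr rfl fun b _ => ?_
  have h : (g x).adjugate a b = (g x).det * ginv g x a b := by
    unfold ginv
    rw [Matrix.inv_def, Ring.inverse_eq_inv', Matrix.smul_apply, smul_eq_mul,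
      mul_inv_cancel_left₀ (G.det_ne x hx)]
  rw [h, G.jetV_symm hx c a b, mul_assoc]
  rfl

theorem det_contDiffAt {x : Pt n} (hx : x ∈ U) : ContDiffAt ℝ 2 (fun y => (g y).det) x :=
  (contDiffOn_det G.smooth).contDiffAt (G.isOpen.mem_nhds hx)

theorem laplaceBeltrami_eq (hpos : ∀ x ∈ U, 0 < (g x).det) {f : Pt n → ℝ}
    (hf : ContDiffOn ℝ 2 f U) {x : Pt n} (hx : x ∈ U) : laplaceBeltrami g f x =
      -ctr (ginv g x) (fun a b => pd a (pd b f) x)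
        + ip (ginv g x) (fun a => gammaLow g a x) fun a => pd a f x := by
  have hfd : ∀ b, DifferentiableAt ℝ (pd b f) x := fun b =>
    ((ContDiffOn.pd G.isOpen (by norm_num : (1 : WithTop ℕ∞) + 1 ≤ 2) hf b).contDiffAt
      (G.isOpen.mem_nhds hx)).differentiableAt (by norm_num)
  have hdd : DifferentiableAt ℝ (fun y => (g y).det) x :=
    (G.det_contDiffAt hx).differentiableAt (by norm_num)
  have hs : 0 < Real.sqrt (g x).det := Real.sqrt_pos.2 (hpos x hx)
  have hsd : DifferentiableAt ℝ (fun y => Real.sqrt (g y).det) x := hdd.sqrt (hpos x hx).ne'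
  have hsp : ∀ a, pd a (fun y => Real.sqrt (g y).det) x =
      Real.sqrt (g x).det * ((1 / 2) * ctr (ginv g x) (jetV g x a)) := by
    intro a
    rw [pd_comp (Real.hasDerivAt_sqrt (hpos x hx).ne') hdd, G.pd_det_eq hx]
    have := Real.mul_self_sqrt (hpos x hx).le
    field_simp
    rw [sq, this]
  have hw : ∀ a b, DifferentiableAt ℝ (fun y => ginv g y a b * pd b f y) x := fun a b =>
    (G.inv_diff hx a b).fun_mul (hfd b)
  have hmain : ∀ a, pd a (fun y => Real.sqrt (g y).det * ∑ b, (g y)⁻¹ a b * pd b f y) x =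
      Real.sqrt (g x).det * ∑ b, ((1 / 2) * (ginv g x a b * (ctr (ginv g x) (jetV g x a) * pd b f x))
        + ginv g x a b * pd a (pd b f) x
        - ∑ e, ∑ h, ginv g x h b * ((ginv g x a e * jetV g x a e h) * pd b f x)) := by
    intro a
    have h1 := pd_mul (a := a) hsd (DifferentiableAt.fun_sum (u := Finset.univ) fun b _ => hw a b)
    refine h1.trans ?_
    rw [hsp, pd_sum fun b _ => hw a b]
    rw [show ∀ p q r s : ℝ, p * (1 / 2 * q) * r + p * s = p * (1 / 2 * q * r + s) by intros; ring,
      Finset.mul_sum, ← Finset.sum_add_distrib]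
    congr 1
    refine Finset.sum_congr rfl fun b _ => ?_
    rw [pd_mul (G.inv_diff hx a b) (hfd b), G.pd_inv hx, neg_mul, Finset.sum_mul]
    simp only [Finset.sum_mul]
    rw [show (∑ e, ∑ h, ginv g x a e * jetV g x a e h * ginv g x h b * pd b f x) =
      ∑ e, ∑ h, ginv g x h b * ((ginv g x a e * jetV g x a e h) * pd b f x) from
        Finset.sum_congr rfl fun e _ => Finset.sum_congr rfl fun h _ => by ring]
    ring
  unfold laplaceBeltrami
  simp only [hmain]
  rw [← Finset.mul_sum, neg_mul, inv_mul_cancel_left₀ hs.ne']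
  simp only [Finset.sum_add_distrib, Finset.sum_sub_distrib]
  have e3 : ∑ a, ∑ b, ∑ e, ∑ h, ginv g x h b * ((ginv g x a e * jetV g x a e h) * pd b f x) =
      ip (ginv g x) (fun h => ctr (ginv g x) fun a e => jetV g x a e h) fun b => pd b f x := by
    unfold ip ctr
    simp only [Finset.mul_sum, Finset.sum_mul]
    calc _ = ∑ a, ∑ e, ∑ h, ∑ b, ginv g x h b * ((ginv g x a e * jetV g x a e h) * pd b f x) := by
          refine Finset.sum_congr rfl fun a _ => ?_
          rw [Finset.sum_comm]
          exact Finset.sum_congr rfl fun e _ => Finset.sum_comm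
      _ = ∑ a, ∑ h, ∑ b, ∑ e, ginv g x h b * ((ginv g x a e * jetV g x a e h) * pd b f x) := by
          refine Finset.sum_congr rfl fun a _ => ?_
          rw [Finset.sum_comm]
          exact Finset.sum_congr rfl fun e _ => Finset.sum_comm
      _ = _ := by
          rw [Finset.sum_comm]
          exact Finset.sum_congr rfl fun e _ => Finset.sum_comm
  rw [e3]
  have e4 : (fun a => gammaLow g a x) = fun a => ctr (ginv g x) (fun c d => jetV g x c d a)
      - (1 / 2) * ctr (ginv g x) (jetV g x a) := funext fun a => G.gammaLow_eq' hx a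
  rw [e4, ip_sub_left, ip_const_mul_left]
  simp only [← Finset.mul_sum]
  unfold ip
  change -(1 / 2 * ctr (ginv g x) (fun a b => ctr (ginv g x) (jetV g x a) * pd b f x)
    + ctr (ginv g x) (fun a b => pd a (pd b f) x) - _) = _
  ring

/-- The scalar curvature in conformal harmonic gauge. -/
theorem scalarCurv_gauge (hn : 3 ≤ n) (hpos : ∀ x ∈ U, 0 < (g x).det) {f : Pt n → ℝ}
    (hf : ContDiffOn ℝ 2 f U) (hf0 : ∀ x ∈ U, 0 < f x) (hL : ∀ x ∈ U, confLap g f x = 0)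
    (hΓ : ∀ a : Fin n, ∀ x ∈ U, gammaLow g a x = 2 * pd a (fun y => Real.log (f y)) x)
    {x : Pt n} (hx : x ∈ U) : scalarCurv g x = 2 * ((n : ℝ) - 1) / ((n : ℝ) - 2) *
      (ctr (ginv g x) (fun a b => pd a (gammaLow g b) x)
        - (1 / 2) * ip (ginv g x) (fun a => gammaLow g a x) fun a => gammaLow g a x) := by
  have h0 : (3 : ℝ) ≤ n := by exact_mod_cast hn
  have n1 : (n : ℝ) - 1 ≠ 0 := by linarith
  have n2 : (n : ℝ) - 2 ≠ 0 := by linarith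
  have hfd : ∀ y ∈ U, DifferentiableAt ℝ f y := fun y hy =>
    (hf.contDiffAt (G.isOpen.mem_nhds hy)).differentiableAt (by norm_num)
  have h1 : ∀ b, ∀ y ∈ U, pd b f y = (1 / 2) * (f y * gammaLow g b y) := by
    intro b y hy
    rw [hΓ b y hy, pd_comp (Real.hasDerivAt_log (hf0 y hy).ne') (hfd y hy)]
    have := (hf0 y hy).ne'
    field_simp
  have hlog : ContDiffOn ℝ 2 (fun y => Real.log (f y)) U := hf.log fun y hy => (hf0 y hy).ne'
  have hΓd : ∀ b, DifferentiableAt ℝ (gammaLow g b) x := by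
    intro b
    have h2 : ContDiffOn ℝ 1 (gammaLow g b) U :=
      ((ContDiffOn.pd G.isOpen (by norm_num : (1 : WithTop ℕ∞) + 1 ≤ 2) hlog b).const_smul (2 : ℝ)).congr
        fun y hy => hΓ b y hy
    exact (h2.contDiffAt (G.isOpen.mem_nhds hx)).differentiableAt (by norm_num)
  have h2 : ∀ a b, pd a (pd b f) x = (1 / 2 * f x) * (pd a (gammaLow g b) x
      + (1 / 2) * (gammaLow g a x * gammaLow g b x)) := by
    intro a b
    rw [pd_congr_on G.isOpen (h1 b) x hx, pd_const_mul ((hfd x hx).fun_mul (hΓd b)),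
      pd_mul (hfd x hx) (hΓd b), h1 a x hx]
    ring
  have h3 := hL x hx
  unfold confLap at h3
  rw [G.laplaceBeltrami_eq hpos hf hx] at h3
  simp only [h2, h1 _ x hx] at h3
  rw [ctr_const_mul, ctr_add, ctr_const_mul, ip_const_mul_right, ip_const_mul_right] at h3
  change -(_ * (_ + 1 / 2 * ip (ginv g x) (fun a => gammaLow g a x) fun a => gammaLow g a x)) + _ + _ = _ at h3
  have h4 := (hf0 x hx).ne'
  generalize ip (ginv g x) (fun a => gammaLow g a x) (fun a => gammaLow g a x) = q at *
  generalize ctr (ginv g x) (fun a b => pd a (gammaLow g b) x) = p at *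
  generalize scalarCurv g x = S at *
  field_simp
  field_simp at h3
  have h5 : f x * (2 * (S * (n - 2)) - 2 * ((n - 1) * (2 * p - q))) = 0 := by
    linear_combination h3 / 2
  have h6 := (mul_eq_zero.1 h5).resolve_left h4
  linear_combination h6 / 2

end GoodMet

end CurvatureFormulas

section ConformalInvariance

variable {n : ℕ} {U : Set (Pt n)}

/-- `g' = φ g` on `U` for a positive `C²` function `φ`. -/
structure ConfMet (g g' : Met n) (φ : Pt n → ℝ) (U : Set (Pt n)) : Prop where
  good : GoodMet g U
  good' : GoodMet g' U
  smooth : ContDiffOn ℝ 2 φ U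
  pos : ∀ x ∈ U, 0 < φ x
  eq : ∀ x ∈ U, ∀ a b, g' x a b = φ x * g x a b

namespace ConfMet

/-- The one-form `d (log φ) / 2`. -/
def form (φ : Pt n → ℝ) (a : Fin n) (x : Pt n) : ℝ := (1 / 2) * pd a (fun y => Real.log (φ y)) x

variable {g g' : Met n} {φ : Pt n → ℝ} (C : ConfMet g g' φ U)
include C

theorem log_smooth : ContDiffOn ℝ 2 (fun y => Real.log (φ y)) U :=
  C.smooth.log fun y hy => (C.pos y hy).ne'

theorem form_diff {x : Pt n} (hx : x ∈ U) (a : Fin n) : DifferentiableAt ℝ (form φ a) x :=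
  (((ContDiffOn.pd C.good.isOpen (by norm_num : (1 : WithTop ℕ∞) + 1 ≤ 2) C.log_smooth a).contDiffAt
    (C.good.isOpen.mem_nhds hx)).differentiableAt (by norm_num)).const_mul _

theorem diff {x : Pt n} (hx : x ∈ U) : DifferentiableAt ℝ φ x :=
  (C.smooth.contDiffAt (C.good.isOpen.mem_nhds hx)).differentiableAt (by norm_num)

theorem pd_factor {x : Pt n} (hx : x ∈ U) (a : Fin n) : pd a φ x = 2 * (φ x * form φ a x) := by
  unfold form
  rw [pd_comp (Real.hasDerivAt_log (C.pos x hx).ne') (C.diff hx)]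
  have := (C.pos x hx).ne'
  field_simp

theorem jetV_eq {x : Pt n} (hx : x ∈ U) (c a b : Fin n) :
    jetV g' x c a b = φ x * (jetV g x c a b + 2 * form φ c x * g x a b) := by
  unfold jetV
  rw [pd_congr_on C.good.isOpen (fun y hy => C.eq y hy a b) x hx,
    pd_mul (C.diff hx) (C.good.diff hx a b), C.pd_factor hx]
  ring

theorem jetH_eq {x : Pt n} (hx : x ∈ U) (i j a b : Fin n) : jetH g' x i j a b =
    φ x * (jetH g x i j a b + 2 * form φ i x * jetV g x j a b + 2 * form φ j x * jetV g x i a b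
      + (2 * pd i (form φ j) x + 4 * form φ i x * form φ j x) * g x a b) := by
  have h1 := (C.form_diff hx j).const_mul 2
  have h2 := h1.fun_mul (C.good.diff hx a b)
  have h3 := C.good.jetV_diff hx j a b
  unfold jetH
  rw [pd_congr_on C.good.isOpen (fun y hy => C.jetV_eq hy j a b) x hx,
    pd_mul (C.diff hx) (h3.fun_add h2), pd_add h3 h2, pd_mul h1 (C.good.diff hx a b),
    pd_const_mul (C.form_diff hx j), C.pd_factor hx]
  change _ = φ x * (_ + 2 * _ * _ + 2 * _ * (pd i (fun y => g y a b) x) + _)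
  ring

theorem ginv_eq {x : Pt n} (hx : x ∈ U) : ginv g' x = fun a b => (φ x)⁻¹ * ginv g x a b := by
  have h : g' x = φ x • g x := by
    ext a b
    exact C.eq x hx a b
  have h0 := (C.pos x hx).ne'
  funext a b
  unfold ginv
  rw [h]
  have : (φ x • g x)⁻¹ = (φ x)⁻¹ • (g x)⁻¹ := by
    refine Matrix.inv_eq_left_inv ?_
    rw [Matrix.smul_mul, Matrix.mul_smul, smul_smul, inv_mul_cancel₀ h0, one_smul,
      Matrix.nonsing_inv_mul _ (isUnit_iff_ne_zero.2 (C.good.det_ne x hx))]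
  rw [this]
  rfl

theorem met_eq {x : Pt n} (hx : x ∈ U) : (fun a b => g' x a b) = fun a b => φ x * g x a b :=
  funext fun a => funext fun b => C.eq x hx a b

theorem curv_eq {x : Pt n} (hx : x ∈ U) :
    (fun a b c d => rlin (jetH g' x) a b c d + rquad (ginv g' x) (jetV g' x) a b c d) =
      fun a b c d => φ x * ((rlin (jetH g x) a b c d + rquad (ginv g x) (jetV g x) a b c d)
        + kn (fun a b => g x a b) (confX (fun a b => g x a b) (ginv g x) (jetV g x)
          (fun a => form φ a x) fun a b => pd a (form φ b) x) a b c d) := by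
  have hV : jetV g' x = fun c a b => φ x * (jetV g x c a b + 2 * form φ c x * g x a b) :=
    funext fun c => funext fun a => funext fun b => C.jetV_eq hx c a b
  have hH : jetH g' x = fun i j a b => φ x * (jetH g x i j a b + 2 * form φ i x * jetV g x j a b
      + 2 * form φ j x * jetV g x i a b
      + (2 * pd i (form φ j) x + 4 * form φ i x * form φ j x) * g x a b) :=
    funext fun i => funext fun j => funext fun a => funext fun b => C.jetH_eq hx i j a b
  funext a b c d
  rw [hV, hH, C.ginv_eq hx]
  exact riem_conf (C.good.pair hx) (C.pos x hx).ne' (N := fun a b => pd a (form φ b) x)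
    (υ := fun a => form φ a x) (fun c a b => C.good.jetV_symm hx c a b) a b c d

/-- Conformal invariance of the Weyl tensor. -/
theorem weylUp_eq (hn : 3 ≤ n) {x : Pt n} (hx : x ∈ U) (a b c d : Fin n) :
    weylUp g' a b c d x = weylUp g a b c d x := by
  rw [C.good'.weylUp_eq hn hx, C.good.weylUp_eq hn hx, C.met_eq hx, C.curv_eq hx, C.ginv_eq hx]
  refine (weylCU_conf (fun a b => g x a b) (ginv g x) (C.pos x hx).ne' _ a b c d).trans ?_
  refine (weylCU_add _ _ _ _ a b c d).trans (add_eq_left.2 ?_)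
  unfold weylCU
  simp only [weylC_kn (C.good.pair hx) hn, mul_zero, Finset.sum_const_zero]

theorem gammaLow_eq {x : Pt n} (hx : x ∈ U) (a : Fin n) :
    gammaLow g' a x = gammaLow g a x - ((n : ℝ) - 2) * form φ a x := by
  have h0 := (C.pos x hx).ne'
  have P := C.good.pair hx
  have h1 : (fun c d => jetV g' x c d a) = fun c d => φ x * (jetV g x c d a + form φ c x * (2 * g x d a)) := by
    funext c d
    rw [C.jetV_eq hx]
    ring
  have h2 : jetV g' x a = fun c d => φ x * (jetV g x a c d + 2 * form φ a x * g x c d) := by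
    funext c d
    rw [C.jetV_eq hx]
  have h3 : ctr (ginv g x) (fun c d => form φ c x * (2 * g x d a)) = 2 * form φ a x := by
    change ip (ginv g x) _ (fun d => 2 * g x d a) = _
    rw [ip_const_mul_right, P.ip_right]
  have h4 : ctr (ginv g x) (fun c d => 2 * form φ a x * g x c d) = 2 * form φ a x * n :=
    (ctr_const_mul _ (fun c d => g x c d) _).trans (by rw [P.ctr_self])
  rw [C.good'.gammaLow_eq' hx, C.good.gammaLow_eq' hx, C.ginv_eq hx, ctr_scale, ctr_scale, h1, h2,
    ctr_const_mul, ctr_const_mul, inv_mul_cancel_left₀ h0, inv_mul_cancel_left₀ h0, ctr_add, ctr_add,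
    h3, h4]
  ring

theorem scalarCurv_eq {x : Pt n} (hx : x ∈ U) : scalarCurv g' x =
    (φ x)⁻¹ * (scalarCurv g x + 2 * ((n : ℝ) - 1) *
      (-ctr (ginv g x) (fun a b => pd a (form φ b) x)
        + ip (ginv g x) (fun a => gammaLow g a x) (fun a => form φ a x)
        - ((n : ℝ) - 2) / 2 * ip (ginv g x) (fun a => form φ a x) fun a => form φ a x)) := by
  rw [C.good'.scalarCurv_eq hx, C.good.scalarCurv_eq hx, C.curv_eq hx, C.ginv_eq hx,
    scalC_conf _ (C.pos x hx).ne', scalC_add, scalC_kn (C.good.pair hx), ctr_confX (C.good.pair hx)]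
  have key : ctr (ginv g x) (fun a b => ip (ginv g x) (chl (jetV g x) a b) fun a => form φ a x) =
      ip (ginv g x) (fun a => gammaLow g a x) fun a => form φ a x := by
    simp only [C.good.gammaLow_eq hx]
    unfold ip ctr
    simp only [Finset.mul_sum, Finset.sum_mul]
    calc _ = ∑ a, ∑ e, ∑ f, ∑ b, ginv g x a b * (ginv g x e f * (chl (jetV g x) a b e * form φ f x)) := by
          refine Finset.sum_congr rfl fun a _ => ?_
          rw [Finset.sum_comm]
          exact Finset.sum_congr rfl fun e _ => Finset.sum_comm
      _ = ∑ e, ∑ f, ∑ a, ∑ b, ginv g x a b * (ginv g x e f * (chl (jetV g x) a b e * form φ f x)) := by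
          rw [Finset.sum_comm]
          exact Finset.sum_congr rfl fun e _ => Finset.sum_comm
      _ = _ := by
          refine Finset.sum_congr rfl fun e _ => Finset.sum_congr rfl fun f _ => ?_
          refine Finset.sum_congr rfl fun a _ => Finset.sum_congr rfl fun b _ => ?_
          ring
  rw [key]

/-- The scalar gauge equation is conformally invariant. -/
theorem scalarCurv_gauge (hn : 3 ≤ n) {x : Pt n} (hx : x ∈ U)
    (hΓ : ∀ b, DifferentiableAt ℝ (gammaLow g b) x)
    (h : scalarCurv g x = 2 * ((n : ℝ) - 1) / ((n : ℝ) - 2) *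
      (ctr (ginv g x) (fun a b => pd a (gammaLow g b) x)
        - (1 / 2) * ip (ginv g x) (fun a => gammaLow g a x) fun a => gammaLow g a x)) :
    scalarCurv g' x = 2 * ((n : ℝ) - 1) / ((n : ℝ) - 2) *
      (ctr (ginv g' x) (fun a b => pd a (gammaLow g' b) x)
        - (1 / 2) * ip (ginv g' x) (fun a => gammaLow g' a x) fun a => gammaLow g' a x) := by
  have h0 : (3 : ℝ) ≤ n := by exact_mod_cast hn
  have n2 : (n : ℝ) - 2 ≠ 0 := by linarith
  have h1 : ∀ a b, pd a (gammaLow g' b) x = pd a (gammaLow g b) x - ((n : ℝ) - 2) * pd a (form φ b) x := by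
    intro a b
    rw [pd_congr_on C.good.isOpen (fun y hy => C.gammaLow_eq hy b) x hx,
      pd_sub (hΓ b) ((C.form_diff hx b).const_mul _), pd_const_mul (C.form_diff hx b)]
  have P := C.good.pair hx
  rw [C.scalarCurv_eq hx, h, C.ginv_eq hx]
  simp only [h1, C.gammaLow_eq hx, ctr_scale, ip_scale, ctr_sub, ctr_const_mul, ip_sub_left, ip_sub_right,
    ip_const_mul_left, ip_const_mul_right]
  rw [ip_comm P.symm' (fun a => form φ a x) fun a => gammaLow g a x]
  field_simp
  ring

end ConfMet

end ConformalInvariance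

section Gauge

variable {n : ℕ} {U : Set (Pt n)}

/-- A unimodular metric whose contracted Christoffel symbols form an exact one-form that controls the
scalar curvature. -/
structure UnimodularGauge (h : Met n) (ψ : Pt n → ℝ) (U : Set (Pt n)) : Prop extends GoodMet h U where
  det_one : ∀ x ∈ U, (h x).det = 1
  potential_smooth : ContDiffOn ℝ 2 ψ U
  gamma : ∀ a, ∀ x ∈ U, gammaLow h a x = pd a ψ x
  scal : ∀ x ∈ U, scalarCurv h x = 2 * ((n : ℝ) - 1) / ((n : ℝ) - 2) *
    (ctr (ginv h x) (fun a b => pd a (gammaLow h b) x)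
      - (1 / 2) * ip (ginv h x) (fun a => gammaLow h a x) fun a => gammaLow h a x)

namespace UnimodularGauge

variable {h : Met n} {ψ : Pt n → ℝ} (N : UnimodularGauge h ψ U)
include N

theorem ctr_jetV {x : Pt n} (hx : x ∈ U) (c : Fin n) : ctr (ginv h x) (jetV h x c) = 0 := by
  have h1 := N.toGoodMet.pd_det_eq hx c
  rw [N.det_one x hx, one_mul, pd_congr_on N.isOpen N.det_one x hx] at h1
  rw [← h1]
  exact pd_const

theorem ctr_jetH {x : Pt n} (hx : x ∈ U) (d c : Fin n) :
    ctr (ginv h x) (jetH h x d c) - ctr₂ (ginv h x) (jetV h x d) (jetV h x c) = 0 := by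
  have h1 := N.toGoodMet.pd_ctr hx (T := fun a b y => jetV h y c a b)
    (fun a b => N.toGoodMet.jetV_diff hx c a b) d
  rw [pd_congr_on (g := fun _ => 0) N.isOpen (fun y hy => N.ctr_jetV hy c) x hx, pd_const] at h1
  exact h1.symm

theorem gammaLow_ctr {x : Pt n} (hx : x ∈ U) (a : Fin n) :
    gammaLow h a x = ctr (ginv h x) fun c d => jetV h x c d a := by
  rw [N.toGoodMet.gammaLow_eq' hx, N.ctr_jetV hx, mul_zero, sub_zero]

theorem pd_gammaLow {x : Pt n} (hx : x ∈ U) (b a : Fin n) : pd b (gammaLow h a) x =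
    ctr (ginv h x) (fun c d => jetH h x b c d a)
      - ctr₂ (ginv h x) (jetV h x b) fun c d => jetV h x c d a := by
  rw [pd_congr_on N.isOpen (fun y hy => N.gammaLow_ctr hy a) x hx]
  exact N.toGoodMet.pd_ctr hx (T := fun c d y => jetV h y c d a) (fun c d => N.toGoodMet.jetV_diff hx c d a) b

theorem gamma_closed {x : Pt n} (hx : x ∈ U) (a b : Fin n) :
    pd a (gammaLow h b) x = pd b (gammaLow h a) x := by
  rw [pd_congr_on N.isOpen (N.gamma a) x hx, pd_congr_on N.isOpen (N.gamma b) x hx]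
  exact pd_comm (N.potential_smooth.contDiffAt (N.isOpen.mem_nhds hx)) a b

end UnimodularGauge

section normalization

variable {g : Met n}

theorem IsMetricOn.det_pos (hgm : IsMetricOn g U) {x : Pt n} (hx : x ∈ U) : 0 < (g x).det :=
  (hgm x hx).2.det_pos

theorem IsMetricOn.goodMet (hgm : IsMetricOn g U) (hU : IsOpen U)
    (hg : ∀ a b, ContDiffOn ℝ 2 (fun x => g x a b) U) : GoodMet g U :=
  ⟨hU, hg, fun _ hx => (hgm.det_pos hx).ne', fun x hx => (hgm x hx).1⟩

theorem dnorm_det (hn : 0 < n) (hgm : IsMetricOn g U) {x : Pt n} (hx : x ∈ U) : (dnorm g x).det = 1 := by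
  have h0 := hgm.det_pos hx
  have h1 : (n : ℝ) ≠ 0 := by positivity
  unfold dnorm
  rw [Matrix.det_smul, Fintype.card_fin, ← Real.rpow_natCast, ← Real.rpow_mul h0.le,
    div_mul_cancel₀ _ h1, Real.rpow_neg_one, inv_mul_cancel₀ h0.ne']

theorem dnorm_conf (hn : 0 < n) (hU : IsOpen U) (hgm : IsMetricOn g U)
    (hg : ∀ a b, ContDiffOn ℝ 2 (fun x => g x a b) U) :
    ConfMet g (dnorm g) (fun x => (g x).det ^ (-(1 : ℝ) / (n : ℝ))) U := by
  have hφ : ContDiffOn ℝ 2 (fun x => (g x).det ^ (-(1 : ℝ) / (n : ℝ))) U :=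
    (contDiffOn_det hg).rpow_const_of_ne fun x hx => (hgm.det_pos hx).ne'
  refine ⟨hgm.goodMet hU hg, ⟨hU, fun a b => ?_, fun x hx => ?_, fun x hx => ?_⟩, hφ,
    fun x hx => Real.rpow_pos_of_pos (hgm.det_pos hx) _, fun x hx a b => rfl⟩
  · exact hφ.mul (hg a b)
  · rw [dnorm_det hn hgm hx]
    exact one_ne_zero
  · exact (hgm x hx).1.smul _

theorem ConfHarmonicGauge.unimodular (hn : 3 ≤ n) (hU : IsOpen U) (hgm : IsMetricOn g U)
    (hg : ∀ a b, ContDiffOn ℝ 2 (fun x => g x a b) U) (hgauge : ConfHarmonicGauge g U) :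
    ∃ ψ, UnimodularGauge (dnorm g) ψ U := by
  obtain ⟨f, hf, hf0, hL, hΓ⟩ := hgauge
  have C := dnorm_conf (by omega) hU hgm hg
  set φ : Pt n → ℝ := fun x => (g x).det ^ (-(1 : ℝ) / (n : ℝ)) with hφ
  have hlf : ContDiffOn ℝ 2 (fun y => Real.log (f y)) U := hf.log fun y hy => (hf0 y hy).ne'
  have hd : ∀ {u : Pt n → ℝ}, ContDiffOn ℝ 2 u U → ∀ {x}, x ∈ U → DifferentiableAt ℝ u x :=
    fun hu _ hx => (hu.contDiffAt (hU.mem_nhds hx)).differentiableAt (by norm_num)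
  have hΓd : ∀ {x}, x ∈ U → ∀ b, DifferentiableAt ℝ (gammaLow g b) x := by
    intro x hx b
    have h1 : DifferentiableAt ℝ (pd b fun y => Real.log (f y)) x :=
      ((ContDiffOn.pd hU (by norm_num : (1 : WithTop ℕ∞) + 1 ≤ 2) hlf b).contDiffAt
        (hU.mem_nhds hx)).differentiableAt (by norm_num)
    refine (h1.const_mul 2).congr_of_eventuallyEq ?_
    filter_upwards [hU.mem_nhds hx] with y hy using hΓ b y hy
  refine ⟨fun y => 2 * Real.log (f y) - ((n : ℝ) - 2) / 2 * Real.log (φ y), C.good', ?_, ?_, ?_, ?_⟩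
  · exact fun x hx => dnorm_det (by omega) hgm hx
  · exact (contDiffOn_const.mul hlf).sub (contDiffOn_const.mul C.log_smooth)
  · intro a x hx
    rw [C.gammaLow_eq hx, hΓ a x hx, pd_sub ((hd hlf hx).const_mul 2) ((hd C.log_smooth hx).const_mul _),
      pd_const_mul (hd hlf hx), pd_const_mul (hd C.log_smooth hx)]
    unfold ConfMet.form
    ring
  · exact fun x hx => C.scalarCurv_gauge hn hx (hΓd hx)
      (C.good.scalarCurv_gauge hn (fun y hy => hgm.det_pos hy) hf hf0 hL hΓ hx)

end normalization

end Gauge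

section PolynomialSystems

variable {n : ℕ}

/-- Indices for the entries of a metric. -/
abbrev Idx (n : ℕ) := Fin n × Fin n

/-- `F` is a polynomial function. -/
def PolyFn (F : (Idx n → ℝ) → ℝ) : Prop :=
  ∃ P : MvPolynomial (Idx n) ℝ, ∀ u, MvPolynomial.eval u P = F u

namespace PolyFn

variable {F F' : (Idx n → ℝ) → ℝ}

theorem const (c : ℝ) : PolyFn fun _ : Idx n → ℝ => c := ⟨MvPolynomial.C c, fun u => by simp⟩

theorem atom (a b : Fin n) : PolyFn fun u : Idx n → ℝ => u (a, b) := ⟨MvPolynomial.X (a, b), fun u => by simp⟩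

theorem adjugate (a b : Fin n) :
    PolyFn fun u : Idx n → ℝ => (Matrix.of fun i j => u (i, j)).adjugate a b := by
  refine ⟨(Matrix.of fun i j => (MvPolynomial.X (i, j) : MvPolynomial (Idx n) ℝ)).adjugate a b, fun u => ?_⟩
  have h1 := RingHom.map_adjugate (MvPolynomial.eval u)
    (Matrix.of fun i j => (MvPolynomial.X (i, j) : MvPolynomial (Idx n) ℝ))
  have h2 := congrFun (congrFun h1 a) b
  rw [RingHom.mapMatrix_apply, Matrix.map_apply] at h2
  rw [h2]
  have h3 : (MvPolynomial.eval u).mapMatrix (Matrix.of fun i j => (MvPolynomial.X (i, j) : MvPolynomial (Idx n) ℝ)) =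
      Matrix.of fun i j => u (i, j) := by
    ext i j
    simp
  rw [h3]

end PolyFn

/-- `F` is linear in the second-order jet with polynomial coefficients. -/
def IsPrin (F : (Idx n → ℝ) → (Fin n → Fin n → Fin n → Fin n → ℝ) → ℝ) : Prop :=
  ∃ A : Idx n → Fin n → Fin n → MvPolynomial (Idx n) ℝ, ∀ u H,
    ∑ J, ∑ i, ∑ j, MvPolynomial.eval u (A J i j) * H i j J.1 J.2 = F u H

namespace IsPrin

variable {F F' : (Idx n → ℝ) → (Fin n → Fin n → Fin n → Fin n → ℝ) → ℝ}

theorem atom (i j a b : Fin n) : IsPrin fun (_ : Idx n → ℝ) H => H i j a b := by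
  refine ⟨fun J i' j' => if J = (a, b) then if i' = i then if j' = j then 1 else 0 else 0 else 0,
    fun u H => ?_⟩
  rw [Finset.sum_eq_single (a, b), Finset.sum_eq_single i, Finset.sum_eq_single j]
  · simp
  · intro j' _ hj
    simp [hj]
  · simp
  · intro i' _ hi
    simp [hi]
  · simp
  · intro J _ hJ
    simp [hJ]
  · simp

theorem add (h : IsPrin F) (h' : IsPrin F') : IsPrin fun u H => F u H + F' u H := by
  obtain ⟨A, hA⟩ := h
  obtain ⟨A', hA'⟩ := h'
  refine ⟨fun J i j => A J i j + A' J i j, fun u H => ?_⟩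
  simp only [map_add, add_mul, Finset.sum_add_distrib, hA, hA']

theorem poly_mul {p : (Idx n → ℝ) → ℝ} (hp : PolyFn p) (h : IsPrin F) : IsPrin fun u H => p u * F u H := by
  obtain ⟨P, hP⟩ := hp
  obtain ⟨A, hA⟩ := h
  refine ⟨fun J i j => P * A J i j, fun u H => ?_⟩
  simp only [map_mul, hP, ← hA, Finset.mul_sum, mul_assoc]

theorem mul_poly {p : (Idx n → ℝ) → ℝ} (hp : PolyFn p) (h : IsPrin F) : IsPrin fun u H => F u H * p u := by
  simpa only [mul_comm] using h.poly_mul hp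

theorem const_mul (c : ℝ) (h : IsPrin F) : IsPrin fun u H => c * F u H := h.poly_mul (PolyFn.const c)

theorem sub (h : IsPrin F) (h' : IsPrin F') : IsPrin fun u H => F u H - F' u H := by
  simpa only [neg_one_mul, ← sub_eq_add_neg] using h.add (h'.const_mul (-1))

theorem sum {κ : Type*} (s : Finset κ) {F : κ → (Idx n → ℝ) → (Fin n → Fin n → Fin n → Fin n → ℝ) → ℝ}
    (h : ∀ t, IsPrin (F t)) : IsPrin fun u H => ∑ t ∈ s, F t u H := by
  choose A hA using h
  refine ⟨fun J i j => ∑ t ∈ s, A t J i j, fun u H => ?_⟩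
  simp only [← hA, map_sum, Finset.sum_mul]
  symm
  refine Finset.sum_comm.trans (Finset.sum_congr rfl fun J _ => ?_)
  refine Finset.sum_comm.trans (Finset.sum_congr rfl fun i _ => ?_)
  exact Finset.sum_comm

theorem ctr {M : (Idx n → ℝ) → Fin n → Fin n → ℝ} (hM : ∀ a b, PolyFn fun u => M u a b)
    {T : Fin n → Fin n → (Idx n → ℝ) → (Fin n → Fin n → Fin n → Fin n → ℝ) → ℝ}
    (hT : ∀ a b, IsPrin (T a b)) : IsPrin fun u H => _root_.ctr (M u) fun a b => T a b u H :=
  sum Finset.univ fun a => sum Finset.univ fun b => (hT a b).poly_mul (hM a b)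

end IsPrin

/-- `F` is polynomial in the first-order jet, homogeneous of degree `k` in the derivatives. -/
def IsHom (k : ℕ) (F : (Idx n → ℝ) → (Fin n → Fin n → Fin n → ℝ) → ℝ) : Prop :=
  (∃ L : MvPolynomial (Idx n ⊕ Idx n × Fin n) ℝ, ∀ u V,
    MvPolynomial.eval (Sum.elim u fun p => V p.2 p.1.1 p.1.2) L = F u V) ∧
  ∀ (c : ℝ) u V, F u (fun d a b => c * V d a b) = c ^ k * F u V

namespace IsHom

variable {k l : ℕ} {F F' : (Idx n → ℝ) → (Fin n → Fin n → Fin n → ℝ) → ℝ}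

theorem of_poly {p : (Idx n → ℝ) → ℝ} (hp : PolyFn p) : IsHom 0 fun u (_ : Fin n → Fin n → Fin n → ℝ) => p u := by
  obtain ⟨P, hP⟩ := hp
  refine ⟨⟨MvPolynomial.rename Sum.inl P, fun u V => ?_⟩, fun c u V => by simp⟩
  rw [MvPolynomial.eval_rename]
  exact hP u

theorem atom (d a b : Fin n) : IsHom 1 fun (_ : Idx n → ℝ) V => V d a b :=
  ⟨⟨MvPolynomial.X (Sum.inr ((a, b), d)), fun u V => by simp⟩, fun c u V => by simp⟩

theorem zero : IsHom k fun (_ : Idx n → ℝ) (_ : Fin n → Fin n → Fin n → ℝ) => 0 :=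
  ⟨⟨0, fun u V => by simp⟩, fun c u V => by simp⟩

theorem add (h : IsHom k F) (h' : IsHom k F') : IsHom k fun u V => F u V + F' u V := by
  obtain ⟨⟨L, hL⟩, h2⟩ := h
  obtain ⟨⟨L', hL'⟩, h2'⟩ := h'
  exact ⟨⟨L + L', fun u V => by rw [map_add, hL, hL']⟩, fun c u V => by
    beta_reduce
    rw [h2, h2', mul_add]⟩

theorem mul (h : IsHom k F) (h' : IsHom l F') : IsHom (k + l) fun u V => F u V * F' u V := by
  obtain ⟨⟨L, hL⟩, h2⟩ := h
  obtain ⟨⟨L', hL'⟩, h2'⟩ := h'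
  exact ⟨⟨L * L', fun u V => by rw [map_mul, hL, hL']⟩, fun c u V => by
    beta_reduce
    rw [h2, h2', pow_add]
    ring⟩

theorem poly_mul {p : (Idx n → ℝ) → ℝ} (hp : PolyFn p) (h : IsHom k F) : IsHom k fun u V => p u * F u V := by
  simpa only [zero_add] using (of_poly hp).mul h

theorem mul_poly {p : (Idx n → ℝ) → ℝ} (hp : PolyFn p) (h : IsHom k F) : IsHom k fun u V => F u V * p u :=
  h.mul (of_poly hp)

theorem const_mul (c : ℝ) (h : IsHom k F) : IsHom k fun u V => c * F u V := h.poly_mul (PolyFn.const c)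

theorem sub (h : IsHom k F) (h' : IsHom k F') : IsHom k fun u V => F u V - F' u V := by
  simpa only [neg_one_mul, ← sub_eq_add_neg] using h.add (h'.const_mul (-1))

theorem sum {κ : Type*} (s : Finset κ) {F : κ → (Idx n → ℝ) → (Fin n → Fin n → Fin n → ℝ) → ℝ}
    (h : ∀ t, IsHom k (F t)) : IsHom k fun u V => ∑ t ∈ s, F t u V := by
  refine ⟨?_, fun c u V => ?_⟩
  · choose L hL using fun t => (h t).1
    exact ⟨∑ t ∈ s, L t, fun u V => by rw [map_sum]; simp only [hL]⟩
  · rw [Finset.mul_sum]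
    exact Finset.sum_congr rfl fun t _ => (h t).2 c u V

theorem ctr {M T : Fin n → Fin n → (Idx n → ℝ) → (Fin n → Fin n → Fin n → ℝ) → ℝ}
    (hM : ∀ a b, IsHom k (M a b)) (hT : ∀ a b, IsHom l (T a b)) :
    IsHom (k + l) fun u V => _root_.ctr (fun a b => M a b u V) fun a b => T a b u V :=
  sum _ fun a => sum _ fun b => (hM a b).mul (hT a b)

theorem poly_ctr {M : (Idx n → ℝ) → Fin n → Fin n → ℝ} (hM : ∀ a b, PolyFn fun u => M u a b)
    {T : Fin n → Fin n → (Idx n → ℝ) → (Fin n → Fin n → Fin n → ℝ) → ℝ}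
    (hT : ∀ a b, IsHom k (T a b)) : IsHom k fun u V => _root_.ctr (M u) fun a b => T a b u V :=
  sum _ fun a => sum _ fun b => (hT a b).poly_mul (hM a b)

theorem ip {M : (Idx n → ℝ) → Fin n → Fin n → ℝ} (hM : ∀ a b, PolyFn fun u => M u a b)
    {X Y : Fin n → (Idx n → ℝ) → (Fin n → Fin n → Fin n → ℝ) → ℝ} (hX : ∀ a, IsHom k (X a))
    (hY : ∀ a, IsHom l (Y a)) :
    IsHom (k + l) fun u V => _root_.ip (M u) (fun a => X a u V) fun a => Y a u V :=
  poly_ctr hM fun a b => (hX a).mul (hY b)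

theorem ctr₂ {M : (Idx n → ℝ) → Fin n → Fin n → ℝ} (hM : ∀ a b, PolyFn fun u => M u a b)
    {W T : Fin n → Fin n → (Idx n → ℝ) → (Fin n → Fin n → Fin n → ℝ) → ℝ}
    (hW : ∀ a b, IsHom k (W a b)) (hT : ∀ a b, IsHom l (T a b)) :
    IsHom (k + l) fun u V => _root_.ctr₂ (M u) (fun a b => W a b u V) fun a b => T a b u V :=
  ctr (fun a b => sum _ fun e => sum _ fun f => ((hW e f).poly_mul (hM a e)).mul_poly (hM f b)) hT

theorem chl (a d e : Fin n) : IsHom 1 fun (_ : Idx n → ℝ) V => _root_.chl V a d e :=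
  (((atom a d e).add (atom d a e)).sub (atom e a d)).const_mul _

theorem rquad {M : (Idx n → ℝ) → Fin n → Fin n → ℝ} (hM : ∀ a b, PolyFn fun u => M u a b)
    (a b c d : Fin n) : IsHom 2 fun u V => _root_.rquad (M u) V a b c d :=
  (ip hM (fun e => chl b d e) fun e => chl a c e).sub (ip hM (fun e => chl a d e) fun e => chl b c e)

end IsHom

/-- Polynomial data determines a quasilinear system. -/
theorem QLSystem.exists_of_functions {σ : Type*}
    {F : σ → (Idx n → ℝ) → (Fin n → Fin n → Fin n → Fin n → ℝ) → ℝ}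
    {L : σ → (Idx n → ℝ) → (Fin n → Fin n → Fin n → ℝ) → ℝ}
    (hF : ∀ s, IsPrin (F s)) (hL : ∀ s, IsHom 2 (L s)) :
    ∃ P : QLSystem n (Idx n) σ,
      (∀ v s (H : Fin n → Fin n → Fin n → Fin n → ℝ),
        ∑ J, ∑ i, ∑ j, P.coeff v s J i j * H i j J.1 J.2 = F s v H) ∧
      ∀ s v (V : Fin n → Fin n → Fin n → ℝ),
        MvPolynomial.eval (Sum.elim v fun p => V p.2 p.1.1 p.1.2) (P.L s) = L s v V := by
  choose A hA using hF
  choose B hB using fun s => (hL s).1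
  refine ⟨⟨A, B, fun s c u W => ?_⟩, fun v s H => hA s v H, hB⟩
  have h1 := hB s u fun d a b => c * W ((a, b), d)
  have h2 := hB s u fun d a b => W ((a, b), d)
  rw [(hL s).2, ← h2] at h1
  exact h1

end PolynomialSystems

section EllipticSystem

variable {n : ℕ}

theorem IsPrin.weylCU {M : (Idx n → ℝ) → Fin n → Fin n → ℝ} (hM : ∀ a b, PolyFn fun u => M u a b)
    {R : Fin n → Fin n → Fin n → Fin n → (Idx n → ℝ) → (Fin n → Fin n → Fin n → Fin n → ℝ) → ℝ}
    (hR : ∀ a b c d, IsPrin (R a b c d)) (a b c d : Fin n) :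
    IsPrin fun u H => weylCU (fun a b => u (a, b)) (M u) (fun a b c d => R a b c d u H) a b c d := by
  have hric : ∀ b c, IsPrin fun u H => ricC (M u) (fun a b c d => R a b c d u H) b c := fun b c =>
    IsPrin.ctr hM fun a d => hR a b c d
  have hscal : IsPrin fun u H => scalC (M u) (fun a b c d => R a b c d u H) := IsPrin.ctr hM hric
  have hh := PolyFn.atom (n := n)
  refine IsPrin.sum Finset.univ fun e => IsPrin.poly_mul (hM d e) ?_
  refine IsPrin.sub (IsPrin.add (hR a b c e) (IsPrin.const_mul _ ?_)) ?_
  · exact ((((hric a c).mul_poly (hh b e)).sub ((hric b c).mul_poly (hh a e))).add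
      ((hric b e).mul_poly (hh a c))).sub ((hric a e).mul_poly (hh b c))
  · have h1 := ((hscal.mul_poly (hh a c)).mul_poly (hh b e)).sub ((hscal.mul_poly (hh b c)).mul_poly (hh a e))
    convert h1.const_mul (1 / (((n : ℝ) - 1) * ((n : ℝ) - 2))) using 3
    ring

theorem IsHom.weylCU {k : ℕ} {M : (Idx n → ℝ) → Fin n → Fin n → ℝ} (hM : ∀ a b, PolyFn fun u => M u a b)
    {R : Fin n → Fin n → Fin n → Fin n → (Idx n → ℝ) → (Fin n → Fin n → Fin n → ℝ) → ℝ}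
    (hR : ∀ a b c d, IsHom k (R a b c d)) (a b c d : Fin n) :
    IsHom k fun u V => weylCU (fun a b => u (a, b)) (M u) (fun a b c d => R a b c d u V) a b c d := by
  have hric : ∀ b c, IsHom k fun u V => ricC (M u) (fun a b c d => R a b c d u V) b c := fun b c =>
    IsHom.poly_ctr hM fun a d => hR a b c d
  have hscal : IsHom k fun u V => scalC (M u) (fun a b c d => R a b c d u V) := IsHom.poly_ctr hM hric
  have hh := PolyFn.atom (n := n)
  refine IsHom.sum Finset.univ fun e => IsHom.poly_mul (hM d e) ?_
  refine IsHom.sub (IsHom.add (hR a b c e) (IsHom.const_mul _ ?_)) ?_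
  · exact ((((hric a c).mul_poly (hh b e)).sub ((hric b c).mul_poly (hh a e))).add
      ((hric b e).mul_poly (hh a c))).sub ((hric a e).mul_poly (hh b c))
  · have h1 := ((hscal.mul_poly (hh a c)).mul_poly (hh b e)).sub ((hscal.mul_poly (hh b c)).mul_poly (hh a e))
    convert h1.const_mul (1 / (((n : ℝ) - 1) * ((n : ℝ) - 2))) using 3
    ring

/-- Symmetrization of a two-tensor. -/
def symT (v : Fin n → Fin n → ℝ) (a b : Fin n) : ℝ := (1 / 2) * (v a b + v b a)

/-- Indices of the equations: derivatives of the unimodularity condition, closedness of the gauge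
one-form, the scalar gauge equation, the Weyl tensor, and symmetry of the metric. -/
abbrev EqIdx (n : ℕ) := Idx n ⊕ Idx n ⊕ Unit ⊕ (Idx n × Idx n) ⊕ (Idx n × Idx n)

/-- Principal part of the determinant equation. -/
def detPrin (γ : Fin n → Fin n → ℝ) (H : Fin n → Fin n → Fin n → Fin n → ℝ) (d c : Fin n) : ℝ :=
  ctr γ (H d c)

/-- Principal part of the derivative of the contracted Christoffel symbol. -/
def gamPrin (γ : Fin n → Fin n → ℝ) (H : Fin n → Fin n → Fin n → Fin n → ℝ) (b a : Fin n) : ℝ :=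
  ctr γ fun c d => H b c d a

/-- Principal part of the scalar gauge equation. -/
def scalPrin (γ : Fin n → Fin n → ℝ) (H : Fin n → Fin n → Fin n → Fin n → ℝ) : ℝ :=
  scalC γ (rlin H) - 2 * ((n : ℝ) - 1) / ((n : ℝ) - 2) * ctr γ (gamPrin γ H)

/-- Lower-order part of the derivative of the contracted Christoffel symbol. -/
def gamLow (γ : Fin n → Fin n → ℝ) (V : Fin n → Fin n → Fin n → ℝ) (b a : Fin n) : ℝ :=
  ctr₂ γ (V b) fun c d => V c d a

/-- Lower-order part of the scalar gauge equation. -/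
def scalLow (γ : Fin n → Fin n → ℝ) (V : Fin n → Fin n → Fin n → ℝ) : ℝ :=
  scalC γ (rquad γ V) + 2 * ((n : ℝ) - 1) / ((n : ℝ) - 2) *
    (ctr γ (gamLow γ V) + (1 / 2) * ip γ (fun a => ctr γ fun c d => V c d a) fun a => ctr γ fun c d => V c d a)

/-- Principal part of the system. -/
def sysPrin (h γ : Fin n → Fin n → ℝ) (H : Fin n → Fin n → Fin n → Fin n → ℝ) : EqIdx n → ℝ
  | .inl (d, c) => detPrin γ (fun i j => symT (H i j)) d c
  | .inr (.inl (a, b)) => gamPrin γ (fun i j => symT (H i j)) b a - gamPrin γ (fun i j => symT (H i j)) a b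
  | .inr (.inr (.inl _)) => scalPrin γ fun i j => symT (H i j)
  | .inr (.inr (.inr (.inl ((a, b), c, d)))) => weylCU h γ (rlin fun i j => symT (H i j)) a b c d
  | .inr (.inr (.inr (.inr ((a, b), i, j)))) => H i j a b - H i j b a

/-- Lower-order part of the system. -/
def sysLow (h γ : Fin n → Fin n → ℝ) (V : Fin n → Fin n → Fin n → ℝ) : EqIdx n → ℝ
  | .inl (d, c) => -1 * ctr₂ γ (V d) (V c)
  | .inr (.inl (a, b)) => gamLow γ V a b - gamLow γ V b a
  | .inr (.inr (.inl _)) => scalLow γ V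
  | .inr (.inr (.inr (.inl ((a, b), c, d)))) => weylCU h γ (rquad γ V) a b c d
  | .inr (.inr (.inr (.inr _))) => 0

/-- The matrix with given entries has this adjugate. -/
def adjF (u : Idx n → ℝ) (a b : Fin n) : ℝ := (Matrix.of fun i j => u (i, j)).adjugate a b

theorem isPrin_sysPrin (s : EqIdx n) :
    IsPrin fun u H => sysPrin (fun a b => u (a, b)) (adjF u) H s := by
  have hM : ∀ a b, PolyFn fun u : Idx n → ℝ => adjF u a b := PolyFn.adjugate
  have hS : ∀ i j a b, IsPrin fun (_ : Idx n → ℝ) H => symT (H i j) a b := fun i j a b =>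
    ((IsPrin.atom i j a b).add (IsPrin.atom i j b a)).const_mul _
  have hr : ∀ a b c d, IsPrin fun (_ : Idx n → ℝ) H => rlin (fun i j => symT (H i j)) a b c d :=
    fun a b c d => ((((hS a c b d).add (hS b d a c)).sub (hS a d b c)).sub (hS b c a d)).const_mul _
  have hg : ∀ a b, IsPrin fun u H => gamPrin (adjF u) (fun i j => symT (H i j)) a b := fun a b =>
    IsPrin.ctr hM fun c d => hS a c d b
  rcases s with ⟨d, c⟩ | ⟨a, b⟩ | _ | ⟨⟨a, b⟩, c, d⟩ | ⟨⟨a, b⟩, i, j⟩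
  · exact IsPrin.ctr hM fun a b => hS d c a b
  · exact (hg b a).sub (hg a b)
  · exact (IsPrin.ctr hM fun b c => IsPrin.ctr hM fun a d => hr a b c d).sub
      ((IsPrin.ctr hM hg).const_mul _)
  · exact IsPrin.weylCU hM hr a b c d
  · exact (IsPrin.atom i j a b).sub (IsPrin.atom i j b a)

theorem isHom_sysLow (s : EqIdx n) :
    IsHom 2 fun u V => sysLow (fun a b => u (a, b)) (adjF u) V s := by
  have hM : ∀ a b, PolyFn fun u : Idx n → ℝ => adjF u a b := PolyFn.adjugate
  have hr : ∀ a b c d, IsHom 2 fun (u : Idx n → ℝ) V => rquad (adjF u) V a b c d := IsHom.rquad hM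
  have hg : ∀ a b, IsHom 2 fun u V => gamLow (adjF u) V a b := fun a b =>
    IsHom.ctr₂ hM (fun e f => IsHom.atom a e f) fun c d => IsHom.atom c d b
  have hG : ∀ a, IsHom 1 fun (u : Idx n → ℝ) V => ctr (adjF u) fun c d => V c d a := fun a =>
    IsHom.poly_ctr hM fun c d => IsHom.atom c d a
  rcases s with ⟨d, c⟩ | ⟨a, b⟩ | _ | ⟨⟨a, b⟩, c, d⟩ | ⟨⟨a, b⟩, i, j⟩
  · exact (IsHom.ctr₂ hM (fun e f => IsHom.atom d e f) fun e f => IsHom.atom c e f).const_mul (-1)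
  · exact (hg a b).sub (hg b a)
  · exact (IsHom.poly_ctr hM fun b c => IsHom.poly_ctr hM fun a d => hr a b c d).add
      (((IsHom.poly_ctr hM hg).add ((IsHom.ip hM hG hG).const_mul _)).const_mul _)
  · exact IsHom.weylCU hM hr a b c d
  · exact IsHom.zero

/-- The inhomogeneity of the system: the components of the Weyl tensor. -/
def sysRhs (g : Met n) (s : EqIdx n) (x : Pt n) : ℝ :=
  match s with
  | .inl _ => 0
  | .inr (.inl _) => 0
  | .inr (.inr (.inl _)) => 0
  | .inr (.inr (.inr (.inl ((a, b), c, d)))) => weylUp g a b c d x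
  | .inr (.inr (.inr (.inr _))) => 0

variable {U : Set (Pt n)}

theorem UnimodularGauge.system {h : Met n} {ψ : Pt n → ℝ} (N : UnimodularGauge h ψ U) (hn : 3 ≤ n)
    {x : Pt n} (hx : x ∈ U) (s : EqIdx n) :
    sysPrin (fun a b => h x a b) (ginv h x) (jetH h x) s
      + sysLow (fun a b => h x a b) (ginv h x) (jetV h x) s = sysRhs h s x := by
  have hS : (fun i j => symT (jetH h x i j)) = jetH h x := by
    funext i j a b
    unfold symT
    rw [N.toGoodMet.jetH_symm hx i j b a]
    ring
  rcases s with ⟨d, c⟩ | ⟨a, b⟩ | _ | ⟨⟨a, b⟩, c, d⟩ | ⟨⟨a, b⟩, i, j⟩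
  · unfold sysPrin sysLow sysRhs detPrin
    rw [hS, ← N.ctr_jetH hx d c]
    ring
  · have h1 := N.gamma_closed hx a b
    rw [N.pd_gammaLow hx, N.pd_gammaLow hx] at h1
    unfold sysPrin sysLow sysRhs gamPrin gamLow
    rw [hS]
    dsimp only
    linarith
  · have h1 := N.scal x hx
    have h2 := scalC_add (ginv h x) (rlin (jetH h x)) (rquad (ginv h x) (jetV h x))
    rw [N.toGoodMet.scalarCurv_eq hx, h2] at h1
    simp only [N.pd_gammaLow hx, N.gammaLow_ctr hx, ctr_sub] at h1
    unfold sysPrin sysLow sysRhs scalPrin scalLow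
    rw [hS]
    unfold gamPrin gamLow
    dsimp only
    linear_combination h1
  · unfold sysPrin sysLow sysRhs
    dsimp only
    rw [hS, N.toGoodMet.weylUp_eq hn hx]
    exact (weylCU_add _ _ _ _ a b c d).symm
  · unfold sysPrin sysLow sysRhs
    dsimp only
    rw [N.toGoodMet.jetH_symm hx i j b a]
    ring

end EllipticSystem

section SymbolComputations

variable {n : ℕ}

/-- The jet obtained from a covector and a two-tensor. -/
def symbJet (ξ : Pt n) (v : Fin n → Fin n → ℝ) (i j a b : Fin n) : ℝ := ξ i * ξ j * v a b

/-- The symbol of the system. -/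
def sysSymb (h γ : Fin n → Fin n → ℝ) (ξ : Pt n) (v : Fin n → Fin n → ℝ) (s : EqIdx n) : ℝ :=
  sysPrin h γ (symbJet ξ v) s

/-- `F` is a combination of the symbol of the system with quadratic coefficients. -/
def Recov (h γ : Fin n → Fin n → ℝ) (F : Pt n → (Fin n → Fin n → ℝ) → ℝ) : Prop :=
  ∃ Q : EqIdx n → Fin n → Fin n → ℝ, ∀ ξ v,
    ∑ s, (∑ k, ∑ l, Q s k l * (ξ k * ξ l)) * sysSymb h γ ξ v s = F ξ v

namespace Recov

variable {h γ : Fin n → Fin n → ℝ} {F F' : Pt n → (Fin n → Fin n → ℝ) → ℝ}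

theorem basic (s : EqIdx n) (k l : Fin n) : Recov h γ fun ξ v => ξ k * ξ l * sysSymb h γ ξ v s := by
  refine ⟨fun s' k' l' => if s' = s then if k' = k then if l' = l then 1 else 0 else 0 else 0, fun ξ v => ?_⟩
  rw [Finset.sum_eq_single s, Finset.sum_eq_single k, Finset.sum_eq_single l]
  · simp
  · intro l' _ hl
    simp [hl]
  · simp
  · intro k' _ hk
    simp [hk]
  · simp
  · intro s' _ hs
    simp [hs]
  · simp

theorem add (H : Recov h γ F) (H' : Recov h γ F') : Recov h γ fun ξ v => F ξ v + F' ξ v := by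
  obtain ⟨Q, hQ⟩ := H
  obtain ⟨Q', hQ'⟩ := H'
  refine ⟨fun s k l => Q s k l + Q' s k l, fun ξ v => ?_⟩
  simp only [add_mul, Finset.sum_add_distrib, hQ, hQ']

theorem const_mul (c : ℝ) (H : Recov h γ F) : Recov h γ fun ξ v => c * F ξ v := by
  obtain ⟨Q, hQ⟩ := H
  refine ⟨fun s k l => c * Q s k l, fun ξ v => ?_⟩
  simp only [mul_assoc, ← Finset.mul_sum]
  simp only [← hQ]

theorem sub (H : Recov h γ F) (H' : Recov h γ F') : Recov h γ fun ξ v => F ξ v - F' ξ v := by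
  simpa only [neg_one_mul, ← sub_eq_add_neg] using H.add (H'.const_mul (-1))

theorem sum {κ : Type*} (t : Finset κ) {F : κ → Pt n → (Fin n → Fin n → ℝ) → ℝ}
    (H : ∀ r, Recov h γ (F r)) : Recov h γ fun ξ v => ∑ r ∈ t, F r ξ v := by
  choose Q hQ using H
  refine ⟨fun s k l => ∑ r ∈ t, Q r s k l, fun ξ v => ?_⟩
  simp only [← hQ, Finset.sum_mul]
  symm
  refine Finset.sum_comm.trans (Finset.sum_congr rfl fun s _ => ?_)
  refine Finset.sum_comm.trans (Finset.sum_congr rfl fun k _ => ?_)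
  exact Finset.sum_comm

theorem contract (M : Fin n → Fin n → ℝ) {T : Fin n → Fin n → Pt n → (Fin n → Fin n → ℝ) → ℝ}
    (H : ∀ a b, Recov h γ (T a b)) : Recov h γ fun ξ v => ctr M fun a b => T a b ξ v :=
  sum Finset.univ fun a => sum Finset.univ fun b => (H a b).const_mul (M a b)

theorem of_eq (H : Recov h γ F) (he : ∀ ξ v, F ξ v = F' ξ v) : Recov h γ F' := by
  rwa [show F' = F from funext fun ξ => funext fun v => (he ξ v).symm]

end Recov

section symbol

variable {γ : Fin n → Fin n → ℝ}

/-- The contraction `γ^{cd} ξ_c w_{da}`. -/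
def divg (γ : Fin n → Fin n → ℝ) (ξ : Pt n) (w : Fin n → Fin n → ℝ) (a : Fin n) : ℝ :=
  ip γ ξ fun d => w d a

theorem symT_symbJet (ξ : Pt n) (v : Fin n → Fin n → ℝ) :
    (fun i j => symT (symbJet ξ v i j)) = symbJet ξ (symT v) := by
  funext i j a b
  unfold symT symbJet
  ring

theorem symT_symm (v : Fin n → Fin n → ℝ) (a b : Fin n) : symT v a b = symT v b a := by
  unfold symT
  ring

theorem detPrin_symb (ξ : Pt n) (w : Fin n → Fin n → ℝ) (d c : Fin n) :
    detPrin γ (symbJet ξ w) d c = ξ d * ξ c * ctr γ w := ctr_const_mul _ _ _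

theorem gamPrin_symb (ξ : Pt n) (w : Fin n → Fin n → ℝ) (b a : Fin n) :
    gamPrin γ (symbJet ξ w) b a = ξ b * divg γ ξ w a := by
  unfold gamPrin divg ip
  rw [← ctr_const_mul]
  simp only [symbJet, mul_assoc]

theorem ricC_symb (hγ : ∀ a b, γ a b = γ b a) (ξ : Pt n) {w : Fin n → Fin n → ℝ}
    (hw : ∀ a b, w a b = w b a) (b c : Fin n) : ricC γ (rlin (symbJet ξ w)) b c =
      (1 / 2) * (ξ c * divg γ ξ w b + ξ b * divg γ ξ w c - ip γ ξ ξ * w b c - ξ b * ξ c * ctr γ w) := by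
  have h1 : ctr γ (fun a d => ξ c * (ξ a * w d b)) = ξ c * divg γ ξ w b := ctr_const_mul _ _ _
  have h2 : ctr γ (fun a d => ξ b * (ξ d * w a c)) = ξ b * divg γ ξ w c := by
    rw [ctr_const_mul, ← ctr_swap hγ]
    rfl
  have h3 : ctr γ (fun a d => ξ a * ξ d * w b c) = ip γ ξ ξ * w b c := ctr_mul_const _ _ _
  have h4 : ctr γ (fun a d => ξ b * ξ c * w a d) = ξ b * ξ c * ctr γ w := ctr_const_mul _ _ _
  rw [← h1, ← h2, ← h3, ← h4, ← ctr_add, ← ctr_sub, ← ctr_sub, ← ctr_const_mul]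
  unfold ricC
  congr 1
  funext a d
  unfold rlin symbJet
  rw [hw b d]
  ring

theorem scalC_symb (hγ : ∀ a b, γ a b = γ b a) (ξ : Pt n) {w : Fin n → Fin n → ℝ}
    (hw : ∀ a b, w a b = w b a) : scalC γ (rlin (symbJet ξ w)) =
      ip γ ξ (divg γ ξ w) - ip γ ξ ξ * ctr γ w := by
  have h1 : ctr γ (fun b c => ξ c * divg γ ξ w b) = ip γ ξ (divg γ ξ w) := by
    rw [← ctr_swap hγ]
    rfl
  have h2 : ctr γ (fun b c => ξ b * divg γ ξ w c) = ip γ ξ (divg γ ξ w) := rfl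
  have h3 : ctr γ (fun b c => ξ b * ξ c * ctr γ w) = ip γ ξ ξ * ctr γ w := ctr_mul_const _ _ _
  have h4 : ctr γ (fun b c => ip γ ξ ξ * w b c) = ip γ ξ ξ * ctr γ w := ctr_const_mul _ _ _
  unfold scalC
  rw [show ricC γ (rlin (symbJet ξ w)) = _ from funext fun b => funext fun c => ricC_symb hγ ξ hw b c,
    ctr_const_mul, ctr_sub, ctr_sub, ctr_add, h1, h2, h3, h4]
  ring

theorem scalPrin_symb (hn : 3 ≤ n) (hγ : ∀ a b, γ a b = γ b a) (ξ : Pt n) {w : Fin n → Fin n → ℝ}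
    (hw : ∀ a b, w a b = w b a) : scalPrin γ (symbJet ξ w) =
      -((n : ℝ) / ((n : ℝ) - 2)) * ip γ ξ (divg γ ξ w) - ip γ ξ ξ * ctr γ w := by
  have h0 : (3 : ℝ) ≤ n := by exact_mod_cast hn
  have n2 : (n : ℝ) - 2 ≠ 0 := by linarith
  have h1 : ctr γ (gamPrin γ (symbJet ξ w)) = ip γ ξ (divg γ ξ w) := by
    rw [show gamPrin γ (symbJet ξ w) = fun b a => ξ b * divg γ ξ w a from
      funext fun b => funext fun a => gamPrin_symb ξ w b a]
    rfl
  unfold scalPrin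
  rw [scalC_symb hγ ξ hw, h1]
  field_simp
  ring

variable {h : Fin n → Fin n → ℝ}

theorem ip_ip_ricC (P : InvPair h γ) (ξ : Pt n) {w : Fin n → Fin n → ℝ} (hw : ∀ a b, w a b = w b a)
    (c : Fin n) : ip γ ξ (fun a => ricC γ (rlin (symbJet ξ w)) a c) =
      (1 / 2) * (ξ c * (ip γ ξ (divg γ ξ w) - ip γ ξ ξ * ctr γ w)) := by
  have h1 : ip γ ξ (fun a => ip γ ξ ξ * w a c) = ip γ ξ ξ * divg γ ξ w c := ip_const_mul_right _ _ _ _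
  have h2 : ip γ ξ (fun a => ξ c * ctr γ w * ξ a) = ξ c * ctr γ w * ip γ ξ ξ := ip_const_mul_right _ _ _ _
  have h3 : ip γ ξ (fun a => divg γ ξ w c * ξ a) = divg γ ξ w c * ip γ ξ ξ := ip_const_mul_right _ _ _ _
  have h4 : ip γ ξ (fun a => ξ c * divg γ ξ w a) = ξ c * ip γ ξ (divg γ ξ w) := ip_const_mul_right _ _ _ _
  have h5 : (fun a => ricC γ (rlin (symbJet ξ w)) a c) = fun a => (1 / 2) * (ξ c * divg γ ξ w a
      + divg γ ξ w c * ξ a - ip γ ξ ξ * w a c - ξ c * ctr γ w * ξ a) := by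
    funext a
    rw [ricC_symb P.symm' ξ hw]
    ring
  rw [h5, ip_const_mul_right, ip_sub_right, ip_sub_right, ip_add_right, h1, h2, h3, h4]
  ring

theorem ip_ip_rlin (ξ : Pt n) {w : Fin n → Fin n → ℝ}
    (hw : ∀ a b, w a b = w b a) (b c : Fin n) :
    ip γ ξ (fun a => ip γ ξ fun e => rlin (symbJet ξ w) a b c e) =
      (1 / 2) * (ip γ ξ ξ * ξ c * divg γ ξ w b + ip γ ξ ξ * ξ b * divg γ ξ w c
        - ip γ ξ ξ * ip γ ξ ξ * w b c - ξ b * ξ c * ip γ ξ (divg γ ξ w)) := by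
  have h1 : ∀ a, ip γ ξ (fun e => rlin (symbJet ξ w) a b c e) = (1 / 2) * (ξ c * divg γ ξ w b * ξ a
      + ξ b * ip γ ξ ξ * w a c - w b c * ip γ ξ ξ * ξ a - ξ b * ξ c * divg γ ξ w a) := by
    intro a
    have h2 : (fun e => rlin (symbJet ξ w) a b c e) = fun e => (1 / 2) * (ξ a * ξ c * w e b
      + ξ b * w a c * ξ e - ξ a * w b c * ξ e - ξ b * ξ c * w e a) := by
      funext e
      unfold rlin symbJet
      rw [hw b e, hw a e]
      ring
    rw [h2, ip_const_mul_right, ip_sub_right, ip_sub_right, ip_add_right, ip_const_mul_right,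
      ip_const_mul_right, ip_const_mul_right, ip_const_mul_right]
    change (1 / 2) * (_ * divg γ ξ w b + _ - _ - _ * divg γ ξ w a) = _
    ring
  simp only [h1]
  rw [ip_const_mul_right, ip_sub_right, ip_sub_right, ip_add_right, ip_const_mul_right,
      ip_const_mul_right, ip_const_mul_right, ip_const_mul_right]
  change (1 / 2) * (_ + _ * divg γ ξ w c - _ - _) = _
  ring

theorem ip_ip_weylC (P : InvPair h γ) (ξ : Pt n) {w : Fin n → Fin n → ℝ}
    (hw : ∀ a b, w a b = w b a) (b c : Fin n) :
    ip γ ξ (fun a => ip γ ξ fun e => weylC h γ (rlin (symbJet ξ w)) a b c e) =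
      (1 / 2) * (ip γ ξ ξ * ξ c * divg γ ξ w b + ip γ ξ ξ * ξ b * divg γ ξ w c
        - ip γ ξ ξ * ip γ ξ ξ * w b c - ξ b * ξ c * ip γ ξ (divg γ ξ w))
      + (1 / ((n : ℝ) - 2)) * (ξ b * ξ c * (ip γ ξ (divg γ ξ w) - ip γ ξ ξ * ctr γ w)
        - ip γ ξ ξ * ricC γ (rlin (symbJet ξ w)) b c
        - (1 / 2) * (ip γ ξ ξ * (ip γ ξ (divg γ ξ w) - ip γ ξ ξ * ctr γ w)) * h b c)
      - (ip γ ξ (divg γ ξ w) - ip γ ξ ξ * ctr γ w) / (((n : ℝ) - 1) * ((n : ℝ) - 2)) *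
        (ξ b * ξ c - ip γ ξ ξ * h b c) := by
  have hr : ∀ a c, ricC γ (rlin (symbJet ξ w)) a c = ricC γ (rlin (symbJet ξ w)) c a := by
    intro a c
    rw [ricC_symb P.symm' ξ hw, ricC_symb P.symm' ξ hw, hw c a]
    ring
  rw [← ip_ip_rlin ξ hw b c, ← scalC_symb P.symm' ξ hw]
  have hρ := fun c => ip_ip_ricC P ξ hw c
  rw [← scalC_symb P.symm' ξ hw] at hρ
  generalize rlin (symbJet ξ w) = R at *
  have h1 : ∀ a, ip γ ξ (fun e => weylC h γ R a b c e) = ip γ ξ (fun e => R a b c e)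
      + (1 / ((n : ℝ) - 2)) * (ξ b * ricC γ R a c - ricC γ R b c * ξ a
        + ip γ ξ (fun e => ricC γ R b e) * h a c - h b c * ip γ ξ (fun e => ricC γ R a e))
      - scalC γ R / (((n : ℝ) - 1) * ((n : ℝ) - 2)) * (ξ b * h a c - h b c * ξ a) := by
    intro a
    have h2 : (fun e => weylC h γ R a b c e) = fun e => R a b c e
        + (1 / ((n : ℝ) - 2)) * (ricC γ R a c * h b e - ricC γ R b c * h a e
          + h a c * ricC γ R b e - h b c * ricC γ R a e)
        - scalC γ R / (((n : ℝ) - 1) * ((n : ℝ) - 2)) * (h a c * h b e - h b c * h a e) := by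
      funext e
      unfold weylC
      ring
    rw [h2]
    simp only [ip_sub_right, ip_add_right, ip_const_mul_right, P.ip_right']
    ring
  have h3 : ∀ a, ip γ ξ (fun e => ricC γ R a e) = (1 / 2) * (ξ a * scalC γ R) := fun a => by
    rw [← hρ a]
    simp only [hr a]
  simp only [h1, h3]
  have h4 : (fun a => ip γ ξ (fun e => R a b c e)
      + (1 / ((n : ℝ) - 2)) * (ξ b * ricC γ R a c - ricC γ R b c * ξ a
        + (1 / 2) * (ξ b * scalC γ R) * h a c - h b c * ((1 / 2) * (ξ a * scalC γ R)))
      - scalC γ R / (((n : ℝ) - 1) * ((n : ℝ) - 2)) * (ξ b * h a c - h b c * ξ a)) = fun a =>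
      ip γ ξ (fun e => R a b c e)
      + (1 / ((n : ℝ) - 2)) * (ξ b * ricC γ R a c - ricC γ R b c * ξ a
        + (1 / 2) * (ξ b * scalC γ R) * h a c - h b c * (1 / 2) * scalC γ R * ξ a)
      - scalC γ R / (((n : ℝ) - 1) * ((n : ℝ) - 2)) * (ξ b * h a c - h b c * ξ a) := by
    funext a
    ring
  rw [h4]
  simp only [ip_sub_right, ip_add_right, ip_const_mul_right, P.ip_right, hρ]
  ring

end symbol

end SymbolComputations

section Ellipticity

variable {n : ℕ} {h γ : Fin n → Fin n → ℝ}

namespace Recov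

theorem trace_term (b c : Fin n) :
    Recov h γ fun ξ v => ξ b * ξ c * (ip γ ξ ξ * ctr γ (symT v)) := by
  refine (contract γ fun d k => basic (h := h) (γ := γ) (.inl (d, k)) b c).of_eq fun ξ v => ?_
  rw [ctr_const_mul]
  unfold sysSymb sysPrin
  simp only [symT_symbJet, detPrin_symb, ctr_mul_const]
  rfl

theorem div_div_term (hn : 3 ≤ n) (hγ : ∀ a b, γ a b = γ b a) (b c : Fin n) :
    Recov h γ fun ξ v => ξ b * ξ c * ip γ ξ (divg γ ξ (symT v)) := by
  have h0 : (3 : ℝ) ≤ n := by exact_mod_cast hn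
  have n0 : (n : ℝ) ≠ 0 := by linarith
  have n2 : (n : ℝ) - 2 ≠ 0 := by linarith
  refine (((basic (.inr (.inr (.inl ()))) b c).add (trace_term b c)).const_mul
    (-(((n : ℝ) - 2) / n))).of_eq fun ξ v => ?_
  unfold sysSymb sysPrin
  simp only [symT_symbJet, scalPrin_symb hn hγ ξ (symT_symm v)]
  field_simp
  ring

theorem div_term (hn : 3 ≤ n) (hγ : ∀ a b, γ a b = γ b a) (c a : Fin n) :
    Recov h γ fun ξ v => ip γ ξ ξ * ξ c * divg γ ξ (symT v) a := by
  refine ((contract γ fun k b => basic (.inr (.inl (a, b))) c k).add (div_div_term hn hγ c a)).of_eq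
    fun ξ v => ?_
  have h1 : ctr γ (fun k b => ξ c * ξ k * sysSymb h γ ξ v (.inr (.inl (a, b)))) =
      ξ c * ip γ ξ fun b => divg γ ξ (symT v) a * ξ b - ξ a * divg γ ξ (symT v) b := by
    unfold ip
    rw [← ctr_const_mul]
    congr 1
    funext k b
    unfold sysSymb sysPrin
    simp only [symT_symbJet, gamPrin_symb]
    ring
  rw [h1, ip_sub_right, ip_const_mul_right, ip_const_mul_right]
  ring

/-- Contraction of a term quadratic in the covector. -/
theorem trace_mul {F : Pt n → (Fin n → Fin n → ℝ) → ℝ}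
    (H : ∀ b c, Recov h γ fun ξ v => ξ b * ξ c * F ξ v) : Recov h γ fun ξ v => ip γ ξ ξ * F ξ v :=
  (contract γ H).of_eq fun _ _ => ctr_mul_const _ _ _

theorem weyl_term (a b c d : Fin n) (k l : Fin n) :
    Recov h γ fun ξ v => ξ k * ξ l * weylCU h γ (rlin (symbJet ξ (symT v))) a b c d := by
  refine (basic (.inr (.inr (.inr (.inl ((a, b), c, d))))) k l).of_eq fun ξ v => ?_
  unfold sysSymb sysPrin
  simp only [symT_symbJet]

theorem sum_weylCU (ξ : Pt n) (R : Fin n → Fin n → Fin n → Fin n → ℝ) (b c : Fin n) :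
    ∑ d, ctr γ (fun k a => ξ k * ξ d * weylCU h γ R a b c d) =
      ip γ ξ fun a => ip γ ξ fun e => weylC h γ R a b c e := by
  unfold ip ctr weylCU
  simp only [Finset.mul_sum]
  rw [Finset.sum_comm]
  refine Finset.sum_congr rfl fun k _ => ?_
  rw [Finset.sum_comm]
  refine Finset.sum_congr rfl fun a _ => Finset.sum_congr rfl fun d _ => Finset.sum_congr rfl fun e _ => ?_
  ring

theorem sym_term (P : InvPair h γ) (hn : 4 ≤ n) (b c : Fin n) :
    Recov h γ fun ξ v => ip γ ξ ξ * ip γ ξ ξ * symT v b c := by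
  have h0 : (4 : ℝ) ≤ n := by exact_mod_cast hn
  have n1 : (n : ℝ) - 1 ≠ 0 := by linarith
  have n2 : (n : ℝ) - 2 ≠ 0 := by linarith
  have n3 : (n : ℝ) - 3 ≠ 0 := by linarith
  have h3 : 3 ≤ n := by omega
  have hW := sum Finset.univ fun d => contract γ fun k a => weyl_term (h := h) (γ := γ) a b c d k d
  have hT := trace_term (h := h) (γ := γ) b c
  have hqT := trace_mul (h := h) (γ := γ) trace_term
  have hS := div_div_term (h := h) h3 P.symm' b c
  have hqS := trace_mul (div_div_term (h := h) h3 P.symm')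
  have hV := div_term (h := h) h3 P.symm' b c
  have hV' := div_term (h := h) h3 P.symm' c b
  have key := (((((((hV'.add hV).sub hS).const_mul (1 / 2)).add
    (((hS.sub hT).sub ((((hV'.add hV).sub hT).const_mul (1 / 2)).add
      ((hqS.sub hqT).const_mul (1 / 2 * h b c)))).const_mul (1 / ((n : ℝ) - 2)))).sub
    (((hS.sub hT).sub ((hqS.sub hqT).const_mul (h b c))).const_mul
      (1 / (((n : ℝ) - 1) * ((n : ℝ) - 2))))).sub hW).const_mul
    (2 * ((n : ℝ) - 2) / ((n : ℝ) - 3)))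
  refine key.of_eq fun ξ v => ?_
  rw [sum_weylCU, ip_ip_weylC P ξ (symT_symm v), ricC_symb P.symm' ξ (symT_symm v)]
  generalize ip γ ξ (divg γ ξ (symT v)) = s
  generalize ctr γ (symT v) = τ
  generalize ip γ ξ ξ = q
  generalize divg γ ξ (symT v) c = vc
  generalize divg γ ξ (symT v) b = vb
  generalize symT v b c = w
  field_simp
  ring

theorem entry (P : InvPair h γ) (hn : 4 ≤ n) (a b : Fin n) :
    Recov h γ fun ξ v => ip γ ξ ξ * ip γ ξ ξ * v a b := by
  have h1 : ∀ k l, Recov h γ fun ξ v => ξ k * ξ l * (ip γ ξ ξ * (v a b - v b a)) := by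
    intro k l
    refine (contract γ fun i j => basic (.inr (.inr (.inr (.inr ((a, b), i, j))))) k l).of_eq fun ξ v => ?_
    rw [ctr_const_mul]
    unfold ip
    rw [← ctr_mul_const]
    congr 2
    funext i j
    unfold sysSymb sysPrin symbJet
    ring
  refine ((sym_term P hn a b).add ((trace_mul h1).const_mul (1 / 2))).of_eq fun ξ v => ?_
  unfold symT
  ring

end Recov

theorem qf_eq_ip (γ : Fin n → Fin n → ℝ) (ξ : Pt n) : qf γ ξ = ip γ ξ ξ := by
  unfold qf ip ctr
  exact Finset.sum_congr rfl fun _ _ => Finset.sum_congr rfl fun _ _ => by ring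

/-- Ellipticity of the system for unimodular metrics in the gauge. -/
theorem elliptic_of_recov {A : EqIdx n → Idx n → Fin n → Fin n → ℝ} (P : InvPair h γ) (hn : 4 ≤ n)
    (hpos : ∀ z : Pt n, z ≠ 0 → 0 < qf h z)
    (hA : ∀ s (H : Fin n → Fin n → Fin n → Fin n → ℝ),
      ∑ J, ∑ i, ∑ j, A s J i j * H i j J.1 J.2 = sysPrin h γ H s) : Elliptic A := by
  choose Q hQ using fun I : Idx n => Recov.entry P hn I.1 I.2
  refine ⟨h, γ, Q, P.symm, P.inv, hpos, fun I J ξ => ?_⟩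
  have h1 := hQ I ξ fun a b => if (a, b) = J then 1 else 0
  have h2 : ∀ s, sysSymb h γ ξ (fun a b => if (a, b) = J then 1 else 0) s =
      ∑ i, ∑ j, A s J i j * (ξ i * ξ j) := by
    intro s
    unfold sysSymb
    rw [← hA, Finset.sum_eq_single J]
    · simp [symbJet]
    · intro K _ hK
      simp [symbJet, hK]
    · simp
  simp only [h2] at h1
  rw [h1, qf_eq_ip, sq]
  simp

end Ellipticity

section Assembly

variable {n : ℕ} {U : Set (Pt n)} {g : Met n}

theorem CH.det (hU : IsOpen U) {β : ℝ} (hβ : 0 < β) (hβ1 : β ≤ 1) {m : ℕ}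
    (hg : ∀ a b, CH m β U fun x => g x a b) : CH m β U fun x => (g x).det := by
  simp only [Matrix.det_apply']
  exact CH.sum hU _ fun s _ => (CH.prod hU hβ hβ1 _ fun i _ => hg (s i) i).const_mul hU hβ hβ1 _

theorem CH.dnorm (hU : IsOpen U) {β : ℝ} (hβ : 0 < β) (hβ1 : β ≤ 1) {m : ℕ} (hgm : IsMetricOn g U)
    (hg : ∀ a b, CH m β U fun x => g x a b) (a b : Fin n) : CH m β U fun x => dnorm g x a b :=
  ((CH.det hU hβ hβ1 hg).rpow hU hβ hβ1 _ fun _ hx => hgm.det_pos hx).mul hU hβ hβ1 (hg a b)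

theorem qf_dnorm_pos (hgm : IsMetricOn g U) {x : Pt n} (hx : x ∈ U) (z : Pt n) (hz : z ≠ 0) :
    0 < qf (fun a b => dnorm g x a b) z := by
  have h1 : 0 < qf (fun a b => g x a b) z := by
    have h2 := (hgm x hx).2.dotProduct_mulVec_pos hz
    have h3 : qf (fun a b => g x a b) z = star z ⬝ᵥ (g x *ᵥ z) := by
      unfold qf
      simp only [dotProduct, mulVec, star_trivial, Finset.mul_sum]
      exact Finset.sum_congr rfl fun _ _ => Finset.sum_congr rfl fun _ _ => by ring
    rwa [h3]
  have h4 : qf (fun a b => dnorm g x a b) z =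
      (g x).det ^ (-(1 : ℝ) / (n : ℝ)) * qf (fun a b => g x a b) z := by
    unfold qf _root_.dnorm
    simp only [Finset.mul_sum, Matrix.smul_apply, smul_eq_mul, mul_assoc]
  rw [h4]
  exact mul_pos (Real.rpow_pos_of_pos (hgm.det_pos hx) _) h1

theorem adjF_dnorm (hn : 0 < n) (hgm : IsMetricOn g U) {x : Pt n} (hx : x ∈ U) :
    adjF (fun J : Idx n => dnorm g x J.1 J.2) = ginv (dnorm g) x := by
  funext a b
  unfold adjF ginv
  rw [Matrix.inv_def, dnorm_det hn hgm hx, Ring.inverse_one, one_smul]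
  rfl

/-- In the conformal harmonic gauge the determinant-normalized metric solves a quasilinear elliptic
system whose inhomogeneity is given by the Weyl tensor. -/
theorem exists_qlSystem (hn : 4 ≤ n) (hU : IsOpen U) (hgm : IsMetricOn g U)
    (hg : ∀ a b, ContDiffOn ℝ 2 (fun x => g x a b) U) (hgauge : ConfHarmonicGauge g U) :
    ∃ P : QLSystem n (Idx n) (EqIdx n),
      (∀ x ∈ U, Elliptic (P.coeff fun K => dnorm g x K.1 K.2)) ∧
      ∀ s, ∀ x ∈ U, P.op (fun K x => dnorm g x K.1 K.2) s x = sysRhs g s x := by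
  have hn0 : 0 < n := by omega
  have hn3 : 3 ≤ n := by omega
  obtain ⟨ψ, N⟩ := ConfHarmonicGauge.unimodular hn3 hU hgm hg hgauge
  obtain ⟨P, hP, hPL⟩ := QLSystem.exists_of_functions (isPrin_sysPrin (n := n)) isHom_sysLow
  refine ⟨P, fun x hx => ?_, fun s x hx => ?_⟩
  · refine elliptic_of_recov (N.toGoodMet.pair hx) hn (qf_dnorm_pos hgm hx) fun s H => ?_
    rw [← adjF_dnorm hn0 hgm hx]
    exact hP (fun K => dnorm g x K.1 K.2) s H
  · have h1 := hP (fun K => dnorm g x K.1 K.2) s (jetH (dnorm g) x)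
    have h2 := hPL s (fun K => dnorm g x K.1 K.2) (jetV (dnorm g) x)
    rw [adjF_dnorm hn0 hgm hx] at h1 h2
    have h3 : P.op (fun K x => dnorm g x K.1 K.2) s x = sysRhs (dnorm g) s x :=
      (congrArg₂ (· + ·) h1 h2).trans (N.system hn3 hx s)
    rw [h3]
    rcases s with _ | _ | _ | ⟨⟨a, b⟩, c, d⟩ | _
    iterate 3 rfl
    · exact (dnorm_conf hn0 hU hgm hg).weylUp_eq hn3 hx a b c d
    · rfl

theorem CH.sysRhs (hU : IsOpen U) {β : ℝ} {m : ℕ} (hW : ∀ a b c d, CH m β U (weylUp g a b c d))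
    (s : EqIdx n) : CH m β U (sysRhs g s) := by
  rcases s with _ | _ | _ | ⟨⟨a, b⟩, c, d⟩ | _
  iterate 3 exact CH.const hU 0
  · exact hW a b c d
  · exact CH.const hU 0

end Assembly

/-- Theorem 3.9(a): elliptic regularity for the Weyl tensor in conformal
harmonic coordinates. -/
theorem weyl_elliptic_regularity
    (n k : ℕ) (hn : 4 ≤ n) (hk : 2 ≤ k) (α : ℝ) (hα : α ∈ Set.Ioo (0 : ℝ) 1)
    (U : Set (Pt n)) (hU : IsOpen U)
    (g : Met n) (hgm : IsMetricOn g U) (hgr : MetCHolderOn k α U g)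
    (hgauge : ConfHarmonicGauge g U) :
    (∀ (m : ℕ) (β : ℝ), β ∈ Set.Ioo (0 : ℝ) 1 → (k : ℝ) + α - 2 < (m : ℝ) + β →
      (∀ a b c d : Fin n, CHolderOn m β U (weylUp g a b c d)) →
      ∀ a b : Fin n, CHolderOn (m + 2) β U fun x => dnorm g x a b) ∧
    ((∀ a b c d : Fin n, ContDiffOn ℝ (⊤ : ℕ∞) (weylUp g a b c d) U) →
      ∀ a b : Fin n, ContDiffOn ℝ (⊤ : ℕ∞) (fun x => dnorm g x a b) U) ∧
    ((∀ a b c d : Fin n, ∀ x ∈ U, weyl g a b c d x = 0) →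
      ∀ a b : Fin n, AnalyticOnNhd ℝ (fun x => dnorm g x a b) U) := by
  obtain ⟨hα0, hα1⟩ := hα
  have hn0 : 0 < n := by omega
  have hg2 : ∀ a b, ContDiffOn ℝ 2 (fun x => g x a b) U := fun a b =>
    (hgr a b).1.of_le (by exact_mod_cast hk)
  have hu : ∀ J : Idx n, CH 2 α U fun x => dnorm g x J.1 J.2 := fun J =>
    CH.dnorm hU hα0 hα1.le hgm
      (fun a b => ((CHolderOn_iff_CH hU hα0).1 (hgr a b)).of_le hU hα0 hα1.le hk) J.1 J.2
  obtain ⟨P, hell, heq⟩ := exists_qlSystem hn hU hgm hg2 hgauge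
  have hreg : ∀ (m : ℕ) (β : ℝ), 0 < β → β < 1 → (∀ a b c d, CH m β U (weylUp g a b c d)) →
      ∀ J : Idx n, CH (m + 2) β U fun x => dnorm g x J.1 J.2 := fun m β hβ hβ1 hW =>
    P.regularity hU hα0 hα1 hβ hβ1 hu hell (CH.sysRhs hU hW) heq
  have hsmooth : (∀ a b c d : Fin n, ContDiffOn ℝ (⊤ : ℕ∞) (weylUp g a b c d) U) →
      ∀ J : Idx n, ContDiffOn ℝ (⊤ : ℕ∞) (fun x => dnorm g x J.1 J.2) U := by
    intro hW J
    rw [contDiffOn_infty_iff_CH hU hα0 hα1.le]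
    exact fun m => (hreg m α hα0 hα1 (fun a b c d =>
      (contDiffOn_infty_iff_CH hU hα0 hα1.le).1 (hW a b c d) m) J).of_le hU hα0 hα1.le (by omega)
  refine ⟨fun m β hβ _ hW a b => ?_, fun hW a b => hsmooth hW (a, b), fun hW a b => ?_⟩
  · rw [CHolderOn_iff_CH hU hβ.1]
    exact hreg m β hβ.1 hβ.2 (fun a b c d => (CHolderOn_iff_CH hU hβ.1).1 (hW a b c d)) (a, b)
  · have hW0 : ∀ a b c d, ∀ x ∈ U, weylUp g a b c d x = 0 := fun a b c d x hx =>
      Finset.sum_eq_zero fun e _ => by rw [hW a b c e x hx, mul_zero]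
    refine P.analytic hn0 hU
      (hsmooth fun a b c d => contDiffOn_const.congr fun x hx => hW0 a b c d x hx) hell
      (fun s x hx => (heq s x hx).trans ?_) (a, b)
    rcases s with _ | _ | _ | ⟨⟨a, b⟩, c, d⟩ | _
    iterate 3 rfl
    · exact hW0 a b c d x hx
    · rfl
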